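/- Let N ⊆ ℝ³ be a nonempty compact connected polyhedron that is a topological 3-manifold with boundary, and assume H₁(N; ℤ/2) = 0. Then N is a perforated ball: there exist a polyhedron B ⊆ ℝ³ homeomorphic to the closed unit ball of ℝ³ and finitely many pairwise disjoint polyhedra B₁, …, B_m contained in the interior of B, each homeomorphic to the closed unit ball of ℝ³, such that N = B ∖ (interior(B₁) ∪ ⋯ ∪ interior(B_m)). -/

import Mathlib

open CategoryTheory Set

noncomputable section

/-- Euclidean 3-space. -/
abbrev R3 := EuclideanSpace ℝ (Fin 3)

/-- The singular chain complex functor with `ℤ/2` coefficients: the free `ℤ/2`-module on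
the singular simplicial set, turned into a chain complex via alternating face maps. -/
def singularChainComplexZ2 : TopCat ⥤ ChainComplex (ModuleCat (ZMod 2)) ℕ :=
  TopCat.toSSet ⋙
    ((SimplicialObject.whiskering Type (ModuleCat (ZMod 2))).obj (ModuleCat.free (ZMod 2))) ⋙
    AlgebraicTopology.alternatingFaceMapComplex _

/-- Singular homology `H_n(X; ℤ/2)` of a topological space `X`. -/
def H (n : ℕ) (X : Type) [TopologicalSpace X] : ModuleCat (ZMod 2) :=
  (singularChainComplexZ2.obj (TopCat.of X)).homology n

/-- The rank of `H_n(X; ℤ/2)` as a `ℤ/2`-vector space. -/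
def rkH (n : ℕ) (X : Type) [TopologicalSpace X] : Cardinal :=
  Module.rank (ZMod 2) (H n X)

/-- A simplex in `ℝ³`: the convex hull of a finite affinely independent set of points. -/
def IsSimplexSet (s : Set R3) : Prop :=
  ∃ t : Finset R3, AffineIndependent ℝ (fun x : (t : Set R3) => (x : R3)) ∧
    s = convexHull ℝ (t : Set R3)

/-- A polyhedron in `ℝ³`: a finite union of simplices. -/
def IsPolyhedron (P : Set R3) : Prop :=
  ∃ F : Finset (Set R3), (∀ s ∈ F, IsSimplexSet s) ∧ P = ⋃ s ∈ F, s

/-- Property `(P_r)`: every neighbourhood of `K` contains a polyhedral neighbourhood `N`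
of `K` with `rk H₁(N; ℤ/2) ≤ r`. -/
def HasPropP (K : Set R3) (r : ℕ) : Prop :=
  ∀ U : Set R3, IsOpen U → K ⊆ U →
    ∃ N : Set R3, N ⊆ U ∧ K ⊆ interior N ∧ IsPolyhedron N ∧ rkH 1 ↥N ≤ (r : Cardinal)

/-- `r(K)`: the least nonnegative integer `r` such that `(P_r)` holds, or `∞` if none does. -/
def rInv (K : Set R3) : ℕ∞ :=
  sInf {n : ℕ∞ | ∃ r : ℕ, n = (r : ℕ∞) ∧ HasPropP K r}

/-- The closed half-space `{x ∈ ℝ³ : x₃ ≥ 0}`. -/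
def HalfSpace3 : Set R3 := {x | 0 ≤ x 2}

/-- `M ⊆ ℝ³` is a topological 3-manifold with boundary if every point of `M` has an open
neighbourhood in `M` homeomorphic to an open subset of the closed half-space. -/
def IsManifold3WithBoundary (M : Set R3) : Prop :=
  ∀ p : M, ∃ V : Set M, IsOpen V ∧ p ∈ V ∧
    ∃ W : Set ↥HalfSpace3, IsOpen W ∧ Nonempty (↥V ≃ₜ ↥W)

open Topology
open Finset (add_sum_erase bipartiteAbove bipartiteBelow card_bij card_eq_one card_eq_three
 card_eq_two card_erase_of_mem card_pair erase_insert erase_subset filter_mem_eq_inter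
 filter_subset insert_erase mem_coe mem_erase mem_filter mem_filter_univ mem_insert_self mul_sum
 ne_of_mem_erase sum_add_distrib sum_bij sum_coe_sort sum_congr sum_const sum_eq_single
 sum_eq_zero sum_eq_zero_iff_of_nonneg sum_filter sum_insert sum_ite_mem sum_neg' sum_nonneg
 sum_pair sum_pi_single' sum_pos' sum_sub_distrib sum_subset)
open Pi (single single_apply)
open LinearMap (ker mem_ker ker_eq_bot')
open Metric (sphere closedBall ball ball_mem_nhds)
open Function (Injective Bijective Surjective update invFun leftInverse_invFun)
open WithLp (fstL toLp linearEquiv)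
open SignType (sign)
open Bornology (IsBounded)
open Module (finrank finrank_prod finrank_pi)
open Real (norm_eq_abs norm_of_nonneg)
open Filter (Tendsto)
open CharTwo (add_self_eq_zero)
open AffineMap (lineMap lineMap_continuous)
open Submodule (span finrank_mono)
open Sum (inr elim_inr elim)

/-- `f` restricts to a continuous bijection from `X` onto `Y`. -/
structure HomeoOn {A B : Type*} [TopologicalSpace A] [TopologicalSpace B]
    (f : A → B) (X : Set A) (Y : Set B) : Prop where
  cont : ContinuousOn f X
  bij : BijOn f X Y

namespace HomeoOn

variable {A B C Q : Type*} [TopologicalSpace A] [TopologicalSpace B] [TopologicalSpace C]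
  [TopologicalSpace Q]

theorem comp {f : A → B} {g : B → C} {X : Set A} {Y : Set B} {Z : Set C}
    (hg : HomeoOn g Y Z) (hf : HomeoOn f X Y) : HomeoOn (g ∘ f) X Z :=
  ⟨hg.cont.comp hf.cont hf.bij.mapsTo, hg.bij.comp hf.bij⟩

protected theorem id (X : Set A) : HomeoOn id X X := ⟨continuousOn_id, bijOn_id X⟩

/-- A homeomorphism between two spaces both parametrized by a compact set. -/
theorem param [T2Space A] [T2Space B] [Nonempty B] {S : Set Q} (hS : IsCompact S) {X : Set A}
    {Y : Set B} {α : Q → A} {β : Q → B} (hα : ContinuousOn α S) (hβ : ContinuousOn β S)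
    (hX : α '' S = X) (hY : β '' S = Y)
    (h : ∀ q ∈ S, ∀ q' ∈ S, α q = α q' ↔ β q = β q') :
    ∃ f : A → B, HomeoOn f X Y ∧ ∀ q ∈ S, f (α q) = β q := by
  classical
  subst hX hY
  have hf : ∃ f : A → B, ∀ q ∈ S, f (α q) = β q := by
    refine ⟨fun a => if ha : ∃ q ∈ S, α q = a then β ha.choose else Classical.arbitrary B, ?_⟩
    intro q hq
    have ha : ∃ q' ∈ S, α q' = α q := ⟨q, hq, rfl⟩
    grind
  obtain ⟨f, hf⟩ := hf
  refine ⟨f, ⟨?_, ?_, ?_, ?_⟩, hf⟩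
  · rw [continuousOn_iff_isClosed]
    intro t ht
    refine ⟨α '' (S ∩ β ⁻¹' t), ?_, ?_⟩
    · have hc : IsCompact (S ∩ β ⁻¹' t) := by
        obtain ⟨u, hu, he⟩ := continuousOn_iff_isClosed.1 hβ t ht
        rw [inter_comm, he, inter_comm]
        exact hS.inter_right hu
      exact (hc.image_of_continuousOn (hα.mono inter_subset_left)).isClosed
    · grind
  · rintro _ ⟨q, hq, rfl⟩
    exact ⟨q, hq, (hf q hq).symm⟩
  · rintro _ ⟨q, hq, rfl⟩ _ ⟨q', hq', rfl⟩ he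
    rw [hf q hq, hf q' hq'] at he
    exact (h q hq q' hq').2 he
  · rintro _ ⟨q, hq, rfl⟩
    exact ⟨α q, ⟨q, hq, rfl⟩, hf q hq⟩

theorem exists_symm [T2Space A] [T2Space B] [Nonempty A] {f : A → B} {X : Set A} {Y : Set B}
    (hX : IsCompact X) (hf : HomeoOn f X Y) : ∃ g : B → A, HomeoOn g Y X ∧ InvOn g f X Y := by
  obtain ⟨g, hg, hgf⟩ := param (α := f) (β := id) hX hf.cont continuousOn_id hf.bij.image_eq
    (image_id X) (fun q hq q' hq' => ⟨fun he => hf.bij.injOn hq hq' he, fun he => by grind⟩)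
  refine ⟨g, hg, hgf, ?_⟩
  intro y hy
  obtain ⟨x, hx, rfl⟩ := hf.bij.surjOn hy
  rw [hgf x hx]; rfl

theorem restrict {f : A → B} {X X' : Set A} {Y Y' : Set B} (hf : HomeoOn f X Y) (hX : X' ⊆ X)
    (hY : Y' ⊆ Y) (h : ∀ x ∈ X, x ∈ X' ↔ f x ∈ Y') : HomeoOn f X' Y' := by
  refine ⟨hf.cont.mono hX, fun x hx => (h x (hX hx)).1 hx, hf.bij.injOn.mono hX, ?_⟩
  intro y hy
  obtain ⟨x, hx, rfl⟩ := hf.bij.surjOn (hY hy)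
  exact ⟨x, (h x hx).2 hy, rfl⟩

theorem nonempty_homeomorph [T2Space B] {f : A → B} {X : Set A} {Y : Set B}
    (hX : IsCompact X) (hf : HomeoOn f X Y) : Nonempty (X ≃ₜ Y) := by
  have : CompactSpace X := isCompact_iff_compactSpace.1 hX
  exact ⟨Continuous.homeoOfEquivCompactToT2 (f := Equiv.ofBijective _ hf.bij.bijective)
    (hf.cont.mapsToRestrict hf.bij.mapsTo)⟩

end HomeoOn

section

variable {V : Type} [Fintype V] [DecidableEq V] {K : Set (Finset V)} {v : V}

/-- Support of a coordinate vector. -/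
def vsupp (x : V → ℝ) : Finset V := Finset.univ.filter fun v => x v ≠ 0

/-- Geometric realization of an abstract complex in barycentric coordinates. -/
def realiz (K : Set (Finset V)) : Set (V → ℝ) := {x | (∀ v, 0 ≤ x v) ∧ ∑ v, x v = 1 ∧ vsupp x ∈ K}

/-- Link of a vertex. -/
def lk (K : Set (Finset V)) (v : V) : Set (Finset V) := {τ | v ∉ τ ∧ insert v τ ∈ K}

/-- Affine extension of a function on vertices. -/
def evCol (g x : V → ℝ) : ℝ := ∑ v, x v * g v

omit [DecidableEq V] in
@[simp] theorem mem_vsupp {x : V → ℝ} : v ∈ vsupp x ↔ x v ≠ 0 := by simp [vsupp]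

omit [DecidableEq V] in
theorem continuous_evCol (g : V → ℝ) : Continuous (evCol g) := by unfold evCol; fun_prop

theorem isClosed_realiz (hK : IsLowerSet K) : IsClosed (realiz K) := by
  have : realiz K = ⋃ σ ∈ K, {x : V → ℝ | (∀ v, 0 ≤ x v) ∧ ∑ v, x v = 1 ∧ ∀ v, v ∉ σ → x v = 0} := by
    ext x
    simp only [realiz, mem_setOf_eq, mem_iUnion, exists_prop]
    constructor
    · aesop
    · rintro ⟨σ, hσ, h1, h2, h3⟩
      refine ⟨h1, h2, hK (fun v hv => ?_) hσ⟩
      by_contra hvs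
      exact (mem_vsupp.1 hv) (h3 v hvs)
  rw [this]
  refine (Set.toFinite K).isClosed_biUnion fun σ _ => ?_
  simp only [setOf_and, setOf_forall]
  refine (isClosed_iInter fun v => ?_).inter (IsClosed.inter ?_ ?_)
  · exact isClosed_le continuous_const (continuous_apply v)
  · exact isClosed_eq (by fun_prop) continuous_const
  · exact isClosed_iInter fun v => isClosed_iInter fun _ => isClosed_eq (continuous_apply v) continuous_const

theorem isCompact_realiz (hK : IsLowerSet K) : IsCompact (realiz K) := by
  refine (isCompact_Icc (a := (0 : V → ℝ)) (b := 1)).of_isClosed_subset (isClosed_realiz hK) ?_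
  rintro x ⟨h1, h2, -⟩
  refine ⟨h1, fun v => ?_⟩
  rw [Pi.one_apply, ← h2]
  exact Finset.single_le_sum (fun i _ => h1 i) (Finset.mem_univ v)

theorem isLowerSet_lk (hK : IsLowerSet K) (v : V) : IsLowerSet (lk K v) := by
  rintro σ τ hτ ⟨h1, h2⟩
  exact ⟨fun h => h1 (hτ h), hK (Finset.insert_subset_insert v hτ) h2⟩

/-- The point dividing the segment from vertex `v` to `y` in ratio `r : 1 - r`. -/
def conePt (v : V) (r : ℝ) (y : V → ℝ) : V → ℝ := fun w => if w = v then 1 - r else r * y w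

@[simp] theorem conePt_self (v : V) (r : ℝ) (y : V → ℝ) : conePt v r y v = 1 - r := by simp [conePt]

theorem conePt_of_ne {v w : V} (h : w ≠ v) (r : ℝ) (y : V → ℝ) : conePt v r y w = r * y w := by simp [conePt, h]

theorem lk_apply_self {y : V → ℝ} (hy : y ∈ realiz (lk K v)) :
    y v = 0 := by
  by_contra h
  exact hy.2.2.1 (mem_vsupp.2 h)

theorem sum_conePt {y : V → ℝ} (hy : y v = 0) (g : V → ℝ) (r : ℝ) :
    evCol g (conePt v r y) = (1 - r) * g v + r * evCol g y := by
  unfold evCol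
  rw [← add_sum_erase _ _ (Finset.mem_univ v), ← add_sum_erase _ (fun w => y w * g w)
    (Finset.mem_univ v), conePt_self, hy, zero_mul, zero_add, mul_sum]
  congr 1
  refine sum_congr rfl fun w hw => ?_
  rw [conePt_of_ne (ne_of_mem_erase hw)]; ring

/-- Closed star of a vertex. -/
def cstar (K : Set (Finset V)) (v : V) : Set (V → ℝ) := {x ∈ realiz K | insert v (vsupp x) ∈ K}

theorem conePt_mem (hK : IsLowerSet K) {y : V → ℝ}
    (hy : y ∈ realiz (lk K v)) {r : ℝ} (hr : r ∈ Icc (0 : ℝ) 1) : conePt v r y ∈ cstar K v := by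
  have hv := lk_apply_self hy
  have hs : vsupp (conePt v r y) ⊆ insert v (vsupp y) := fun w hw => by
    rw [Finset.mem_insert, mem_vsupp]
    by_cases h : w = v
    · exact Or.inl h
    · rw [mem_vsupp, conePt_of_ne h] at hw
      exact Or.inr (right_ne_zero_of_mul hw)
  refine ⟨⟨fun w => ?_, ?_, hK hs hy.2.2.2⟩, hK (Finset.insert_subset (by simp) hs) hy.2.2.2⟩
  · by_cases h : w = v
    · subst h; simp [hr.2]
    · rw [conePt_of_ne h]; exact mul_nonneg hr.1 (hy.1 w)
  · have := sum_conePt hv 1 r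
    simp only [evCol, Pi.one_apply, mul_one, hy.2.1] at this
    rw [this]; ring

theorem conePt_inj {y y' : V → ℝ} (hy : y v = 0) (hy' : y' v = 0) {r r' : ℝ} :
    conePt v r y = conePt v r' y' ↔ r = r' ∧ (r = 0 ∨ y = y') := by
  constructor
  · intro h
    have h1 : r = r' := by have := congrFun h v; simp at this; exact this
    refine ⟨h1, ?_⟩
    subst h1
    by_cases h0 : r = 0
    · exact Or.inl h0
    · right
      ext w
      by_cases hw : w = v
      · rw [hw, hy, hy']
      · have := congrFun h w
        rw [conePt_of_ne hw, conePt_of_ne hw] at this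
        exact mul_left_cancel₀ h0 this
  · rintro ⟨rfl, h⟩
    rcases h with rfl | rfl
    · ext w; simp [conePt]
    · rfl

omit [DecidableEq V] in
theorem le_one_of_sum {x : V → ℝ} (h1 : ∀ v, 0 ≤ x v) (h2 : ∑ v, x v = 1) (v : V) : x v ≤ 1 := by
  rw [← h2]; exact Finset.single_le_sum (fun i _ => h1 i) (Finset.mem_univ v)

theorem exists_conePt (hK : IsLowerSet K) {x : V → ℝ}
    (hx : x ∈ cstar K v) (h1 : x v ≠ 1) : ∃ y ∈ realiz (lk K v), x = conePt v (1 - x v) y := by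
  obtain ⟨⟨hx0, hx1, hxK⟩, hxs⟩ := hx
  have hlt : 0 < 1 - x v := by
    have := le_one_of_sum hx0 hx1 v
    grind
  refine ⟨fun w => if w = v then 0 else x w / (1 - x v), ⟨fun w => ?_, ?_, ?_, ?_⟩, ?_⟩
  · dsimp only; split_ifs
    · exact le_rfl
    · exact div_nonneg (hx0 w) hlt.le
  · rw [← add_sum_erase _ _ (Finset.mem_univ v)] at hx1 ⊢
    rw [if_pos rfl, zero_add, sum_congr rfl fun w hw => if_neg (ne_of_mem_erase hw),
      ← Finset.sum_div, div_eq_one_iff_eq hlt.ne']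
    linarith
  · simp
  · refine hK (Finset.insert_subset (by simp) fun w hw => ?_) hxs
    rw [mem_vsupp] at hw
    by_cases h : w = v
    · simp [h]
    · simp_all
  · ext w
    by_cases h : w = v
    · subst h; simp
    · rw [conePt_of_ne h, if_neg h]; field_simp

theorem realiz_eq_cstar_union (v : V) :
    realiz K = cstar K v ∪ {x ∈ realiz K | x v = 0} := by
  ext x
  constructor
  · intro hx
    by_cases h : x v = 0
    · exact Or.inr ⟨hx, h⟩
    · exact Or.inl ⟨hx, by rw [Finset.insert_eq_of_mem (mem_vsupp.2 h)]; exact hx.2.2⟩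
  · rintro (h | h)
    exacts [h.1, h.1]

theorem mem_lk_of_cstar {x : V → ℝ} (hx : x ∈ cstar K v)
    (h0 : x v = 0) : x ∈ realiz (lk K v) :=
  ⟨hx.1.1, hx.1.2.1, by simp [h0], hx.2⟩

theorem continuous_conePt (v : V) : Continuous fun q : ℝ × (V → ℝ) => conePt v q.1 q.2 := by
  refine continuous_pi fun w => ?_
  by_cases h : w = v
  · subst h; simp only [conePt_self]; fun_prop
  · simp only [conePt_of_ne h]; fun_prop

theorem isClosed_cstar (hK : IsLowerSet K) (v : V) : IsClosed (cstar K v) := by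
  have : cstar K v = realiz {σ ∈ K | insert v σ ∈ K} := by
    ext x; exact ⟨fun h => ⟨h.1.1, h.1.2.1, h.1.2.2, h.2⟩, fun h => ⟨⟨h.1, h.2.1, h.2.2.1⟩, h.2.2.2⟩⟩
  rw [this]
  refine isClosed_realiz ?_
  rintro σ τ h ⟨h1, h2⟩
  exact ⟨hK h h1, hK (Finset.insert_subset_insert v h) h2⟩

end

section

variable {E : Type} [NormedAddCommGroup E] [NormedSpace ℝ E]

/-- Push the unit ball towards `p`, fixing the unit sphere. -/
def pushPt (p x : E) : E := x + (1 - ‖x‖) • p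

theorem continuous_pushPt (p : E) : Continuous (pushPt p) := by unfold pushPt; fun_prop

theorem pushPt_inj {p : E} (hp : ‖p‖ < 1) {x y : E} (h : pushPt p x = pushPt p y) : x = y := by
  unfold pushPt at h
  have h1 : x - y = (‖x‖ - ‖y‖) • p := by
    rw [sub_smul]
    have : x - y = (1 - ‖y‖) • p - (1 - ‖x‖) • p := by grind
    rw [this, ← sub_smul, ← sub_smul]; congr 1; ring
  have h2 : ‖x - y‖ ≤ ‖x - y‖ * ‖p‖ := by
    conv_lhs => rw [h1, norm_smul]
    exact mul_le_mul_of_nonneg_right (abs_norm_sub_norm_le x y) (norm_nonneg _)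
  have h3 : ‖x - y‖ = 0 := by nlinarith [norm_nonneg (x - y)]
  exact sub_eq_zero.1 (norm_eq_zero.1 h3)

theorem norm_pushPt_le {p x : E} (hp : ‖p‖ < 1) (hx : ‖x‖ ≤ 1) : ‖pushPt p x‖ ≤ 1 := by
  unfold pushPt
  refine (norm_add_le _ _).trans ?_
  rw [norm_smul, norm_of_nonneg (by linarith)]
  nlinarith [norm_nonneg p]

theorem exists_pushPt {p w : E} (hp : ‖p‖ < 1) (hw : ‖w‖ ≤ 1) : ∃ x, ‖x‖ ≤ 1 ∧ pushPt p x = w := by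
  have hc : ContinuousOn (fun s : ℝ => s + ‖w - s • p‖ - 1) (Icc 0 1) := by fun_prop
  have := intermediate_value_Icc (zero_le_one (α := ℝ)) hc
  obtain ⟨s, hs, hs0⟩ := this (show (0 : ℝ) ∈ _ from ⟨by aesop, by simp⟩)
  have hs0 : s + ‖w - s • p‖ - 1 = 0 := hs0
  refine ⟨w - s • p, by grind, ?_⟩
  unfold pushPt
  rw [show 1 - ‖w - s • p‖ = s by linarith]; simp

end

section

/-- Graph of the piecewise linear self-map of `[0,1]` sending `ρ` to `ρ'`. -/
def Thr (ρ ρ' r r' : ℝ) : Prop :=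
  (r ≤ ρ ∧ r' * ρ = r * ρ') ∨ (ρ ≤ r ∧ ρ' ≤ r' ∧ (1 - r') * (1 - ρ) = (1 - r) * (1 - ρ'))

theorem Thr.symm {ρ ρ' r r' : ℝ} (h0 : 0 < ρ) (h0' : 0 < ρ') (h : Thr ρ ρ' r r') :
    Thr ρ' ρ r' r := by
  rcases h with ⟨h1, h2⟩ | ⟨h1, h2, h3⟩
  · refine Or.inl ⟨?_, h2.symm⟩
    nlinarith
  · tauto

theorem Thr.exists {ρ ρ' r : ℝ} (h0 : 0 < ρ) (h0' : 0 < ρ') (h1 : ρ ≤ 1) (h1' : ρ' ≤ 1)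
    (he : ρ = 1 ↔ ρ' = 1) (hr : r ∈ Icc (0 : ℝ) 1) : ∃ r' ∈ Icc (0 : ℝ) 1, Thr ρ ρ' r r' := by
  by_cases h : r ≤ ρ
  · refine ⟨r * ρ' / ρ, ⟨by have := hr.1; positivity, ?_⟩, Or.inl ⟨h, by grind⟩⟩
    rw [div_le_one h0]; nlinarith [hr.1]
  · push Not at h
    have hρ : ρ < 1 := lt_of_lt_of_le h hr.2
    have h2 : 0 < 1 - ρ := by linarith
    have key : (1 - r) * (1 - ρ') / (1 - ρ) ≤ 1 - ρ' := by rw [div_le_iff₀ h2]; nlinarith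
    have key0 : 0 ≤ (1 - r) * (1 - ρ') / (1 - ρ) := div_nonneg (mul_nonneg (by grind) (by linarith)) h2.le
    refine ⟨1 - (1 - r) * (1 - ρ') / (1 - ρ), ⟨by linarith, by linarith⟩, Or.inr ⟨h.le, by linarith, by grind⟩⟩

theorem Thr.unique {ρ ρ' r r' s' : ℝ} (h0 : 0 < ρ) (h0' : 0 < ρ') (h1 : ρ ≤ 1) (h1' : ρ' ≤ 1)
    (he : ρ = 1 ↔ ρ' = 1) (hr : r ∈ Icc (0 : ℝ) 1) (hr' : r' ∈ Icc (0 : ℝ) 1)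
    (hs' : s' ∈ Icc (0 : ℝ) 1) (h : Thr ρ ρ' r r') (h' : Thr ρ ρ' r s') : r' = s' := by
  rcases h1.lt_or_eq with hlt | rfl
  · have h2 : 0 < 1 - ρ := by linarith
    have hlt' : ρ' < 1 := lt_of_le_of_ne h1' fun hh => hlt.ne (he.2 hh)
    have h3 : 0 < 1 - ρ' := by linarith
    rcases h with ⟨a, b⟩ | ⟨a, b, c⟩ <;> rcases h' with ⟨a', b'⟩ | ⟨a', b', c'⟩
    · grind
    · grind
    · grind
    · grind
  · have h2 : ρ' = 1 := he.1 rfl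
    subst h2
    rcases h with ⟨a, b⟩ | ⟨a, b, c⟩ <;> rcases h' with ⟨a', b'⟩ | ⟨a', b', c'⟩ <;>
      linarith [hr.2, hr'.2, hs'.2]

theorem Thr.zero_iff {ρ ρ' r r' : ℝ} (h0 : 0 < ρ) (h0' : 0 < ρ') (h : Thr ρ ρ' r r') :
    r = 0 ↔ r' = 0 := by
  rcases h with ⟨a, b⟩ | ⟨a, b, c⟩
  · grind
  · grind

theorem Thr.sign {ρ ρ' r r' : ℝ} (h0 : 0 < ρ) (h0' : 0 < ρ') (h1 : ρ < 1) (h1' : ρ' < 1)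
    (h : Thr ρ ρ' r r') : sign (ρ - r) = sign (ρ' - r') := by
  have hlt : ∀ {ρ ρ' r r' : ℝ}, 0 < ρ → 0 < ρ' → ρ < 1 → ρ' < 1 → Thr ρ ρ' r r' →
      r < ρ → r' < ρ' := by
    intro ρ ρ' r r' h0 h0' h1 h1' h hr
    rcases h with ⟨a, b⟩ | ⟨a, b, c⟩
    · nlinarith
    · linarith
  have hgt : ∀ {ρ ρ' r r' : ℝ}, 0 < ρ → 0 < ρ' → ρ < 1 → ρ' < 1 → Thr ρ ρ' r r' →
      ρ < r → ρ' < r' := by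
    intro ρ ρ' r r' h0 h0' h1 h1' h hr
    rcases h with ⟨a, b⟩ | ⟨a, b, c⟩
    · linarith
    · by_contra hh
      nlinarith
  have hs := h.symm h0 h0'
  rcases lt_trichotomy r ρ with hr | hr | hr
  · rw [sign_pos (by linarith), sign_pos (by grind)]
  · grind
  · rw [sign_neg (by linarith), sign_neg (by grind)]

end

section

variable {V : Type} [Fintype V] [DecidableEq V] {K L : Set (Finset V)}
variable {E : Type} [NormedAddCommGroup E] [NormedSpace ℝ E]

theorem cone_homeo [Nontrivial E] (hK : IsLowerSet K) (v : V)
    {e : (V → ℝ) → E} (he : HomeoOn e (realiz (lk K v)) (sphere 0 1)) {p : E} (hp : ‖p‖ < 1)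
    (Rel : ℝ → ℝ → realiz (lk K v) → Prop)
    (hcl : IsClosed {q : ℝ × ℝ × realiz (lk K v) | Rel q.1 q.2.1 q.2.2})
    (hex : ∀ y, ∀ r ∈ Icc (0 : ℝ) 1, ∃ r' ∈ Icc (0 : ℝ) 1, Rel r r' y)
    (hex' : ∀ y, ∀ r' ∈ Icc (0 : ℝ) 1, ∃ r ∈ Icc (0 : ℝ) 1, Rel r r' y)
    (hun : ∀ y, ∀ r ∈ Icc (0 : ℝ) 1, ∀ r' ∈ Icc (0 : ℝ) 1, ∀ s ∈ Icc (0 : ℝ) 1,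
      ∀ s' ∈ Icc (0 : ℝ) 1, Rel r r' y → Rel s s' y → (r = s ↔ r' = s'))
    (h0 : ∀ y, ∀ r ∈ Icc (0 : ℝ) 1, ∀ r' ∈ Icc (0 : ℝ) 1, Rel r r' y → (r = 0 ↔ r' = 0)) :
    ∃ f : (V → ℝ) → E, HomeoOn f (cstar K v) (closedBall 0 1) ∧
      ∀ r ∈ Icc (0 : ℝ) 1, ∀ r' ∈ Icc (0 : ℝ) 1, ∀ y, Rel r r' y →
        f (conePt v r y) = pushPt p (r' • e y) := by
  have hcY : CompactSpace (realiz (lk K v)) := isCompact_iff_compactSpace.1 (isCompact_realiz (isLowerSet_lk hK v))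
  have hsph : ∀ y : realiz (lk K v), ‖e y‖ = 1 := fun y => by simpa using he.bij.mapsTo y.2
  obtain ⟨s0, hs0⟩ : (sphere (0 : E) 1).Nonempty := NormedSpace.sphere_nonempty.2 zero_le_one
  obtain ⟨y0, hy0, rfl⟩ := he.bij.surjOn hs0
  let S : Set (ℝ × ℝ × realiz (lk K v)) := (Icc (0 : ℝ) 1 ×ˢ Icc (0 : ℝ) 1 ×ˢ univ) ∩
    {q | Rel q.1 q.2.1 q.2.2}
  have hS : IsCompact S := (isCompact_Icc.prod (isCompact_Icc.prod isCompact_univ)).inter_right hcl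
  have hece : Continuous fun y : realiz (lk K v) => e y := continuousOn_iff_continuous_domRestrict.1 he.cont
  have H := HomeoOn.param (X := cstar K v) (Y := closedBall (0 : E) 1) hS
    (α := fun q => conePt v q.1 (q.2.2 : V → ℝ)) (β := fun q => pushPt p (q.2.1 • e q.2.2))
    (Continuous.continuousOn ((continuous_conePt v).comp (f := fun q : ℝ × ℝ × realiz (lk K v) =>
      (q.1, (q.2.2 : V → ℝ))) (by fun_prop)))
    (Continuous.continuousOn ((continuous_pushPt p).comp
      (continuous_snd.fst.smul (hece.comp continuous_snd.snd))))
  refine (H ?_ ?_ ?_).elim fun f ⟨hf, hfq⟩ => ?_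
  rotate_right
  · exact ⟨f, hf, fun r hr r' hr' y hrel => hfq (r, r', y) ⟨⟨hr, hr', trivial⟩, hrel⟩⟩
  · apply Subset.antisymm
    · rintro _ ⟨q, hq, rfl⟩
      exact conePt_mem hK q.2.2.2 hq.1.1
    · intro x hx
      by_cases h1 : x v = 1
      · obtain ⟨r', hr', hrel⟩ := hex ⟨y0, hy0⟩ 0 (by simp)
        refine ⟨(0, r', ⟨y0, hy0⟩), ⟨⟨by simp, hr', trivial⟩, hrel⟩, ?_⟩
        have hz : ∀ w, w ≠ v → x w = 0 := fun w hw => by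
          have h2 := hx.1.2.1
          rw [← add_sum_erase _ _ (Finset.mem_univ v), h1] at h2
          have h3 : ∑ w ∈ Finset.univ.erase v, x w = 0 := by linarith
          exact (sum_eq_zero_iff_of_nonneg fun i _ => hx.1.1 i).1 h3 w (by simp [hw])
        ext w
        by_cases hw : w = v
        · subst hw; simp [h1]
        · simp [conePt, hw, hz w hw]
      · obtain ⟨y, hy, hxy⟩ := exists_conePt hK hx h1
        have hr : 1 - x v ∈ Icc (0 : ℝ) 1 := ⟨by linarith [le_one_of_sum hx.1.1 hx.1.2.1 v], by linarith [hx.1.1 v]⟩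
        obtain ⟨r', hr', hrel⟩ := hex ⟨y, hy⟩ _ hr
        exact ⟨(1 - x v, r', ⟨y, hy⟩), ⟨⟨hr, hr', trivial⟩, hrel⟩, hxy.symm⟩
  · apply Subset.antisymm
    · rintro _ ⟨q, hq, rfl⟩
      rw [mem_closedBall_zero_iff]
      refine norm_pushPt_le hp ?_
      rw [norm_smul, hsph, mul_one, norm_of_nonneg hq.1.2.1.1]
      exact hq.1.2.1.2
    · intro w hw
      rw [mem_closedBall_zero_iff] at hw
      obtain ⟨x, hx, rfl⟩ := exists_pushPt hp hw
      have : ∃ y : realiz (lk K v), ‖x‖ • e y = x := by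
        by_cases hx0 : x = 0
        · exact ⟨⟨y0, hy0⟩, by simp [hx0]⟩
        · have hn : ‖x‖ ≠ 0 := norm_ne_zero_iff.2 hx0
          have : ‖x‖⁻¹ • x ∈ sphere (0 : E) 1 := by
            rw [mem_sphere_zero_iff_norm, norm_smul, norm_inv, norm_norm, inv_mul_cancel₀ hn]
          obtain ⟨y, hy, hye⟩ := he.bij.surjOn this
          refine ⟨⟨y, hy⟩, ?_⟩
          simp only [hye, smul_smul, mul_inv_cancel₀ hn, one_smul]
      obtain ⟨y, hy⟩ := this
      have hxI : ‖x‖ ∈ Icc (0 : ℝ) 1 := ⟨norm_nonneg _, hx⟩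
      obtain ⟨r, hr, hrel⟩ := hex' y _ hxI
      refine ⟨(r, ‖x‖, y), ⟨⟨hr, hxI, trivial⟩, hrel⟩, ?_⟩
      simp only [hy]
  · rintro ⟨r, r', y⟩ ⟨⟨hr, hr', -⟩, hrel⟩ ⟨s, s', y'⟩ ⟨⟨hs, hs', -⟩, hrel'⟩
    simp only at hr hr' hs hs' hrel hrel' ⊢
    have hz := h0 y r hr r' hr' hrel
    have hz' := h0 y' s hs s' hs' hrel'
    rw [conePt_inj (lk_apply_self y.2) (lk_apply_self y'.2)]
    constructor
    · rintro ⟨rfl, rfl | hyy⟩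
      · rw [hz.1 rfl, hz'.1 rfl, zero_smul, zero_smul]
      · grind
    · intro h
      have h2 := pushPt_inj hp h
      have h3 : r' = s' := by
        have := congrArg norm h2
        rwa [norm_smul, norm_smul, hsph, hsph, mul_one, mul_one, norm_of_nonneg hr'.1,
          norm_of_nonneg hs'.1] at this
      subst h3
      by_cases hr0 : r' = 0
      · grind
      · have h4 : e y = e y' := smul_right_injective E hr0 h2
        obtain rfl : y = y' := Subtype.ext (he.bij.injOn y.2 y'.2 h4)
        grind

/-- The realization of `L` is a unit sphere on which the affine extension of `g` has the sign
of the linear functional `z`. -/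
def SignPair (z : E →L[ℝ] ℝ) (L : Set (Finset V)) (g : V → ℝ) : Prop :=
  ∃ e : (V → ℝ) → E, HomeoOn e (realiz L) (sphere 0 1) ∧
    ∀ x ∈ realiz L, sign (evCol g x) = sign (z (e x))

/-- There is a self-homeomorphism of the realization of `L` carrying the sign of `g` to that
of `g'`. -/
def SignEquiv (L : Set (Finset V)) (g g' : V → ℝ) : Prop :=
  ∃ h : (V → ℝ) → (V → ℝ), HomeoOn h (realiz L) (realiz L) ∧
    ∀ x ∈ realiz L, sign (evCol g' (h x)) = sign (evCol g x)

theorem evCol_neg (g x : V → ℝ) : evCol (-g) x = -evCol g x := by simp [evCol, Finset.sum_neg_distrib]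

theorem sign_neg_eq {a b : ℝ} (h : sign a = sign b) :
    sign (-a) = sign (-b) := by
  rw [Left.sign_neg, Left.sign_neg, h]

theorem SignEquiv.trans {g₁ g₂ g₃ : V → ℝ} (h : SignEquiv L g₁ g₂)
    (h' : SignEquiv L g₂ g₃) : SignEquiv L g₁ g₃ := by
  obtain ⟨f, hf, hs⟩ := h
  obtain ⟨f', hf', hs'⟩ := h'
  exact ⟨f' ∘ f, hf'.comp hf, fun x hx => (hs' _ (hf.bij.mapsTo hx)).trans (hs x hx)⟩

theorem SignEquiv.symm (hL : IsLowerSet L) {g₁ g₂ : V → ℝ}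
    (h : SignEquiv L g₁ g₂) : SignEquiv L g₂ g₁ := by
  obtain ⟨f, hf, hs⟩ := h
  obtain ⟨k, hk, hi⟩ := hf.exists_symm (isCompact_realiz hL)
  refine ⟨k, hk, fun x hx => ?_⟩
  rw [← hs _ (hk.bij.mapsTo hx), hi.2 hx]

theorem SignEquiv.neg {g₁ g₂ : V → ℝ}
    (h : SignEquiv L g₁ g₂) : SignEquiv L (-g₁) (-g₂) := by
  obtain ⟨f, hf, hs⟩ := h
  refine ⟨f, hf, fun x hx => ?_⟩
  rw [evCol_neg, evCol_neg]
  exact sign_neg_eq (hs x hx)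

theorem SignPair.of_equiv {z : E →L[ℝ] ℝ} {g₁ g₂ : V → ℝ}
    (h : SignPair z L g₂) (h' : SignEquiv L g₁ g₂) : SignPair z L g₁ := by
  obtain ⟨e, he, hs⟩ := h
  obtain ⟨f, hf, hs'⟩ := h'
  exact ⟨e ∘ f, he.comp hf, fun x hx => (hs' x hx).symm.trans (hs _ (hf.bij.mapsTo hx))⟩

theorem evCol_congr {g g' x : V → ℝ} (h : ∀ v, x v ≠ 0 → g v = g' v) : evCol g x = evCol g' x := by
  refine sum_congr rfl fun v _ => ?_
  by_cases hv : x v = 0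
  · simp [hv]
  · rw [h v hv]

theorem exists_norm_lt_pos {z : E →L[ℝ] ℝ} (hz : z ≠ 0) : ∃ p : E, ‖p‖ < 1 ∧ 0 < z p := by
  obtain ⟨q, hq⟩ : ∃ q, z q ≠ 0 := by by_contra h; push Not at h; exact hz (ContinuousLinearMap.ext h)
  have hq0 : 0 < ‖q‖ + 1 := by positivity
  refine ⟨((z q) / |z q| / (‖q‖ + 1)) • q, ?_, ?_⟩
  · rw [norm_smul, norm_div, norm_div, norm_eq_abs, norm_eq_abs, abs_abs,
      div_self (abs_ne_zero.2 hq), norm_of_nonneg hq0.le, one_div, inv_mul_lt_iff₀ hq0]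
    linarith
  · rw [map_smul, smul_eq_mul]
    have : z q / |z q| / (‖q‖ + 1) * z q = (z q * z q) / (|z q| * (‖q‖ + 1)) := by field_simp
    rw [this]
    have := mul_self_pos.2 hq
    have := abs_pos.2 hq
    positivity

theorem signPair_cone {z : E →L[ℝ] ℝ} (hz : z ≠ 0) (hK : IsLowerSet K)
    {v : V} {g : V → ℝ} {e : (V → ℝ) → E}
    (he : HomeoOn e (realiz (lk K v)) (sphere 0 1))
    (hs : ∀ x ∈ realiz (lk K v), sign (evCol g x) = sign (z (e x)))
    (hg : 0 ≤ g v) : ∃ f : (V → ℝ) → E, HomeoOn f (cstar K v) (closedBall 0 1) ∧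
      (∀ x ∈ realiz (lk K v), f x = e x) ∧
      ∀ x ∈ cstar K v, sign (evCol g x) = sign (z (f x)) := by
  have hnt : Nontrivial E := by
    by_contra hh
    rw [not_nontrivial_iff_subsingleton] at hh
    exact hz (ContinuousLinearMap.ext fun x => by rw [Subsingleton.elim x 0]; simp)
  set Y := realiz (lk K v) with hY
  -- a common wrap-up
  suffices H : ∃ (p : E) (Rel : ℝ → ℝ → Y → Prop), ‖p‖ < 1 ∧
      IsClosed {q : ℝ × ℝ × Y | Rel q.1 q.2.1 q.2.2} ∧
      (∀ y, ∀ r ∈ Icc (0 : ℝ) 1, ∃ r' ∈ Icc (0 : ℝ) 1, Rel r r' y) ∧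
      (∀ y, ∀ r' ∈ Icc (0 : ℝ) 1, ∃ r ∈ Icc (0 : ℝ) 1, Rel r r' y) ∧
      (∀ y, ∀ r ∈ Icc (0 : ℝ) 1, ∀ r' ∈ Icc (0 : ℝ) 1, ∀ s ∈ Icc (0 : ℝ) 1,
        ∀ s' ∈ Icc (0 : ℝ) 1, Rel r r' y → Rel s s' y → (r = s ↔ r' = s')) ∧
      (∀ y, ∀ r ∈ Icc (0 : ℝ) 1, ∀ r' ∈ Icc (0 : ℝ) 1, Rel r r' y → (r = 0 ↔ r' = 0)) ∧
      (∀ y, Rel 1 1 y) ∧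
      (∀ y, ∀ r ∈ Icc (0 : ℝ) 1, ∀ r' ∈ Icc (0 : ℝ) 1, Rel r r' y →
        sign ((1 - r) * g v + r * evCol g y) =
          sign (r' * z (e y) + (1 - r') * z p)) by
    obtain ⟨p, Rel, hp, hcl, hex, hex', hun, h0, h1, hsg⟩ := H
    obtain ⟨f, hf, hfq⟩ := cone_homeo hK v he hp Rel hcl hex hex' hun h0
    have hsph : ∀ y : Y, ‖e y‖ = 1 := fun y => by simpa using he.bij.mapsTo y.2
    have key : ∀ y : Y, ∀ r ∈ Icc (0 : ℝ) 1,
        sign (evCol g (conePt v r y)) = sign (z (f (conePt v r y))) := fun y r hr => by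
      obtain ⟨r', hr', hrel⟩ := hex y r hr
      rw [hfq r hr r' hr' y hrel, sum_conePt (lk_apply_self y.2), hsg y r hr r' hr' hrel]
      congr 1
      rw [pushPt, map_add, map_smul, map_smul, norm_smul, hsph, mul_one,
        norm_of_nonneg hr'.1, smul_eq_mul, smul_eq_mul]
    have hone : ∀ y : Y, conePt v 1 (y : V → ℝ) = y := fun y => by
      ext w
      by_cases hw : w = v
      · subst hw; simp [lk_apply_self y.2]
      · simp [conePt, hw]
    refine ⟨f, hf, fun x hx => ?_, fun x hx => ?_⟩
    · have := hfq 1 (by simp) 1 (by simp) ⟨x, hx⟩ (h1 _)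
      rw [hone ⟨x, hx⟩] at this
      have hx1 := hsph ⟨x, hx⟩
      simpa [pushPt, hx1] using this
    · by_cases hxv : x v = 1
      · obtain ⟨s0, hs0⟩ : (sphere (0 : E) 1).Nonempty :=
          NormedSpace.sphere_nonempty.2 zero_le_one
        obtain ⟨y0, hy0, rfl⟩ := he.bij.surjOn hs0
        have hxe : x = conePt v 0 y0 := by
          ext w
          by_cases hw : w = v
          · subst hw; simp [hxv]
          · have h2 := hx.1.2.1
            rw [← add_sum_erase _ _ (Finset.mem_univ v), hxv] at h2
            have h3 : ∑ w ∈ Finset.univ.erase v, x w = 0 := by linarith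
            rw [(sum_eq_zero_iff_of_nonneg fun i _ => hx.1.1 i).1 h3 w (by simp [hw])]
            simp [conePt, hw]
        rw [hxe]; exact key ⟨y0, hy0⟩ 0 (by simp)
      · obtain ⟨y, hy, hxy⟩ := exists_conePt hK hx hxv
        rw [hxy]
        exact key ⟨y, hy⟩ _ ⟨by linarith [le_one_of_sum hx.1.1 hx.1.2.1 v], by linarith [hx.1.1 v]⟩
  rcases hg.eq_or_lt with ha | ha
  · refine ⟨0, fun r r' _ => r = r', by simp, ?_, ?_, ?_, ?_, ?_, ?_, ?_⟩
    · exact isClosed_eq continuous_fst continuous_snd.fst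
    · grind
    · grind
    · grind
    · grind
    · exact fun _ => rfl
    · rintro y r hr r' - rfl
      rw [← ha, mul_zero, zero_add, map_zero, mul_zero, add_zero, sign_mul, sign_mul, hs y y.2]
  · obtain ⟨p, hp, hzp⟩ := exists_norm_lt_pos hz
    let ρ : Y → ℝ := fun y => g v / (g v + max (-(evCol g y)) 0)
    let ρ' : Y → ℝ := fun y => z p / (z p + max (-(z (e y))) 0)
    have hd : ∀ y : Y, 0 < g v + max (-(evCol g y)) 0 := fun y => add_pos_of_pos_of_nonneg ha (le_max_right _ _)
    have hd' : ∀ y : Y, 0 < z p + max (-(z (e y))) 0 := fun y => add_pos_of_pos_of_nonneg hzp (le_max_right _ _)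
    have hρ0 : ∀ y, 0 < ρ y := fun y => div_pos ha (hd y)
    have hρ0' : ∀ y, 0 < ρ' y := fun y => div_pos hzp (hd' y)
    have hρ1 : ∀ y, ρ y ≤ 1 := fun y => (div_le_one (hd y)).2 (by simp)
    have hρ1' : ∀ y, ρ' y ≤ 1 := fun y => (div_le_one (hd' y)).2 (by simp)
    have hone : ∀ y, ρ y = 1 ↔ 0 ≤ evCol g y := by grind
    have hone' : ∀ y, ρ' y = 1 ↔ 0 ≤ z (e y) := by grind
    have hsgn : ∀ y : Y, 0 ≤ evCol g y ↔ 0 ≤ z (e y) := fun y => by rw [← sign_nonneg_iff, hs y y.2, sign_nonneg_iff]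
    have hee : ∀ y, ρ y = 1 ↔ ρ' y = 1 := fun y => by grind
    have hcρ : Continuous ρ := by
      refine continuous_const.div ?_ fun y => (hd y).ne'
      exact continuous_const.add ((((continuous_evCol g).comp continuous_subtype_val).neg).max
        continuous_const)
    have hece : Continuous fun y : Y => e y := continuousOn_iff_continuous_domRestrict.1 he.cont
    have hcρ' : Continuous ρ' := by
      refine continuous_const.div ?_ fun y => (hd' y).ne'
      exact continuous_const.add (((z.continuous.comp hece).neg).max continuous_const)
    refine ⟨p, fun r r' y => Thr (ρ y) (ρ' y) r r', hp, ?_, ?_, ?_, ?_, ?_, ?_, ?_⟩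
    · unfold Thr
      have c1 : Continuous fun q : ℝ × ℝ × Y => ρ q.2.2 := hcρ.comp continuous_snd.snd
      have c2 : Continuous fun q : ℝ × ℝ × Y => ρ' q.2.2 := hcρ'.comp continuous_snd.snd
      rw [setOf_or, setOf_and, setOf_and, setOf_and]
      refine ((isClosed_le ?_ ?_).inter (isClosed_eq ?_ ?_)).union ((isClosed_le ?_ ?_).inter
        ((isClosed_le ?_ ?_).inter (isClosed_eq ?_ ?_))) <;> fun_prop
    · exact fun y r hr => Thr.exists (hρ0 y) (hρ0' y) (hρ1 y) (hρ1' y) (hee y) hr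
    · intro y r hr
      obtain ⟨s, hs, hh⟩ := Thr.exists (hρ0' y) (hρ0 y) (hρ1' y) (hρ1 y) (hee y).symm hr
      exact ⟨s, hs, hh.symm (hρ0' y) (hρ0 y)⟩
    · intro y r hr r' hr' s hs s' hs' h h'
      constructor
      · rintro rfl
        exact Thr.unique (hρ0 y) (hρ0' y) (hρ1 y) (hρ1' y) (hee y) hr hr' hs' h h'
      · rintro rfl
        exact Thr.unique (hρ0' y) (hρ0 y) (hρ1' y) (hρ1 y) (hee y).symm hr' hr hs
          (h.symm (hρ0 y) (hρ0' y)) (h'.symm (hρ0 y) (hρ0' y))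
    · exact fun y r hr r' hr' h => h.zero_iff (hρ0 y) (hρ0' y)
    · exact fun y => Or.inr ⟨hρ1 y, hρ1' y, by ring⟩
    · intro y r hr r' hr' h
      by_cases hn : 0 ≤ evCol g y
      · have e1 := (hone y).2 hn
        have e2 := (hone' y).2 ((hsgn y).1 hn)
        have : r' = r := by
          have hrr : Thr (ρ y) (ρ' y) r r := Or.inl ⟨by rw [e1]; exact hr.2, by rw [e1, e2]⟩
          exact Thr.unique (hρ0 y) (hρ0' y) (hρ1 y) (hρ1' y) (hee y) hr hr' hr h hrr
        subst this
        have hpos : ∀ {a b : ℝ}, 0 < a → 0 ≤ b → r' < 1 → 0 < (1 - r') * a + r' * b := by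
          intro a b ha hb h1
          have := mul_pos (sub_pos.2 h1) ha
          have := mul_nonneg hr.1 hb
          linarith
        rcases hr.2.lt_or_eq with h1 | h1
        · rw [sign_pos (hpos ha hn h1), add_comm, sign_pos (hpos hzp ((hsgn y).1 hn) h1)]
        · grind
      · have hn' := fun hh => hn ((hsgn y).2 hh)
        have e1 : ρ y < 1 := lt_of_le_of_ne (hρ1 y) fun hh => hn ((hone y).1 hh)
        have e2 : ρ' y < 1 := lt_of_le_of_ne (hρ1' y) fun hh => hn' ((hone' y).1 hh)
        replace hn' := not_le.1 hn'
        rw [not_le] at hn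
        have m1 : max (-(evCol g y)) 0 = -(evCol g y) := max_eq_left (by linarith)
        have m2 : max (-(z (e y))) 0 = -(z (e y)) := max_eq_left (by linarith)
        have f1 : (1 - r) * g v + r * evCol g y = (g v + max (-(evCol g y)) 0) * (ρ y - r) := by grind
        have f2 : r' * z (e y) + (1 - r') * z p = (z p + max (-(z (e y))) 0) * (ρ' y - r') := by grind
        rw [f1, f2, sign_mul, sign_mul, sign_pos (hd y), sign_pos (hd' y), h.sign (hρ0 y) (hρ0' y) e1 e2]

end

section

variable {V : Type} [Fintype V] [DecidableEq V] {K : Set (Finset V)} {v : V}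
variable {E : Type} [NormedAddCommGroup E] [NormedSpace ℝ E]

theorem signPair_cone' {z : E →L[ℝ] ℝ} (hz : z ≠ 0) (hK : IsLowerSet K)
    {g : V → ℝ} {e : (V → ℝ) → E}
    (he : HomeoOn e (realiz (lk K v)) (sphere 0 1))
    (hs : ∀ x ∈ realiz (lk K v), sign (evCol g x) = sign (z (e x))) :
    ∃ f : (V → ℝ) → E, HomeoOn f (cstar K v) (closedBall 0 1) ∧
      (∀ x ∈ realiz (lk K v), f x = e x) ∧
      ∀ x ∈ cstar K v, sign (evCol g x) = sign (z (f x)) := by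
  rcases le_total 0 (g v) with h | h
  · exact signPair_cone hz hK he hs h
  · obtain ⟨f, hf, hfe, hfs⟩ := signPair_cone (neg_ne_zero.2 hz) hK (g := -g) he (fun x hx => by
      rw [evCol_neg, ContinuousLinearMap.neg_apply]; exact sign_neg_eq (hs x hx))
      (by aesop)
    refine ⟨f, hf, hfe, fun x hx => ?_⟩
    have := hfs x hx
    rw [evCol_neg, ContinuousLinearMap.neg_apply] at this
    simpa using sign_neg_eq this

theorem signEquiv_flip {z : E →L[ℝ] ℝ} (hz : z ≠ 0) (hK : IsLowerSet K)
    {g : V → ℝ} (h : SignPair z (lk K v) g) (b : ℝ) :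
    SignEquiv K g (update g v b) := by
  classical
  obtain ⟨e, he, hs⟩ := h
  have hgg : ∀ x : V → ℝ, x v = 0 → evCol g x = evCol (update g v b) x := fun x hx => by
    refine evCol_congr fun w hw => ?_
    rw [Function.update_of_ne]
    rintro rfl; exact hw hx
  obtain ⟨f, hf, hfe, hfs⟩ := signPair_cone' hz hK he hs
  obtain ⟨f', hf', hfe', hfs'⟩ := signPair_cone' (g := update g v b) hz hK he
    (fun x hx => by rw [← hgg x (lk_apply_self hx)]; exact hs x hx)
  have hstar : IsCompact (cstar K v) :=
    (isCompact_realiz hK).of_isClosed_subset (isClosed_cstar hK v) fun x hx => hx.1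
  obtain ⟨k, hk, hki⟩ := hf'.exists_symm hstar
  have hkf := hk.comp hf
  have hid : ∀ x ∈ realiz (lk K v), x ∈ cstar K v → k (f x) = x := fun x hx hxs => by
    rw [hfe x hx, ← hfe' x hx, hki.1 hxs]
  refine ⟨fun x => if x ∈ cstar K v then k (f x) else x, ⟨?_, ?_, ?_, ?_⟩, ?_⟩
  · rw [realiz_eq_cstar_union v]
    have hc2 : IsClosed {x ∈ realiz K | x v = 0} :=
      (isClosed_realiz hK).inter (isClosed_eq (continuous_apply v) continuous_const)
    refine ContinuousOn.union_of_isClosed ?_ ?_ (isClosed_cstar hK v) hc2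
    · exact hkf.cont.congr fun x hx => by simp [hx]
    · refine continuousOn_id.congr fun x hx => ?_
      by_cases hxs : x ∈ cstar K v
      · simp only [if_pos hxs]; exact hid x (mem_lk_of_cstar hxs hx.2) hxs
      · simp [hxs]
  · intro x hx
    dsimp only
    split_ifs with h
    · exact (hkf.bij.mapsTo h).1
    · exact hx
  · intro x hx y hy hxy
    dsimp only at hxy
    split_ifs at hxy with h1 h2 h2
    · exact hkf.bij.injOn h1 h2 hxy
    · exact absurd (hxy ▸ hkf.bij.mapsTo h1) h2
    · exact absurd (hxy.symm ▸ hkf.bij.mapsTo h2) h1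
    · exact hxy
  · intro y hy
    by_cases h : y ∈ cstar K v
    · obtain ⟨x, hx, rfl⟩ := hkf.bij.surjOn h
      exact ⟨x, hx.1, by simp [hx]⟩
    · grind
  · intro x hx
    dsimp only
    split_ifs with h
    · have e1 := hfs' _ (hkf.bij.mapsTo h)
      rw [Function.comp_apply] at e1
      rw [e1, hki.2 (hf.bij.mapsTo h), hfs x h]
    · have : x v = 0 := by
        by_contra h0
        exact h ⟨hx, by rw [Finset.insert_eq_of_mem (mem_vsupp.2 h0)]; exact hx.2.2⟩
      rw [hgg x this]

/-- The coloring which is `1` on `P` and `-1` elsewhere. -/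
def pmCol (P : Finset V) : V → ℝ := fun w => if w ∈ P then 1 else -1

theorem evCol_pmCol_singleton {x : V → ℝ} (hx : ∑ v, x v = 1) (u : V) :
    evCol (pmCol {u}) x = 2 * x u - 1 := by
  unfold evCol pmCol
  rw [← add_sum_erase _ _ (Finset.mem_univ u)] at hx ⊢
  rw [sum_congr rfl (g := fun w => -x w) fun w hw => by
    simp [ne_of_mem_erase hw], Finset.sum_neg_distrib]
  simp only [Finset.mem_singleton, if_true]
  linarith

theorem exists_conePt_of_pos (hK : IsLowerSet K) {x : V → ℝ}
    (hx : x ∈ realiz K) (h : 0 < x v) (hne : (realiz (lk K v)).Nonempty) :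
    ∃ y ∈ realiz (lk K v), x = conePt v (1 - x v) y := by
  have hxs : x ∈ cstar K v := ⟨hx, by rw [Finset.insert_eq_of_mem (mem_vsupp.2 h.ne')]; exact hx.2.2⟩
  by_cases h1 : x v = 1
  · obtain ⟨y0, hy0⟩ := hne
    refine ⟨y0, hy0, ?_⟩
    ext w
    by_cases hw : w = v
    · subst hw; simp
    · have h2 := hx.2.1
      rw [← add_sum_erase _ _ (Finset.mem_univ v), h1] at h2
      have h3 : ∑ w ∈ Finset.univ.erase v, x w = 0 := by linarith
      rw [(sum_eq_zero_iff_of_nonneg fun i _ => hx.1 i).1 h3 w (by simp [hw])]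
      simp [conePt, hw, h1]
  · exact exists_conePt hK hxs h1

/-- Gluing two cones: if the open stars of `u` and `v` can be exchanged up to homeomorphism and
the link of `u` is a sphere, then the whole complex is a sphere. -/
theorem signPair_glue [Nontrivial E] (hK : IsLowerSet K) {u v : V}
    {e : (V → ℝ) → E} (he : HomeoOn e (realiz (lk K u)) (sphere 0 1))
    (hh : SignEquiv K (pmCol {u}) (-pmCol {v})) :
    SignPair (fstL 1 ℝ ℝ E) K (pmCol {u}) := by
  obtain ⟨h, hh, hsg⟩ := hh
  obtain ⟨k, hk, hki⟩ := hh.exists_symm (isCompact_realiz hK)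
  have hsg' : ∀ x ∈ realiz K, sign (1 - 2 * h x v) = sign (2 * x u - 1) := fun x hx => by
    rw [← evCol_pmCol_singleton hx.2.1, ← hsg x hx, evCol_neg, evCol_pmCol_singleton (hh.bij.mapsTo hx).2.1]
    congr 1; ring
  set Y := realiz (lk K u) with hY
  have hsph : ∀ y ∈ Y, ‖e y‖ = 1 := fun y hy => by simpa using he.bij.mapsTo hy
  obtain ⟨s0, hs0⟩ : (sphere (0 : E) 1).Nonempty := NormedSpace.sphere_nonempty.2 zero_le_one
  obtain ⟨y0, hy0, rfl⟩ := he.bij.surjOn hs0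
  have hIcc : ∀ {r : ℝ}, r ∈ Icc (0 : ℝ) 2⁻¹ → r ∈ Icc (0 : ℝ) 1 := fun hr => ⟨hr.1, hr.2.trans (by norm_num)⟩
  have hhalf : (2⁻¹ : ℝ) ∈ Icc (0 : ℝ) 1 := by norm_num
  have hhalf' : (2⁻¹ : ℝ) ≠ 0 := by norm_num
  let b : (V → ℝ) → V → ℝ := fun y w => if w = v then 0 else 2 * h (conePt u 2⁻¹ y) w
  have hval : ∀ y ∈ Y, h (conePt u 2⁻¹ y) v = 2⁻¹ := fun y hy => by
    have := hsg' _ (conePt_mem hK hy hhalf).1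
    rw [conePt_self, show (2 : ℝ) * (1 - 2⁻¹) - 1 = 0 by norm_num, sign_zero, sign_eq_zero_iff] at this
    linarith
  have hb : ∀ y ∈ Y, h (conePt u 2⁻¹ y) = conePt v 2⁻¹ (b y) := fun y hy => by
    ext w
    by_cases hw : w = v
    · subst hw; rw [hval y hy, conePt_self]; norm_num
    · rw [conePt_of_ne hw]; simp only [b, if_neg hw]; ring
  have hbv : ∀ y, b y v = 0 := fun y => by simp [b]
  have hne : (realiz (lk K v)).Nonempty := by
    obtain ⟨y, hy, -⟩ := exists_conePt hK (v := v) (x := h (conePt u 2⁻¹ y0))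
      ⟨hh.bij.mapsTo (conePt_mem hK hy0 hhalf).1, by
        rw [Finset.insert_eq_of_mem (mem_vsupp.2 (by rw [hval y0 hy0]; norm_num))]
        exact (hh.bij.mapsTo (conePt_mem hK hy0 hhalf).1).2.2⟩ (by rw [hval y0 hy0]; norm_num)
    exact ⟨y, hy⟩
  have hbmem : ∀ y ∈ Y, b y ∈ realiz (lk K v) := fun y hy => by
    obtain ⟨y', hy', he'⟩ := exists_conePt_of_pos hK (hh.bij.mapsTo (conePt_mem hK hy hhalf).1)
      (v := v) (by rw [hval y hy]; norm_num) hne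
    rw [hval y hy, hb y hy, show (1 : ℝ) - 2⁻¹ = 2⁻¹ by norm_num, conePt_inj (hbv y) (lk_apply_self hy')] at he'
    rw [he'.2.resolve_left hhalf']; exact hy'
  have hbinj : ∀ y ∈ Y, ∀ y' ∈ Y, b y = b y' → y = y' := fun y hy y' hy' hbb => by
    have := hh.bij.injOn (conePt_mem hK hy hhalf).1 (conePt_mem hK hy' hhalf).1
      (by rw [hb y hy, hb y' hy', hbb])
    rw [conePt_inj (lk_apply_self hy) (lk_apply_self hy')] at this
    exact this.2.resolve_left hhalf'
  have hbsurj : ∀ y' ∈ realiz (lk K v), ∃ y ∈ Y, b y = y' := fun y' hy' => by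
    have hm := (conePt_mem hK hy' hhalf).1
    have hkm := hk.bij.mapsTo hm
    have h1 := hsg' _ hkm
    rw [hki.2 hm, conePt_self, show (1 : ℝ) - 2 * (1 - 2⁻¹) = 0 by norm_num, sign_zero, eq_comm,
      sign_eq_zero_iff] at h1
    have h2 : k (conePt v 2⁻¹ y') u = 2⁻¹ := by linarith
    obtain ⟨y, hy, hye⟩ := exists_conePt_of_pos hK hkm (v := u) (by linarith) ⟨y0, hy0⟩
    rw [h2, show (1 : ℝ) - 2⁻¹ = 2⁻¹ by norm_num] at hye
    refine ⟨y, hy, ?_⟩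
    have h3 := hb y hy
    rw [← hye, hki.2 hm, conePt_inj (lk_apply_self hy') (hbv y)] at h3
    exact (h3.2.resolve_left hhalf').symm
  have hbc : ContinuousOn b Y := by
    have : ContinuousOn (fun y => h (conePt u 2⁻¹ y)) Y :=
      hh.cont.comp (Continuous.continuousOn ((continuous_conePt u).comp
        (continuous_const.prodMk continuous_id))) fun y hy => (conePt_mem hK hy hhalf).1
    refine continuousOn_pi.2 fun w => ?_
    by_cases hw : w = v
    · simp only [b, hw, if_true]; exact continuousOn_const
    · simp only [b, if_neg hw]
      exact continuousOn_const.mul (continuousOn_pi.1 this w)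
  have hcY : CompactSpace Y := isCompact_iff_compactSpace.1 (isCompact_realiz (isLowerSet_lk hK u))
  let α₂ : Icc (0 : ℝ) 2⁻¹ × Y → V → ℝ := fun q => k (conePt v q.1 (b q.2))
  let β₁ : Icc (0 : ℝ) 2⁻¹ × Y → WithLp 1 (ℝ × E) := fun q => toLp 1 (1 - 2 * (q.1 : ℝ), (2 * (q.1 : ℝ)) • e q.2)
  let β₂ : Icc (0 : ℝ) 2⁻¹ × Y → WithLp 1 (ℝ × E) := fun q => toLp 1 (-(1 - 2 * (q.1 : ℝ)), (2 * (q.1 : ℝ)) • e q.2)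
  let α : (Icc (0 : ℝ) 2⁻¹ × Y) ⊕ (Icc (0 : ℝ) 2⁻¹ × Y) → V → ℝ := elim (fun q => conePt u q.1 q.2) α₂
  let β : (Icc (0 : ℝ) 2⁻¹ × Y) ⊕ (Icc (0 : ℝ) 2⁻¹ × Y) → WithLp 1 (ℝ × E) := elim β₁ β₂
  have hece : Continuous fun y : Y => e y := continuousOn_iff_continuous_domRestrict.1 he.cont
  have hbce : Continuous fun y : Y => b y := continuousOn_iff_continuous_domRestrict.1 hbc
  have hβ₁ : Continuous β₁ := by
    refine (WithLp.prod_continuous_toLp 1 ℝ E).comp ?_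
    refine Continuous.prodMk (by fun_prop) (Continuous.smul (by fun_prop) (hece.comp continuous_snd))
  have hβ₂ : Continuous β₂ := by
    refine (WithLp.prod_continuous_toLp 1 ℝ E).comp ?_
    refine Continuous.prodMk (by fun_prop) (Continuous.smul (by fun_prop) (hece.comp continuous_snd))
  have hmem₂ : ∀ q : Icc (0 : ℝ) 2⁻¹ × Y, conePt v q.1 (b q.2) ∈ realiz K := fun q =>
    (conePt_mem hK (hbmem _ q.2.2) (hIcc q.1.2)).1
  have hα₂ : Continuous α₂ := by
    refine hk.cont.comp_continuous ?_ hmem₂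
    exact (continuous_conePt v).comp (f := fun q : Icc (0 : ℝ) 2⁻¹ × Y => ((q.1 : ℝ), b q.2))
      (Continuous.prodMk (by fun_prop) (hbce.comp continuous_snd))
  have hα₁ : Continuous fun q : Icc (0 : ℝ) 2⁻¹ × Y => conePt u (q.1 : ℝ) (q.2 : V → ℝ) :=
    (continuous_conePt u).comp (f := fun q : Icc (0 : ℝ) 2⁻¹ × Y => ((q.1 : ℝ), (q.2 : V → ℝ))) (by fun_prop)
  have hsign1 : ∀ q : Icc (0 : ℝ) 2⁻¹ × Y, evCol (pmCol {u}) (conePt u (q.1 : ℝ) (q.2 : V → ℝ)) = 1 - 2 * (q.1 : ℝ) := fun q => by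
    rw [evCol_pmCol_singleton (conePt_mem hK q.2.2 (hIcc q.1.2)).1.2.1, conePt_self]; ring
  have hsign2 : ∀ q : Icc (0 : ℝ) 2⁻¹ × Y, sign (evCol (pmCol {u}) (α₂ q)) =
      sign (-(1 - 2 * (q.1 : ℝ))) := fun q => by
    rw [← hsg _ (hk.bij.mapsTo (hmem₂ q)), hki.2 (hmem₂ q), evCol_neg,
      evCol_pmCol_singleton (hmem₂ q).2.1, conePt_self]
    congr 1; ring
  have H := HomeoOn.param (X := realiz K) (Y := sphere (0 : WithLp 1 (ℝ × E)) 1)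
    (S := univ) isCompact_univ (α := α) (β := β) (hα₁.sumElim hα₂).continuousOn
    (hβ₁.sumElim hβ₂).continuousOn
  have hA : α '' univ = realiz K := by
    rw [image_univ]
    apply Subset.antisymm
    · rintro _ ⟨q | q, rfl⟩
      · exact (conePt_mem hK q.2.2 (hIcc q.1.2)).1
      · exact hk.bij.mapsTo (hmem₂ q)
    · intro x hx
      by_cases h1 : 2⁻¹ ≤ x u
      · obtain ⟨y, hy, hxy⟩ := exists_conePt_of_pos hK hx (v := u) (by linarith) ⟨y0, hy0⟩
        exact ⟨Sum.inl (⟨1 - x u, by linarith [le_one_of_sum hx.1 hx.2.1 u], by linarith⟩, ⟨y, hy⟩), hxy.symm⟩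
      · have h2 := hsg' x hx
        rw [sign_neg (show 2 * x u - 1 < 0 by linarith), sign_eq_neg_one_iff] at h2
        have hhx := hh.bij.mapsTo hx
        obtain ⟨y', hy', hxy⟩ := exists_conePt_of_pos hK hhx (v := v) (by linarith) hne
        obtain ⟨y, hy, rfl⟩ := hbsurj y' hy'
        refine ⟨inr (⟨1 - h x v, by linarith [le_one_of_sum hhx.1 hhx.2.1 v], by linarith⟩, ⟨y, hy⟩), ?_⟩
        simp only [α, α₂, elim_inr]
        rw [← hxy, hki.1 hx]
  have hB : β '' univ = sphere (0 : WithLp 1 (ℝ × E)) 1 := by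
    rw [image_univ]
    have hn : ∀ (a : ℝ) (r : ℝ) (y : Y), 0 ≤ r → ‖(toLp 1 (a, (2 * r) • e y) : WithLp 1 (ℝ × E))‖ = |a| + 2 * r := fun a r y hr => by
      rw [WithLp.prod_norm_eq_of_L1]
      simp only [norm_eq_abs, WithLp.fst, WithLp.snd]
      rw [norm_smul, hsph y y.2, mul_one, norm_of_nonneg (by positivity)]
    have hab : ∀ r ∈ Icc (0 : ℝ) 2⁻¹, |1 - 2 * r| = 1 - 2 * r := fun r hr => abs_of_nonneg (by linarith [hr.2])
    apply Subset.antisymm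
    · rintro _ ⟨q | q, rfl⟩
      · simp only [β, β₁, Sum.elim_inl, mem_sphere_zero_iff_norm]
        rw [hn _ _ _ q.1.2.1, hab _ q.1.2]; ring
      · simp only [β, β₂, elim_inr, mem_sphere_zero_iff_norm]
        rw [hn _ _ _ q.1.2.1, abs_neg, hab _ q.1.2]; ring
    · intro w hw
      rw [mem_sphere_zero_iff_norm, WithLp.prod_norm_eq_of_L1, norm_eq_abs] at hw
      have hex : ∃ y : Y, ‖w.snd‖ • e y = w.snd := by
        by_cases hx0 : w.snd = 0
        · exact ⟨⟨y0, hy0⟩, by simp [hx0]⟩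
        · have hn : ‖w.snd‖ ≠ 0 := norm_ne_zero_iff.2 hx0
          have : ‖w.snd‖⁻¹ • w.snd ∈ sphere (0 : E) 1 := by
            rw [mem_sphere_zero_iff_norm, norm_smul, norm_inv, norm_norm, inv_mul_cancel₀ hn]
          obtain ⟨y, hy, hye⟩ := he.bij.surjOn this
          refine ⟨⟨y, hy⟩, ?_⟩
          simp only [hye, smul_smul, mul_inv_cancel₀ hn, one_smul]
      obtain ⟨y, hy⟩ := hex
      have hI : ‖w.snd‖ / 2 ∈ Icc (0 : ℝ) 2⁻¹ := ⟨by positivity, by linarith [abs_nonneg w.fst]⟩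
      have h2 : 2 * (‖w.snd‖ / 2) = ‖w.snd‖ := by ring
      rcases le_total 0 w.fst with h0 | h0
      · rw [abs_of_nonneg h0] at hw
        refine ⟨Sum.inl (⟨_, hI⟩, y), ?_⟩
        simp only [β, β₁, Sum.elim_inl, h2, hy]
        rw [show 1 - ‖w.snd‖ = w.fst by linarith]; rfl
      · rw [abs_of_nonpos h0] at hw
        refine ⟨inr (⟨_, hI⟩, y), ?_⟩
        simp only [β, β₂, elim_inr, h2, hy]
        rw [show -(1 - ‖w.snd‖) = w.fst by linarith]; rfl
  have hsm : ∀ (r s : ℝ) (y y' : Y), 0 ≤ r → r = s →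
      ((2 * r) • e y = (2 * s) • e y' ↔ r = 0 ∨ y = y') := by
    rintro r s y y' hr rfl
    constructor
    · intro h
      by_cases h0 : r = 0
      · exact Or.inl h0
      · exact Or.inr (Subtype.ext (he.bij.injOn y.2 y'.2
          (smul_right_injective E (mul_ne_zero two_ne_zero h0) h)))
    · rintro (rfl | rfl)
      · simp
      · rfl
  have htl : ∀ (a a' : ℝ) (w w' : E), (toLp 1 (a, w) : WithLp 1 (ℝ × E)) =
      toLp 1 (a', w') ↔ a = a' ∧ w = w' := fun a a' w w' => by
    rw [(WithLp.toLp_injective 1).eq_iff, Prod.mk.injEq]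
  have hbb : ∀ y y' : Y, b y = b y' ↔ (y : V → ℝ) = y' := fun y y' => ⟨hbinj y y.2 y' y'.2, fun h => by rw [h]⟩
  have hmix : ∀ q q' : Icc (0 : ℝ) 2⁻¹ × Y, conePt u (q.1 : ℝ) (q.2 : V → ℝ) = α₂ q' ↔
      β₁ q = β₂ q' := by
    rintro ⟨⟨r, hr⟩, y⟩ ⟨⟨s, hs⟩, y'⟩
    simp only [β₁, β₂, htl]
    constructor
    · intro heq
      have e1 := hsign2 (⟨s, hs⟩, y')
      have e0 := hsign1 (⟨r, hr⟩, y)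
      simp only at e0 e1
      rw [← heq, e0] at e1
      have hr2 : r = 2⁻¹ := by
        rcases hr.2.lt_or_eq with h1 | h1
        · rw [sign_pos (by linarith), eq_comm, sign_eq_one_iff] at e1
          linarith [hs.2]
        · exact h1
      subst hr2
      have hs2 : s = 2⁻¹ := by
        rw [show (1 : ℝ) - 2 * 2⁻¹ = 0 by norm_num, sign_zero, eq_comm, sign_eq_zero_iff] at e1
        linarith
      subst hs2
      have e2 := congrArg h heq
      simp only [α₂] at e2
      rw [hki.2 (hmem₂ (⟨_, hs⟩, y')), hb y y.2, conePt_inj (hbv _) (hbv _)] at e2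
      have e3 := Subtype.ext ((hbb y y').1 (e2.2.resolve_left hhalf'))
      rw [e3]
      norm_num
    · rintro ⟨h1, h2⟩
      have hr2 : r = 2⁻¹ := by linarith [hr.2, hs.2]
      have hs2 : s = 2⁻¹ := by linarith
      subst hr2 hs2
      have h3 := ((hsm _ _ y y' hr.1 rfl).1 h2).resolve_left hhalf'
      subst h3
      simp only [α₂]
      rw [← hb y y.2, hki.1 (conePt_mem hK y.2 hhalf).1]
  have hC : ∀ q ∈ univ, ∀ q' ∈ univ, α q = α q' ↔ β q = β q' := by
    rintro (⟨⟨r, hr⟩, y⟩ | ⟨⟨r, hr⟩, y⟩) - (⟨⟨s, hs⟩, y'⟩ | ⟨⟨s, hs⟩, y'⟩) -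
    · simp only [α, β, β₁, Sum.elim_inl, htl]
      rw [conePt_inj (lk_apply_self y.2) (lk_apply_self y'.2)]
      constructor
      · grind
      · grind
    · exact hmix (⟨r, hr⟩, y) (⟨s, hs⟩, y')
    · rw [eq_comm, eq_comm (a := β _)]
      exact hmix (⟨s, hs⟩, y') (⟨r, hr⟩, y)
    · simp only [α, β, α₂, β₂, elim_inr, htl]
      rw [hk.bij.injOn.eq_iff (hmem₂ (⟨r, hr⟩, y)) (hmem₂ (⟨s, hs⟩, y')), conePt_inj (hbv _) (hbv _), hbb]
      constructor
      · grind
      · grind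
  obtain ⟨f, hf, hfq⟩ := H hA hB hC
  refine ⟨f, hf, fun x hx => ?_⟩
  rw [← hA] at hx
  obtain ⟨q, -, rfl⟩ := hx
  rw [hfq q trivial]
  rcases q with q | q
  · tauto
  · tauto

end

section
open scoped Classical
variable {V : Type} [Fintype V] [DecidableEq V] {L : Set (Finset V)} {v : V} {P Q σ : Finset V}

/-- The full subcomplex of `L` on the vertex set `Q`. -/
def res (L : Set (Finset V)) (Q : Finset V) : Set (Finset V) := {σ | σ ∈ L ∧ σ ⊆ Q}

/-- The vertices of a complex. -/
def verts (L : Set (Finset V)) : Finset V := Finset.univ.filter fun v => {v} ∈ L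

theorem mem_verts : v ∈ verts L ↔ {v} ∈ L := by simp [verts]

theorem isLowerSet_res (hL : IsLowerSet L) (Q : Finset V) :
    IsLowerSet (res L Q) := fun _ _ h h' => ⟨hL h h'.1, h.trans h'.2⟩

theorem verts_res : verts (res L Q) = verts L ∩ Q := by ext v; simp [verts, res]

theorem mem_verts_lk {v w : V} : w ∈ verts (lk L v) ↔ w ≠ v ∧ {v, w} ∈ L := by
  rw [mem_verts]
  simp only [lk, mem_setOf_eq, Finset.mem_singleton]
  grind

theorem lk_res (hv : v ∈ Q) :
    lk (res L Q) v = res (lk L v) Q := by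
  ext τ
  simp only [lk, res, mem_setOf_eq, Finset.insert_subset_iff]
  tauto

theorem mem_verts_of_mem (hL : IsLowerSet L) (hσ : σ ∈ L)
    (hv : v ∈ σ) : v ∈ verts L :=
  mem_verts.2 (hL (Finset.singleton_subset_iff.2 hv) hσ)

theorem verts_lk_subset (hL : IsLowerSet L) (v : V) :
    verts (lk L v) ⊆ verts L := fun w hw =>
  mem_verts_of_mem hL (mem_verts_lk.1 hw).2 (by simp)

theorem lk_subset_self (hL : IsLowerSet L) (v : V) : lk L v ⊆ L := fun _ h => hL (Finset.subset_insert _ _) h.2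

theorem vsupp_subset_verts (hL : IsLowerSet L) {x : V → ℝ}
    (hx : x ∈ realiz L) (hv : x v ≠ 0) : v ∈ verts L :=
  mem_verts_of_mem hL hx.2.2 (by aesop)

/-- `P` spans a connected graph in `L`. -/
def Conn (L : Set (Finset V)) (P : Finset V) : Prop :=
  ∀ A ⊆ P, A.Nonempty → A ≠ P → ∃ a ∈ A, ∃ b ∈ P, b ∉ A ∧ {a, b} ∈ L

theorem Conn.const (h : Conn L P) {α : Type*} {f : V → α}
    (hf : ∀ a ∈ P, ∀ b ∈ P, {a, b} ∈ L → f a = f b) {a b : V} (ha : a ∈ P) (hb : b ∈ P) :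
    f a = f b := by
  by_contra hne
  obtain ⟨c, hc, d, hd, hd', hcd⟩ := h (P.filter fun x => f x = f a) (filter_subset _ _)
    ⟨a, by simp [ha]⟩ (fun h => by grind)
  grind

theorem Conn.insert (h : Conn L P) {v w : V} (hw : w ∈ P)
    (hvw : {v, w} ∈ L) : Conn L (insert v P) := fun A hA hne hne' => by
  by_contra! hcon
  have hAP : A ∩ P = ∅ ∨ A ∩ P = P := by
    by_contra! hh
    obtain ⟨a, ha, b, hb, hb', hab⟩ := h (A ∩ P) Finset.inter_subset_right
      hh.1 hh.2
    grind
  rcases hAP with h0 | h0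
  · have hwA : w ∉ A := fun hh => by
      have : w ∈ A ∩ P := Finset.mem_inter.2 ⟨hh, hw⟩
      simp [h0] at this
    obtain ⟨x, hx⟩ := hne
    rcases Finset.mem_insert.1 (hA hx) with rfl | h1
    · grind
    · have : x ∈ A ∩ P := Finset.mem_inter.2 ⟨hx, h1⟩
      simp [h0] at this
  · have hPA : P ⊆ A := Finset.inter_eq_right.1 h0
    have hv : v ∉ A := fun hh => hne' (hA.antisymm (Finset.insert_subset hh hPA))
    exact hcon w (hPA hw) v (mem_insert_self _ _) hv (by rwa [Finset.pair_comm])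

theorem conn_singleton (L : Set (Finset V)) (v : V) : Conn L {v} := fun A hA hne hne' => by grind

/-- A simplicial `0`-sphere. -/
structure IsPair (L : Set (Finset V)) : Prop where
  lower : IsLowerSet L
  dim : ∀ σ ∈ L, σ.card ≤ 1
  card : (verts L).card = 2

/-- A simplicial circle. -/
structure IsCirc (L : Set (Finset V)) : Prop where
  lower : IsLowerSet L
  conn : Conn L (verts L)
  ne : (verts L).Nonempty
  link : ∀ v ∈ verts L, IsPair (lk L v)

/-- A connected closed simplicial surface. -/
structure IsSurf (L : Set (Finset V)) : Prop where
  lower : IsLowerSet L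
  conn : Conn L (verts L)
  ne : (verts L).Nonempty
  link : ∀ v ∈ verts L, IsCirc (lk L v)

theorem IsCirc.dim (h : IsCirc L) (hσ : σ ∈ L) : σ.card ≤ 2 := by
  rcases σ.eq_empty_or_nonempty with rfl | ⟨v, hv⟩
  · simp
  · have := (h.link v (mem_verts_of_mem h.lower hσ hv)).dim (σ.erase v)
      ⟨by simp, by aesop⟩
    rw [card_erase_of_mem hv] at this
    omega

theorem IsSurf.dim (h : IsSurf L) (hσ : σ ∈ L) : σ.card ≤ 3 := by
  rcases σ.eq_empty_or_nonempty with rfl | ⟨v, hv⟩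
  · simp
  · have := (h.link v (mem_verts_of_mem h.lower hσ hv)).dim (σ := σ.erase v)
      ⟨by simp, by aesop⟩
    rw [card_erase_of_mem hv] at this
    omega

theorem signPair_pair (h : IsPair L) {g : V → ℝ} {a b : V}
    (ha : a ∈ verts L) (hb : b ∈ verts L) (hga : 0 < g a) (hgb : g b < 0) :
    SignPair (ContinuousLinearMap.id ℝ ℝ) L g := by
  have hab : a ≠ b := by grind
  have hV : verts L = {a, b} := by
    symm
    apply Finset.eq_of_subset_of_card_le
    · grind
    · rw [h.card, card_pair hab]
  have hpt : ∀ x ∈ realiz L, (x = single a 1 ∨ x = single b 1) := fun x hx => by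
    have hcard := h.dim _ hx.2.2
    have hx1 : ∃ v, x = single v 1 := by
      have hs := hx.2.1
      rcases Nat.le_one_iff_eq_zero_or_eq_one.1 hcard with h0 | h1
      · exfalso
        have : ∀ v, x v = 0 := fun v => by
          by_contra hv
          have : v ∈ vsupp x := by simpa [vsupp] using hv
          simp [Finset.card_eq_zero.1 h0] at this
        simp [this] at hs
      · obtain ⟨v, hv⟩ := card_eq_one.1 h1
        have hz : ∀ w, w ≠ v → x w = 0 := fun w hw => by
          by_contra hw'
          have : w ∈ vsupp x := by simpa [vsupp] using hw'
          rw [hv] at this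
          exact hw (by grind)
        refine ⟨v, funext fun w => ?_⟩
        rw [sum_eq_single v (fun w _ hw => hz w hw) (by simp)] at hs
        grind
    obtain ⟨v, rfl⟩ := hx1
    have := vsupp_subset_verts h.lower hx (v := v) (by simp)
    grind
  have hmem : ∀ v ∈ verts L, (single v 1 : V → ℝ) ∈ realiz L := fun v hv => by
    refine ⟨fun w => ?_, by simp, ?_⟩
    · grind
    · rw [show vsupp (single v 1 : V → ℝ) = {v} by
        ext w; simp [vsupp, single_apply]]
      exact mem_verts.1 hv
  have hev : ∀ v, evCol g (single v 1) = g v := fun v => by simp [evCol, single_apply]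
  refine ⟨fun x => x a - x b, ⟨by fun_prop, ⟨?_, ?_, ?_⟩⟩, ?_⟩
  · intro x hx
    rcases hpt x hx with rfl | rfl <;> simp [hab, hab.symm]
  · intro x hx y hy hxy
    rcases hpt x hx with rfl | rfl <;> rcases hpt y hy with rfl | rfl <;>
      simp [hab, hab.symm] at hxy ⊢ <;> norm_num at hxy
  · intro t ht
    rw [mem_sphere_zero_iff_norm, norm_eq_abs] at ht
    grind
  · intro x hx
    rcases hpt x hx with rfl | rfl
    · simp_all
    · simp_all

end

section
open scoped Classical
variable {V : Type} [Fintype V] [DecidableEq V] {L : Set (Finset V)} {v : V} {P Q : Finset V}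
variable {E : Type} [NormedAddCommGroup E] [NormedSpace ℝ E]

theorem evCol_eqOn (hL : IsLowerSet L) {g g' : V → ℝ}
    (h : ∀ v ∈ verts L, g v = g' v) {x : V → ℝ} (hx : x ∈ realiz L) : evCol g x = evCol g' x :=
  evCol_congr fun v hv => h v (vsupp_subset_verts hL hx hv)

theorem SignEquiv.of_eqOn (hL : IsLowerSet L) {g g' : V → ℝ}
    (h : ∀ v ∈ verts L, g v = g' v) : SignEquiv L g g' :=
  ⟨id, HomeoOn.id _, fun x hx => by rw [id, evCol_eqOn hL h hx]⟩

/-- `g'` arises from `g` by turning some zeros positive. -/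
def Flip (g g' : V → ℝ) : Prop := ∀ v, g' v = g v ∨ (g v = 0 ∧ g' v = 1)

theorem signEquiv_of_flip {z : E →L[ℝ] ℝ} (hz : z ≠ 0) (hL : IsLowerSet L)
    {g : V → ℝ} (h : ∀ w ∈ verts L, g w = 0 → ∀ g', Flip g g' → SignPair z (lk L w) g') :
    ∀ g', Flip g g' → SignEquiv L g g' := by
  suffices H : ∀ n : ℕ, ∀ g', Flip g g' → (Finset.univ.filter fun v => g' v ≠ g v).card = n →
      SignEquiv L g g' from fun g' hg => H _ g' hg rfl
  intro n
  induction n with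
  | zero =>
    intro g' _ hc
    refine SignEquiv.of_eqOn hL fun v _ => ?_
    by_contra hv
    have : v ∈ (Finset.univ.filter fun v => g' v ≠ g v) := by grind
    rw [Finset.card_eq_zero.1 hc] at this
    simp at this
  | succ n ih =>
    intro g' hg' hc
    obtain ⟨v, hv⟩ : (Finset.univ.filter fun v => g' v ≠ g v).Nonempty := by rw [← Finset.card_pos, hc]; omega
    have hvne : g' v ≠ g v := by grind
    have hv0 : g v = 0 := ((hg' v).resolve_left hvne).1
    have hF : Flip g (update g' v (g v)) := fun w => by
      by_cases hw : w = v
      · subst hw; simp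
      · simpa [hw] using hg' w
    have h1 := ih _ hF (by
      have : (Finset.univ.filter fun w => update g' v (g v) w ≠ g w) =
          (Finset.univ.filter fun v => g' v ≠ g v).erase v := by
        ext w
        grind
      rw [this, card_erase_of_mem hv, hc]; rfl)
    have hup : g' = update (update g' v (g v)) v (g' v) := by simp
    refine h1.trans ?_
    by_cases hvL : v ∈ verts L
    · have := signEquiv_flip hz hL (h v hvL hv0 _ hF) (g' v)
      rwa [← hup] at this
    · refine SignEquiv.of_eqOn hL fun w hw => ?_
      rw [Function.update_of_ne]
      rintro rfl; exact hvL hw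

theorem pmCol_insert (P : Finset V) (v : V) : pmCol (insert v P) = update (pmCol P) v 1 := by
  ext w
  by_cases hw : w = v
  · subst hw; simp [pmCol]
  · simp [pmCol, hw]

/-- One can add a vertex to `P` keeping both sides connected and crossing a standard link. -/
def StepProp (z : E →L[ℝ] ℝ) (L : Set (Finset V)) : Prop :=
  ∀ P ⊆ verts L, P.Nonempty → 2 ≤ (verts L \ P).card → Conn L P → Conn L (verts L \ P) →
    ∃ v ∈ verts L \ P, Conn L (insert v P) ∧ Conn L ((verts L \ P).erase v) ∧
      SignPair z (lk L v) (pmCol P)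

theorem StepProp.chain {z : E →L[ℝ] ℝ} (hz : z ≠ 0) (hL : IsLowerSet L)
    (hstep : StepProp z L) : ∀ n : ℕ, ∀ P ⊆ verts L, P.Nonempty → (verts L \ P).card = n + 1 →
      Conn L P → Conn L (verts L \ P) →
      ∃ r ∈ verts L \ P, SignEquiv L (pmCol P) (-pmCol {r}) := fun n => by
  induction n with
  | zero =>
    intro P hP _ hc _ _
    obtain ⟨r, hr⟩ := card_eq_one.1 hc
    refine ⟨r, by simp [hr], SignEquiv.of_eqOn hL fun v hv => ?_⟩
    have : v ∉ P ↔ v = r := by rw [← Finset.mem_singleton, ← hr, Finset.mem_sdiff]; simp [hv]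
    by_cases hvP : v ∈ P
    · have h2 : v ≠ r := fun h => (this.2 h) hvP
      simp [pmCol, hvP, h2]
    · have h3 := this.1 hvP
      subst h3
      simp [pmCol, hvP]
  | succ n ih =>
    intro P hP hne hc hcP hcM
    obtain ⟨v, hv, h1, h2, h3⟩ := hstep P hP hne (by omega) hcP hcM
    have hsd : verts L \ insert v P = (verts L \ P).erase v := by grind
    obtain ⟨r, hr, hs⟩ := ih (insert v P) (Finset.insert_subset (Finset.mem_sdiff.1 hv).1 hP)
      (Finset.insert_nonempty _ _) (by grind) h1 (hsd ▸ h2)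
    rw [hsd] at hr
    refine ⟨r, Finset.mem_of_mem_erase hr, SignEquiv.trans ?_ hs⟩
    rw [pmCol_insert]
    exact signEquiv_flip hz hL h3 1

theorem StepProp.signPair [Nontrivial E] {z : E →L[ℝ] ℝ} (hz : z ≠ 0)
    (hL : IsLowerSet L) (hstep : StepProp z L)
    (hsph : ∀ u ∈ verts L, ∃ e, HomeoOn e (realiz (lk L u)) (sphere (0 : E) 1))
    (hP : P ⊆ verts L) (hne : P.Nonempty) (hne' : (verts L \ P).Nonempty)
    (hcP : Conn L P) (hcM : Conn L (verts L \ P)) :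
    SignPair (fstL 1 ℝ ℝ E) L (pmCol P) := by
  have hss : verts L \ (verts L \ P) = P := by grind
  have h1 : ∃ n, (verts L \ P).card = n + 1 := Nat.exists_eq_succ_of_ne_zero (Finset.card_pos.2 hne').ne'
  have h2 : ∃ n, (verts L \ (verts L \ P)).card = n + 1 := by simp_all
  obtain ⟨n, hn⟩ := h1
  obtain ⟨m, hm⟩ := h2
  obtain ⟨r, hr, hsr⟩ := hstep.chain hz hL n P hP hne hn hcP hcM
  obtain ⟨u, hu, hsu⟩ := hstep.chain hz hL m _ Finset.sdiff_subset hne' hm hcM (hss.symm ▸ hcP)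
  rw [hss] at hu
  have h3 : SignEquiv L (pmCol P) (pmCol {u}) := by
    have h4 := hsu.neg
    rw [neg_neg] at h4
    refine SignEquiv.trans (SignEquiv.of_eqOn hL fun v hv => ?_) h4
    by_cases h : v ∈ P <;> simp [pmCol, h, hv]
  obtain ⟨e, he⟩ := hsph u (hP hu)
  exact (signPair_glue hL he ((h3.symm hL).trans hsr)).of_equiv h3

/-- The number of faces with `n` vertices. -/
def fc (L : Set (Finset V)) (n : ℕ) : ℕ := (Finset.univ.filter fun σ => σ ∈ L ∧ σ.card = n).card

/-- The Euler characteristic of a complex of dimension at most `3`. -/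
def chi (L : Set (Finset V)) : ℤ := fc L 1 - fc L 2 + fc L 3 - fc L 4

theorem fc_eq_zero {n k : ℕ} (h : ∀ σ ∈ L, σ.card ≤ n) (hk : n < k) :
    fc L k = 0 := by
  rw [fc, Finset.card_eq_zero, Finset.filter_eq_empty_iff]
  rintro σ - ⟨h1, h2⟩
  have := h σ h1; omega

theorem fc_zero (h : ∅ ∈ L) : fc L 0 = 1 := by
  rw [fc, card_eq_one]
  refine ⟨∅, ?_⟩
  grind

theorem fc_one (L : Set (Finset V)) : fc L 1 = (verts L).card := by
  rw [fc]
  symm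
  refine card_bij (fun v _ => {v}) ?_ ?_ ?_
  · intro v hv; simpa using mem_verts.1 hv
  · simp_all
  · intro σ hσ
    simp only [mem_filter_univ] at hσ
    obtain ⟨v, rfl⟩ := card_eq_one.1 hσ.2
    exact ⟨v, mem_verts.2 hσ.1, rfl⟩

theorem fc_insert (L : Set (Finset V)) (hv : v ∉ Q) (n : ℕ) :
    fc (res L (insert v Q)) (n + 1) = fc (res L Q) (n + 1) + fc (res (lk L v) Q) n := by
  have h1 : fc (res (lk L v) Q) n =
      (Finset.univ.filter fun σ => (σ ∈ res L (insert v Q) ∧ σ.card = n + 1) ∧ v ∈ σ).card := by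
    rw [fc]
    refine card_bij (fun σ _ => insert v σ) ?_ ?_ ?_
    · grind [lk, res, mem_verts, IsLowerSet]
    · intro σ hσ τ hτ h
      simp only [mem_filter_univ, res, lk, mem_setOf_eq] at hσ hτ
      rw [← erase_insert hσ.1.1.1, h, erase_insert hτ.1.1.1]
    · intro σ hσ
      simp only [mem_filter_univ, res, lk, mem_setOf_eq] at hσ
      obtain ⟨⟨⟨h1, h2⟩, h3⟩, h4⟩ := hσ
      refine ⟨σ.erase v, ?_, insert_erase h4⟩
      simp only [mem_filter_univ, res, lk, mem_setOf_eq]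
      exact ⟨⟨⟨by simp, by aesop⟩, Finset.subset_insert_iff.1 h2⟩, by grind⟩
  have h2 : fc (res L Q) (n + 1) =
      (Finset.univ.filter fun σ => (σ ∈ res L (insert v Q) ∧ σ.card = n + 1) ∧ ¬ v ∈ σ).card := by
    rw [fc]
    congr 1
    grind [lk, res, mem_verts, IsLowerSet]
  rw [h1, h2, fc, add_comm (Finset.card _), ← Finset.card_filter_add_card_filter_not (fun σ : Finset V => v ∈ σ),
    Finset.filter_filter, Finset.filter_filter]

theorem fc_res_union (hL : IsLowerSet L) {A Q : Finset V} (hA : A ⊆ Q)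
    (h : ∀ a ∈ A, ∀ b ∈ Q, b ∉ A → {a, b} ∉ L) {n : ℕ} (hn : n ≠ 0) :
    fc (res L Q) n = fc (res L A) n + fc (res L (Q \ A)) n := by
  rw [fc, fc, fc, ← Finset.card_union_of_disjoint]
  · congr 1
    ext σ
    simp only [mem_filter_univ, res, mem_setOf_eq, Finset.mem_union]
    grind [lk, res, mem_verts, IsLowerSet]
  · rw [Finset.disjoint_left]
    intro σ h1 h2
    simp only [mem_filter_univ, res, mem_setOf_eq] at h1 h2
    obtain ⟨v, hv⟩ : σ.Nonempty := by rw [← Finset.card_pos]; omega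
    exact (Finset.mem_sdiff.1 (h2.1.2 hv)).2 (h1.1.2 hv)

theorem IsCirc.handshake (h : IsCirc L) {A : Finset V} (hA : A ⊆ verts L) :
    2 * A.card = 2 * fc (res L A) 2 + ∑ a ∈ A, ((verts (lk L a)).filter fun b => b ∉ A).card := by
  have h1 : ∑ a ∈ A, (verts (lk L a)).card = 2 * A.card := by
    rw [sum_congr rfl fun a ha => (h.link a (hA ha)).card]
    simp [mul_comm]
  have h2 : ∑ a ∈ A, ((verts (lk L a)).filter fun b => b ∈ A).card = 2 * fc (res L A) 2 := by
    have h3 : ∀ a ∈ A, ((verts (lk L a)).filter fun b => b ∈ A).card =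
        ((Finset.univ.filter fun σ => σ ∈ res L A ∧ σ.card = 2).filter fun σ => a ∈ σ).card := fun a ha => by
      refine card_bij (fun b _ => {a, b}) ?_ ?_ ?_
      · intro b hb
        simp only [mem_filter, mem_verts_lk] at hb
        grind [lk, res, mem_verts, IsLowerSet]
      · intro b hb c hc hbc
        simp only [mem_filter, mem_verts_lk] at hb hc
        have : b ∈ ({a, c} : Finset V) := hbc ▸ (by simp)
        simp at this
        exact this.resolve_left hb.1.1
      · intro σ hσ
        simp only [mem_filter, Finset.mem_univ, true_and, res, mem_setOf_eq] at hσ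
        obtain ⟨⟨⟨h1, h2⟩, h3⟩, h4⟩ := hσ
        obtain ⟨b, hb⟩ := card_eq_one.1 (show (σ.erase a).card = 1 by rw [card_erase_of_mem h4, h3])
        have hσ : σ = {a, b} := by grind
        grind [lk, res, mem_verts, IsLowerSet]
    rw [sum_congr rfl h3]
    have := Finset.sum_card_bipartiteAbove_eq_sum_card_bipartiteBelow (s := A)
      (t := Finset.univ.filter fun σ => σ ∈ res L A ∧ σ.card = 2) (fun a σ => a ∈ σ)
    simp only [bipartiteAbove, bipartiteBelow] at this
    rw [this, sum_congr rfl (g := fun _ => 2)]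
    · simp [fc, mul_comm]
    · intro σ hσ
      simp only [mem_filter_univ, res, mem_setOf_eq] at hσ
      rw [← hσ.2]
      congr 1
      grind
  rw [← h1, ← h2, ← sum_add_distrib]
  exact sum_congr rfl fun a _ => (Finset.card_filter_add_card_filter_not _).symm

theorem out_pos {A : Finset V} {a b : V} (ha : a ∈ A) (hb : b ∉ A)
    (hab : {a, b} ∈ L) : 0 < ∑ a ∈ A, ((verts (lk L a)).filter fun b => b ∉ A).card := by
  refine sum_pos' (fun _ _ => Nat.zero_le _) ⟨a, ha, Finset.card_pos.2 ⟨b, ?_⟩⟩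
  grind [lk, res, mem_verts, IsLowerSet]

theorem IsCirc.edges_lt (h : IsCirc L) {A : Finset V} (hA : A ⊆ verts L)
    (hne : A.Nonempty) (hne' : A ≠ verts L) : fc (res L A) 2 < A.card := by
  obtain ⟨a, ha, b, hb, hb', hab⟩ := h.conn A hA hne hne'
  have := h.handshake hA
  have := out_pos ha hb' hab
  omega

theorem IsCirc.conn_of_edges (h : IsCirc L) (hQ : Q ⊆ verts L)
    (hne : Q ≠ verts L) (he : Q.card = fc (res L Q) 2 + 1) : Conn L Q := fun A hA h1 h2 => by
  by_contra! hcon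
  have h3 := fc_res_union h.lower hA hcon (n := 2) (by norm_num)
  have h4 := h.edges_lt (hA.trans hQ) h1 (fun h => h2 (hA.antisymm (h ▸ hQ)))
  have h5 := h.edges_lt (A := Q \ A) (Finset.sdiff_subset.trans hQ)
    (Finset.sdiff_nonempty.2 fun h' => h2 (hA.antisymm h'))
    (fun h => hne (hQ.antisymm (h ▸ Finset.sdiff_subset)))
  have := Finset.card_sdiff_add_card_eq_card hA
  omega

theorem IsCirc.edges_sdiff (h : IsCirc L) (hP : P ⊆ verts L) :
    P.card + fc (res L (verts L \ P)) 2 = (verts L \ P).card + fc (res L P) 2 := by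
  have h1 := h.handshake hP
  have h2 := h.handshake (A := verts L \ P) Finset.sdiff_subset
  have h3 : ∑ a ∈ P, ((verts (lk L a)).filter fun b => b ∉ P).card =
      ∑ a ∈ verts L \ P, ((verts (lk L a)).filter fun b => b ∉ verts L \ P).card := by
    have := Finset.sum_card_bipartiteAbove_eq_sum_card_bipartiteBelow (s := P)
      (t := verts L \ P) (fun a b => b ∈ verts (lk L a))
    simp only [bipartiteAbove, bipartiteBelow] at this
    convert this using 3 with a ha a ha
    · ext b
      simp only [mem_filter, Finset.mem_sdiff]
      have := @verts_lk_subset _ _ _ L h.lower a b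
      tauto
    · ext b
      simp only [mem_filter, Finset.mem_sdiff]
      have := @verts_lk_subset _ _ _ L h.lower a b
      have h4 := @hP b
      have h5 : b ∈ verts (lk L a) ↔ a ∈ verts (lk L b) := by
        rw [mem_verts_lk, mem_verts_lk, Finset.pair_comm, ne_comm]
      tauto
  omega

theorem IsCirc.conn_erase (h : IsCirc L) (hv : v ∈ verts L) :
    Conn L ((verts L).erase v) := by
  have h1 := h.edges_sdiff (P := {v}) (by grind)
  have h2 : fc (res L {v}) 2 = 0 := by
    rw [fc, Finset.card_eq_zero, Finset.filter_eq_empty_iff]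
    rintro σ - ⟨h1, h2⟩
    have := Finset.card_le_card h1.2
    simp at this; omega
  rw [← Finset.sdiff_singleton_eq_erase]
  refine h.conn_of_edges Finset.sdiff_subset ?_ (by grind)
  intro h'
  have hv' := hv
  rw [← h'] at hv'
  simp at hv'

end

section
open scoped Classical
variable {V : Type} [Fintype V] [DecidableEq V] {L : Set (Finset V)}
variable {E : Type} [NormedAddCommGroup E] [NormedSpace ℝ E]

theorem Conn.erase_leaf {M : Finset V} (h : Conn L M) {v b : V} (hv : v ∈ M)
    (hb : ∀ c ∈ M, c ≠ v → {v, c} ∈ L → c = b) : Conn L (M.erase v) := fun A hA hne hne' => by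
  by_contra! hcon
  by_cases hbA : b ∈ A
  · obtain ⟨a, ha, c, hc, hc', hac⟩ := h (Insert.insert v A)
      (Finset.insert_subset hv (hA.trans (erase_subset _ _))) (Finset.insert_nonempty _ _)
      (fun h' => hne' (by
        rw [← h', erase_insert]
        intro hh; simpa using hA hh))
    grind
  · obtain ⟨a, ha, c, hc, hc', hac⟩ := h A (hA.trans (erase_subset _ _)) hne
      (fun h' => by grind)
    have ha' := mem_erase.1 (hA ha)
    by_cases hcv : c = v
    · subst hcv
      rw [Finset.pair_comm] at hac
      exact hbA (hb a ha'.2 ha'.1 hac ▸ ha)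
    · grind

/-- A colouring with values in `{-1, 0, 1}`. -/
def Tern (g : V → ℝ) : Prop := ∀ v, g v = -1 ∨ g v = 0 ∨ g v = 1

theorem Flip.tern {g g' : V → ℝ} (h : Flip g g') (hg : Tern g) : Tern g' := fun v => by
  rcases h v with h | h
  · rw [h]; exact hg v
  · exact Or.inr (Or.inr h.2)

theorem Flip.nonneg_iff {g g' : V → ℝ} (h : Flip g g') (v : V) : 0 ≤ g' v ↔ 0 ≤ g v := by
  rcases h v with h | ⟨h, h'⟩
  · rw [h]
  · rw [h, h']; norm_num

theorem Flip.refl (g : V → ℝ) : Flip g g := fun _ => Or.inl rfl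

theorem Flip.trans {g g' g'' : V → ℝ} (h : Flip g g') (h' : Flip g' g'') : Flip g g'' := fun v => by
  rcases h v with h | ⟨h1, h2⟩ <;> rcases h' v with h3 | ⟨h3, h4⟩
  · exact Or.inl (h3.trans h)
  · exact Or.inr ⟨h ▸ h3, h4⟩
  · grind
  · grind

/-- The nonnegative vertices of `L`. -/
def nnv (L : Set (Finset V)) (g : V → ℝ) : Finset V := (verts L).filter fun v => 0 ≤ g v

theorem signPair_of_pmCol {z : E →L[ℝ] ℝ} (hz : z ≠ 0) (hL : IsLowerSet L)
    {E' : Type} [NormedAddCommGroup E'] [NormedSpace ℝ E'] {w : E' →L[ℝ] ℝ}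
    {g : V → ℝ} (hg : Tern g)
    (h : ∀ w ∈ verts L, g w = 0 → ∀ g', Flip g g' → SignPair z (lk L w) g')
    (hp : SignPair w L (pmCol (nnv L g))) : SignPair w L g := by
  have h1 : Flip g (fun v => if g v = 0 then 1 else g v) := fun v => by grind
  refine hp.of_equiv ((signEquiv_of_flip hz hL h _ h1).trans (SignEquiv.of_eqOn hL fun v hv => ?_))
  simp only [pmCol, nnv, mem_filter]
  rcases hg v with h | h | h <;> simp [h, hv]

theorem id_ne_zero : ContinuousLinearMap.id ℝ ℝ ≠ 0 := fun h => by
  have := congrArg (fun f => f 1) h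
  simp at this

theorem fstL_ne_zero : fstL 1 ℝ ℝ E ≠ 0 := fun h => by
  have := congrArg (fun f => f (toLp 1 (1, 0))) h
  simp at this

theorem IsPair.verts_eq (h : IsPair L) {a b : V} (ha : a ∈ verts L)
    (hb : b ∈ verts L) (hab : a ≠ b) : verts L = {a, b} := by
  symm
  apply Finset.eq_of_subset_of_card_le
  · grind
  · rw [h.card, card_pair hab]

theorem IsCirc.stepProp (h : IsCirc L) :
    StepProp (ContinuousLinearMap.id ℝ ℝ) L := fun P hP hne hc hcP hcM => by
  have hMne : (verts L \ P).Nonempty := Finset.card_pos.1 (by omega)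
  obtain ⟨a, ha, v, hv, hvP, hav⟩ := h.conn P hP hne (fun h => by grind)
  have hvM : v ∈ verts L \ P := Finset.mem_sdiff.2 ⟨hv, hvP⟩
  obtain ⟨v', hv', b, hb, hbv, hvb⟩ := hcM {v} (by grind) (by simp) (fun h => by grind)
  rw [Finset.mem_singleton] at hv' hbv
  subst hv'
  have hb' := Finset.mem_sdiff.1 hb
  have hav' : a ≠ v' := fun h => hvP (h ▸ ha)
  have hab : a ≠ b := fun h => hb'.2 (h ▸ ha)
  have ha1 : a ∈ verts (lk L v') := mem_verts_lk.2 ⟨hav', by rwa [Finset.pair_comm]⟩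
  have hb1 : b ∈ verts (lk L v') := mem_verts_lk.2 ⟨hbv, hvb⟩
  have heq := (h.link v' hv).verts_eq ha1 hb1 hab
  refine ⟨v', hvM, hcP.insert ha (by rwa [Finset.pair_comm]), hcM.erase_leaf hvM (b := b) ?_, ?_⟩
  · intro c hc hcv hvc
    have : c ∈ verts (lk L v') := mem_verts_lk.2 ⟨hcv, hvc⟩
    grind
  · exact signPair_pair (h.link v' hv) ha1 hb1 (by simp [pmCol, ha]) (by simp [pmCol, hb'.2])

theorem IsPair.homeo (h : IsPair L) :
    ∃ e, HomeoOn e (realiz L) (sphere (0 : ℝ) 1) := by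
  obtain ⟨a, b, hab, hV⟩ := card_eq_two.1 h.card
  obtain ⟨e, he, -⟩ := signPair_pair h (g := fun v => if v = a then 1 else -1) (a := a) (b := b)
    (by simp [hV]) (by simp [hV]) (by simp) (by grind)
  exact ⟨e, he⟩

theorem IsCirc.signPair_pm (h : IsCirc L) {P : Finset V} (hP : P ⊆ verts L)
    (hne : P.Nonempty) (hne' : (verts L \ P).Nonempty) (hcP : Conn L P)
    (hcM : Conn L (verts L \ P)) : SignPair (fstL 1 ℝ ℝ ℝ) L (pmCol P) :=
  h.stepProp.signPair id_ne_zero h.lower (fun u hu => (h.link u hu).homeo) hP hne hne' hcP hcM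

theorem IsCirc.signPair (h : IsCirc L) {g : V → ℝ} (hg : Tern g)
    (hne : (nnv L g).Nonempty) (hne' : (verts L \ nnv L g).Nonempty) (hcP : Conn L (nnv L g))
    (hcM : Conn L (verts L \ nnv L g))
    (h0 : ∀ v ∈ verts L, g v = 0 → (∃ a ∈ verts (lk L v), 0 < g a) ∧ ∃ b ∈ verts (lk L v), g b < 0) :
    SignPair (fstL 1 ℝ ℝ ℝ) L g := by
  refine signPair_of_pmCol id_ne_zero h.lower hg ?_ (h.signPair_pm (filter_subset _ _) hne hne' hcP hcM)
  intro w hw hgw g' hg'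
  obtain ⟨⟨a, ha, hga⟩, b, hb, hgb⟩ := h0 w hw hgw
  refine signPair_pair (h.link w hw) ha hb ?_ ?_
  · rcases hg' a with h | h
    · rwa [h]
    · rw [h.2]; norm_num
  · rcases hg' b with h | h
    · rwa [h]
    · linarith [h.1]

theorem IsCirc.homeo (h : IsCirc L) :
    ∃ e, HomeoOn e (realiz L) (sphere (0 : WithLp 1 (ℝ × ℝ)) 1) := by
  obtain ⟨v, hv⟩ := h.ne
  have h2 : ((verts L).erase v).Nonempty := by
    obtain ⟨a, b, -, hV⟩ := card_eq_two.1 (h.link v hv).card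
    have ha : a ∈ verts (lk L v) := by simp [hV]
    exact ⟨a, mem_erase.2 ⟨(mem_verts_lk.1 ha).1, verts_lk_subset h.lower v ha⟩⟩
  have h3 : verts L \ {v} = (verts L).erase v := Finset.sdiff_singleton_eq_erase _ _
  obtain ⟨e, he, -⟩ := h.signPair_pm (P := {v}) (by grind) (by simp) (h3 ▸ h2)
    (conn_singleton L v) (h3 ▸ h.conn_erase hv)
  exact ⟨e, he⟩

end

section
open scoped Classical
variable {V : Type} [Fintype V] [DecidableEq V] {L : Set (Finset V)}

/-- The faces with `n` vertices. -/
abbrev Fc (L : Set (Finset V)) (n : ℕ) := {σ : Finset V // σ ∈ L ∧ σ.card = n}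

theorem card_Fc (L : Set (Finset V)) (n : ℕ) : Fintype.card (Fc L n) = fc L n := by rw [Fintype.card_subtype, fc]

/-- The coboundary matrix modulo `2`. -/
def cobd (L : Set (Finset V)) (n : ℕ) : Matrix (Fc L (n + 1)) (Fc L n) (ZMod 2) :=
  fun τ σ => if σ.1 ⊆ τ.1 then 1 else 0

theorem cobd_mulVec (L : Set (Finset V)) (n : ℕ) (f : Fc L n → ZMod 2) (τ : Fc L (n + 1)) :
    (cobd L n).mulVec f τ = ∑ σ : Fc L n, if σ.1 ⊆ τ.1 then f σ else 0 := by
  simp [Matrix.mulVec, dotProduct, cobd]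

theorem sum_faces (hL : IsLowerSet L) (n : ℕ) (f : Finset V → ZMod 2)
    (τ : Fc L (n + 1)) :
    (∑ σ : Fc L n, if σ.1 ⊆ τ.1 then f σ else 0) = ∑ v ∈ τ.1, f (τ.1.erase v) := by
  rw [← sum_filter]
  symm
  refine sum_bij (fun v hv => ⟨τ.1.erase v, hL (erase_subset _ _) τ.2.1, by grind⟩) ?_ ?_ ?_ ?_
  · grind
  · intro v hv w hw h
    grind [lk, res, mem_verts, IsLowerSet]
  · intro σ hσ
    simp only [mem_filter_univ] at hσ
    obtain ⟨v, hv⟩ := card_eq_one.1 (show (τ.1 \ σ.1).card = 1 by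
      rw [Finset.card_sdiff_of_subset hσ, τ.2.2, σ.2.2]; omega)
    have hv' : v ∈ τ.1 \ σ.1 := by simp [hv]
    refine ⟨v, (Finset.mem_sdiff.1 hv').1, Subtype.ext ?_⟩
    simp only
    rw [← Finset.sdiff_singleton_eq_erase, ← hv, Finset.sdiff_sdiff_eq_self hσ]
  · intro v hv; rfl

/-- Extension by zero. -/
def ext0 {n : ℕ} (f : Fc L n → ZMod 2) : Finset V → ZMod 2 := fun σ => if h : σ ∈ L ∧ σ.card = n then f ⟨σ, h⟩ else 0

theorem ext0_apply {n : ℕ} (f : Fc L n → ZMod 2) (σ : Fc L n) :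
    ext0 f σ = f σ := by simp [ext0, σ.2]

theorem cobd_apply (hL : IsLowerSet L) (n : ℕ) (f : Fc L n → ZMod 2)
    (τ : Fc L (n + 1)) : (cobd L n).mulVec f τ = ∑ v ∈ τ.1, ext0 f (τ.1.erase v) := by
  rw [cobd_mulVec, ← sum_faces hL]
  refine sum_congr rfl fun σ _ => ?_
  rw [ext0_apply]

theorem zmod2_add_self (a : ZMod 2) : a + a = 0 := add_self_eq_zero a

theorem cobd_cobd (hL : IsLowerSet L) (n : ℕ) (f : Fc L n → ZMod 2) :
    (cobd L (n + 1)).mulVec ((cobd L n).mulVec f) = 0 := by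
  ext τ
  rw [cobd_apply hL]
  have h1 : ∀ v ∈ τ.1, ext0 ((cobd L n).mulVec f) (τ.1.erase v) =
      ∑ w ∈ τ.1.erase v, ext0 f ((τ.1.erase v).erase w) := fun v hv => by
    have hm : τ.1.erase v ∈ L ∧ (τ.1.erase v).card = n + 1 := ⟨hL (erase_subset _ _) τ.2.1, by grind⟩
    rw [ext0_apply _ (⟨_, hm⟩ : Fc L (n + 1)), cobd_apply hL]
  rw [sum_congr rfl h1, Finset.sum_sigma']
  simp only [Pi.zero_apply]
  refine Finset.sum_involution (fun p _ => ⟨p.2, p.1⟩) ?_ ?_ ?_ ?_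
  · rintro ⟨v, w⟩ h
    simp only
    rw [Finset.erase_right_comm, zmod2_add_self]
  · grind
  · grind
  · rintro ⟨v, w⟩ h; rfl

theorem rank_add_ker (L : Set (Finset V)) (n : ℕ) :
    (cobd L n).rank + finrank (ZMod 2) (ker (cobd L n).mulVecLin) = fc L n := by
  rw [Matrix.rank, LinearMap.finrank_range_add_finrank_ker, finrank_pi, card_Fc]

theorem rank_add_le (hL : IsLowerSet L) (n : ℕ) :
    (cobd L n).rank + (cobd L (n + 1)).rank ≤ fc L (n + 1) := by
  have h1 : (cobd L n).rank ≤ finrank (ZMod 2) (ker (cobd L (n + 1)).mulVecLin) := by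
    rw [Matrix.rank]
    refine finrank_mono ?_
    rintro _ ⟨f, rfl⟩
    simpa using cobd_cobd hL n f
  have := rank_add_ker L (n + 1)
  omega

theorem rank_add_eq (hL : IsLowerSet L) (n : ℕ)
    (h : ∀ f, (cobd L (n + 1)).mulVec f = 0 → ∃ g, (cobd L n).mulVec g = f) :
    (cobd L n).rank + (cobd L (n + 1)).rank = fc L (n + 1) := by
  refine le_antisymm (rank_add_le hL n) ?_
  have h1 : finrank (ZMod 2) (ker (cobd L (n + 1)).mulVecLin) ≤ (cobd L n).rank := by
    rw [Matrix.rank]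
    refine finrank_mono ?_
    intro f hf
    obtain ⟨g, hg⟩ := h f (by aesop)
    exact ⟨g, by aesop⟩
  have := rank_add_ker L (n + 1)
  omega

/-- The dimension of the space of mod `2` two-cycles. -/
def z2 (L : Set (Finset V)) : ℕ := finrank (ZMod 2) (ker (cobd L 2).transpose.mulVecLin)

theorem rank_two (L : Set (Finset V)) : (cobd L 2).rank + z2 L = fc L 3 := by
  rw [← Matrix.rank_transpose, Matrix.rank, z2, LinearMap.finrank_range_add_finrank_ker, finrank_pi, card_Fc]

theorem sum_pair_erase (f : Finset V → ZMod 2) {a b : V} (hab : a ≠ b) :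
    ∑ v ∈ ({a, b} : Finset V), f (({a, b} : Finset V).erase v) = f {b} + f {a} := by
  rw [sum_pair hab, erase_insert (by grind), Finset.pair_comm, erase_insert (by grind)]

theorem rank_zero_one (hL : IsLowerSet L) (hne : (verts L).Nonempty)
    (hc : Conn L (verts L)) : 1 + (cobd L 1).rank = fc L 1 := by
  obtain ⟨v, hv⟩ := hne
  have he : (∅ : Finset V) ∈ L := hL (Finset.empty_subset _) (mem_verts.1 hv)
  have h0 : (cobd L 0).rank = 1 := by
    have := rank_add_ker L 0
    rw [fc_zero he] at this
    have hk : ker (cobd L 0).mulVecLin = ⊥ := by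
      rw [ker_eq_bot']
      intro f hf
      have h1 := congrFun hf (⟨{v}, mem_verts.1 hv, by simp⟩ : Fc L 1)
      rw [Matrix.mulVecLin_apply, cobd_apply hL] at h1
      ext σ
      have h2 : σ.1 = ∅ := Finset.card_eq_zero.1 σ.2.2
      simp at h1
      rw [← ext0_apply f σ, h2, h1]; rfl
    rw [hk] at this
    simpa using this
  suffices H : (cobd L 0).rank + (cobd L 1).rank = fc L 1 by omega
  refine rank_add_eq hL 0 fun f hf => ?_
  have hconst : ∀ a ∈ verts L, ∀ b ∈ verts L, ext0 f {a} = ext0 f {b} := fun a ha b hb => by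
    refine hc.const (f := fun v => ext0 f {v}) ?_ ha hb
    intro a ha b hb hab
    by_cases h : a = b
    · rw [h]
    · have h1 := congrFun hf (⟨{a, b}, hab, card_pair h⟩ : Fc L 2)
      rw [cobd_apply hL, sum_pair_erase _ h] at h1
      exact (CharTwo.add_eq_zero.1 h1).symm
  refine ⟨fun _ => ext0 f {v}, ?_⟩
  ext σ
  obtain ⟨w, hw⟩ := card_eq_one.1 σ.2.2
  have hwL : w ∈ verts L := mem_verts.2 (hw ▸ σ.2.1)
  rw [cobd_apply hL, hw, ← ext0_apply f σ, hw, hconst w hwL v hv]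
  simp [ext0, he]

/-- Every simplicial mod `2` one-cocycle is a coboundary. -/
def B1 (L : Set (Finset V)) : Prop :=
  ∀ φ : V → V → ZMod 2, (∀ a b, φ a b = φ b a) →
    (∀ a b c, {a, b, c} ∈ L → φ a b + φ b c = φ a c) →
    ∃ ψ : V → ZMod 2, ∀ a b, {a, b} ∈ L → φ a b = ψ a + ψ b

theorem sum_triple_erase (f : Finset V → ZMod 2) {a b c : V} (hab : a ≠ b) (hac : a ≠ c)
    (hbc : b ≠ c) :
    ∑ v ∈ ({a, b, c} : Finset V), f (({a, b, c} : Finset V).erase v) =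
      f {b, c} + f {a, c} + f {a, b} := by
  rw [sum_insert (by grind), sum_pair hbc,
    show ({a, b, c} : Finset V).erase a = {b, c} by
      ext x; simp only [mem_erase, Finset.mem_insert, Finset.mem_singleton]; grind,
    show ({a, b, c} : Finset V).erase b = {a, c} by
      ext x; simp only [mem_erase, Finset.mem_insert, Finset.mem_singleton]; grind,
    show ({a, b, c} : Finset V).erase c = {a, b} by
      ext x; simp only [mem_erase, Finset.mem_insert, Finset.mem_singleton]; grind, add_assoc]

theorem rank_one_two (hL : IsLowerSet L) (hb : B1 L) :
    (cobd L 1).rank + (cobd L 2).rank = fc L 2 := by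
  refine rank_add_eq hL 1 fun f hf => ?_
  obtain ⟨ψ, hψ⟩ := hb (fun a b => ext0 f {a, b}) (fun a b => by rw [Finset.pair_comm]) (by
    intro a b c habc
    have hdiag : ∀ a, ext0 f {a, a} = 0 := fun a => by simp [ext0]
    by_cases hab : a = b
    · grind
    by_cases hbc : b = c
    · grind
    by_cases hac : a = c
    · subst hac; simp only [hdiag]; rw [Finset.pair_comm, zmod2_add_self]
    have h1 := congrFun hf (⟨{a, b, c}, habc, card_eq_three.2 ⟨a, b, c, hab, hac, hbc, rfl⟩⟩ : Fc L 3)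
    rw [cobd_apply hL, sum_triple_erase _ hab hac hbc] at h1
    have h2 := CharTwo.add_eq_zero.1 h1
    rw [← h2, add_right_comm, zmod2_add_self, zero_add])
  refine ⟨fun σ => ∑ v ∈ σ.1, ψ v, ?_⟩
  ext σ
  obtain ⟨a, b, hab, hs⟩ := card_eq_two.1 σ.2.2
  have hsL : {a, b} ∈ L := hs ▸ σ.2.1
  rw [cobd_apply hL, ← ext0_apply f σ, hs, sum_pair_erase _ hab, hψ a b hsL]
  have ha : ∀ x, {x} ∈ L → ext0 (fun σ : Fc L 1 => ∑ v ∈ σ.1, ψ v) {x} = ψ x := fun x hx => by simp [ext0, hx]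
  rw [ha _ (hL (by simp) hsL), ha _ (hL (by simp) hsL), add_comm]

theorem chi_le (hL : IsLowerSet L) (hne : (verts L).Nonempty)
    (hc : Conn L (verts L)) : chi L + fc L 4 ≤ 1 + z2 L := by
  have h1 := rank_zero_one hL hne hc
  have h2 : (cobd L 1).rank + (cobd L 2).rank ≤ fc L 2 := rank_add_le hL 1
  have h3 := rank_two L
  simp only [chi]
  omega

theorem chi_eq (hL : IsLowerSet L) (hne : (verts L).Nonempty)
    (hc : Conn L (verts L)) (hb : B1 L) : chi L + fc L 4 = 1 + z2 L := by
  have h1 := rank_zero_one hL hne hc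
  have h2 := rank_one_two hL hb
  have h3 := rank_two L
  simp only [chi]
  omega

/-- `c` is a mod `2` two-cycle of `L`. -/
def IsCyc2 (L : Set (Finset V)) (c : Finset V → ZMod 2) : Prop :=
  (∀ τ, c τ ≠ 0 → τ ∈ L ∧ τ.card = 3) ∧ ∀ e, e.card = 2 → ∑ v ∈ eᶜ, c (insert v e) = 0

theorem cobdT_apply (L : Set (Finset V)) (n : ℕ) (f : Fc L (n + 1) → ZMod 2) (e : Fc L n) :
    (cobd L n).transpose.mulVec f e = ∑ v ∈ e.1ᶜ, ext0 f (insert v e.1) := by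
  have h1 : (cobd L n).transpose.mulVec f e = ∑ τ : Fc L (n + 1), if e.1 ⊆ τ.1 then f τ else 0 := by
    simp [Matrix.mulVec, dotProduct, cobd]
  rw [h1, ← sum_filter,
    ← Finset.sum_filter_add_sum_filter_not (e.1ᶜ) (fun v => insert v e.1 ∈ L),
    sum_eq_zero (s := (e.1ᶜ).filter fun v => ¬ insert v e.1 ∈ L), add_zero]
  · symm
    refine sum_bij (fun v hv => ⟨insert v e.1, (mem_filter.1 hv).2, by
      rw [Finset.card_insert_of_notMem (Finset.mem_compl.1 (mem_filter.1 hv).1), e.2.2]⟩)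
      ?_ ?_ ?_ ?_
    · intro v hv; simp
    · intro v hv w hw h
      have h' : insert v e.1 = insert w e.1 := congrArg Subtype.val h
      have : v ∈ insert w e.1 := h' ▸ mem_insert_self _ _
      grind
    · intro τ hτ
      simp only [mem_filter_univ] at hτ
      obtain ⟨v, hv⟩ := card_eq_one.1 (show (τ.1 \ e.1).card = 1 by
        rw [Finset.card_sdiff_of_subset hτ, τ.2.2, e.2.2]; omega)
      have hv' : v ∈ τ.1 \ e.1 := by simp [hv]
      have hi : insert v e.1 = τ.1 := by rw [Finset.insert_eq, ← hv, Finset.sdiff_union_of_subset hτ]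
      exact ⟨v, mem_filter.2 ⟨Finset.mem_compl.2 (Finset.mem_sdiff.1 hv').2, hi ▸ τ.2.1⟩, Subtype.ext hi⟩
    · intro v hv
      exact ext0_apply f ⟨_, _⟩
  · intro v hv
    simp [ext0, (mem_filter.1 hv).2]

theorem mem_ker_iff (hL : IsLowerSet L) (f : Fc L 3 → ZMod 2) :
    f ∈ ker (cobd L 2).transpose.mulVecLin ↔ IsCyc2 L (ext0 f) := by
  have h0 := cobdT_apply L 2 f
  rw [mem_ker, Matrix.mulVecLin_apply]
  constructor
  · intro h
    refine ⟨fun τ hτ => ?_, fun e he => ?_⟩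
    · by_contra h'
      exact hτ (by simp only [ext0, dif_neg h'])
    · by_cases heL : e ∈ L
      · rw [← h0 ⟨e, heL, he⟩, h]; rfl
      · refine sum_eq_zero fun v _ => ?_
        rw [ext0, dif_neg]
        exact fun h => heL (hL (Finset.subset_insert _ _) h.1)
  · intro h
    ext e
    rw [h0, h.2 _ e.2.2]; rfl

theorem z2_eq_zero (hL : IsLowerSet L) (h : ∀ c, IsCyc2 L c → c = 0) :
    z2 L = 0 := by
  rw [z2, show ker (cobd L 2).transpose.mulVecLin = ⊥ by
    rw [ker_eq_bot']
    intro f hf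
    have := h _ ((mem_ker_iff hL f).1 hf)
    ext σ
    rw [← ext0_apply f σ, this]; rfl]
  simp

end

section
open scoped Classical
variable {V : Type} [Fintype V] [DecidableEq V] {L : Set (Finset V)} {Q : Finset V}

theorem conn_res (hQ : Q ⊆ verts L) (h : Conn L Q) :
    Conn (res L Q) (verts (res L Q)) := by
  rw [verts_res, Finset.inter_eq_right.2 hQ]
  intro A hA hne hne'
  obtain ⟨a, ha, b, hb, hb', hab⟩ := h A hA hne hne'
  grind [lk, res, mem_verts, IsLowerSet]

theorem res_inter_verts (hL : IsLowerSet L) (Q : Finset V) :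
    res L (Q ∩ verts L) = res L Q := by
  ext σ
  grind [lk, res, mem_verts, IsLowerSet]

theorem IsCirc.exists_edge {C : Set (Finset V)} (h : IsCirc C) {b : V} (hb : b ∈ verts C) :
    ∃ x, x ≠ b ∧ {b, x} ∈ C := by
  obtain ⟨x, y, -, hxy⟩ := card_eq_two.1 (h.link b hb).card
  have : x ∈ verts (lk C b) := by grind
  exact ⟨x, mem_verts_lk.1 this⟩

theorem IsSurf.cyc_link (h : IsSurf L) {c : Finset V → ZMod 2}
    (hc : IsCyc2 L c) {a : V} (ha : a ∈ verts L) :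
    ∃ k, ∀ b x, b ≠ x → {b, x} ∈ lk L a → c {a, b, x} = k := by
  have hC := h.link a ha
  have h1 : ∀ b ∈ verts (lk L a), ∃ k, ∀ x, x ≠ b → {b, x} ∈ lk L a → c {a, b, x} = k := fun b hb => by
    obtain ⟨x, y, hxy, hV⟩ := card_eq_two.1 (hC.link b hb).card
    have hx : x ∈ verts (lk (lk L a) b) := by simp [hV]
    have hy : y ∈ verts (lk (lk L a) b) := by simp [hV]
    rw [mem_verts_lk] at hx hy
    have hab := (mem_verts_lk.1 hb).1
    have hxa : x ≠ a := fun h => by have := hx.2.1; simp [h] at this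
    have hya : y ≠ a := fun h => by have := hy.2.1; simp [h] at this
    have hs := hc.2 {a, b} (card_pair hab.symm)
    have hsub : ({x, y} : Finset V) ⊆ ({a, b} : Finset V)ᶜ := by
      intro z hz; simp at hz ⊢; rcases hz with rfl | rfl
      exacts [⟨hxa, hx.1⟩, ⟨hya, hy.1⟩]
    have hper : ∀ z, insert z ({a, b} : Finset V) = {a, b, z} := fun z => by ext w; simp; tauto
    rw [← sum_subset hsub, sum_pair hxy, hper, hper] at hs
    · refine ⟨c {a, b, x}, fun z hz hbz => ?_⟩
      have : z ∈ verts (lk (lk L a) b) := mem_verts_lk.2 ⟨hz, hbz⟩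
      grind
    · intro z hz hz'
      by_contra hne
      have h2 := (hc.1 _ hne).1
      simp at hz
      grind [lk, res, mem_verts, IsLowerSet]
  choose! f hf using h1
  obtain ⟨b0, hb0⟩ := hC.ne
  refine ⟨f b0, fun b x hbx hm => ?_⟩
  have hb : b ∈ verts (lk L a) := mem_verts_of_mem hC.lower hm (by simp)
  rw [hf b hb x hbx.symm hm]
  refine hC.conn.const (f := f) ?_ hb hb0
  intro y hy z hz hyz
  by_cases hyz' : y = z
  · rw [hyz']
  · rw [← hf y hy z (Ne.symm hyz') hyz, ← hf z hz y hyz' (by rwa [Finset.pair_comm]), Finset.pair_comm y z]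

theorem IsSurf.cyc_const (h : IsSurf L) {c : Finset V → ZMod 2}
    (hc : IsCyc2 L c) : ∃ k, ∀ τ ∈ L, τ.card = 3 → c τ = k := by
  have h1 : ∀ a ∈ verts L, ∃ k, ∀ b x, b ≠ x → {b, x} ∈ lk L a → c {a, b, x} = k := fun a ha => h.cyc_link hc ha
  choose! m hm using h1
  obtain ⟨a0, ha0⟩ := h.ne
  refine ⟨m a0, fun τ hτ hcard => ?_⟩
  obtain ⟨a, b, x, hab, hax, hbx, rfl⟩ := card_eq_three.1 hcard
  have ha : a ∈ verts L := mem_verts_of_mem h.lower hτ (by simp)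
  rw [hm a ha b x hbx ⟨by grind, hτ⟩]
  refine h.conn.const (f := m) ?_ ha ha0
  intro y hy z hz hyz
  by_cases hne : y = z
  · rw [hne]
  · have hzy : z ∈ verts (lk L y) := mem_verts_lk.2 ⟨Ne.symm hne, hyz⟩
    obtain ⟨w, hwz, hw⟩ := (h.link y hy).exists_edge hzy
    have hwy : w ≠ y := fun h => by have := hw.1; simp [h] at this
    rw [← hm y hy z w hwz.symm hw, ← hm z hz y w hwy.symm ⟨by grind, by
      have := hw.2; rwa [Finset.insert_comm] at this⟩, Finset.insert_comm]

theorem isCyc2_res {c : Finset V → ZMod 2}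
    (h : IsCyc2 (res L Q) c) : IsCyc2 L c := ⟨fun τ hτ => ⟨(h.1 τ hτ).1.1, (h.1 τ hτ).2⟩, h.2⟩

theorem IsSurf.cyc_proper (h : IsSurf L) {r : V}
    (hr : r ∈ verts L) (hrQ : r ∉ Q) {c : Finset V → ZMod 2} (hc : IsCyc2 (res L Q) c) : c = 0 := by
  obtain ⟨k, hk⟩ := h.cyc_const (isCyc2_res hc)
  obtain ⟨b, hb⟩ := (h.link r hr).ne
  obtain ⟨x, hx, hbx⟩ := (h.link r hr).exists_edge hb
  have h1 := hbx.1
  simp at h1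
  have hk0 : k = 0 := by
    rw [← hk _ hbx.2 (card_eq_three.2 ⟨r, b, x, h1.1, h1.2, hx.symm, rfl⟩)]
    by_contra hne
    exact hrQ ((hc.1 _ hne).1.2 (by simp))
  ext τ
  by_contra hne
  have := (hc.1 τ hne)
  exact hne ((hk τ this.1.1 this.2).trans hk0)

theorem IsSurf.fc_four (h : IsSurf L) : fc L 4 = 0 := fc_eq_zero (fun σ hσ => h.dim hσ) (by norm_num)

theorem IsSurf.fc_res_four (h : IsSurf L) (Q : Finset V) :
    fc (res L Q) 4 = 0 := fc_eq_zero (fun σ hσ => h.dim hσ.1) (by norm_num)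

theorem IsSurf.chi_res_le (h : IsSurf L) (hQ : Q ⊆ verts L)
    (hne : Q.Nonempty) {r : V} (hr : r ∈ verts L) (hrQ : r ∉ Q) (hc : Conn L Q) :
    chi (res L Q) ≤ 1 := by
  have h1 := chi_le (isLowerSet_res h.lower Q)
    (by rwa [verts_res, Finset.inter_eq_right.2 hQ]) (conn_res hQ hc)
  rw [z2_eq_zero (isLowerSet_res h.lower Q) fun c hc => h.cyc_proper hr hrQ hc, h.fc_res_four] at h1
  simpa using h1

theorem IsSurf.chi_res_eq (h : IsSurf L) (hQ : Q ⊆ verts L)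
    (hne : Q.Nonempty) {r : V} (hr : r ∈ verts L) (hrQ : r ∉ Q) (hc : Conn L Q)
    (hb : B1 (res L Q)) : chi (res L Q) = 1 := by
  have h1 := chi_eq (isLowerSet_res h.lower Q)
    (by rwa [verts_res, Finset.inter_eq_right.2 hQ]) (conn_res hQ hc) hb
  rw [z2_eq_zero (isLowerSet_res h.lower Q) fun c hc => h.cyc_proper hr hrQ hc, h.fc_res_four] at h1
  simpa using h1

theorem IsSurf.z2_le (h : IsSurf L) : z2 L ≤ 1 := by
  obtain ⟨a, ha⟩ := h.ne
  obtain ⟨b, hb⟩ := (h.link a ha).ne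
  obtain ⟨x, hx, hbx⟩ := (h.link a ha).exists_edge hb
  have h1 := hbx.1
  simp at h1
  let τ : Fc L 3 := ⟨_, hbx.2, card_eq_three.2 ⟨a, b, x, h1.1, h1.2, hx.symm, rfl⟩⟩
  let ev : ker (cobd L 2).transpose.mulVecLin →ₗ[ZMod 2] ZMod 2 :=
    (LinearMap.proj τ).comp (Submodule.subtype _)
  have hinj : Injective ev := by
    rw [← LinearMap.ker_eq_bot, ker_eq_bot']
    rintro ⟨f, hf⟩ h0
    obtain ⟨k, hk⟩ := h.cyc_const ((mem_ker_iff h.lower f).1 hf)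
    have h2 : f τ = 0 := h0
    ext σ
    have h3 := hk σ.1 σ.2.1 σ.2.2
    rw [← hk τ.1 τ.2.1 τ.2.2, ext0_apply, ext0_apply, h2] at h3
    exact h3
  have := LinearMap.finrank_le_finrank_of_injective hinj
  simpa [z2] using this

theorem IsSurf.chi_le_two (h : IsSurf L) : chi L ≤ 2 := by
  have h1 := chi_le h.lower h.ne h.conn
  have := h.z2_le
  rw [h.fc_four] at h1
  push_cast at h1
  omega

theorem IsSurf.cyc_one (h : IsSurf L) :
    IsCyc2 L fun τ => if τ ∈ L ∧ τ.card = 3 then 1 else 0 := by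
  refine ⟨fun τ hτ => by_contra fun h => hτ (if_neg h), fun e he => ?_⟩
  obtain ⟨a, b, hab, rfl⟩ := card_eq_two.1 he
  by_cases heL : {a, b} ∈ L
  · have ha : a ∈ verts L := mem_verts_of_mem h.lower heL (by simp)
    have hb : b ∈ verts (lk L a) := mem_verts_lk.2 ⟨hab.symm, heL⟩
    have hcard := ((h.link a ha).link b hb).card
    rw [← sum_filter, sum_const]
    have : (({a, b} : Finset V)ᶜ.filter fun v => insert v {a, b} ∈ L ∧
        (insert v ({a, b} : Finset V)).card = 3) = verts (lk (lk L a) b) := by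
      ext v
      rw [mem_verts_lk]
      simp only [mem_filter, Finset.mem_compl, Finset.mem_insert, Finset.mem_singleton,
        not_or, lk, mem_setOf_eq]
      have hper : insert v ({a, b} : Finset V) = {a, b, v} := by grind
      grind
    rw [this, hcard]; rfl
  · refine sum_eq_zero fun v _ => if_neg fun h' => heL (h.lower (Finset.subset_insert _ _) h'.1)

theorem IsSurf.chi_eq_two (h : IsSurf L) (hb : B1 L) : chi L = 2 := by
  have h1 := chi_eq h.lower h.ne h.conn hb
  have h2 : z2 L ≠ 0 := fun h0 => by
    obtain ⟨a, ha⟩ := h.ne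
    obtain ⟨b, hb⟩ := (h.link a ha).ne
    obtain ⟨x, hx, hbx⟩ := (h.link a ha).exists_edge hb
    have h1 := hbx.1
    simp at h1
    let τ : Fc L 3 := ⟨_, hbx.2, card_eq_three.2 ⟨a, b, x, h1.1, h1.2, hx.symm, rfl⟩⟩
    rw [z2, Submodule.finrank_eq_zero] at h0
    have hm : (fun _ => 1 : Fc L 3 → ZMod 2) ∈ ker (cobd L 2).transpose.mulVecLin := by
      rw [mem_ker_iff h.lower]
      convert h.cyc_one using 1
      ext τ
      by_cases hτ : τ ∈ L ∧ τ.card = 3 <;> simp [ext0, hτ]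
    rw [h0, Submodule.mem_bot] at hm
    exact one_ne_zero (congrFun hm τ)
  have := h.z2_le
  rw [h.fc_four] at h1
  push_cast at h1
  omega

end

section
open scoped Classical
variable {V : Type} [Fintype V] [DecidableEq V] {L : Set (Finset V)} {v : V} {P : Finset V}

theorem empty_mem_of_verts (hL : IsLowerSet L) (h : (verts L).Nonempty) :
    ∅ ∈ L := by
  obtain ⟨v, hv⟩ := h
  exact hL (Finset.empty_subset _) (mem_verts.1 hv)

theorem IsSurf.chi_insert (h : IsSurf L) {Q : Finset V}
    (hv : v ∈ verts L) (hvQ : v ∉ Q) :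
    chi (res L (insert v Q)) = chi (res L Q) + 1 - (Q ∩ verts (lk L v)).card +
      fc (res (lk L v) (Q ∩ verts (lk L v))) 2 := by
  have hC := h.link v hv
  rw [res_inter_verts hC.lower]
  have h0 : fc (res (lk L v) Q) 0 = 1 := fc_zero ⟨empty_mem_of_verts hC.lower hC.ne, Finset.empty_subset _⟩
  have h1 : fc (res (lk L v) Q) 1 = (Q ∩ verts (lk L v)).card := by rw [fc_one, verts_res, Finset.inter_comm]
  have h3 : fc (res (lk L v) Q) 3 = 0 := fc_eq_zero (fun σ hσ => hC.dim hσ.1) (by norm_num)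
  have e0 := fc_insert L hvQ 0
  have e1 := fc_insert L hvQ 1
  have e2 := fc_insert L hvQ 2
  have e3 := fc_insert L hvQ 3
  simp only [zero_add, Nat.reduceAdd] at e0 e1 e2 e3
  rw [chi, chi, e0, e1, e2, e3, h0, h1, h3]
  push_cast
  ring

theorem fc_empty (n : ℕ) (L : Set (Finset V)) : fc (res L ∅) (n + 1) = 0 := by
  rw [fc_eq_zero (n := 0) _ (Nat.succ_pos n)]
  rintro σ ⟨-, hσ⟩
  simp [Finset.subset_empty.1 hσ]

theorem res_verts (hL : IsLowerSet L) : res L (verts L) = L := by grind [lk, res, mem_verts, IsLowerSet]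

theorem sdiff_inter_link (hL : IsLowerSet L) (P : Finset V) (v : V) :
    verts (lk L v) \ (P ∩ verts (lk L v)) = (verts L \ insert v P) ∩ verts (lk L v) := by
  ext x
  grind [lk, res, mem_verts, IsLowerSet]

theorem IsSurf.chi_add (h : IsSurf L) (P : Finset V) (hP : P ⊆ verts L) :
    chi L = chi (res L P) + chi (res L (verts L \ P)) := by
  induction P using Finset.induction_on with
  | empty =>
    rw [Finset.sdiff_empty, res_verts h.lower]
    simp [chi, fc_empty]
  | insert v P hvP ih =>
    rw [ih ((Finset.subset_insert _ _).trans hP)]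
    have hv : v ∈ verts L := hP (by simp)
    have hM : verts L \ P = insert v (verts L \ insert v P) := by grind
    rw [h.chi_insert hv hvP, hM, h.chi_insert hv (by simp)]
    have h1 := (h.link v hv).edges_sdiff (P := P ∩ verts (lk L v)) Finset.inter_subset_right
    rw [sdiff_inter_link h.lower] at h1
    omega

theorem IsSurf.conn_erase (h : IsSurf L) (hv : v ∈ verts L) :
    Conn L ((verts L).erase v) := fun A hA hne hne' => by
  by_contra! hcon
  have hvA : v ∉ A := fun h => by grind
  obtain ⟨a, ha, b, hb, hbA, hab⟩ := h.conn A (hA.trans (erase_subset _ _)) hne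
    (fun h => hvA (h ▸ hv))
  have hbv : b = v := by grind
  subst hbv
  obtain ⟨c, hc, d, hd, hdA, hcd⟩ := h.conn (insert b A)
    (Finset.insert_subset hv (hA.trans (erase_subset _ _))) ⟨b, by simp⟩
    (fun h => hne' (by grind))
  simp only [Finset.mem_insert, not_or] at hc hdA
  have hcb : c = b := by grind
  subst hcb
  have hal : a ∈ verts (lk L c) := mem_verts_lk.2 ⟨fun h => hvA (h ▸ ha), by rwa [Finset.pair_comm]⟩
  have hdl : d ∈ verts (lk L c) := mem_verts_lk.2 ⟨hdA.1, hcd⟩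
  obtain ⟨x, hx, y, hy, hyA, hxy⟩ := (h.link c hv).conn (A ∩ verts (lk L c))
    Finset.inter_subset_right ⟨a, by grind⟩ (fun h => hdA.2 (by
      rw [← h] at hdl; exact (Finset.mem_inter.1 hdl).1))
  simp only [Finset.mem_inter] at hx hyA
  refine hcon x hx.1 y (mem_erase.2 ⟨(mem_verts_lk.1 hy).1, verts_lk_subset h.lower c hy⟩)
    (fun h => hyA ⟨h, hy⟩) (lk_subset_self h.lower c hxy)

theorem IsSurf.exists_nonsep (h : IsSurf L) (hP : P ⊆ verts L)
    (hne : P.Nonempty) (hne' : (verts L \ P).Nonempty) (hcM : Conn L (verts L \ P)) :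
    ∃ v ∈ verts L \ P, (∃ p ∈ P, {p, v} ∈ L) ∧ Conn L ((verts L \ P).erase v) := by
  set M := verts L \ P with hM
  suffices H : ∀ n : ℕ, ∀ v ∈ M, (∃ p ∈ P, {p, v} ∈ L) → ∀ A ⊆ M.erase v, A.Nonempty →
      A ≠ M.erase v → (∀ a ∈ A, ∀ b ∈ M.erase v, b ∉ A → {a, b} ∉ L) → A.card = n →
      ∃ v ∈ M, (∃ p ∈ P, {p, v} ∈ L) ∧ Conn L (M.erase v) by
    obtain ⟨p, hp, v, hv, hvP, hpv⟩ := h.conn P hP hne (by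
      rintro rfl; simp [hM] at hne')
    have hvM : v ∈ M := Finset.mem_sdiff.2 ⟨hv, hvP⟩
    by_cases hc : Conn L (M.erase v)
    · grind
    · rw [Conn] at hc
      push Not at hc
      obtain ⟨A, hA, h1, h2, h3⟩ := hc
      exact H _ v hvM ⟨p, hp, hpv⟩ A hA h1 h2 h3 rfl
  intro n
  induction n using Nat.strong_induction_on with
  | _ n ih =>
  intro v hv hpv A hA hAne hAne' hcl hcard
  have hvL : v ∈ verts L := (Finset.mem_sdiff.1 hv).1
  have hAM : A ⊆ M := hA.trans (erase_subset _ _)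
  have hvA : v ∉ A := fun h => by grind
  obtain ⟨w, hw, b, hb, hbA, hwb⟩ := h.conn_erase hvL A
    (fun x hx => mem_erase.2 ⟨(mem_erase.1 (hA hx)).1,
      (Finset.mem_sdiff.1 (hAM hx)).1⟩) hAne (fun h => by
      obtain ⟨p, hp⟩ := hne
      grind)
  have hbP : b ∈ P := by grind
  have hwM := hAM hw
  have hwp : ∃ p ∈ P, {p, w} ∈ L := ⟨b, hbP, by rwa [Finset.pair_comm]⟩
  by_cases hc : Conn L (M.erase w)
  · exact ⟨w, hwM, hwp, hc⟩
  have H : ∃ A' ⊆ M.erase w, A'.Nonempty ∧ A' ≠ M.erase w ∧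
      (∀ a ∈ A', ∀ b ∈ M.erase w, b ∉ A' → {a, b} ∉ L) ∧ v ∉ A' := by
    rw [Conn] at hc
    push Not at hc
    obtain ⟨A', hA', h1, h2, h3⟩ := hc
    by_cases hvA' : v ∈ A'
    · refine ⟨M.erase w \ A', Finset.sdiff_subset, ?_, ?_, ?_, by grind⟩
      · grind
      · grind
      · intro a ha b hb hb'
        have hbA' : b ∈ A' := by grind
        have := Finset.mem_sdiff.1 ha
        rw [Finset.pair_comm]
        exact h3 b hbA' a this.1 this.2
    · grind
  obtain ⟨A', hA', h1, h2, h3, hvA'⟩ := H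
  have hsub : A' ⊆ A := by
    rw [← Finset.sdiff_eq_empty_iff_subset]
    by_contra hne2
    obtain ⟨a, ha, c, hc, hcA, hac⟩ := hcM (A' \ A)
      (Finset.sdiff_subset.trans (hA'.trans (erase_subset _ _)))
      (Finset.nonempty_iff_ne_empty.2 hne2)
      (fun h => hvA' (Finset.mem_sdiff.1 (h ▸ hv)).1)
    obtain ⟨ha1, ha2⟩ := Finset.mem_sdiff.1 ha
    have haM : a ∈ M := (mem_erase.1 (hA' ha1)).2
    have hav : a ≠ v := fun h => hvA' (h ▸ ha1)
    by_cases hcA2 : c ∈ A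
    · rw [Finset.pair_comm] at hac
      exact hcl c hcA2 a (mem_erase.2 ⟨hav, haM⟩) ha2 hac
    · grind
  refine ih A'.card ?_ w hwM hwp A' hA' h1 h2 h3 rfl
  rw [← hcard]
  refine Finset.card_lt_card ⟨hsub, fun h => ?_⟩
  simpa using hA' (h hw)

theorem IsSurf.chi_res_one (h : IsSurf L) (h2 : chi L = 2)
    (hP : P ⊆ verts L) (hne : P.Nonempty) (hne' : (verts L \ P).Nonempty) (hcP : Conn L P)
    (hcM : Conn L (verts L \ P)) : chi (res L P) = 1 := by
  have h1 := h.chi_add P hP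
  obtain ⟨p, hp⟩ := hne
  obtain ⟨m, hm⟩ := hne'
  have := h.chi_res_le hP ⟨p, hp⟩ (Finset.mem_sdiff.1 hm).1 (Finset.mem_sdiff.1 hm).2 hcP
  have := h.chi_res_le (Q := verts L \ P) Finset.sdiff_subset ⟨m, hm⟩ (hP hp) (by simp [hp]) hcM
  omega

theorem pmCol_inter {P Q : Finset V} (hv : v ∈ Q) : pmCol P v = pmCol (P ∩ Q) v := by simp [pmCol, hv]

theorem IsSurf.stepProp (h : IsSurf L) (h2 : chi L = 2) :
    StepProp (fstL 1 ℝ ℝ ℝ) L := fun P hP hne hc hcP hcM => by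
  have hMne : (verts L \ P).Nonempty := Finset.card_pos.1 (by omega)
  obtain ⟨v, hv, ⟨p, hp, hpv⟩, hcv⟩ := h.exists_nonsep hP hne hMne hcM
  have hvL := (Finset.mem_sdiff.1 hv).1
  have hvP := (Finset.mem_sdiff.1 hv).2
  have hci : Conn L (insert v P) := hcP.insert hp (by rwa [Finset.pair_comm])
  refine ⟨v, hv, hci, hcv, ?_⟩
  have hM' : verts L \ insert v P = (verts L \ P).erase v := by ext x; simp; tauto
  have h3 := h.chi_res_one h2 hP hne hMne hcP hcM
  have h4 := h.chi_res_one h2 (P := insert v P) (Finset.insert_subset hvL hP) ⟨v, by simp⟩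
    (by rw [hM', ← Finset.card_pos, card_erase_of_mem hv]; omega) hci (by rwa [hM'])
  have h5 := h.chi_insert hvL hvP
  have hC := h.link v hvL
  have h6 := hC.edges_sdiff (P := P ∩ verts (lk L v)) Finset.inter_subset_right
  have h7 : (P ∩ verts (lk L v)).card = fc (res (lk L v) (P ∩ verts (lk L v))) 2 + 1 := by omega
  have h8 : (verts (lk L v) \ (P ∩ verts (lk L v))).card =
    fc (res (lk L v) (verts (lk L v) \ (P ∩ verts (lk L v)))) 2 + 1 := by omega
  have n1 : (P ∩ verts (lk L v)).Nonempty := Finset.card_pos.1 (by omega)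
  have n2 : (verts (lk L v) \ (P ∩ verts (lk L v))).Nonempty := Finset.card_pos.1 (by omega)
  have hsp := hC.signPair_pm Finset.inter_subset_right n1 n2
    (hC.conn_of_edges Finset.inter_subset_right (fun h => by grind) h7)
    (hC.conn_of_edges Finset.sdiff_subset (fun h => by grind) h8)
  exact hsp.of_equiv (SignEquiv.of_eqOn hC.lower fun w hw => pmCol_inter hw)

/-- The target of the colour on a sphere. -/
abbrev E2 := WithLp 1 (ℝ × ℝ)
abbrev E3 := WithLp 1 (ℝ × E2)

theorem IsSurf.signPair_pm (h : IsSurf L) (h2 : chi L = 2)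
    (hP : P ⊆ verts L) (hne : P.Nonempty) (hne' : (verts L \ P).Nonempty) (hcP : Conn L P)
    (hcM : Conn L (verts L \ P)) : SignPair (fstL 1 ℝ ℝ E2) L (pmCol P) :=
  (h.stepProp h2).signPair fstL_ne_zero h.lower (fun u hu => (h.link u hu).homeo) hP hne hne' hcP hcM

theorem IsSurf.signPair (h : IsSurf L) (h2 : chi L = 2) {g : V → ℝ}
    (hg : Tern g)
    (hne : (nnv L g).Nonempty) (hne' : (verts L \ nnv L g).Nonempty) (hcP : Conn L (nnv L g))
    (hcM : Conn L (verts L \ nnv L g))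
    (h0 : ∀ v ∈ verts L, g v = 0 → ∀ g', Flip g g' →
      SignPair (fstL 1 ℝ ℝ ℝ) (lk L v) g') :
    SignPair (fstL 1 ℝ ℝ E2) L g :=
  signPair_of_pmCol fstL_ne_zero h.lower hg h0
    (h.signPair_pm h2 (filter_subset _ _) hne hne' hcP hcM)

theorem IsSurf.homeo (h : IsSurf L) (h2 : chi L = 2) :
    ∃ e, HomeoOn e (realiz L) (sphere (0 : E3) 1) := by
  obtain ⟨v, hv⟩ := h.ne
  have h3 : verts L \ {v} = (verts L).erase v := by grind
  have hne : ((verts L).erase v).Nonempty := by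
    obtain ⟨b, hb⟩ := (h.link v hv).ne
    exact ⟨b, mem_erase.2 ⟨(mem_verts_lk.1 hb).1, verts_lk_subset h.lower v hb⟩⟩
  obtain ⟨e, he, -⟩ := h.signPair_pm h2 (P := {v}) (by grind) (by simp)
    (by rwa [h3]) (conn_singleton L v) (by rw [h3]; exact h.conn_erase hv)
  exact ⟨e, he⟩

theorem fc_res_closed (hL : IsLowerSet L) {A Q : Finset V} (hA : A ⊆ Q)
    (h : ∀ a ∈ A, ∀ b ∈ Q, b ∉ A → {a, b} ∉ L) :
    chi (res L Q) = chi (res L A) + chi (res L (Q \ A)) := by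
  simp only [chi]
  rw [fc_res_union hL hA h (n := 1) (by norm_num), fc_res_union hL hA h (n := 2) (by norm_num),
    fc_res_union hL hA h (n := 3) (by norm_num), fc_res_union hL hA h (n := 4) (by norm_num)]
  push_cast; ring

theorem IsSurf.conn_compl (h : IsSurf L) (h2 : chi L = 2)
    (hP : P ⊆ verts L) (hne : P.Nonempty) (hne' : (verts L \ P).Nonempty) (hcP : Conn L P)
    (hb : B1 (res L P)) : Conn L (verts L \ P) := by
  obtain ⟨m, hm⟩ := hne'
  have h3 := h.chi_res_eq hP hne (Finset.mem_sdiff.1 hm).1 (Finset.mem_sdiff.1 hm).2 hcP hb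
  have h4 := h.chi_add P hP
  have key : ∀ A ⊆ verts L \ P, A.Nonempty →
      (∀ a ∈ A, ∀ b ∈ verts L \ P, b ∉ A → {a, b} ∉ L) → Conn L (verts L \ A) → 1 ≤ chi (res L A) := fun A hA hAn hcl hcon => by
    have hAV : A ⊆ verts L := hA.trans Finset.sdiff_subset
    have h5 := h.chi_add A hAV
    obtain ⟨a, ha⟩ := hAn
    obtain ⟨p, hp⟩ := hne
    have := h.chi_res_le (Q := verts L \ A) Finset.sdiff_subset
      ⟨p, Finset.mem_sdiff.2 ⟨hP hp, fun h => (Finset.mem_sdiff.1 (hA h)).2 hp⟩⟩ (hAV ha)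
      (by simp [ha]) hcon
    omega
  have hcomp : ∀ A ⊆ verts L \ P, (∀ a ∈ A, ∀ b ∈ verts L \ P, b ∉ A → {a, b} ∉ L) →
      Conn L (verts L \ A) := fun A hA hcl D hD hDn hDn' => by
    by_contra! hcon
    have hPA : ∀ p ∈ P, p ∈ verts L \ A := fun p hp =>
      Finset.mem_sdiff.2 ⟨hP hp, fun h => (Finset.mem_sdiff.1 (hA h)).2 hp⟩
    have main : ∀ D ⊆ verts L \ A, D.Nonempty → D ∩ P = ∅ →
        (∀ a ∈ D, ∀ b ∈ verts L \ A, b ∉ D → {a, b} ∉ L) → False := fun D hD hDn hDP hcon => by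
      obtain ⟨a, ha, b, hb, hbD, hab⟩ := h.conn D (hD.trans Finset.sdiff_subset) hDn (fun h => by
        obtain ⟨p, hp⟩ := hne
        have : p ∈ D ∩ P := Finset.mem_inter.2 ⟨h ▸ hP hp, hp⟩
        simp [hDP] at this)
      by_cases hbA : b ∈ A
      · have haP : a ∉ P := fun h => by
          have : a ∈ D ∩ P := Finset.mem_inter.2 ⟨ha, h⟩
          simp [hDP] at this
        have haA := (Finset.mem_sdiff.1 (hD ha))
        rw [Finset.pair_comm] at hab
        grind
      · grind
    by_cases hDP : D ∩ P = ∅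
    · grind
    by_cases hDP2 : P ⊆ D
    · refine main ((verts L \ A) \ D) Finset.sdiff_subset ?_ ?_ ?_
      · grind
      · grind
      · intro a ha b hb hb'
        have hbD : b ∈ D := by grind
        rw [Finset.pair_comm]
        grind
    · obtain ⟨a, ha, b, hb, hbD, hab⟩ := hcP (D ∩ P) Finset.inter_subset_right
        (Finset.nonempty_iff_ne_empty.2 hDP) (fun h => hDP2 (Finset.inter_eq_right.1 h))
      grind
  intro A hA hAn hAne
  by_contra! hcon
  have hcl2 : ∀ a ∈ (verts L \ P) \ A, ∀ b ∈ verts L \ P, b ∉ (verts L \ P) \ A → {a, b} ∉ L := fun a ha b hb hb' => by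
    have hbA : b ∈ A := by grind
    rw [Finset.pair_comm]
    grind
  have e1 := key A hA hAn hcon (hcomp A hA hcon)
  have e2 := key _ Finset.sdiff_subset (by
    rw [Finset.sdiff_nonempty]; exact fun h => hAne (Finset.Subset.antisymm hA h)) hcl2
    (hcomp _ Finset.sdiff_subset hcl2)
  have e3 := fc_res_closed h.lower hA hcon
  omega

end

section

variable {X Y : Type*} [TopologicalSpace X] [TopologicalSpace Y] {I : Type}

/-- A sign cocycle over `A`: an open cover by the sets `{0 < ρ i}` with transition signs `s i j`. -/
structure SgnOn (A : Set X) (ρ : I → X → ℝ) (s : I → I → ℝ) : Prop where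
  cont : ∀ i, ContinuousOn (ρ i) A
  nonneg : ∀ i, ∀ x ∈ A, 0 ≤ ρ i x
  cover : ∀ x ∈ A, ∃ i, 0 < ρ i x
  sgn : ∀ i j, s i j = 1 ∨ s i j = -1
  coc : ∀ x ∈ A, ∀ i j k, 0 < ρ i x → 0 < ρ j x → 0 < ρ k x → s i j * s j k = s i k

/-- `v` lies in the fibre over `x` of the double cover of a sign cocycle. -/
def InFib (ρ : I → X → ℝ) (s : I → I → ℝ) (x : X) (v : I → ℝ) : Prop := ∀ i j, v i * v j = s i j * ρ i x * ρ j x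

theorem SgnOn.diag {A : Set X} {ρ : I → X → ℝ} {s : I → I → ℝ} (h : SgnOn A ρ s) {x : X}
    (hx : x ∈ A) {i : I} (hi : 0 < ρ i x) : s i i = 1 := by
  have := h.coc x hx i i i hi hi hi
  rcases h.sgn i i with h | h <;> rw [h] at this ⊢
  norm_num at this

theorem SgnOn.mono {A B : Set X} {ρ : I → X → ℝ} {s : I → I → ℝ} (h : SgnOn A ρ s) (hB : B ⊆ A) :
    SgnOn B ρ s :=
  ⟨fun i => (h.cont i).mono hB, fun i x hx => h.nonneg i x (hB hx), fun x hx => h.cover x (hB hx),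
    h.sgn, fun x hx => h.coc x (hB hx)⟩

theorem InFib.neg {ρ : I → X → ℝ} {s : I → I → ℝ} {x : X} {v : I → ℝ} (h : InFib ρ s x v) :
    InFib ρ s x (-v) := fun i j => by aesop

theorem InFib.ne_zero {A : Set X} {ρ : I → X → ℝ} {s : I → I → ℝ} (h : SgnOn A ρ s) {x : X}
    (hx : x ∈ A) {v : I → ℝ} (hv : InFib ρ s x v) {i : I} (hi : 0 < ρ i x) : v i ≠ 0 := fun h0 => by
  have := hv i i
  rw [h.diag hx hi, h0] at this
  have := mul_pos hi hi
  linarith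

theorem InFib.eq_of_apply {A : Set X} {ρ : I → X → ℝ} {s : I → I → ℝ} (h : SgnOn A ρ s) {x : X}
    (hx : x ∈ A) {v w : I → ℝ} (hv : InFib ρ s x v) (hw : InFib ρ s x w) {i : I} (hi : 0 < ρ i x)
    (hvw : v i = w i) : v = w := by
  have h0 := hv.ne_zero h hx hi
  ext j
  have h1 := hv i j
  rw [← hw i j, ← hvw] at h1
  exact mul_left_cancel₀ h0 h1

theorem InFib.eq_or {A : Set X} {ρ : I → X → ℝ} {s : I → I → ℝ} (h : SgnOn A ρ s) {x : X}
    (hx : x ∈ A) {v w : I → ℝ} (hv : InFib ρ s x v) (hw : InFib ρ s x w) : v = w ∨ v = -w := by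
  obtain ⟨i, hi⟩ := h.cover x hx
  have : v i * v i = w i * w i := by rw [hv i i, hw i i]
  rcases mul_self_eq_mul_self_iff.1 this with h1 | h1
  · exact Or.inl (hv.eq_of_apply h hx hw hi h1)
  · exact Or.inr (hv.eq_of_apply h hx hw.neg hi h1)

theorem InFib.exists {A : Set X} {ρ : I → X → ℝ} {s : I → I → ℝ} (h : SgnOn A ρ s) {x : X}
    (hx : x ∈ A) {i : I} (hi : 0 < ρ i x) {t : ℝ} (ht : t = 1 ∨ t = -1) :
    InFib ρ s x fun j => t * s i j * ρ j x := fun j k => by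
  have htt : t * t = 1 := by rcases ht with h | h <;> rw [h] <;> norm_num
  by_cases hj : 0 < ρ j x
  · by_cases hk : 0 < ρ k x
    · have h1 := h.coc x hx i j k hi hj hk
      have h2 : s i j * s i j = 1 := by rcases h.sgn i j with h | h <;> rw [h] <;> norm_num
      grind
    · have : ρ k x = 0 := le_antisymm (not_lt.1 hk) (h.nonneg k x hx)
      simp [this]
  · have : ρ j x = 0 := le_antisymm (not_lt.1 hj) (h.nonneg j x hx)
    simp [this]

theorem InFib.mul_abs {A : Set X} {ρ : I → X → ℝ} {s : I → I → ℝ} (h : SgnOn A ρ s) {x : X}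
    (hx : x ∈ A) {v : I → ℝ} (hv : InFib ρ s x v) {i : I} (hi : 0 < ρ i x) :
    v i = ρ i x ∨ v i = -ρ i x := by
  have := hv i i
  rw [h.diag hx hi, one_mul] at this
  exact mul_self_eq_mul_self_iff.1 this

theorem section_unique {A : Set Y} (hA : IsPreconnected A) {B : Set X} {ρ : I → X → ℝ}
    {s : I → I → ℝ} (h : SgnOn B ρ s) {f : Y → X} (hf : MapsTo f A B) {e e' : Y → I → ℝ}
    (he : ContinuousOn e A) (he' : ContinuousOn e' A) (hfe : ∀ y ∈ A, InFib ρ s (f y) (e y))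
    (hfe' : ∀ y ∈ A, InFib ρ s (f y) (e' y)) :
    (∀ y ∈ A, e y = e' y) ∨ ∀ y ∈ A, e y = -e' y := by
  by_contra! hcon
  obtain ⟨⟨a, ha, hae⟩, b, hb, hbe⟩ := hcon
  have hd : ∀ y ∈ A, e y = e' y ∨ e y = -e' y := fun y hy => (hfe y hy).eq_or h (hf hy) (hfe' y hy)
  have hpc := isPreconnected_iff_preconnectedSpace.1 hA
  have c1 : Continuous fun y : A => e y := continuousOn_iff_continuous_domRestrict.1 he
  have c2 : Continuous fun y : A => e' y := continuousOn_iff_continuous_domRestrict.1 he'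
  have hcl1 : IsClosed {y : A | e y = e' y} := isClosed_eq c1 c2
  have hcl2 : IsClosed {y : A | e y = -e' y} := isClosed_eq c1 c2.neg
  have hcompl : {y : A | e y = e' y}ᶜ = {y : A | e y = -e' y} := by
    ext y
    simp only [mem_compl_iff, mem_setOf_eq]
    constructor
    · grind
    · intro h1 h2
      obtain ⟨i, hi⟩ := h.cover _ (hf y.2)
      have h3 := (hfe y y.2).ne_zero h (hf y.2) hi
      have h4 : e y i = -e y i := by
        conv_lhs => rw [h1]
        rw [h2]; rfl
      exact h3 (by linarith)
  have hclop : IsClopen {y : A | e y = e' y} := ⟨hcl1, by rw [← isClosed_compl_iff, hcompl]; exact hcl2⟩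
  rcases isClopen_iff.1 hclop with h1 | h1
  · have : (⟨b, hb⟩ : A) ∈ {y : A | e y = e' y} := (hd b hb).resolve_right hbe
    rw [h1] at this; exact this
  · have : (⟨a, ha⟩ : A) ∈ {y : A | e y = e' y} := h1 ▸ mem_univ _
    exact hae this

/-- The double cover of a sign cocycle. -/
def DCov (ρ : I → X → ℝ) (s : I → I → ℝ) : Type _ := {p : X × (I → ℝ) // InFib ρ s p.1 p.2}

instance (ρ : I → X → ℝ) (s : I → I → ℝ) : TopologicalSpace (DCov ρ s) :=
  inferInstanceAs (TopologicalSpace {p : X × (I → ℝ) // InFib ρ s p.1 p.2})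

/-- The projection of the double cover. -/
def DCov.proj (ρ : I → X → ℝ) (s : I → I → ℝ) (p : DCov ρ s) : X := p.1.1

theorem DCov.continuous_proj (ρ : I → X → ℝ) (s : I → I → ℝ) : Continuous (DCov.proj ρ s) :=
  continuous_fst.comp continuous_subtype_val

theorem DCov.isCoveringMap {ρ : I → X → ℝ} {s : I → I → ℝ} (h : SgnOn univ ρ s) :
    IsCoveringMap (DCov.proj ρ s) := fun x => by
  refine IsEvenlyCovered.to_isEvenlyCovered_preimage (I := Bool) ?_
  obtain ⟨i, hi⟩ := h.cover x (mem_univ x)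
  have hρ : ∀ j, Continuous (ρ j) := fun j => continuousOn_univ.1 (h.cont j)
  have hUo : IsOpen {y | 0 < ρ i y} := isOpen_lt continuous_const (hρ i)
  have hsg : ∀ b : Bool, (if b then (1 : ℝ) else -1) = 1 ∨ (if b then (1 : ℝ) else -1) = -1 := by grind
  have hcoord : Continuous fun p : DCov ρ s => p.1.2 i :=
    (continuous_apply i).comp (continuous_snd.comp continuous_subtype_val)
  refine ⟨inferInstance, {y | 0 < ρ i y}, hi, hUo, hUo.preimage (DCov.continuous_proj ρ s),
    { toFun := fun p => (⟨p.1.1.1, p.2⟩, decide (0 < p.1.1.2 i))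
      invFun := fun q => ⟨⟨(q.1.1, fun j => (if q.2 then 1 else -1) * s i j * ρ j q.1.1),
        InFib.exists h (mem_univ _) q.1.2 (hsg q.2)⟩, q.1.2⟩
      left_inv := ?_
      right_inv := ?_
      continuous_toFun := ?_
      continuous_invFun := ?_ }, fun p => rfl⟩
  · intro p
    have hp : 0 < ρ i p.1.1.1 := p.2
    refine Subtype.ext (Subtype.ext (Prod.ext rfl ?_))
    refine InFib.eq_of_apply h (mem_univ _) (InFib.exists h (mem_univ _) hp (hsg _)) p.1.2 hp ?_
    change (if decide (0 < p.1.1.2 i) then (1 : ℝ) else -1) * s i i * ρ i p.1.1.1 = p.1.1.2 i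
    rw [h.diag (mem_univ _) hp]
    rcases p.1.2.mul_abs h (mem_univ _) hp with h1 | h1
    · grind
    · grind
  · rintro ⟨⟨y, hy⟩, b⟩
    have hy' : 0 < ρ i y := hy
    refine Prod.ext rfl ?_
    have h1 := h.diag (mem_univ _) hy'
    cases b
    · simp [h1, hy'.le]
    · simp [h1, hy']
  · refine Continuous.prodMk ?_ ?_
    · fun_prop
    · have hc : Continuous fun p : DCov.proj ρ s ⁻¹' {y | 0 < ρ i y} => p.1.1.2 i :=
        hcoord.comp continuous_subtype_val
      refine continuous_discrete_rng.2 fun b => ?_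
      have hpos : IsOpen {p : DCov.proj ρ s ⁻¹' {y | 0 < ρ i y} | 0 < p.1.1.2 i} := isOpen_lt continuous_const hc
      have hneg : IsOpen {p : DCov.proj ρ s ⁻¹' {y | 0 < ρ i y} | p.1.1.2 i < 0} := isOpen_lt hc continuous_const
      cases b
      · convert hneg using 1
        ext p
        have := p.1.2.ne_zero h (mem_univ _) (i := i) p.2
        grind
      · convert hpos using 1
        ext p
        simp
  · refine Continuous.subtype_mk (Continuous.subtype_mk ?_ _) _
    have hb : Continuous fun q : {y | 0 < ρ i y} × Bool => (if q.2 then (1 : ℝ) else -1) :=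
      (continuous_of_discreteTopology (f := fun b : Bool => if b then (1 : ℝ) else -1)).comp
        continuous_snd
    refine (continuous_subtype_val.comp continuous_fst).prodMk (continuous_pi fun j => ?_)
    exact (hb.mul continuous_const).mul ((hρ j).comp (continuous_subtype_val.comp continuous_fst))

theorem exists_section_of_contraction {ρ : I → X → ℝ} {s : I → I → ℝ} (h : SgnOn univ ρ s)
    (G : C(unitInterval × Y, X)) {c : X} (h0 : ∀ y, G (0, y) = c) :
    ∃ e : Y → I → ℝ, Continuous e ∧ ∀ y, InFib ρ s (G (1, y)) (e y) := by
  obtain ⟨i, hi⟩ := h.cover c (mem_univ c)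
  have cov := DCov.isCoveringMap h
  let p0 : DCov ρ s := ⟨(c, _), InFib.exists h (mem_univ c) hi (Or.inl rfl)⟩
  let L := cov.liftHomotopy G (ContinuousMap.const Y p0) (fun a => h0 a)
  have hL : ∀ q, DCov.proj ρ s (L q) = G q := fun q => congrFun (cov.liftHomotopy_lifts G _ _) q
  refine ⟨fun y => (L (1, y)).1.2, ?_, fun y => ?_⟩
  · fun_prop
  · have := (L (1, y)).2
    rwa [show (L (1, y)).1.1 = G (1, y) from hL _] at this

/-- Every sign cocycle over the set is trivial. -/
def SimplyConn (A : Set X) : Prop := ∀ (I : Type) (ρ : I → X → ℝ) (s : I → I → ℝ), SgnOn A ρ s →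
  ∃ e : X → I → ℝ, ContinuousOn e A ∧ ∀ x ∈ A, InFib ρ s x (e x)

theorem SgnOn.comp {B : Set X} {ρ : I → X → ℝ} {s : I → I → ℝ} (h : SgnOn B ρ s) {A : Set Y}
    {f : Y → X} (hf : ContinuousOn f A) (hm : MapsTo f A B) : SgnOn A (fun i => ρ i ∘ f) s :=
  ⟨fun i => (h.cont i).comp hf hm, fun i y hy => h.nonneg i _ (hm hy), fun y hy => h.cover _ (hm hy),
    h.sgn, fun y hy => h.coc _ (hm hy)⟩

theorem SimplyConn.of_retract {A : Set X} {B : Set Y} (hA : SimplyConn A) {f : X → Y} {g : Y → X}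
    (hf : ContinuousOn f A) (hg : ContinuousOn g B) (hfm : MapsTo f A B) (hgm : MapsTo g B A)
    (hfg : ∀ y ∈ B, f (g y) = y) : SimplyConn B := fun I ρ s h => by
  obtain ⟨e, he, hfib⟩ := hA I _ s (h.comp hf hfm)
  refine ⟨e ∘ g, he.comp hg hgm, fun y hy i j => ?_⟩
  have := hfib (g y) (hgm hy) i j
  simpa [hfg y hy] using this

theorem simplyConn_of_contraction {A : Set X} (G : ℝ → X → X)
    (hG : ContinuousOn (fun q : ℝ × X => G q.1 q.2) (Icc 0 1 ×ˢ A))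
    (hm : ∀ t ∈ Icc (0 : ℝ) 1, ∀ x ∈ A, G t x ∈ A) {c : X} (h0 : ∀ x ∈ A, G 0 x = c)
    (h1 : ∀ x ∈ A, G 1 x = x) : SimplyConn A := by
  classical
  intro I ρ s h
  have hD : SgnOn (univ : Set A) (fun i x => ρ i x) s :=
    h.comp (f := ((↑) : A → X)) continuous_subtype_val.continuousOn fun x _ => x.2
  rcases A.eq_empty_or_nonempty with rfl | ⟨a, ha⟩
  · simp_all
  have hc : c ∈ A := h0 a ha ▸ hm 0 (by simp) a ha
  let Φ : C(unitInterval × A, A) := ⟨fun q => ⟨G q.1 q.2, hm q.1 q.1.2 q.2 q.2.2⟩, by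
    refine Continuous.subtype_mk ?_ _
    exact hG.comp_continuous (f := fun q : unitInterval × A => ((q.1 : ℝ), (q.2 : X)))
      (by fun_prop) fun q => ⟨q.1.2, q.2.2⟩⟩
  obtain ⟨e, he, hfib⟩ := exists_section_of_contraction hD Φ (c := ⟨c, hc⟩)
    (fun y => Subtype.ext (h0 y y.2))
  refine ⟨fun x => if hx : x ∈ A then e ⟨x, hx⟩ else 0, ?_, fun x hx => ?_⟩
  · rw [continuousOn_iff_continuous_domRestrict]
    convert he using 1
    ext x
    simp [domRestrict]
  · aesop

theorem _root_.StarConvex.simplyConn {E : Type*} [AddCommGroup E] [Module ℝ E] [TopologicalSpace E]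
    [ContinuousAdd E] [ContinuousSMul ℝ E] {A : Set E} {c : E} (h : StarConvex ℝ c A) :
    SimplyConn A := by
  refine simplyConn_of_contraction (fun t x => (1 - t) • c + t • x) (c := c) ?_ ?_ ?_ ?_
  · fun_prop
  · aesop
  · intro x hx; simp
  · intro x hx; simp

theorem SimplyConn.union {A B : Set X} (hA : SimplyConn A) (hB : SimplyConn B) (hAo : IsOpen A)
    (hBo : IsOpen B) (hAB : IsPreconnected (A ∩ B)) : SimplyConn (A ∪ B) := by
  classical
  intro I ρ s h
  obtain ⟨e, he, hfe⟩ := hA I ρ s (h.mono subset_union_left)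
  obtain ⟨e', he', hfe'⟩ := hB I ρ s (h.mono subset_union_right)
  suffices H : ∃ e' : X → I → ℝ, ContinuousOn e' B ∧ (∀ x ∈ B, InFib ρ s x (e' x)) ∧
      ∀ x ∈ A ∩ B, e x = e' x by
    obtain ⟨e', he', hfe', heq⟩ := H
    have h1 : ∀ x ∈ A, A.piecewise e e' x = e x := fun x hx => by simp [hx]
    have h2 : ∀ x ∈ B, A.piecewise e e' x = e' x := fun x hx => by
      by_cases hxA : x ∈ A
      · grind
      · simp [hxA]
    refine ⟨A.piecewise e e', ?_, ?_⟩
    · exact (he.congr h1).union_of_isOpen (he'.congr h2) hAo hBo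
    · grind
  rcases section_unique hAB (f := id) h (fun x hx => Or.inl hx.1) (he.mono inter_subset_left)
    (he'.mono inter_subset_right) (fun x hx => hfe x hx.1) (fun x hx => hfe' x hx.2) with h1 | h1
  · exact ⟨e', he', hfe', h1⟩
  · exact ⟨-e', he'.neg, fun x hx => (hfe' x hx).neg, h1⟩

end

section
open scoped Classical

/-- singular simplices of `X` in dimension `n` -/
abbrev SSimp (X : Type) [TopologicalSpace X] (n : ℕ) : Type :=
  (TopCat.toSSet.obj (TopCat.of X)).obj (Opposite.op (SimplexCategory.mk n))

/-- the continuous map underlying a singular simplex -/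
def SSimp.ev {X : Type} [TopologicalSpace X] {n : ℕ} (σ : SSimp X n) :
    C(stdSimplex ℝ (Fin (n + 1)), X) :=
  TopCat.toSSetObjEquiv (TopCat.of X) (Opposite.op (SimplexCategory.mk n)) σ

theorem SSimp.ev_face {X : Type} [TopologicalSpace X] {n : ℕ} (σ : SSimp X (n + 1)) (i : Fin (n + 2))
    (t : stdSimplex ℝ (Fin (n + 1))) :
    SSimp.ev (n := n) ((TopCat.toSSet.obj (TopCat.of X)).δ i σ) t
      = σ.ev (stdSimplex.map (SimplexCategory.δ i) t) := by
  rfl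

theorem exists_SSimp {X : Type} [TopologicalSpace X] {n : ℕ} (f : C(stdSimplex ℝ (Fin (n + 1)), X)) :
    ∃ σ : SSimp X n, σ.ev = f :=
  (TopCat.toSSetObjEquiv (TopCat.of X) (Opposite.op (SimplexCategory.mk n))).surjective f

theorem alternatingFaceMap_hom_apply (Y : SimplicialObject (ModuleCat (ZMod 2))) (n : ℕ)
    (x : Y.obj (Opposite.op (SimplexCategory.mk (n + 1)))) :
    (AlgebraicTopology.AlternatingFaceMapComplex.objD Y n).hom x =
      ∑ i : Fin (n + 2), (Y.δ i).hom x := by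
  rw [AlgebraicTopology.AlternatingFaceMapComplex.objD, ModuleCat.hom_sum, LinearMap.sum_apply]
  refine sum_congr rfl fun i _ => ?_
  rw [ModuleCat.hom_zsmul, LinearMap.smul_apply]
  rcases neg_one_pow_eq_or ℤ (i : ℕ) with h | h <;> rw [h]
  · rw [one_smul]
  · rw [neg_smul, one_smul, ← neg_one_smul (ZMod 2)]
    exact one_smul _ _

theorem coboundary_of_H1 {X : Type} [TopologicalSpace X] (h1 : Subsingleton (H 1 X))
    (Φ : SSimp X 1 → ZMod 2)
    (hΦ : ∀ τ : SSimp X 2, ∑ i : Fin 3, Φ ((TopCat.toSSet.obj (TopCat.of X)).δ i τ) = 0) :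
    ∃ h : SSimp X 0 → ZMod 2, ∀ σ : SSimp X 1,
      Φ σ = h ((TopCat.toSSet.obj (TopCat.of X)).δ 0 σ) +
        h ((TopCat.toSSet.obj (TopCat.of X)).δ 1 σ) := by
  let C := singularChainComplexZ2.obj (TopCat.of X)
  have hE : C.ExactAt 1 := by
    rw [HomologicalComplex.exactAt_iff_isZero_homology]
    have : Subsingleton ↑(C.homology 1) := h1
    exact ModuleCat.isZero_of_subsingleton _
  have hE' : (C.sc' 2 1 0).Exact := by
    rw [HomologicalComplex.exactAt_iff' C 2 1 0 (by simp) (by simp)] at hE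
    exact hE
  rw [ShortComplex.moduleCat_exact_iff] at hE'
  have hd : ∀ n (σ : SSimp X (n + 1)), (C.d (n + 1) n).hom (Finsupp.single σ (1 : ZMod 2)) =
      ∑ i : Fin (n + 2), Finsupp.single ((TopCat.toSSet.obj (TopCat.of X)).δ i σ) (1 : ZMod 2) := fun n σ => by
    let Y := ((SimplicialObject.whiskering Type (ModuleCat (ZMod 2))).obj
          (ModuleCat.free (ZMod 2))).obj (TopCat.toSSet.obj (TopCat.of X))
    have e1 : C.d (n + 1) n = AlgebraicTopology.AlternatingFaceMapComplex.objD Y n :=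
      AlgebraicTopology.AlternatingFaceMapComplex.obj_d_eq _ n
    rw [e1]
    refine (alternatingFaceMap_hom_apply Y n _).trans ?_
    refine sum_congr rfl fun i _ => ?_
    exact ModuleCat.free_map_apply _ _
  let F : (SSimp X 1 →₀ ZMod 2) →ₗ[ZMod 2] ZMod 2 := Finsupp.lsum (ZMod 2) fun σ => (LinearMap.id).smulRight (Φ σ)
  have hF : ∀ σ, F (Finsupp.single σ 1) = Φ σ := by intro σ; simp [F]
  let d1 : (SSimp X 1 →₀ ZMod 2) →ₗ[ZMod 2] (SSimp X 0 →₀ ZMod 2) := (C.d 1 0).hom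
  let d2 : (SSimp X 2 →₀ ZMod 2) →ₗ[ZMod 2] (SSimp X 1 →₀ ZMod 2) := (C.d 2 1).hom
  have hFd : F ∘ₗ d2 = 0 := by
    apply Finsupp.lhom_ext
    intro τ b
    have hb : Finsupp.single τ b = b • Finsupp.single τ (1 : ZMod 2) := by simp
    have h2 : d2 (Finsupp.single τ 1) = _ := hd 1 τ
    rw [hb, map_smul, LinearMap.comp_apply, h2, map_sum]
    simp only [hF]
    rw [hΦ τ]; simp
  have hker : F ∈ (ker d1).dualAnnihilator := by
    rw [Submodule.mem_dualAnnihilator]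
    intro w hw
    obtain ⟨y, hy⟩ := hE' w hw
    have hy' : d2 y = w := hy
    rw [← hy']
    exact LinearMap.congr_fun hFd y
  rw [← LinearMap.range_dualMap_eq_dualAnnihilator_ker] at hker
  obtain ⟨h, hh⟩ := hker
  refine ⟨fun p => h (Finsupp.single p 1), fun σ => ?_⟩
  have h1 : d1 (Finsupp.single σ 1) = _ := hd 0 σ
  rw [← hF, ← hh, LinearMap.dualMap_apply, h1, map_sum]
  exact Fin.sum_univ_two _

variable {X : Type} [TopologicalSpace X] {I : Type} {ρ : I → X → ℝ} {s : I → I → ℝ}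

theorem SgnOn.exists_lift_simplex (h : SgnOn univ ρ s) {n : ℕ}
    (f : C(stdSimplex ℝ (Fin (n + 1)), X)) :
    ∃ e : stdSimplex ℝ (Fin (n + 1)) → I → ℝ, Continuous e ∧ ∀ t, InFib ρ s (f t) (e t) := by
  have hc : SimplyConn (univ : Set (stdSimplex ℝ (Fin (n + 1)))) := by
    have h1 := ((convex_stdSimplex ℝ (Fin (n + 1))).starConvex
      (stdSimplex.vertex (S := ℝ) (0 : Fin (n + 1))).2).simplyConn
    refine h1.of_retract (f := fun t => if ht : t ∈ stdSimplex ℝ (Fin (n + 1)) then ⟨t, ht⟩ else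
      stdSimplex.vertex 0) (g := Subtype.val) ?_ continuous_subtype_val.continuousOn
      (fun _ _ => mem_univ _) (fun y _ => y.2) fun y _ => by simp
    rw [continuousOn_iff_continuous_domRestrict]
    convert continuous_id using 1
    ext t
    simp [domRestrict]
  obtain ⟨e, he, hf⟩ := hc I _ s (h.comp f.continuous.continuousOn (mapsTo_univ _ _))
  exact ⟨e, continuousOn_univ.1 he, fun t => hf t (mem_univ _)⟩

/-- the difference of two points of a fibre -/
def fibDiff (v w : I → ℝ) : ZMod 2 := if v = w then 0 else 1

theorem fibDiff_neg (h : SgnOn univ ρ s) {x : X} {v w : I → ℝ} (hv : InFib ρ s x v)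
    (hw : InFib ρ s x w) : fibDiff (-v) w = fibDiff v w + 1 := by
  obtain ⟨i, hi⟩ := h.cover x (mem_univ _)
  have h0 := hw.ne_zero h (mem_univ _) hi
  have hne : -w ≠ w := fun hh => by
    have := congrFun hh i
    simp only [Pi.neg_apply] at this
    exact h0 (by linarith)
  rcases hv.eq_or h (mem_univ _) hw with rfl | rfl
  · simp only [fibDiff, hne, if_true, if_false]; decide
  · rw [neg_neg]; simp only [fibDiff, hne, if_true, if_false]; decide

theorem exists_path_section (h1 : Subsingleton (H 1 X)) (h : SgnOn univ ρ s) :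
    ∃ e : X → I → ℝ, (∀ x, InFib ρ s x (e x)) ∧ ∀ γ : C(unitInterval, X), Continuous (e ∘ γ) := by
  have hb : ∀ x, ∃ v, InFib ρ s x v := fun x => by
    obtain ⟨i, hi⟩ := h.cover x (mem_univ _)
    exact ⟨_, InFib.exists h (mem_univ x) hi (Or.inl rfl)⟩
  choose e₀ he₀ using hb
  have hL : ∀ f : C(stdSimplex ℝ (Fin 2), X), ∃ e : stdSimplex ℝ (Fin 2) → I → ℝ,
    Continuous e ∧ ∀ t, InFib ρ s (f t) (e t) := fun f => h.exists_lift_simplex f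
  choose L hLc hL using hL
  let v0 : stdSimplex ℝ (Fin 2) := stdSimplex.vertex 0
  let v1 : stdSimplex ℝ (Fin 2) := stdSimplex.vertex 1
  let D : C(stdSimplex ℝ (Fin 2), X) → (stdSimplex ℝ (Fin 2) → I → ℝ) → ZMod 2 := fun f e =>
    fibDiff (e v0) (e₀ (f v0)) + fibDiff (e v1) (e₀ (f v1))
  have hconn : _root_.IsPreconnected (univ : Set (stdSimplex ℝ (Fin 2))) := isPreconnected_univ
  have hD : ∀ (f : C(stdSimplex ℝ (Fin 2), X)) (e : stdSimplex ℝ (Fin 2) → I → ℝ), Continuous e →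
      (∀ t, InFib ρ s (f t) (e t)) → D f e = D f (L f) := fun f e he hfe => by
    rcases section_unique hconn h (f := f) (mapsTo_univ _ _) he.continuousOn
      (hLc f).continuousOn (fun y _ => hfe y) (fun y _ => hL f y) with hh | hh
    · grind
    · simp only [D, hh _ (mem_univ _)]
      rw [fibDiff_neg h (hL f v0) (he₀ _), fibDiff_neg h (hL f v1) (he₀ _)]
      grind
  obtain ⟨g, hg⟩ := coboundary_of_H1 h1 (fun σ => D σ.ev (L σ.ev)) (by
    intro τ
    obtain ⟨e, hec, he⟩ := h.exists_lift_simplex τ.ev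
    have key : ∀ i : Fin 3, D (SSimp.ev (n := 1) ((TopCat.toSSet.obj (TopCat.of X)).δ i τ))
        (L (SSimp.ev (n := 1) ((TopCat.toSSet.obj (TopCat.of X)).δ i τ))) =
        fibDiff (e (stdSimplex.vertex (i.succAbove 0)))
          (e₀ (τ.ev (stdSimplex.vertex (i.succAbove 0)))) +
        fibDiff (e (stdSimplex.vertex (i.succAbove 1)))
          (e₀ (τ.ev (stdSimplex.vertex (i.succAbove 1)))) := fun i => by
      rw [← hD _ (fun t => e (stdSimplex.map (SimplexCategory.δ i) t))
        (hec.comp (stdSimplex.continuous_map _))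
        (fun t => by rw [SSimp.ev_face]; exact he _)]
      simp only [D, SSimp.ev_face, v0, v1, stdSimplex.map_vertex]
      rfl
    simp only [key, Fin.sum_univ_three]
    have : ∀ a b c : ZMod 2, a + b + (c + b) + (c + a) = 0 := by decide
    exact this _ _ _)
  have hpt : ∀ x : X, ∃ p : SSimp X 0, p.ev = ContinuousMap.const _ x := fun x => exists_SSimp _
  choose pt hpt using hpt
  have hface : ∀ (σ : SSimp X 1) (i : Fin 2), (TopCat.toSSet.obj (TopCat.of X)).δ i σ =
      pt (σ.ev (stdSimplex.vertex (i.succAbove 0))) := fun σ i => by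
    apply (TopCat.toSSetObjEquiv (TopCat.of X) (Opposite.op (SimplexCategory.mk 0))).injective
    refine Eq.trans ?_ (hpt _).symm
    ext t
    have ht : t = stdSimplex.vertex 0 :=
      @Subsingleton.elim _ (inferInstanceAs (Subsingleton (stdSimplex ℝ (Fin 1)))) _ _
    refine (SSimp.ev_face (n := 0) σ i t).trans ?_
    rw [ht, stdSimplex.map_vertex]
    rfl
  let hh : X → ZMod 2 := fun x => g (pt x)
  have hg' : ∀ f : C(stdSimplex ℝ (Fin 2), X), D f (L f) = hh (f v1) + hh (f v0) := fun f => by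
    obtain ⟨σ, rfl⟩ := exists_SSimp (n := 1) f
    rw [hg σ, hface, hface]
    rfl
  let e : X → I → ℝ := fun x => if hh x = 0 then e₀ x else -e₀ x
  refine ⟨e, fun x => ?_, fun γ => ?_⟩
  · simp only [e]
    split_ifs
    · exact he₀ x
    · exact (he₀ x).neg
  obtain ⟨l, hlc, hl⟩ := exists_section_of_contraction h
    (⟨fun q => γ (q.1 * q.2), by fun_prop⟩ : C(unitInterval × unitInterval, X)) (c := γ 0)
    (fun y => by simp)
  simp only [ContinuousMap.coe_mk, one_mul] at hl
  have key : ∀ t, fibDiff (l t) (e₀ (γ t)) + hh (γ t) = fibDiff (l 0) (e₀ (γ 0)) + hh (γ 0) := fun t => by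
    let m : stdSimplex ℝ (Fin 2) → unitInterval := fun q => ⟨q.1 1, q.2.1 1, by
      have := q.2.2
      rw [Fin.sum_univ_two] at this
      have := q.2.1 0
      linarith⟩
    have hmc : Continuous m := Continuous.subtype_mk
      ((continuous_apply (1 : Fin 2)).comp continuous_subtype_val) _
    have hm0 : m v0 = 0 := Subtype.ext (by simp [m, v0])
    have hm1 : m v1 = 1 := Subtype.ext (by simp [m, v1])
    let f : C(stdSimplex ℝ (Fin 2), X) := ⟨fun q => γ (t * m q), by fun_prop⟩
    have h3 := hD f (fun q => l (t * m q)) (by fun_prop) (fun q => hl _)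
    rw [hg' f] at h3
    simp only [D, f, ContinuousMap.coe_mk, hm0, hm1, mul_zero, mul_one] at h3
    have : ∀ a b c d : ZMod 2, a + b = c + d → b + c = a + d := by decide
    exact this _ _ _ _ h3
  have hpm : ∀ t, e (γ t) = if fibDiff (l t) (e₀ (γ t)) + hh (γ t) = 0 then l t else -l t := fun t => by
    have hz : ∀ a : ZMod 2, a = 0 ∨ a = 1 := by decide
    have h11 : (1 + 1 : ZMod 2) = 0 := by decide
    simp only [e]
    by_cases h4 : l t = e₀ (γ t)
    · simp only [fibDiff, h4, if_true, zero_add]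
    · have h5 : l t = -e₀ (γ t) := ((hl t).eq_or h (mem_univ _) (he₀ _)).resolve_left h4
      rcases hz (hh (γ t)) with h6 | h6 <;> simp [fibDiff, h4, h6, h11]
      · rw [h5, neg_neg]
      · rw [h5]
  have : e ∘ γ = fun t => if fibDiff (l 0) (e₀ (γ 0)) + hh (γ 0) = 0 then l t else -l t := by
    ext1 t
    rw [Function.comp_apply, hpm t, key t]
  rw [this]
  split_ifs
  · exact hlc
  · exact hlc.neg

end

section
open scoped Classical

variable {X Y : Type*} [TopologicalSpace X] [TopologicalSpace Y]

/-- `x` has arbitrarily small neighbourhoods whose punctured versions are connected and have no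
nontrivial sign cocycles. -/
def LocPunct (x : X) : Prop := ∀ O ∈ 𝓝 x, ∃ U ∈ 𝓝 x, U ⊆ O ∧
  _root_.IsConnected (U \ {x}) ∧ SimplyConn (U \ {x})

theorem SimplyConn.image {A : Set X} (hA : SimplyConn A) {f : X → Y} (hf : IsOpenEmbedding f) :
    SimplyConn (f '' A) := by
  rcases A.eq_empty_or_nonempty with rfl | ⟨a, ha⟩
  · rw [image_empty]
    exact fun I ρ s h => ⟨fun _ _ => 0, continuousOn_empty _, by simp⟩
  have : Nonempty X := ⟨a⟩
  refine hA.of_retract (g := invFun f) hf.continuous.continuousOn ?_ (mapsTo_image _ _) ?_ ?_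
  · rintro _ ⟨x, hx, rfl⟩
    have h1 : ContinuousAt (invFun f) (f x) := by
      rw [hf.continuousAt_iff.symm, Function.invFun_comp hf.injective]
      exact continuousAt_id
    exact h1.continuousWithinAt
  · rintro _ ⟨x, hx, rfl⟩
    rw [leftInverse_invFun hf.injective]
    exact hx
  · rintro _ ⟨x, hx, rfl⟩
    rw [leftInverse_invFun hf.injective]

theorem SimplyConn.of_image {A : Set X} {f : X → Y} (hf : IsOpenEmbedding f)
    (hA : SimplyConn (f '' A)) : SimplyConn A := by
  rcases A.eq_empty_or_nonempty with rfl | ⟨a, ha⟩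
  · exact fun I ρ s h => ⟨fun _ _ => 0, continuousOn_empty _, by simp⟩
  have : Nonempty X := ⟨a⟩
  refine hA.of_retract (f := invFun f) (g := f) ?_ hf.continuous.continuousOn ?_
    (mapsTo_image _ _) (fun y _ => leftInverse_invFun hf.injective y)
  · rintro _ ⟨x, hx, rfl⟩
    have h1 : ContinuousAt (invFun f) (f x) := by
      rw [hf.continuousAt_iff.symm, Function.invFun_comp hf.injective]
      exact continuousAt_id
    exact h1.continuousWithinAt
  · rintro _ ⟨x, hx, rfl⟩
    rw [leftInverse_invFun hf.injective]
    exact hx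

theorem LocPunct.image {x : X} (h : LocPunct x) {f : X → Y} (hf : IsOpenEmbedding f) :
    LocPunct (f x) := fun O hO => by
  obtain ⟨U, hU, hUO, hc, hs⟩ := h _ (hf.continuous.continuousAt hO)
  have e : f '' U \ {f x} = f '' (U \ {x}) := by rw [image_diff hf.injective, image_singleton]
  refine ⟨f '' U, hf.isOpenMap.image_mem_nhds hU, image_subset_iff.2 hUO, ?_, ?_⟩
  · rw [e]; exact hc.image _ hf.continuous.continuousOn
  · rw [e]; exact hs.image hf

theorem LocPunct.of_image {x : X} {f : X → Y} (hf : IsOpenEmbedding f) (h : LocPunct (f x)) :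
    LocPunct x := fun O hO => by
  obtain ⟨U, hU, hUO, hc, hs⟩ := h _ (hf.isOpenMap.image_mem_nhds hO)
  have hr : U ⊆ range f := hUO.trans (image_subset_range _ _)
  have e : f '' (f ⁻¹' U \ {x}) = U \ {f x} := by
    rw [image_diff hf.injective, image_singleton, image_preimage_eq_of_subset hr]
  refine ⟨f ⁻¹' U, hf.continuous.continuousAt hU, ?_, ?_, ?_⟩
  · intro y hy
    obtain ⟨z, hz, hzy⟩ := hUO hy
    exact hf.injective hzy ▸ hz
  · have := hc.preimage_of_isOpenMap hf.injective hf.isOpenMap (diff_subset.trans hr)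
    convert this using 1
    grind
  · rw [← e] at hs
    exact hs.of_image hf

theorem simplyConn_compl_zero {E : Type*} [NormedAddCommGroup E] [NormedSpace ℝ E]
    (hE : 2 < Module.rank ℝ E) : SimplyConn ({0}ᶜ : Set E) := by
  have : Nontrivial E := rank_pos_iff_nontrivial.1 (lt_trans (by norm_num) hE)
  obtain ⟨e, he⟩ := exists_ne (0 : E)
  let R : E → Set E := fun v => (fun t : ℝ => t • v) '' Ici 0
  have hR : ∀ v : E, v ≠ 0 → IsOpen (R v)ᶜ ∧ SimplyConn (R v)ᶜ := fun v hv => by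
    constructor
    · exact ((isClosedEmbedding_smul_left hv).isClosedMap _ isClosed_Ici).isOpen_compl
    · apply StarConvex.simplyConn (c := -v)
      rintro y hy a b ha hb hab ⟨t, ht, hty⟩
      have ht : 0 ≤ t := ht
      simp only at hty
      rcases hb.eq_or_lt with rfl | hb
      · have ha1 : a = 1 := by linarith
        rw [ha1, zero_smul, add_zero, one_smul] at hty
        have : (t + 1) • v = 0 := by rw [add_smul, one_smul, hty]; simp
        rcases smul_eq_zero.1 this with h | h
        · linarith
        · exact hv h
      · refine hy ⟨b⁻¹ * (t + a), by simp only [mem_Ici]; positivity, ?_⟩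
        have h2 : b • y = (t + a) • v := by rw [add_smul, hty]; simp
        simp only
        rw [mul_smul, ← h2, inv_smul_smul₀ hb.ne']
  have hU := (hR e he).2.union (hR (-e) (neg_ne_zero.2 he)).2 (hR e he).1
    (hR (-e) (neg_ne_zero.2 he)).1 (by
      have e1 : (R e)ᶜ ∩ (R (-e))ᶜ = ((span ℝ {e} : Submodule ℝ E) : Set E)ᶜ := by
        rw [← compl_union]
        congr 1
        ext y
        simp only [R, mem_union, mem_image, mem_Ici, SetLike.mem_coe, Submodule.mem_span_singleton]
        constructor
        · rintro (⟨t, ht, rfl⟩ | ⟨t, ht, rfl⟩)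
          · exact ⟨t, rfl⟩
          · exact ⟨-t, by simp⟩
        · rintro ⟨t, rfl⟩
          rcases le_total 0 t with h | h
          · exact Or.inl ⟨t, h, rfl⟩
          · exact Or.inr ⟨-t, by linarith, by simp⟩
      rw [e1]
      refine (isConnected_compl_of_one_lt_codim ?_).isPreconnected
      have h1 : Module.rank ℝ (span ℝ {e} : Submodule ℝ E) ≤ 1 := by
        simpa using rank_span_le (R := ℝ) ({e} : Set E)
      have h2 := Submodule.rank_quotient_add_rank (span ℝ {e} : Submodule ℝ E)
      by_contra! hcon
      have h3 := add_le_add hcon h1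
      rw [h2] at h3
      exact absurd (lt_of_lt_of_le hE h3) (by norm_num))
  convert hU using 1
  ext y
  simp only [R, mem_compl_iff, mem_singleton_iff, mem_union, mem_image, mem_Ici, not_exists, not_and]
  constructor
  · intro hy
    by_contra! hcon
    obtain ⟨⟨t, ht, hty⟩, t', ht', hty'⟩ := hcon
    have : (t + t') • e = 0 := by rw [add_smul, hty, ← hty']; simp
    rcases smul_eq_zero.1 this with h | h
    · have : t = 0 := by linarith
      rw [this, zero_smul] at hty
      exact hy hty.symm
    · exact he h
  · aesop

theorem locPunct_r3 (x : R3) : LocPunct x := fun O hO => by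
  obtain ⟨r, hr, hO⟩ := Metric.mem_nhds_iff.1 hO
  let f := OpenPartialHomeomorph.univBall x r
  have hf : IsOpenEmbedding f := f.to_isOpenEmbedding (by simp [f])
  have hrk : Module.rank ℝ R3 = 3 := by rw [rank_eq_card_basis (EuclideanSpace.basisFun (Fin 3) ℝ).toBasis]; simp
  have h0 : f 0 = x := OpenPartialHomeomorph.univBall_apply_zero x r
  have himg : f '' univ = ball x r := by
    have := f.image_source_eq_target
    rw [OpenPartialHomeomorph.univBall_target x hr] at this
    simpa [f] using this
  have e : ball x r \ {x} = f '' {0}ᶜ := by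
    rw [compl_eq_univ_diff, image_diff hf.injective, image_singleton, h0, himg]
  refine ⟨ball x r, ball_mem_nhds x hr, hO, ?_, ?_⟩
  · rw [e]
    exact (isConnected_compl_singleton_of_one_lt_rank (by aesop) 0).image _
      hf.continuous.continuousOn
  · rw [e]
    exact (simplyConn_compl_zero (by rw [hrk]; norm_num)).image hf

theorem locPunct_halfSpace (q : HalfSpace3) : LocPunct q := by
  rcases (show 0 ≤ q.1 2 from q.2).eq_or_lt with h0 | h0
  · intro O hO
    rw [nhds_subtype_eq_comap] at hO
    obtain ⟨O', hO', hOO⟩ := hO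
    obtain ⟨r, hr, hO'⟩ := Metric.mem_nhds_iff.1 hO'
    let c : R3 := q.1 + EuclideanSpace.single 2 (r / 2)
    let B : Set R3 := (ball q.1 r ∩ HalfSpace3) \ {q.1}
    have hc2 : c 2 = r / 2 := by aesop
    have hHS : Convex ℝ HalfSpace3 := fun x hx y hy a b ha hb hab => by
      have hx : 0 ≤ x 2 := hx
      have hy : 0 ≤ y 2 := hy
      show 0 ≤ (a • x + b • y) 2
      simp; positivity
    have hcB : c ∈ ball q.1 r ∩ HalfSpace3 := by
      refine ⟨?_, ?_⟩
      · simp [c, abs_of_pos hr]; linarith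
      · show 0 ≤ c 2
        rw [hc2]; positivity
    have hstar : StarConvex ℝ c B := by
      rintro y ⟨hy, hyq⟩ a b ha hb hab
      refine ⟨((convex_ball q.1 r).inter hHS) hcB hy ha hb hab, ?_⟩
      intro hh
      have h2 : (a • c + b • y) 2 = q.1 2 := by rw [hh]
      rw [← h0] at h2
      have hy2 : 0 ≤ y 2 := hy.2
      simp [hc2] at h2
      have h3 := mul_nonneg hb hy2
      have h4 : 0 ≤ a * (r / 2) := by positivity
      have h5 : a * (r / 2) = 0 := by linarith
      have ha0 : a = 0 := by grind
      have hb1 : b = 1 := by linarith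
      rw [ha0, hb1] at hh
      simp at hh
      exact hyq hh
    have hcB' : c ∈ B := ⟨hcB, fun h => by
      have : c 2 = q.1 2 := by rw [h]
      rw [hc2, ← h0] at this; linarith⟩
    have e : Subtype.val '' ((Subtype.val ⁻¹' ball q.1 r : Set HalfSpace3) \ {q}) = B := by aesop
    refine ⟨Subtype.val ⁻¹' ball q.1 r, continuous_subtype_val.continuousAt
      (ball_mem_nhds _ hr), fun y hy => hOO (hO' hy), ?_, ?_⟩
    · have h1 : _root_.IsConnected B := (hstar.isPathConnected hcB').isConnected
      rw [← e] at h1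
      refine ⟨h1.nonempty.of_image, ?_⟩
      exact (IsInducing.subtypeVal.isPreconnected_image).1 h1.isPreconnected
    · refine hstar.simplyConn.of_retract (f := fun z => if hz : z ∈ HalfSpace3 then ⟨z, hz⟩ else q)
        (g := Subtype.val) ?_ continuous_subtype_val.continuousOn ?_ ?_ ?_
      · rw [continuousOn_iff_continuous_domRestrict]
        have : Continuous (fun z : B => (⟨z.1, z.2.1.2⟩ : HalfSpace3)) := by fun_prop
        convert this using 1
        ext z : 1
        simp [domRestrict, z.2.1.2]
      · rintro z hz
        rw [← e] at hz
        obtain ⟨w, hw, rfl⟩ := hz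
        simpa using hw
      · rintro z hz
        rw [← e]
        exact mem_image_of_mem _ hz
      · intro z hz
        simp
  · let U : Set HalfSpace3 := {x | 0 < x.1 2}
    have hcont : Continuous fun x : R3 => x 2 := by fun_prop
    have hU : IsOpen U := isOpen_lt continuous_const (hcont.comp continuous_subtype_val)
    have h1 : IsOpenEmbedding (fun u : U => (u.1.1 : R3)) := by
      refine ⟨(IsEmbedding.subtypeVal.comp IsEmbedding.subtypeVal), ?_⟩
      have : range (fun u : U => (u.1.1 : R3)) = {x | 0 < x 2} := by
        ext x
        constructor
        · aesop
        · intro hx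
          exact ⟨⟨⟨x, show 0 ≤ x 2 from le_of_lt hx⟩, hx⟩, rfl⟩
      rw [this]
      exact isOpen_lt continuous_const hcont
    have h2 : LocPunct (⟨q, h0⟩ : U) := LocPunct.of_image h1 (locPunct_r3 _)
    exact h2.image hU.isOpenEmbedding_subtypeVal

theorem locPunct_manifold {N : Set R3} (hN : IsManifold3WithBoundary N) (p : N) : LocPunct p := by
  obtain ⟨V, hV, hp, W, hW, ⟨e⟩⟩ := hN p
  have h1 : LocPunct (e ⟨p, hp⟩ : W) := LocPunct.of_image hW.isOpenEmbedding_subtypeVal (locPunct_halfSpace _)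
  have h2 : LocPunct (⟨p, hp⟩ : V) := LocPunct.of_image e.isOpenEmbedding h1
  exact h2.image hV.isOpenEmbedding_subtypeVal

theorem locPunct_interior {W : Set R3} (p : W) (hp : p.1 ∈ interior W) : LocPunct p := by
  let U : Set W := Subtype.val ⁻¹' interior W
  have hU : IsOpen U := isOpen_interior.preimage continuous_subtype_val
  have h1 : IsOpenEmbedding (fun u : U => (u.1.1 : R3)) := by
    refine ⟨(IsEmbedding.subtypeVal.comp IsEmbedding.subtypeVal), ?_⟩
    have : range (fun u : U => (u.1.1 : R3)) = interior W := by
      ext x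
      constructor
      · aesop
      · intro hx
        exact ⟨⟨⟨x, interior_subset hx⟩, hx⟩, rfl⟩
    rw [this]
    exact isOpen_interior
  have h2 : LocPunct (⟨p, hp⟩ : U) := LocPunct.of_image h1 (locPunct_r3 _)
  exact h2.image hU.isOpenEmbedding_subtypeVal

end

section
open scoped Classical

variable {X Y : Type*} [TopologicalSpace X] [TopologicalSpace Y]

/-- Every sign cocycle over the set has a section continuous along paths. -/
def PathSimply (A : Set X) : Prop := ∀ (I : Type) (ρ : I → X → ℝ) (s : I → I → ℝ), SgnOn A ρ s →
  ∃ e : X → I → ℝ, (∀ x ∈ A, InFib ρ s x (e x)) ∧ ∀ γ : ℝ → X, ContinuousOn γ (Icc 0 1) →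
    MapsTo γ (Icc 0 1) A → ContinuousOn (e ∘ γ) (Icc 0 1)

theorem SimplyConn.pathSimply {A : Set X} (h : SimplyConn A) : PathSimply A := fun I ρ s hs => by
  obtain ⟨e, he, hf⟩ := h I ρ s hs
  exact ⟨e, hf, fun γ hγ hm => he.comp hγ hm⟩

theorem pathSimply_of_H1 {X : Type} [TopologicalSpace X] {A : Set X}
    (h1 : Subsingleton (H 1 ↥A)) : PathSimply A := fun I ρ s hs => by
  have hD : SgnOn (univ : Set A) (fun i x => ρ i x) s :=
    hs.comp (f := ((↑) : A → X)) continuous_subtype_val.continuousOn fun x _ => x.2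
  obtain ⟨e, he, hγ⟩ := exists_path_section h1 hD
  refine ⟨fun x => if hx : x ∈ A then e ⟨x, hx⟩ else 0, fun x hx => ?_, fun γ hc hm => ?_⟩
  · aesop
  · let γ' : C(unitInterval, A) := ⟨fun t => ⟨γ t, hm t.2⟩,
      Continuous.subtype_mk (continuousOn_iff_continuous_domRestrict.1 hc) _⟩
    rw [continuousOn_iff_continuous_domRestrict]
    convert hγ γ' using 1
    ext1 t
    simp only [domRestrict, Function.comp_apply, γ']
    rw [dif_pos (hm t.2)]
    rfl

theorem PathSimply.of_retract {A : Set X} {B : Set Y} (hA : PathSimply A) {f : X → Y} {g : Y → X}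
    (hf : ContinuousOn f A) (hg : ContinuousOn g B) (hfm : MapsTo f A B) (hgm : MapsTo g B A)
    (hfg : ∀ y ∈ B, f (g y) = y) : PathSimply B := fun I ρ s h => by
  obtain ⟨e, hfib, he⟩ := hA I _ s (h.comp hf hfm)
  refine ⟨e ∘ g, fun y hy i j => ?_, fun γ hγ hm => ?_⟩
  · have := hfib (g y) (hgm hy) i j
    simpa [hfg y hy] using this
  · exact he (g ∘ γ) (hg.comp hγ hm) (hgm.comp hm)

end

section
open scoped Classical

variable {V : Type} [Fintype V] [DecidableEq V] {K : Set (Finset V)} {σ : Finset V}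

theorem single_mem_realiz_nonneg (w v : V) : 0 ≤ (single w 1 : V → ℝ) v := by grind

theorem single_mem_realiz {v : V} (hv : v ∈ verts K) :
    (single v 1 : V → ℝ) ∈ realiz K := by
  refine ⟨fun w => ?_, by simp, ?_⟩
  · grind
  · have : vsupp (single v 1 : V → ℝ) = {v} := by
      ext w
      by_cases h : w = v
      · subst h; simp
      · simp [h]
    rw [this]
    exact mem_verts.1 hv

theorem verts_nonempty_of_realiz (hK : IsLowerSet K)
    (h : (realiz K).Nonempty) : (verts K).Nonempty := by
  obtain ⟨x, hx⟩ := h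
  obtain ⟨v, hv⟩ : ∃ v, x v ≠ 0 := by
    by_contra! hcon
    have := hx.2.1
    simp [hcon] at this
  exact ⟨v, mem_verts_of_mem hK hx.2.2 (mem_vsupp.2 hv)⟩

theorem conn_of_realiz (hK : IsLowerSet K)
    (h : _root_.IsPreconnected (realiz K)) : Conn K (verts K) := fun A hA hne hne' => by
  by_contra! hcon
  obtain ⟨a, ha⟩ := hne
  obtain ⟨b, hb, hbA⟩ : ∃ b ∈ verts K, b ∉ A := by grind
  have hf : Continuous fun x : V → ℝ => ∑ v ∈ A, x v := by fun_prop
  have h01 : ∀ x ∈ realiz K, ∑ v ∈ A, x v = 0 ∨ ∑ v ∈ A, x v = 1 := fun x hx => by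
    by_cases hd : ∃ c ∈ A, x c ≠ 0
    · obtain ⟨c, hc, hxc⟩ := hd
      right
      rw [← hx.2.1]
      refine sum_subset (Finset.subset_univ _) fun d _ hd => ?_
      by_contra hxd
      have hdK := mem_verts_of_mem hK hx.2.2 (mem_vsupp.2 hxd)
      refine hcon c hc d hdK hd (hK ?_ hx.2.2)
      intro z hz
      simp only [Finset.mem_insert, Finset.mem_singleton] at hz
      rcases hz with rfl | rfl <;> simpa
    · simp_all
  have himg := h.image _ hf.continuousOn
  have h1 : (1 : ℝ) ∈ (fun x : V → ℝ => ∑ v ∈ A, x v) '' realiz K := by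
    refine ⟨_, single_mem_realiz (hA ha), ?_⟩
    simp [sum_pi_single', ha]
  have h0 : (0 : ℝ) ∈ (fun x : V → ℝ => ∑ v ∈ A, x v) '' realiz K := by
    refine ⟨_, single_mem_realiz hb, ?_⟩
    simp [sum_pi_single', hbA]
  obtain ⟨x, hx, hx2⟩ := himg.Icc_subset h0 h1 (show (1 / 2 : ℝ) ∈ Icc 0 1 by norm_num)
  grind

theorem b1_of_pathSimply (hK : IsLowerSet K) (h : PathSimply (realiz K)) :
    B1 K := fun φ hsym hcoc => by
  have hz : ∀ a : ZMod 2, a = 0 ∨ a = 1 := by decide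
  let σ : ZMod 2 → ℝ := fun a => if a = 0 then 1 else -1
  have hσ : ∀ a b, σ a * σ b = σ (a + b) := fun a b => by
    rcases hz a with rfl | rfl <;> rcases hz b with rfl | rfl <;>
      simp [σ, show (1 + 1 : ZMod 2) = 0 by decide]
  have hσi : ∀ a b, 0 < σ a * σ b → a = b := fun a b => by
    rcases hz a with rfl | rfl <;> rcases hz b with rfl | rfl <;> simp [σ]
  obtain ⟨e, he, hγ⟩ := h V (fun v x => x v) (fun a b => σ (φ a b)) {
    cont := fun i => by fun_prop
    nonneg := fun i x hx => hx.1 i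
    cover := fun x hx => by
      by_contra! hcon
      have : ∑ v, x v ≤ 0 := Finset.sum_nonpos fun i _ => hcon i
      rw [hx.2.1] at this
      linarith
    sgn := fun i j => by rcases hz (φ i j) with h | h <;> simp [σ, h]
    coc := fun x hx i j k hi hj hk => by
      rw [hσ, hcoc]
      refine hK ?_ hx.2.2
      intro z hz
      simp only [Finset.mem_insert, Finset.mem_singleton] at hz
      rcases hz with rfl | rfl | rfl <;> rw [mem_vsupp] <;> positivity }
  have hdiag : ∀ a ∈ verts K, φ a a = 0 := by grind [lk, res, mem_verts, IsLowerSet]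
  refine ⟨fun v => if 0 < e (single v 1) v then 0 else 1, fun a b hab => ?_⟩
  have ha : a ∈ verts K := mem_verts_of_mem hK hab (by simp)
  have hb : b ∈ verts K := mem_verts_of_mem hK hab (by simp)
  let m : V → ℝ := (1 / 2 : ℝ) • single a 1 + (1 / 2 : ℝ) • single b 1
  have hpath : ∀ c ∈ ({a, b} : Finset V), 0 < e (single c 1) c ↔ 0 < e m c := fun c hc => by
    let γ : ℝ → V → ℝ := fun t => (1 - t) • single c 1 + t • m
    have hmc : 1 / 2 ≤ m c := by
      simp only [Finset.mem_insert, Finset.mem_singleton] at hc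
      by_cases hab' : a = b
      · subst hab'
        have : c = a := by grind
        subst this
        simp [m]
      · rcases hc with rfl | rfl
        · simp [m, hab']
        · simp [m, Ne.symm hab']
    have hcK : c ∈ verts K := mem_verts_of_mem hK hab hc
    have hmem : MapsTo γ (Icc 0 1) (realiz K) := by
      rintro t ⟨ht0, ht1⟩
      refine ⟨fun v => ?_, ?_, ?_⟩
      · have h1 : ∀ w : V, 0 ≤ (single w 1 : V → ℝ) v := fun w => (single_mem_realiz_nonneg w v)
        have := h1 a
        have := h1 b
        have := h1 c
        simp only [γ, m, Pi.add_apply, Pi.smul_apply, smul_eq_mul]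
        have : 0 ≤ 1 - t := by linarith
        positivity
      · simp only [γ, m, Pi.add_apply, Pi.smul_apply, smul_eq_mul, sum_add_distrib,
          ← mul_sum, sum_pi_single', Finset.mem_univ, if_true]
        norm_num
      · refine hK ?_ hab
        intro z hz
        rw [mem_vsupp] at hz
        by_contra hz'
        simp only [Finset.mem_insert, Finset.mem_singleton, not_or] at hz' hc
        refine hz ?_
        rcases hc with rfl | rfl <;> simp [γ, m, hz'.1, hz'.2]
    have hpos : ∀ t ∈ Icc (0 : ℝ) 1, 0 < γ t c := by
      rintro t ⟨ht0, ht1⟩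
      simp only [γ, Pi.add_apply, Pi.smul_apply, smul_eq_mul, Pi.single_eq_same]
      nlinarith
    have hne : ∀ t ∈ Icc (0 : ℝ) 1, e (γ t) c ≠ 0 := fun t ht h0 => by
      have h2 := he _ (hmem ht) c c
      have h3 := hpos t ht
      simp only at h2
      rw [h0, hdiag c hcK] at h2
      simp [σ] at h2
      exact h3.ne' h2
    have hcont : ContinuousOn (fun t => e (γ t) c) (Icc 0 1) :=
      (continuous_apply c).comp_continuousOn (hγ γ (by fun_prop) hmem)
    have hg0 : γ 0 = single c 1 := by simp [γ]
    have hg1 : γ 1 = m := by simp [γ]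
    have key : ∀ f : ℝ → ℝ, ContinuousOn f (Icc 0 1) → (∀ t ∈ Icc (0 : ℝ) 1, f t ≠ 0) → 0 < f 0 →
        0 < f 1 := fun f hf hfn hf0 => by
      by_contra! hcon
      obtain ⟨t, ht, ht0⟩ := intermediate_value_Icc' (by norm_num : (0 : ℝ) ≤ 1) hf ⟨hcon, hf0.le⟩
      exact hfn t ht ht0
    rw [← hg0, ← hg1]
    constructor
    · exact key _ hcont hne
    · intro h1
      by_contra h0
      have h0' : e (γ 0) c < 0 := lt_of_le_of_ne (not_lt.1 h0) (hne 0 (by simp))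
      have := key (fun t => -e (γ t) c) hcont.neg (fun t ht => neg_ne_zero.2 (hne t ht)) (by linarith)
      linarith
  have hm1 : 0 < m a := by
    simp only [m, Pi.add_apply, Pi.smul_apply, smul_eq_mul, Pi.single_eq_same]
    have := single_mem_realiz_nonneg b a
    positivity
  have hm2 : 0 < m b := by
    simp only [m, Pi.add_apply, Pi.smul_apply, smul_eq_mul, Pi.single_eq_same]
    have := single_mem_realiz_nonneg a b
    positivity
  have hmK : m ∈ realiz K := by
    refine ⟨fun v => ?_, ?_, ?_⟩
    · have := single_mem_realiz_nonneg a v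
      have := single_mem_realiz_nonneg b v
      simp only [m, Pi.add_apply, Pi.smul_apply, smul_eq_mul]
      positivity
    · simp only [m, Pi.add_apply, Pi.smul_apply, smul_eq_mul, sum_add_distrib,
          ← mul_sum, sum_pi_single', Finset.mem_univ, if_true]
      norm_num
    · refine hK ?_ hab
      intro z hz
      rw [mem_vsupp] at hz
      by_contra hz'
      simp only [Finset.mem_insert, Finset.mem_singleton, not_or] at hz'
      exact hz (by simp [m, hz'.1, hz'.2])
  have hfin := he m hmK a b
  simp only at hfin
  simp only [hpath a (by simp), hpath b (by simp)]
  have hq : 0 < m a * m b := by positivity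
  rw [mul_assoc] at hfin
  rcases hz (φ a b) with h | h <;> simp only [h, σ, if_true, if_false, one_ne_zero] at hfin ⊢
  · by_cases h1 : 0 < e m a <;> by_cases h2 : 0 < e m b <;> simp [h1, h2]
    · nlinarith
    · nlinarith
    · decide
  · by_cases h1 : 0 < e m a <;> by_cases h2 : 0 < e m b <;> simp [h1, h2]
    · nlinarith
    · nlinarith

/-- The link of the barycentre of `σ` in the stellar subdivision at `σ`. -/
def lkb (K : Set (Finset V)) (σ : Finset V) : Set (Finset V) := {τ | σ ∪ τ ∈ K ∧ ¬ σ ⊆ τ}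

theorem isLowerSet_lkb (hK : IsLowerSet K) (σ : Finset V) :
    IsLowerSet (lkb K σ) := fun a b hba ha =>
  ⟨hK (Finset.union_subset_union_right hba) ha.1, fun h => ha.2 (h.trans hba)⟩

theorem lkb_singleton (v : V) : lkb K {v} = lk K v := by
  ext τ
  simp only [lkb, lk, mem_setOf_eq, Finset.singleton_subset_iff, and_comm]
  rw [← Finset.insert_eq]

/-- barycentre of a face -/
def bary (σ : Finset V) : V → ℝ := fun v => if v ∈ σ then (σ.card : ℝ)⁻¹ else 0

theorem vsupp_bary (hσ : σ.Nonempty) : vsupp (bary σ) = σ := by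
  have : (σ.card : ℝ) ≠ 0 := by aesop
  ext v
  by_cases h : v ∈ σ <;> simp [bary, h, this]

theorem bary_mem (hσ : σ ∈ K) (hne : σ.Nonempty) :
    bary σ ∈ realiz K := by
  have : (σ.card : ℝ) ≠ 0 := by aesop
  refine ⟨fun v => ?_, ?_, by rwa [vsupp_bary hne]⟩
  · unfold bary
    split_ifs <;> positivity
  · simp only [bary, sum_ite_mem, Finset.univ_inter, sum_const, nsmul_eq_mul]
    field_simp

theorem link_lemma (hK : IsLowerSet K) (hσ : σ ∈ K)
    (hne : σ.Nonempty) (hp : LocPunct (⟨bary σ, bary_mem hσ hne⟩ : realiz K)) :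
    _root_.IsConnected (realiz (lkb K σ)) ∧ SimplyConn (realiz (lkb K σ)) := by
  have hcard : 0 < (σ.card : ℝ) := by simp_all
  set p : realiz K := ⟨bary σ, bary_mem hσ hne⟩ with hpdef
  let ρ : (V → ℝ) → V → ℝ := fun x i => if i ∈ σ then x i - σ.inf' hne x else x i
  have hρc : Continuous ρ := by
    refine continuous_pi fun i => ?_
    have h1 : Continuous fun x : V → ℝ => σ.inf' hne x :=
      Continuous.finset_inf'_apply hne fun i _ => continuous_apply i
    by_cases hi : i ∈ σ <;> simp only [ρ, hi, if_true, if_false]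
    · fun_prop
    · exact continuous_apply i
  let O : Set (realiz K) := {x | ∀ i ∈ σ, 0 < x.1 i}
  have hO : O ∈ 𝓝 p := by
    have : IsOpen O := by
      have : O = ⋂ i ∈ σ, {x : realiz K | 0 < x.1 i} := by ext; simp [O]
      rw [this]
      refine isOpen_biInter_finset fun i _ => isOpen_lt continuous_const ?_
      exact (continuous_apply i).comp continuous_subtype_val
    refine this.mem_nhds fun i hi => ?_
    simp [hpdef, bary, hi, hcard]
  have hρ0 : ∀ x : realiz K, ∀ i, 0 ≤ ρ x.1 i := fun x i => by
    by_cases hi : i ∈ σ <;> simp only [ρ, hi, if_true, if_false]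
    · aesop
    · exact x.2.1 i
  have hpos : ∀ x ∈ O \ {p}, 0 < ∑ i, ρ x.1 i := by
    rintro x ⟨hx, hxp⟩
    refine lt_of_le_of_ne (sum_nonneg fun i _ => hρ0 x i) fun h0 => hxp ?_
    have h1 := (sum_eq_zero_iff_of_nonneg fun i _ => hρ0 x i).1 h0.symm
    have h2 : ∀ i, x.1 i = if i ∈ σ then σ.inf' hne x.1 else 0 := by grind
    have h3 := x.2.2.1
    rw [sum_congr rfl fun i _ => h2 i] at h3
    simp only [sum_ite_mem, Finset.univ_inter, sum_const, nsmul_eq_mul] at h3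
    apply Subtype.ext
    ext i
    rw [h2 i]
    simp only [hpdef, bary]
    rw [eq_inv_of_mul_eq_one_right h3]
  have hO2 : ∀ x ∈ O \ {p}, (∑ i, ρ x.1 i)⁻¹ • ρ x.1 ∈ realiz (lkb K σ) := fun x hx => by
    have hs := hpos x hx
    refine ⟨fun i => mul_nonneg (inv_nonneg.2 hs.le) (hρ0 x i), ?_, ?_, ?_⟩
    · simp only [Pi.smul_apply, smul_eq_mul, ← mul_sum]
      exact inv_mul_cancel₀ hs.ne'
    · refine hK ?_ x.2.2.2
      intro i hi
      rw [Finset.mem_union] at hi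
      by_cases hiσ : i ∈ σ
      · exact mem_vsupp.2 (hx.1 i hiσ).ne'
      · have := hi.resolve_left hiσ
        rw [mem_vsupp] at this ⊢
        intro h0
        apply this
        simp [ρ, hiσ, h0]
    · intro hsub
      obtain ⟨j, hj, hj2⟩ := Finset.exists_mem_eq_inf' hne x.1
      have := hsub hj
      rw [mem_vsupp] at this
      apply this
      simp [ρ, hj, hj2]
  obtain ⟨U, hU, hUO, hc, hs⟩ := hp O hO
  have hU' := hU
  rw [nhds_subtype_eq_comap] at hU'
  obtain ⟨U', hU'1, hU'2⟩ := hU'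
  obtain ⟨δ, hδ, hball⟩ := Metric.mem_nhds_iff.1 hU'1
  let ε : ℝ := min (δ / 2) (1 / 2)
  have hε : 0 < ε := by positivity
  have hε1 : ε ≤ 1 / 2 := min_le_right _ _
  have hεδ : ε < δ := lt_of_le_of_lt (min_le_left _ _) (by linarith)
  let g : (V → ℝ) → V → ℝ := fun y => (1 - ε) • bary σ + ε • y
  have hgρ : ∀ y ∈ realiz (lkb K σ), ρ (g y) = ε • y := fun y hy => by
    obtain ⟨j, hjσ, hj⟩ : ∃ j ∈ σ, y j = 0 := by
      by_contra! hcon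
      exact hy.2.2.2 fun i hi => mem_vsupp.2 (hcon i hi)
    have hinf : σ.inf' hne (g y) = (1 - ε) * (σ.card : ℝ)⁻¹ := by
      apply le_antisymm
      · refine (Finset.inf'_le _ hjσ).trans ?_
        simp [g, bary, hjσ, hj]
      · refine Finset.le_inf' _ _ fun i hi => ?_
        have := hy.1 i
        simp only [g, bary, hi, Pi.add_apply, Pi.smul_apply, smul_eq_mul, if_true]
        nlinarith
    ext i
    by_cases hi : i ∈ σ
    · simp only [ρ, hi, if_true, hinf]
      simp [g, bary, hi]
    · simp [ρ, g, bary, hi]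
  have hgK : ∀ y ∈ realiz (lkb K σ), g y ∈ realiz K := fun y hy => by
    have hb := bary_mem hσ hne
    refine ⟨fun i => ?_, ?_, hK ?_ hy.2.2.1⟩
    · have := hy.1 i
      have := hb.1 i
      have : 0 ≤ 1 - ε := by linarith
      simp only [g, Pi.add_apply, Pi.smul_apply, smul_eq_mul]
      positivity
    · simp only [g, Pi.add_apply, Pi.smul_apply, smul_eq_mul, sum_add_distrib,
        ← mul_sum, hb.2.1, hy.2.1]
      ring
    · intro i hi
      rw [mem_vsupp] at hi
      rw [Finset.mem_union]
      by_contra! hcon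
      rw [mem_vsupp, not_not] at hcon
      exact hi (by simp [g, bary, hcon.1, hcon.2])
  have hgU : ∀ y (hy : y ∈ realiz (lkb K σ)), (⟨g y, hgK y hy⟩ : realiz K) ∈ U \ {p} := fun y hy => by
    constructor
    · apply hU'2
      apply hball
      rw [Metric.mem_ball]
      refine lt_of_le_of_lt ?_ hεδ
      rw [dist_pi_le_iff hε.le]
      intro i
      have h1 := le_one_of_sum hy.1 hy.2.1 i
      have h2 := le_one_of_sum (bary_mem hσ hne).1 (bary_mem hσ hne).2.1 i
      have h3 := hy.1 i
      have h4 := (bary_mem hσ hne).1 i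
      rw [Real.dist_eq]
      have : g y i - bary σ i = ε * (y i - bary σ i) := by
        simp only [g, Pi.add_apply, Pi.smul_apply, smul_eq_mul]; ring
      rw [this, abs_mul, abs_of_pos hε]
      have : |y i - bary σ i| ≤ 1 := abs_le.2 ⟨by linarith, by linarith⟩
      nlinarith
    · intro h
      have h1 : g y = bary σ := congrArg Subtype.val h
      have h2 := hgρ y hy
      have h3 : ρ (bary σ) = 0 := by
        ext i
        by_cases hi : i ∈ σ
        · have : σ.inf' hne (bary σ) = (σ.card : ℝ)⁻¹ := by
            rw [Finset.inf'_congr hne rfl (g := fun _ => (σ.card : ℝ)⁻¹)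
              (fun x hx => by simp [bary, hx])]
            simp
          simp only [ρ, hi, if_true, this]
          simp [bary, hi]
        · simp [ρ, bary, hi]
      rw [h1, h3] at h2
      have h4 : y = 0 := by
        rcases smul_eq_zero.1 h2.symm with h | h
        · exact absurd h hε.ne'
        · exact h
      have := hy.2.1
      rw [h4] at this
      simp at this
  let f : realiz K → V → ℝ := fun x => (∑ i, ρ x.1 i)⁻¹ • ρ x.1
  have hUO' : U \ {p} ⊆ O \ {p} := diff_subset_diff_left hUO
  have hfc : ContinuousOn f (U \ {p}) := by
    have h1 : Continuous fun x : realiz K => ρ x.1 := hρc.comp continuous_subtype_val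
    refine ContinuousOn.smul (ContinuousOn.inv₀ ?_ fun x hx => (hpos x (hUO' hx)).ne')
      h1.continuousOn
    exact (continuous_finset_sum _ fun i _ => (continuous_apply i).comp h1).continuousOn
  have hfg : ∀ y (hy : y ∈ realiz (lkb K σ)), f ⟨g y, hgK y hy⟩ = y := fun y hy => by
    simp only [f]
    rw [hgρ y hy]
    simp only [Pi.smul_apply, smul_eq_mul, ← mul_sum, hy.2.1, mul_one]
    exact inv_smul_smul₀ hε.ne' y
  constructor
  · convert hc.image f hfc using 1
    apply Subset.antisymm
    · grind
    · rintro _ ⟨x, hx, rfl⟩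
      exact hO2 x (hUO' hx)
  · refine hs.of_retract (g := fun y => if hy : y ∈ realiz (lkb K σ) then ⟨g y, hgK y hy⟩ else p)
      hfc ?_ (fun x hx => hO2 x (hUO' hx)) ?_ ?_
    · rw [continuousOn_iff_continuous_domRestrict]
      have h1 : Continuous fun y : realiz (lkb K σ) => (⟨g y.1, hgK y.1 y.2⟩ : realiz K) := by fun_prop
      convert h1 using 1
      ext1 y
      simp only [domRestrict, y.2, dif_pos]
    · intro y hy
      simp only [hy, dif_pos]
      exact hgU y hy
    · intro y hy
      simp only [hy, dif_pos]
      exact hfg y hy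

end

section
open scoped Classical

variable {V : Type} [Fintype V] [DecidableEq V] {K : Set (Finset V)} {σ : Finset V}

/-- The barycentre of the face `σ` is a locally simply punctured point of the realization. -/
def LocFace (K : Set (Finset V)) (σ : Finset V) : Prop :=
  ∀ (h : σ ∈ K) (hne : σ.Nonempty), LocPunct (⟨bary σ, bary_mem h hne⟩ : realiz K)

theorem LocFace.props (hK : IsLowerSet K) (h : LocFace K σ)
    (hσ : σ ∈ K) (hne : σ.Nonempty) :
    (verts (lkb K σ)).Nonempty ∧ Conn (lkb K σ) (verts (lkb K σ)) ∧ B1 (lkb K σ) := by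
  obtain ⟨h1, h2⟩ := link_lemma hK hσ hne (h hσ hne)
  have hl := isLowerSet_lkb hK σ
  exact ⟨verts_nonempty_of_realiz hl h1.nonempty, conn_of_realiz hl h1.isPreconnected,
    b1_of_pathSimply hl h2.pathSimply⟩

theorem LocFace.vertex (hK : IsLowerSet K) {v : V} (h : LocFace K {v})
    (hv : v ∈ verts K) :
    (verts (lk K v)).Nonempty ∧ Conn (lk K v) (verts (lk K v)) ∧ B1 (lk K v) := by
  have := h.props hK (mem_verts.1 hv) (Finset.singleton_nonempty v)
  rwa [lkb_singleton] at this

theorem LocFace.edge (hK : IsLowerSet K) {u v : V} (huv : u ≠ v)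
    (h : LocFace K {u, v}) (hσ : {u, v} ∈ K) :
    (verts (lk (lk K u) v)).Nonempty ∧ Conn (lk (lk K u) v) (verts (lk (lk K u) v)) := by
  obtain ⟨hne, hc, hb⟩ := h.props hK hσ ⟨u, by simp⟩
  set E := lk (lk K u) v with hE
  have hEmem : ∀ w, w ∈ verts E ↔ w ≠ u ∧ w ≠ v ∧ {u, v, w} ∈ K := by grind [lk, res, mem_verts, IsLowerSet]
  have huL : u ∈ verts (lkb K {u, v}) := by
    rw [mem_verts]
    refine ⟨hK (by grind) hσ, fun hh => ?_⟩
    grind [lk, res, mem_verts, IsLowerSet]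
  have hvL : v ∈ verts (lkb K {u, v}) := by
    rw [mem_verts]
    refine ⟨hK (by simp) hσ, fun hh => ?_⟩
    grind
  have hLmem : ∀ w ∈ verts (lkb K {u, v}), w ≠ u → w ≠ v → w ∈ verts E := fun w hw h1 h2 => by
    exact (hEmem w).2 ⟨h1, h2, hK (by simp) (mem_verts.1 hw).1⟩
  have huvL : {u, v} ∉ lkb K {u, v} := fun hh => hh.2 subset_rfl
  constructor
  · by_contra hcon
    rw [Finset.not_nonempty_iff_eq_empty] at hcon
    obtain ⟨a, ha, b, hb', hba, hab⟩ := hc {u} (by grind) (by simp) (fun hh => by grind)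
    grind
  · intro A hA hAne hAne'
    by_contra! hcon
    obtain ⟨a, ha⟩ := hAne
    obtain ⟨b, hb', hbA⟩ : ∃ b ∈ verts E, b ∉ A := by grind
    let f : V → ZMod 2 := fun x => if x ∈ A then 1 else 0
    have hadj : ∀ x y, x ∈ verts E → y ∈ verts E → {x, y} ∈ lkb K {u, v} → f x = f y := fun x y hx hy hxy => by
      have hxy' : {x, y} ∈ E := by
        obtain ⟨h1, h2, -⟩ := (hEmem x).1 hx
        obtain ⟨h3, h4, -⟩ := (hEmem y).1 hy
        refine ⟨?_, ?_, ?_⟩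
        · simp [h2.symm, h4.symm]
        · grind
        · exact hK (by grind) hxy.1
      by_cases h1 : x ∈ A <;> by_cases h2 : y ∈ A <;> simp only [f, h1, h2, if_true, if_false]
      · grind
      · rw [Finset.pair_comm] at hxy'
        exact absurd hxy' (hcon y h2 x hx h1)
    have hvA : v ∉ A := fun h => ((hEmem v).1 (hA h)).2.1 rfl
    have huA : u ∉ A := fun h => ((hEmem u).1 (hA h)).1 rfl
    have hlow := isLowerSet_lkb hK {u, v}
    obtain ⟨ψ, hψ⟩ := hb (fun x y => if x = v ∨ y = v then 0 else f x + f y) (by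
      intro x y
      simp only [or_comm, add_comm]) (by
      intro x y z hxyz
      by_cases hv3 : x = v ∨ y = v ∨ z = v
      · have hu3 : ∀ w, w ∈ ({x, y, z} : Finset V) → w ≠ u := by
          rintro w hw rfl
          refine hxyz.2 ?_
          intro t ht
          simp only [Finset.mem_insert, Finset.mem_singleton] at ht hw ⊢
          rcases ht with rfl | rfl
          · exact hw
          · tauto
        have hall : ∀ p q, p ∈ ({x, y, z} : Finset V) → q ∈ ({x, y, z} : Finset V) →
            (if p = v ∨ q = v then (0 : ZMod 2) else f p + f q) = 0 := fun p q hp hq => by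
          split_ifs with hpq
          · rfl
          · push Not at hpq
            have hp' := hLmem p (mem_verts_of_mem hlow hxyz hp) (hu3 p hp) hpq.1
            have hq' := hLmem q (mem_verts_of_mem hlow hxyz hq) (hu3 q hq) hpq.2
            rw [hadj p q hp' hq' (hlow (by
              intro t ht
              simp only [Finset.mem_insert, Finset.mem_singleton] at ht
              rcases ht with rfl | rfl <;> assumption) hxyz)]
            exact add_self_eq_zero _
        rw [hall x y (by simp) (by simp), hall y z (by simp) (by simp), hall x z (by simp) (by simp)]
        rfl
      · grind)
    have hjoin : ∀ w ∈ verts E, {w, u} ∈ lkb K {u, v} ∧ {w, v} ∈ lkb K {u, v} := fun w hw => by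
      obtain ⟨h1, h2, h3⟩ := (hEmem w).1 hw
      refine ⟨⟨hK (by intro z; simp; tauto) h3, fun hh => ?_⟩, ⟨hK (by intro z; simp; tauto) h3, fun hh => ?_⟩⟩
      · grind [lk, res, mem_verts, IsLowerSet]
      · have := hh (show u ∈ ({u, v} : Finset V) by simp)
        simp [h1.symm, huv] at this
    grind

theorem LocFace.triangle (hK : IsLowerSet K) (hcard : σ.card = 3)
    (h : LocFace K σ) (hσ : σ ∈ K) : ∃ z, z ∉ σ ∧ insert z σ ∈ K := by
  by_contra! hcon
  obtain ⟨u, v, w, huv, huw, hvw, rfl⟩ := card_eq_three.1 hcard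
  obtain ⟨hne, hc, hb⟩ := h.props hK hσ ⟨u, by simp⟩
  have hsub : ∀ τ ∈ lkb K {u, v, w}, τ ⊆ {u, v, w} := by
    intro τ hτ z hz
    by_contra hz'
    refine hcon z hz' (hK ?_ hτ.1)
    grind
  have hmem : ∀ p q, p ∈ ({u, v, w} : Finset V) → q ∈ ({u, v, w} : Finset V) →
      {p, q} ∈ lkb K {u, v, w} := fun p q hp hq => by
    refine ⟨?_, fun hh => ?_⟩
    · grind
    · have := Finset.card_le_card hh
      grind
  obtain ⟨ψ, hψ⟩ := hb (fun x y => if (x = u ∧ y = v) ∨ (x = v ∧ y = u) then 1 else 0) (by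
    intro x y
    congr 1
    apply propext
    tauto) (by
    intro x y z hxyz
    have hs := hsub _ hxyz
    have hdeg : x = y ∨ y = z ∨ x = z := by
      by_contra! hd
      have hc3 : ({x, y, z} : Finset V).card = 3 := card_eq_three.2 ⟨x, y, z, hd.1, hd.2.2, hd.2.1, rfl⟩
      exact hxyz.2 (Finset.eq_of_subset_of_card_le hs (by grind)).symm.subset
    have hself : ∀ t, ¬ ((t = u ∧ t = v) ∨ (t = v ∧ t = u)) := by grind
    rcases hdeg with rfl | rfl | rfl
    · simp_all
    · simp_all
    · rw [if_neg (hself x)]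
      have hcm : ((y = u ∧ x = v) ∨ (y = v ∧ x = u)) ↔ ((x = u ∧ y = v) ∨ (x = v ∧ y = u)) := by tauto
      simp only [hcm]
      exact add_self_eq_zero _)
  grind

end

section
open scoped Classical
variable {V : Type} [Fintype V] [DecidableEq V] {K L : Set (Finset V)} {v : V}

/-- The combinatorial structure of a triangulated convex body (`K`) together with a full subcomplex
spanned by `T` which is a `3`-manifold; `Z` is the set of boundary vertices of the latter. -/
structure Trig (K : Set (Finset V)) (T Z : Finset V) : Prop where
  lower : IsLowerSet K
  dim : ∀ σ ∈ K, σ.card ≤ 4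
  conn : Conn K (verts K)
  b1 : B1 K
  subT : T ⊆ verts K
  subZ : Z ⊆ T
  noPM : ∀ a ∈ T, a ∉ Z → ∀ b, b ∉ T → {a, b} ∉ K
  zneg : ∀ σ ∈ K, σ.Nonempty → σ ⊆ Z → ∃ b, b ∉ T ∧ insert b σ ∈ K
  kv : ∀ v ∈ T, (verts (lk K v)).Nonempty ∧ Conn (lk K v) (verts (lk K v)) ∧ B1 (lk K v)
  ke : ∀ u ∈ T, ∀ v, u ≠ v → {u, v} ∈ K →
    (verts (lk (lk K u) v)).Nonempty ∧ Conn (lk (lk K u) v) (verts (lk (lk K u) v))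
  kt : ∀ σ ∈ K, σ.card = 3 → (∃ u ∈ σ, u ∈ T) →
    (Finset.univ.filter fun z => z ∉ σ ∧ insert z σ ∈ K).card = 2
  ne : T.Nonempty
  connT : Conn K T
  b1T : B1 (res K T)
  nv : ∀ v ∈ T, (verts (lk (res K T) v)).Nonempty ∧
    Conn (lk (res K T) v) (verts (lk (res K T) v)) ∧ B1 (lk (res K T) v)
  nee : ∀ u v, u ≠ v → {u, v} ∈ res K T → (verts (lk (lk (res K T) u) v)).Nonempty ∧
    Conn (lk (lk (res K T) u) v) (verts (lk (lk (res K T) u) v))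
  nt : ∀ σ ∈ res K T, σ.card = 3 → ∃ z, z ∉ σ ∧ insert z σ ∈ res K T

theorem conn_of_res {P Q : Finset V} (h : Conn (res L Q) P) : Conn L P := fun A hA hne hne' => by
  obtain ⟨a, ha, b, hb, hb', hab⟩ := h A hA hne hne'
  exact ⟨a, ha, b, hb, hb', hab.1⟩

theorem verts_lk3 {u v w : V} (huv : u ≠ v) (hw : w ∉ ({u, v} : Finset V)) :
    verts (lk (lk (lk K u) v) w) =
      Finset.univ.filter fun z => z ∉ ({w, v, u} : Finset V) ∧ insert z {w, v, u} ∈ K := by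
  ext z
  simp only [mem_verts, lk, mem_setOf_eq, mem_filter_univ,
    Finset.mem_insert, Finset.mem_singleton, not_or] at hw ⊢
  have e : (insert u (insert v (insert w {z})) : Finset V) = insert z {w, v, u} := by ext y; simp; tauto
  grind

/-- The colouring attached to a pair of vertex sets. -/
def zcol (T Z : Finset V) (v : V) : ℝ := if v ∈ Z then 0 else if v ∈ T then 1 else -1

theorem zcol_tern (T Z : Finset V) : Tern (zcol T Z) := by intro v; unfold zcol; split_ifs <;> simp

variable {T Z : Finset V}

theorem zcol_zero : zcol T Z v = 0 ↔ v ∈ Z := by unfold zcol; split_ifs <;> simp_all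

theorem zcol_pos : 0 < zcol T Z v ↔ v ∈ T ∧ v ∉ Z := by unfold zcol; split_ifs <;> simp_all

namespace Trig
variable (h : Trig K T Z)
include h

theorem zcol_neg : zcol T Z v < 0 ↔ v ∉ T := by
  have := @h.subZ v
  unfold zcol; split_ifs <;> simp_all

theorem zcol_nonneg : 0 ≤ zcol T Z v ↔ v ∈ T := by rw [← not_lt, h.zcol_neg, not_not]

theorem nnv_eq (L : Set (Finset V)) {g' : V → ℝ} (hg : Flip (zcol T Z) g') :
    nnv L g' = verts L ∩ T := by
  ext v
  rw [nnv, mem_filter, hg.nonneg_iff, h.zcol_nonneg, Finset.mem_inter]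

theorem pair_edge {u v w : V} (hu : u ∈ T) (huv : u ≠ v) (hw : w ∈ verts (lk (lk K u) v)) :
    IsPair (lk (lk (lk K u) v) w) := by
  have hwe := mem_verts.1 hw
  simp only [lk, mem_setOf_eq, Finset.mem_singleton, Finset.mem_insert, not_or] at hwe
  obtain ⟨h1, ⟨h2, h3⟩, h4⟩ := hwe
  have hwuv : w ∉ ({u, v} : Finset V) := by grind
  refine ⟨isLowerSet_lk (isLowerSet_lk (isLowerSet_lk h.lower u) v) w, ?_, ?_⟩
  · rintro σ ⟨g1, g2, g3, g4⟩
    have := h.dim _ g4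
    grind
  · rw [verts_lk3 huv hwuv]
    refine h.kt _ ?_ ?_ ⟨u, by simp, hu⟩
    · have e : ({w, v, u} : Finset V) = insert u (insert v {w}) := by ext; simp; tauto
      rw [e]; exact h4
    · grind

theorem circ {u v : V} (hu : u ∈ T) (hv : v ∈ verts (lk K u)) : IsCirc (lk (lk K u) v) := by
  obtain ⟨h1, h2⟩ := mem_verts_lk.1 hv
  obtain ⟨h3, h4⟩ := h.ke u hu v h1.symm h2
  exact ⟨isLowerSet_lk (isLowerSet_lk h.lower u) v, h4, h3, fun w hw => h.pair_edge hu h1.symm hw⟩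

theorem surf {u : V} (hu : u ∈ T) : IsSurf (lk K u) :=
  ⟨isLowerSet_lk h.lower u, (h.kv u hu).2.1, (h.kv u hu).1, fun v hv => h.circ hu hv⟩

theorem chi_surf {u : V} (hu : u ∈ T) : chi (lk K u) = 2 := (h.surf hu).chi_eq_two (h.kv u hu).2.2

/-- A triangle all of whose vertices are zeros has exactly one positive and one negative neighbour. -/
theorem zero_tri {σ : Finset V} (hσ : σ ∈ K) (h3 : σ.card = 3) (hZ : σ ⊆ Z) :
    ∃ a b, a ∈ T ∧ a ∉ Z ∧ b ∉ T ∧ (Finset.univ.filter fun z => z ∉ σ ∧ insert z σ ∈ K) = {a, b} := by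
  obtain ⟨v, hv⟩ : σ.Nonempty := by rw [← Finset.card_pos]; omega
  obtain ⟨a, ha, hab⟩ := h.nt σ ⟨hσ, hZ.trans h.subZ⟩ h3
  obtain ⟨b, hb, hbb⟩ := h.zneg σ hσ ⟨v, hv⟩ hZ
  have haT : a ∈ T := hab.2 (mem_insert_self _ _)
  have haZ : a ∉ Z := fun haZ => by
    obtain ⟨b, hb, hbb⟩ := h.zneg (insert a σ) hab.1 ⟨a, by simp⟩ (by
      intro x hx; rcases Finset.mem_insert.1 hx with rfl | hx; exacts [haZ, hZ hx])
    have := h.dim _ hbb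
    grind [lk, res, mem_verts, IsLowerSet]
  refine ⟨a, b, haT, haZ, hb, ?_⟩
  symm
  refine Finset.eq_of_subset_of_card_le ?_ ?_
  · grind [lk, res, mem_verts, IsLowerSet]
  · rw [h.kt σ hσ h3 ⟨v, hv, h.subZ (hZ hv)⟩, card_pair]
    rintro rfl; exact hb haT

theorem pair_zero {u v w : V} (hu : u ∈ Z) (hv : v ∈ Z) (hw : w ∈ Z) (huv : u ≠ v)
    (hm : w ∈ verts (lk (lk K u) v)) :
    ∃ a b, a ∈ T ∧ a ∉ Z ∧ b ∉ T ∧ verts (lk (lk (lk K u) v) w) = {a, b} := by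
  have hwe := mem_verts.1 hm
  simp only [lk, mem_setOf_eq, Finset.mem_singleton, Finset.mem_insert, not_or] at hwe
  obtain ⟨h1, ⟨h2, h3⟩, h4⟩ := hwe
  rw [verts_lk3 huv (by grind)]
  refine h.zero_tri ?_ ?_ ?_
  · have e : ({w, v, u} : Finset V) = insert u (insert v {w}) := by ext; simp; tauto
    rw [e]; exact h4
  · grind
  · grind

theorem edge_neg {u v : V} (hu : u ∈ Z) (hv : v ∈ Z) (huv : {u, v} ∈ K) (hne : u ≠ v) :
    ∃ b ∈ verts (lk (lk K u) v), b ∉ T := by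
  obtain ⟨b, hb, hbb⟩ := h.zneg _ huv ⟨u, by simp⟩
    (by intro x hx; simp at hx; rcases hx with rfl | rfl <;> assumption)
  refine ⟨b, ?_, hb⟩
  rw [mem_verts]
  have hbu : b ≠ u := by rintro rfl; exact hb (h.subZ hu)
  have hbv : b ≠ v := by rintro rfl; exact hb (h.subZ hv)
  refine ⟨by grind, by grind, ?_⟩
  have e : (insert u (insert v {b}) : Finset V) = insert b {u, v} := by grind
  rw [e]; exact hbb

theorem lk2_res {u v : V} (hu : u ∈ T) (hv : v ∈ T) :
    lk (lk (res K T) u) v = res (lk (lk K u) v) T := by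
  rw [lk_res hu, lk_res hv]

theorem conn_edge {u v : V} (hu : u ∈ T) (hv : v ∈ T) (huv : {u, v} ∈ K) (hne : u ≠ v) :
    (verts (lk (lk K u) v) ∩ T).Nonempty ∧
      Conn (lk (lk K u) v) (verts (lk (lk K u) v) ∩ T) := by
  have H := h.nee u v hne ⟨huv, by intro x hx; simp at hx; rcases hx with rfl | rfl <;> assumption⟩
  rw [h.lk2_res hu hv, verts_res] at H
  exact ⟨H.1, conn_of_res H.2⟩

theorem signPair_edge {u v : V} (hu : u ∈ Z) (hv : v ∈ Z) (huv : {u, v} ∈ K) (hne : u ≠ v)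
    {g' : V → ℝ} (hg : Flip (zcol T Z) g') :
    SignPair (fstL 1 ℝ ℝ ℝ) (lk (lk K u) v) g' := by
  have hC := h.circ (h.subZ hu) (mem_verts_lk.2 ⟨hne.symm, huv⟩)
  obtain ⟨h1, h2⟩ := h.conn_edge (h.subZ hu) (h.subZ hv) huv hne
  obtain ⟨b, hb, hbT⟩ := h.edge_neg hu hv huv hne
  have hbM : b ∈ verts (lk (lk K u) v) \ (verts (lk (lk K u) v) ∩ T) := by grind
  refine hC.signPair (hg.tern (zcol_tern T Z)) ?_ ?_ ?_ ?_ ?_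
  · rwa [h.nnv_eq _ hg]
  · rw [h.nnv_eq _ hg]; exact ⟨b, hbM⟩
  · rwa [h.nnv_eq _ hg]
  · rw [h.nnv_eq _ hg]
    refine hC.conn_of_edges Finset.sdiff_subset (fun he => ?_) ?_
    · grind
    · have e1 := hC.edges_sdiff (P := verts (lk (lk K u) v) ∩ T) Finset.inter_subset_left
      have e2 := hC.edges_lt (A := verts (lk (lk K u) v) ∩ T) Finset.inter_subset_left h1
        (fun he => hbT (Finset.mem_inter.1 (he.symm ▸ hb)).2)
      have e3 := chi_le (isLowerSet_res hC.lower (verts (lk (lk K u) v) ∩ T))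
        (by rwa [verts_res, ← Finset.inter_assoc, Finset.inter_self]) (conn_res Finset.inter_subset_left h2)
      have e4 : z2 (res (lk (lk K u) v) (verts (lk (lk K u) v) ∩ T)) = 0 := by
        refine z2_eq_zero (isLowerSet_res hC.lower _) fun c hc => ?_
        ext τ
        by_contra hτ
        have := hc.1 τ hτ
        have := hC.dim this.1.1
        omega
      have e5 : ∀ k, 2 < k → fc (res (lk (lk K u) v) (verts (lk (lk K u) v) ∩ T)) k = 0 :=
        fun k hk => fc_eq_zero (fun σ hσ => hC.dim hσ.1) hk
      rw [chi, e4, e5 3 (by norm_num), e5 4 (by norm_num), fc_one, verts_res, ← Finset.inter_assoc,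
        Finset.inter_self] at e3
      push_cast at e3
      omega
  · intro w hw hw0
    have hwZ : w ∈ Z := by
      rw [← zcol_zero (T := T)]
      rcases hg w with h' | h'
      · rw [← h', hw0]
      · exact h'.1
    obtain ⟨a, b, ha, haZ, hb, he⟩ := h.pair_zero hu hv hwZ hne hw
    rw [he]
    refine ⟨⟨a, by simp, ?_⟩, b, by simp, ?_⟩
    · rcases hg a with h' | h'
      · rw [h']; exact zcol_pos.2 ⟨ha, haZ⟩
      · rw [h'.2]; norm_num
    · rcases hg b with h' | h'
      · rw [h']; exact h.zcol_neg.2 hb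
      · have := h.zcol_neg.2 hb; linarith [h'.1]

theorem link_zero (hv : v ∈ Z) : (verts (lk K v) ∩ T).Nonempty ∧
    (verts (lk K v) \ (verts (lk K v) ∩ T)).Nonempty ∧ Conn (lk K v) (verts (lk K v) ∩ T) ∧
    B1 (res (lk K v) (verts (lk K v) ∩ T)) ∧
    Conn (lk K v) (verts (lk K v) \ (verts (lk K v) ∩ T)) := by
  obtain ⟨h1, h2, h3⟩ := h.nv v (h.subZ hv)
  rw [lk_res (h.subZ hv), verts_res] at h1 h2
  rw [lk_res (h.subZ hv)] at h3
  rw [← res_inter_verts (isLowerSet_lk h.lower v), Finset.inter_comm] at h3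
  obtain ⟨b, hb, hbb⟩ := h.zneg {v} (by rw [← mem_verts]; exact h.subT (h.subZ hv)) (by simp)
    (by grind)
  have hbM : b ∈ verts (lk K v) \ (verts (lk K v) ∩ T) := by
    simp only [Finset.mem_sdiff, Finset.mem_inter, hb, and_false, not_false_eq_true, and_true, mem_verts_lk]
    refine ⟨?_, by rwa [Finset.pair_comm]⟩
    rintro rfl; exact hb (h.subZ hv)
  exact ⟨h1, ⟨b, hbM⟩, conn_of_res h2, h3,
    (h.surf (h.subZ hv)).conn_compl (h.chi_surf (h.subZ hv)) Finset.inter_subset_left h1 ⟨b, hbM⟩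
      (conn_of_res h2) h3⟩

theorem signPair_vertex (hv : v ∈ Z) {g' : V → ℝ} (hg : Flip (zcol T Z) g') :
    SignPair (fstL 1 ℝ ℝ E2) (lk K v) g' := by
  obtain ⟨h1, h2, h3, h4, h5⟩ := h.link_zero hv
  refine (h.surf (h.subZ hv)).signPair (h.chi_surf (h.subZ hv)) (hg.tern (zcol_tern T Z)) ?_ ?_ ?_ ?_ ?_
  · rwa [h.nnv_eq _ hg]
  · rwa [h.nnv_eq _ hg]
  · rwa [h.nnv_eq _ hg]
  · rwa [h.nnv_eq _ hg]
  · intro w hw hw0 g'' hg''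
    obtain ⟨e1, e2⟩ := mem_verts_lk.1 hw
    refine h.signPair_edge hv ?_ e2 e1.symm (hg.trans hg'')
    rw [← zcol_zero (T := T)]
    rcases hg w with h' | h'
    · rw [← h', hw0]
    · exact h'.1

end Trig

/-- The zero set of a sign pair is an equator. -/
theorem SignPair.zeros {E : Type} [NormedAddCommGroup E] [NormedSpace ℝ E] {z : E →L[ℝ] ℝ}
    {g : V → ℝ} (h : SignPair z L g) {Z : Finset V}
    (hZ : ∀ v ∈ verts L, g v = 0 ↔ v ∈ Z) (hno : ∀ a b, 0 < g a → g b < 0 → {a, b} ∉ L)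
    (hL : IsLowerSet L) :
    ∃ e, HomeoOn e (realiz (res L Z)) (sphere 0 1 ∩ {y | z y = 0}) := by
  obtain ⟨e, he, hs⟩ := h
  have key : ∀ x ∈ realiz L, x ∈ realiz (res L Z) ↔ evCol g x = 0 := by
    rintro x ⟨h0, h1, h2⟩
    constructor
    · rintro ⟨-, -, h3⟩
      refine sum_eq_zero fun v _ => ?_
      by_cases hv : v ∈ vsupp x
      · rw [(hZ v (mem_verts_of_mem hL h2 hv)).2 (h3.2 hv), mul_zero]
      · simp_all
    · intro h3
      refine ⟨h0, h1, h2, fun v hv => ?_⟩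
      rw [← hZ v (mem_verts_of_mem hL h2 hv)]
      have hpair : ∀ a ∈ vsupp x, ∀ b ∈ vsupp x, 0 < g a → g b < 0 → False := fun a ha b hb hga hgb =>
        hno a b hga hgb (hL (by intro x hx; simp at hx; rcases hx with rfl | rfl <;> assumption) h2)
      have hxv : ∀ v, v ∈ vsupp x → 0 < x v := fun v hv => lt_of_le_of_ne (h0 v) (Ne.symm (mem_vsupp.1 hv))
      have hz : ∀ v, v ∉ vsupp x → x v = 0 := fun v hv => not_not.1 (mt mem_vsupp.2 hv)
      rcases lt_trichotomy (g v) 0 with hgv | hgv | hgv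
      · exfalso
        have : evCol g x < 0 := by
          refine sum_neg' (fun w _ => ?_) ⟨v, Finset.mem_univ _, mul_neg_of_pos_of_neg (hxv v hv) hgv⟩
          by_cases hw : w ∈ vsupp x
          · exact mul_nonpos_of_nonneg_of_nonpos (h0 w) (not_lt.1 fun hgw => hpair w hw v hv hgw hgv)
          · rw [hz w hw, zero_mul]
        linarith
      · exact hgv
      · exfalso
        have : 0 < evCol g x := by
          refine sum_pos' (fun w _ => ?_) ⟨v, Finset.mem_univ _, mul_pos (hxv v hv) hgv⟩
          by_cases hw : w ∈ vsupp x
          · exact mul_nonneg (h0 w) (not_lt.1 fun hgw => hpair v hv w hw hgv hgw)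
          · rw [hz w hw, zero_mul]
        linarith
  refine ⟨e, he.restrict ?_ inter_subset_left ?_⟩
  · rintro x ⟨h0, h1, h2⟩; exact ⟨h0, h1, h2.1⟩
  · intro x hx
    rw [key x hx]
    have h1 := hs x hx
    have h2 : e x ∈ sphere (0 : E) 1 := he.bij.mapsTo hx
    simp only [mem_inter_iff, h2, true_and, mem_setOf_eq]
    rw [← sign_eq_zero_iff, h1, sign_eq_zero_iff]

end

section
open scoped Classical
variable {V : Type} [Fintype V] [DecidableEq V] {L : Set (Finset V)} {v : V}

theorem HomeoOn.isPreconnected {A B : Type*} [TopologicalSpace A] [TopologicalSpace B] [T2Space A] [T2Space B] [Nonempty A]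
    {f : A → B}
    {X : Set A} {Y : Set B} (hX : IsCompact X) (h : HomeoOn f X Y) (hY : _root_.IsPreconnected Y) :
    _root_.IsPreconnected X := by
  obtain ⟨g, hg, -⟩ := HomeoOn.exists_symm hX h
  rw [← hg.bij.image_eq]
  exact hY.image g hg.cont

theorem ncard_equator2 : (sphere (0 : WithLp 1 (ℝ × ℝ)) 1 ∩
    {y | fstL 1 ℝ ℝ ℝ y = 0}).ncard = 2 := by
  have : sphere (0 : WithLp 1 (ℝ × ℝ)) 1 ∩ {y | fstL 1 ℝ ℝ ℝ y = 0} =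
      {toLp 1 (0, 1), toLp 1 (0, -1)} := by
    ext ⟨⟨a, b⟩⟩
    simp only [mem_inter_iff, mem_sphere_iff_norm, sub_zero, WithLp.prod_norm_eq_of_L1, mem_setOf_eq,
      mem_insert_iff, mem_singleton_iff]
    constructor
    · rintro ⟨h1, h2⟩
      have h2 : a = 0 := h2
      subst h2
      have h1 : |(0 : ℝ)| + |b| = 1 := h1
      grind
    · aesop
  rw [this, ncard_pair]
  grind

theorem conn_equator3 : IsConnected (sphere (0 : E3) 1 ∩ {y | fstL 1 ℝ ℝ E2 y = 0}) := by
  have h2 : (1 : Cardinal) < Module.rank ℝ E2 := by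
    rw [← Module.finrank_eq_rank', (linearEquiv 1 ℝ (ℝ × ℝ)).finrank_eq]
    simp
  have h1 := isConnected_sphere h2 (0 : E2) zero_le_one
  have h3 : Continuous fun y : E2 => (toLp 1 ((0 : ℝ), y) : E3) :=
    (WithLp.prod_continuous_toLp 1 ℝ E2).comp (by fun_prop)
  convert h1.image _ h3.continuousOn using 1
  ext ⟨⟨a, b⟩⟩
  simp only [mem_inter_iff, mem_sphere_iff_norm, sub_zero, WithLp.prod_norm_eq_of_L1, mem_setOf_eq, mem_image]
  constructor
  · aesop
  · simp_all

theorem ncard_realiz_of_dim (hL : IsLowerSet L) (hd : ∀ σ ∈ L, σ.card ≤ 1) :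
    (realiz L).ncard = (verts L).card := by
  have : realiz L = (fun v => (single v 1 : V → ℝ)) '' (verts L : Set V) := by
    ext x
    constructor
    · rintro ⟨h0, h1, h2⟩
      have hne : (vsupp x).Nonempty := by
        by_contra hcon
        rw [Finset.not_nonempty_iff_eq_empty] at hcon
        have : ∀ v, x v = 0 := fun v => not_not.1 (mt mem_vsupp.2 (by grind))
        simp [this] at h1
      obtain ⟨v, hv⟩ := hne
      have hz : ∀ w, w ≠ v → x w = 0 := fun w hw => by
        by_contra hx
        exact hw (Finset.card_le_one.1 (hd _ h2) w (mem_vsupp.2 hx) v hv)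
      refine ⟨v, mem_verts_of_mem hL h2 hv, ?_⟩
      funext w
      by_cases hw : w = v
      · subst hw
        rw [sum_eq_single w (fun b _ hb => hz b hb) (by simp)] at h1
        simp [h1]
      · simp [hw, hz w hw]
    · rintro ⟨v, hv, rfl⟩
      exact single_mem_realiz hv
  rw [this, ncard_image_of_injective, ncard_coe_finset]
  intro a b hab
  by_contra hne
  have := congrFun hab a
  simp [hne] at this

namespace Trig
variable {K : Set (Finset V)} {T Z : Finset V} (h : Trig K T Z)
include h

theorem no_edge (L : Set (Finset V)) (hL : ∀ a b, {a, b} ∈ L → {a, b} ∈ K) :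
    ∀ a b, 0 < zcol T Z a → zcol T Z b < 0 → {a, b} ∉ L := fun a b ha hb hab => by
  obtain ⟨h1, h2⟩ := zcol_pos.1 ha
  exact h.noPM a h1 h2 b (h.zcol_neg.1 hb) (hL a b hab)

theorem no_zero_tet {σ : Finset V} (hσ : σ ∈ K) (hZ : σ ⊆ Z) : σ.card ≤ 3 := by
  rcases σ.eq_empty_or_nonempty with rfl | hne
  · simp
  obtain ⟨b, hb, hbb⟩ := h.zneg σ hσ hne hZ
  have := h.dim _ hbb
  rw [Finset.card_insert_of_notMem fun hb' => hb (h.subZ (hZ hb'))] at this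
  omega

theorem zero_pair {u v : V} (hu : u ∈ Z) (hv : v ∈ Z) (huv : {u, v} ∈ K) (hne : u ≠ v) :
    IsPair (res (lk (lk K u) v) Z) := by
  have hlow := isLowerSet_lk (isLowerSet_lk h.lower u) v
  have hdim : ∀ σ ∈ res (lk (lk K u) v) Z, σ.card ≤ 1 := by
    rintro σ ⟨⟨h1, h2, h3⟩, h4⟩
    have := h.no_zero_tet h3 (by
      intro x hx
      grind)
    grind
  refine ⟨isLowerSet_res hlow Z, hdim, ?_⟩
  obtain ⟨e, he⟩ := (h.signPair_edge hu hv huv hne (Flip.refl _)).zeros (Z := Z)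
    (fun v _ => zcol_zero) (h.no_edge _ fun a b hab => h.lower (fun x hx => by simp [hx]) hab.2.2) hlow
  rw [← ncard_realiz_of_dim (isLowerSet_res hlow Z) hdim, ← ncard_equator2, ← he.bij.image_eq,
    ncard_image_of_injOn he.bij.injOn]

theorem zero_circ (hv : v ∈ Z) : IsCirc (res (lk K v) Z) := by
  have hlow := isLowerSet_lk h.lower v
  obtain ⟨e, he⟩ := (h.signPair_vertex hv (Flip.refl _)).zeros (Z := Z)
    (fun v _ => zcol_zero) (h.no_edge _ fun a b hab => h.lower (fun x hx => by simp [hx]) hab.2) hlow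
  have hr := isLowerSet_res hlow Z
  refine ⟨hr, ?_, ?_, ?_⟩
  · exact conn_of_realiz hr (he.isPreconnected (isCompact_realiz hr) conn_equator3.isPreconnected)
  · obtain ⟨y, hy⟩ := conn_equator3.nonempty
    rw [← he.bij.image_eq] at hy
    obtain ⟨x, hx, -⟩ := hy
    exact verts_nonempty_of_realiz hr ⟨x, hx⟩
  · intro w hw
    rw [verts_res, Finset.mem_inter, mem_verts_lk] at hw
    rw [lk_res hw.2]
    exact h.zero_pair hv hw.2 hw.1.2 hw.1.1.symm

theorem zero_surf {S : Finset V} (hS : S ⊆ Z) (hne : S.Nonempty) (hc : Conn K S)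
    (hcl : ∀ a ∈ S, ∀ b ∈ Z, b ∉ S → {a, b} ∉ K) : IsSurf (res K S) := by
  have hSV := hS.trans (h.subZ.trans h.subT)
  have hv : verts (res K S) = S := by rw [verts_res, Finset.inter_eq_right.2 hSV]
  refine ⟨isLowerSet_res h.lower S, conn_res hSV hc, by rwa [hv], fun v hvS => ?_⟩
  rw [hv] at hvS
  rw [lk_res hvS]
  have : res (lk K v) S = res (lk K v) Z := by
    ext σ
    refine ⟨fun hσ => ⟨hσ.1, hσ.2.trans hS⟩, fun hσ => ⟨hσ.1, fun x hx => ?_⟩⟩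
    by_contra hxS
    refine hcl v hvS x (hσ.2 hx) hxS (h.lower ?_ hσ.1.2)
    grind
  rw [this]
  exact h.zero_circ (hS hvS)

end Trig

/-- The connected component of `v` in the graph spanned by `Q`. -/
def cl (L : Set (Finset V)) (Q : Finset V) (v : V) : Finset V :=
  Q.filter fun w => Relation.ReflTransGen (fun a b => b ∈ Q ∧ {a, b} ∈ L) v w

section
variable {Q : Finset V}

theorem cl_sub (v : V) : cl L Q v ⊆ Q := filter_subset _ _

theorem mem_cl_self (hv : v ∈ Q) : v ∈ cl L Q v := mem_filter.2 ⟨hv, Relation.ReflTransGen.refl⟩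

theorem cl_closed {v a b : V} (ha : a ∈ cl L Q v) (hb : b ∈ Q) (hab : {a, b} ∈ L) : b ∈ cl L Q v :=
  mem_filter.2 ⟨hb, (mem_filter.1 ha).2.tail ⟨hb, hab⟩⟩

theorem cl_min {A : Finset V} (hv : v ∈ A) (hA : ∀ a ∈ A, ∀ b ∈ Q, {a, b} ∈ L → b ∈ A) :
    cl L Q v ⊆ A := fun w hw => by
  have := (mem_filter.1 hw).2
  clear hw
  induction this with
  | refl => exact hv
  | tail h1 h2 ih => exact hA _ ih _ h2.1 h2.2

theorem conn_cl (hv : v ∈ Q) : Conn L (cl L Q v) := by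
  have key : ∀ A ⊆ cl L Q v, v ∈ A → A ≠ cl L Q v → ∃ a ∈ A, ∃ b ∈ cl L Q v, b ∉ A ∧ {a, b} ∈ L := fun A hA hvA hne => by
    by_contra! hcon
    refine hne (hA.antisymm (cl_min hvA fun a ha b hb hab => ?_))
    by_contra hbA
    exact hcon a ha b (cl_closed (hA ha) hb hab) hbA hab
  intro A hA hne hne'
  by_cases hvA : v ∈ A
  · exact key A hA hvA hne'
  · obtain ⟨a, ha, b, hb, hb', hab⟩ := key (cl L Q v \ A) Finset.sdiff_subset
      (Finset.mem_sdiff.2 ⟨mem_cl_self hv, hvA⟩) (fun he => by grind)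
    refine ⟨b, ?_, a, (Finset.mem_sdiff.1 ha).1, (Finset.mem_sdiff.1 ha).2, by rwa [Finset.pair_comm]⟩
    by_contra hbA
    exact hb' (Finset.mem_sdiff.2 ⟨hb, hbA⟩)

theorem cl_eq {v w : V} (hv : v ∈ Q) (hw : w ∈ cl L Q v) : cl L Q w = cl L Q v := by
  have h1 : cl L Q w ⊆ cl L Q v := cl_min hw fun a ha b hb hab => cl_closed ha hb hab
  by_contra hne
  obtain ⟨a, ha, b, hb, hb', hab⟩ := conn_cl hv _ h1 ⟨w, mem_cl_self (cl_sub v hw)⟩ hne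
  exact hb' (cl_closed ha (cl_sub v hb) hab)

theorem cl_eq_of_edge {a b : V} (ha : a ∈ Q) (hb : b ∈ Q) (hab : {a, b} ∈ L) : cl L Q b = cl L Q a :=
  cl_eq ha (cl_closed (mem_cl_self ha) hb hab)

theorem cl_eq_of_conn {A : Finset V} (hA : A ⊆ Q) (hc : Conn L A) {a b : V} (ha : a ∈ A) (hb : b ∈ A) :
    cl L Q a = cl L Q b :=
  hc.const (f := cl L Q) (fun a ha b hb hab => (cl_eq_of_edge (hA ha) (hA hb) hab).symm) ha hb

theorem cl_sep : ∀ a ∈ cl L Q v, ∀ b ∈ Q, b ∉ cl L Q v → {a, b} ∉ L :=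
  fun _ ha _ hb hb' hab => hb' (cl_closed ha hb hab)

theorem fc_comps (hL : IsLowerSet L) {n : ℕ} (hn : n ≠ 0) :
    fc (res L Q) n = ∑ S ∈ Q.image (cl L Q), fc (res L S) n := by
  simp only [fc]
  rw [← Finset.card_biUnion]
  · congr 1
    ext σ
    simp only [mem_filter_univ, res, mem_setOf_eq, Finset.mem_biUnion, Finset.mem_image]
    constructor
    · rintro ⟨⟨h1, h2⟩, h3⟩
      obtain ⟨v, hv⟩ : σ.Nonempty := by rw [← Finset.card_pos]; omega
      refine ⟨_, ⟨v, h2 hv, rfl⟩, ⟨h1, fun w hw => cl_closed (mem_cl_self (h2 hv)) (h2 hw) (hL ?_ h1)⟩, h3⟩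
      intro x hx; simp at hx; rcases hx with rfl | rfl <;> assumption
    · rintro ⟨_, ⟨v, hv, rfl⟩, ⟨h1, h2⟩, h3⟩
      exact ⟨⟨h1, h2.trans (cl_sub v)⟩, h3⟩
  · intro S hS S' hS' hne
    obtain ⟨v, hv, rfl⟩ := Finset.mem_image.1 hS
    obtain ⟨w, hw, rfl⟩ := Finset.mem_image.1 hS'
    rw [Function.onFun, Finset.disjoint_left]
    intro σ h1 h2
    simp only [mem_filter_univ, res, mem_setOf_eq] at h1 h2
    obtain ⟨x, hx⟩ : σ.Nonempty := by rw [← Finset.card_pos]; omega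
    exact hne ((cl_eq hv (h1.1.2 hx)).symm.trans (cl_eq hw (h2.1.2 hx)))

end

theorem sum_fc_lk (hL : IsLowerSet L) (n : ℕ) :
    ∑ v ∈ verts L, fc (lk L v) n = (n + 1) * fc L (n + 1) := by
  have h1 : ∀ v ∈ verts L, fc (lk L v) n =
      ((Finset.univ.filter fun σ => σ ∈ L ∧ σ.card = n + 1).filter fun σ => v ∈ σ).card := fun v _ => by
    refine card_bij (fun σ _ => insert v σ) ?_ ?_ ?_
    · grind [lk, res, mem_verts, IsLowerSet]
    · intro σ hσ τ hτ he
      simp only [mem_filter, Finset.mem_univ, true_and, lk, mem_setOf_eq] at hσ hτ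
      rw [← erase_insert hσ.1.1, he, erase_insert hτ.1.1]
    · intro σ hσ
      simp only [mem_filter, Finset.mem_univ, true_and, lk, mem_setOf_eq] at hσ ⊢
      refine ⟨σ.erase v, ⟨⟨by simp, by rw [insert_erase hσ.2]; exact hσ.1.1⟩, ?_⟩, insert_erase hσ.2⟩
      rw [card_erase_of_mem hσ.2, hσ.1.2]; rfl
  rw [sum_congr rfl h1]
  have := Finset.sum_card_bipartiteAbove_eq_sum_card_bipartiteBelow (s := verts L)
    (t := Finset.univ.filter fun σ => σ ∈ L ∧ σ.card = n + 1) (fun v σ => v ∈ σ)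
  simp only [bipartiteAbove, bipartiteBelow] at this
  rw [this, sum_congr rfl (g := fun _ => n + 1), sum_const, smul_eq_mul, mul_comm, fc]
  intro σ hσ
  simp only [mem_filter_univ] at hσ
  rw [← hσ.2]
  congr 1
  grind [lk, res, mem_verts, IsLowerSet]

end

section
open scoped Classical
variable {V : Type} [Fintype V] [DecidableEq V] {v : V}

theorem IsCirc.card_edges {C : Set (Finset V)} (h : IsCirc C) : fc C 1 = fc C 2 := by
  have h1 := sum_fc_lk h.lower 1
  rw [sum_congr rfl (g := fun _ => 2) fun v hv => by rw [fc_one, (h.link v hv).card],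
    sum_const, ← fc_one, smul_eq_mul] at h1
  norm_num at h1
  omega

namespace Trig
variable {K : Set (Finset V)} {T Z : Finset V} (h : Trig K T Z)
include h

theorem pos_sub {σ : Finset V} (hσ : σ ∈ K) {p : V} (hp : p ∈ σ) (hpT : p ∈ T) (hpZ : p ∉ Z) : σ ⊆ T := fun x hx => by
  by_contra hxT
  refine h.noPM p hpT hpZ x hxT (h.lower ?_ hσ)
  intro y hy; simp at hy; rcases hy with rfl | rfl <;> assumption

theorem res_link_eq {L : Set (Finset V)} (hL : ∀ τ ∈ L, ∃ σ ∈ K, τ ⊆ σ ∧ ∃ p ∈ σ, p ∈ T ∧ p ∉ Z) :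
    res L T = L := by
  ext τ
  refine ⟨fun h => h.1, fun hτ => ⟨hτ, ?_⟩⟩
  obtain ⟨σ, hσ, hs, p, hp, hpT, hpZ⟩ := hL τ hτ
  exact hs.trans (h.pos_sub hσ hp hpT hpZ)

theorem chi_lk (hv : v ∈ T) : chi (lk (res K T) v) = 2 - if v ∈ Z then 1 else 0 := by
  rw [lk_res hv]
  by_cases hvZ : v ∈ Z
  · obtain ⟨h1, ⟨b, hb⟩, h3, h4, h5⟩ := h.link_zero hvZ
    have hS := h.surf hv
    rw [if_pos hvZ, ← res_inter_verts hS.lower, Finset.inter_comm,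
      hS.chi_res_eq Finset.inter_subset_left h1 (Finset.mem_sdiff.1 hb).1 (Finset.mem_sdiff.1 hb).2 h3 h4]
    norm_num
  · rw [if_neg hvZ, h.res_link_eq fun τ hτ => ⟨_, hτ.2, Finset.subset_insert _ _, v, by simp, hv, hvZ⟩,
      h.chi_surf hv]
    norm_num

theorem chi_lk2 {v w : V} (hv : v ∈ T) (hw : w ∈ verts (lk (res K T) v)) :
    (fc (lk (lk (res K T) v) w) 1 : ℤ) - fc (lk (lk (res K T) v) w) 2 =
      if v ∈ Z ∧ w ∈ Z then 1 else 0 := by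
  rw [lk_res hv, verts_res, Finset.mem_inter] at hw
  have hC := h.circ hv hw.1
  obtain ⟨e1, e2⟩ := mem_verts_lk.1 hw.1
  rw [lk_res hv, lk_res hw.2]
  split_ifs with hZ
  · obtain ⟨h1, h2⟩ := h.conn_edge hv hw.2 e2 e1.symm
    obtain ⟨b, hb, hbT⟩ := h.edge_neg hZ.1 hZ.2 e2 e1.symm
    have e3 := hC.edges_lt (A := verts (lk (lk K v) w) ∩ T) Finset.inter_subset_left h1
        (fun he => hbT (Finset.mem_inter.1 (he.symm ▸ hb)).2)
    have hr := isLowerSet_res hC.lower T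
    have e4 := chi_le hr (by rwa [verts_res]) (by
      have := conn_res Finset.inter_subset_left h2
      rwa [Finset.inter_comm, res_inter_verts hC.lower] at this)
    have e5 : z2 (res (lk (lk K v) w) T) = 0 := by
      refine z2_eq_zero hr fun c hc => ?_
      ext τ
      by_contra hτ
      have := hc.1 τ hτ
      have := hC.dim this.1.1
      omega
    have e6 : ∀ k, 2 < k → fc (res (lk (lk K v) w) T) k = 0 := fun k hk => fc_eq_zero (fun σ hσ => hC.dim hσ.1) hk
    rw [Finset.inter_comm, res_inter_verts hC.lower, Finset.inter_comm] at e3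
    rw [chi, e5, e6 3 (by norm_num), e6 4 (by norm_num), fc_one, verts_res] at e4
    rw [fc_one, verts_res]
    push_cast at e4
    omega
  · rw [h.res_link_eq, hC.card_edges, sub_self]
    intro τ hτ
    refine ⟨_, hτ.2.2, fun x hx => by simp [hx], ?_⟩
    grind

theorem chi_lk3 {u v w : V} (hu : u ∈ T) (hv : v ∈ verts (lk (res K T) u))
    (hw : w ∈ verts (lk (lk (res K T) u) v)) :
    (fc (lk (lk (lk (res K T) u) v) w) 1 : ℤ) = 2 - if u ∈ Z ∧ v ∈ Z ∧ w ∈ Z then 1 else 0 := by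
  rw [lk_res hu, verts_res, Finset.mem_inter] at hv
  rw [lk_res hu, lk_res hv.2, verts_res, Finset.mem_inter] at hw
  obtain ⟨e1, e2⟩ := mem_verts_lk.1 hv.1
  rw [lk_res hu, lk_res hv.2, lk_res hw.2, fc_one]
  split_ifs with hZ
  · obtain ⟨a, b, ha, haZ, hb, he⟩ := h.pair_zero hZ.1 hZ.2.1 hZ.2.2 e1.symm hw.1
    rw [verts_res, he, show ({a, b} : Finset V) ∩ T = {a} by
      ext x; simp only [Finset.mem_inter, Finset.mem_insert, Finset.mem_singleton]
      grind]
    simp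
  · rw [h.res_link_eq, (h.pair_edge hu e1.symm hw.1).card]
    · norm_num
    intro τ hτ
    refine ⟨_, hτ.2.2.2, fun x hx => by simp [hx], ?_⟩
    grind

theorem verts_T : verts (res K T) = T := by rw [verts_res, Finset.inter_eq_right.2 h.subT]

theorem verts_Z : verts (res K Z) = Z := by rw [verts_res, Finset.inter_eq_right.2 (h.subZ.trans h.subT)]

theorem verts_lk_Z (hv : v ∈ Z) : verts (lk (res K Z) v) = (verts (lk (res K T) v)).filter (· ∈ Z) := by
  rw [lk_res hv, lk_res (h.subZ hv), verts_res, verts_res]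
  ext x
  simp only [Finset.mem_inter, mem_filter]
  have := @h.subZ x
  tauto

theorem verts_lk2_Z {v w : V} (hv : v ∈ Z) (hw : w ∈ Z) :
    verts (lk (lk (res K Z) v) w) = (verts (lk (lk (res K T) v) w)).filter (· ∈ Z) := by
  rw [lk_res hv, lk_res hw, lk_res (h.subZ hv), lk_res (h.subZ hw), verts_res, verts_res]
  ext x
  simp only [Finset.mem_inter, mem_filter]
  have := @h.subZ x
  tauto

theorem sum_zero_edges : ∑ v ∈ T, ∑ w ∈ verts (lk (res K T) v), (if v ∈ Z ∧ w ∈ Z then (1 : ℤ) else 0) =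
    2 * fc (res K Z) 2 := by
  have h1 := sum_fc_lk (isLowerSet_res h.lower Z) 1
  have e : ∀ v ∈ T, ∑ w ∈ verts (lk (res K T) v), (if v ∈ Z ∧ w ∈ Z then (1 : ℤ) else 0) =
      if v ∈ Z then (fc (lk (res K Z) v) 1 : ℤ) else 0 := fun v hv => by
    split_ifs with hvZ
    · rw [fc_one, h.verts_lk_Z hvZ]
      simp [hvZ, filter_mem_eq_inter]
    · simp [hvZ]
  rw [sum_congr rfl e, ← sum_filter, filter_mem_eq_inter,
    Finset.inter_eq_right.2 h.subZ, ← Nat.cast_sum]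
  rw [h.verts_Z] at h1
  rw [h1]; push_cast; ring

theorem sum_zero_tris : ∑ u ∈ T, ∑ v ∈ verts (lk (res K T) u), ∑ w ∈ verts (lk (lk (res K T) u) v),
    (if u ∈ Z ∧ v ∈ Z ∧ w ∈ Z then (1 : ℤ) else 0) = 6 * fc (res K Z) 3 := by
  have hlow := isLowerSet_res h.lower Z
  have e : ∀ u ∈ T, ∑ v ∈ verts (lk (res K T) u), ∑ w ∈ verts (lk (lk (res K T) u) v),
      (if u ∈ Z ∧ v ∈ Z ∧ w ∈ Z then (1 : ℤ) else 0) =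
      if u ∈ Z then (2 * fc (lk (res K Z) u) 2 : ℤ) else 0 := fun u hu => by
    split_ifs with huZ
    · have h1 := sum_fc_lk (isLowerSet_lk hlow u) 1
      have e : ∀ v ∈ verts (lk (res K T) u), ∑ w ∈ verts (lk (lk (res K T) u) v),
          (if u ∈ Z ∧ v ∈ Z ∧ w ∈ Z then (1 : ℤ) else 0) =
          if v ∈ Z then (fc (lk (lk (res K Z) u) v) 1 : ℤ) else 0 := fun v hv => by
        split_ifs with hvZ
        · rw [fc_one, h.verts_lk2_Z huZ hvZ]
          simp [huZ, hvZ, filter_mem_eq_inter]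
        · simp [hvZ]
      rw [sum_congr rfl e, ← sum_filter, ← h.verts_lk_Z huZ, ← Nat.cast_sum, h1]
      push_cast; ring
    · simp [huZ]
  have h1 := sum_fc_lk hlow 2
  rw [sum_congr rfl e, ← sum_filter, filter_mem_eq_inter,
    Finset.inter_eq_right.2 h.subZ, ← mul_sum, ← Nat.cast_sum]
  rw [h.verts_Z] at h1
  rw [h1]; push_cast; ring

theorem chi_zero : chi (res K Z) = 2 * chi (res K T) := by
  have hlow := isLowerSet_res h.lower T
  have f5 : fc (res K T) 5 = 0 := fc_eq_zero (fun σ hσ => h.dim σ hσ.1) (by norm_num)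
  have g4 : fc (res K Z) 4 = 0 := fc_eq_zero (fun σ hσ => h.no_zero_tet hσ.1 hσ.2) (by norm_num)
  have s1 : ∀ n, (∑ v ∈ T, (fc (lk (res K T) v) n : ℤ)) = (n + 1) * fc (res K T) (n + 1) := fun n => by
    have := sum_fc_lk hlow n
    rw [h.verts_T] at this
    exact_mod_cast this
  have s2 : ∀ n, (∑ v ∈ T, ∑ w ∈ verts (lk (res K T) v), (fc (lk (lk (res K T) v) w) n : ℤ)) =
      (n + 1) * ((n + 2) * fc (res K T) (n + 2)) := fun n => by
    have e : ∀ v ∈ T, ∑ w ∈ verts (lk (res K T) v), (fc (lk (lk (res K T) v) w) n : ℤ) =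
        (n + 1) * (fc (lk (res K T) v) (n + 1) : ℤ) := fun v _ => by
      exact_mod_cast sum_fc_lk (isLowerSet_lk hlow v) n
    rw [sum_congr rfl e, ← mul_sum, s1 (n + 1)]
    push_cast; ring
  have s3 : (∑ u ∈ T, ∑ v ∈ verts (lk (res K T) u), ∑ w ∈ verts (lk (lk (res K T) u) v),
      (fc (lk (lk (lk (res K T) u) v) w) 1 : ℤ)) = 24 * fc (res K T) 4 := by
    have e : ∀ u ∈ T, ∀ v ∈ verts (lk (res K T) u), ∑ w ∈ verts (lk (lk (res K T) u) v),
        (fc (lk (lk (lk (res K T) u) v) w) 1 : ℤ) = 2 * fc (lk (lk (res K T) u) v) 2 := fun u _ v _ => by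
      exact_mod_cast sum_fc_lk (isLowerSet_lk (isLowerSet_lk hlow u) v) 1
    rw [sum_congr rfl fun u hu => sum_congr rfl (e u hu)]
    simp only [← mul_sum]
    rw [s2 2]; push_cast; ring
  have C : 2 * (T.card : ℤ) - Z.card = 2 * fc (res K T) 2 - 3 * fc (res K T) 3 + 4 * fc (res K T) 4 := by
    have e := sum_congr rfl fun v hv => h.chi_lk (v := v) hv
    simp only [chi, sum_sub_distrib, sum_add_distrib, s1] at e
    rw [← sum_filter, filter_mem_eq_inter, Finset.inter_eq_right.2 h.subZ] at e
    simp only [sum_const, nsmul_eq_mul, f5] at e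
    push_cast at e
    linarith
  have B : 6 * (fc (res K T) 3 : ℤ) - 12 * fc (res K T) 4 = 2 * fc (res K Z) 2 := by
    have e := sum_congr rfl fun v hv => sum_congr rfl fun w hw => h.chi_lk2 (v := v) (w := w) hv hw
    rw [h.sum_zero_edges] at e
    simp only [sum_sub_distrib, s2] at e
    push_cast at e
    linarith
  have A : 24 * (fc (res K T) 4 : ℤ) = 12 * fc (res K T) 3 - 6 * fc (res K Z) 3 := by
    have e := sum_congr rfl fun u hu => sum_congr rfl fun v hv =>
      sum_congr rfl fun w hw => h.chi_lk3 (u := u) (v := v) (w := w) hu hv hw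
    rw [s3] at e
    simp only [sum_sub_distrib] at e
    rw [h.sum_zero_tris] at e
    have e2 := s2 1
    simp only [fc_one] at e2
    simp only [sum_const, nsmul_eq_mul] at e
    simp only [← Finset.sum_mul] at e
    push_cast at e2
    linarith
  have t1 : (fc (res K T) 1 : ℤ) = T.card := by rw [fc_one, h.verts_T]
  have t2 : (fc (res K Z) 1 : ℤ) = Z.card := by rw [fc_one, h.verts_Z]
  simp only [chi, t1, t2, g4]
  push_cast
  linarith

end Trig
end

section
open scoped Classical
variable {V : Type} [Fintype V] [DecidableEq V] {K : Set (Finset V)} {T Z : Finset V}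

namespace Trig
variable (h : Trig K T Z)
include h

theorem tri_count {t : Finset V} (ht : t ∈ res K T) (h3 : t.card = 3) :
    (tᶜ.filter fun z => insert z t ∈ res K T).card = if t ⊆ Z then 1 else 2 := by
  split_ifs with hZ
  · obtain ⟨a, b, haT, haZ, hb, hab⟩ := h.zero_tri ht.1 h3 hZ
    rw [card_eq_one]
    refine ⟨a, ?_⟩
    ext z
    have hz : (z ∉ t ∧ insert z t ∈ K) ↔ z = a ∨ z = b := by
      have := congrArg (z ∈ ·) hab
      simpa using this
    simp only [mem_filter, Finset.mem_compl, Finset.mem_singleton]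
    grind [lk, res, mem_verts, IsLowerSet]
  · obtain ⟨p, hp, hpZ⟩ := Finset.not_subset.1 hZ
    rw [← h.kt t ht.1 h3 ⟨p, hp, ht.2 hp⟩]
    congr 1
    ext z
    simp only [mem_filter, Finset.mem_compl, Finset.mem_univ, true_and]
    exact and_congr_right fun _ => ⟨fun h => h.1, fun h1 =>
      ⟨h1, h.pos_sub h1 (Finset.mem_insert_of_mem hp) (ht.2 hp) hpZ⟩⟩

theorem exists_tet {u w : V} (huw : {u, w} ∈ res K T) : ∃ σ ∈ res K T, σ.card = 4 ∧ u ∈ σ ∧ w ∈ σ := by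
  have key : ∀ u w, u ≠ w → {u, w} ∈ res K T → ∃ σ ∈ res K T, σ.card = 4 ∧ u ∈ σ ∧ w ∈ σ := fun u w hne huw => by
    obtain ⟨x, hx⟩ := (h.nee u w hne huw).1
    have hx' := mem_verts.1 hx
    simp only [lk, mem_setOf_eq, Finset.mem_singleton, Finset.mem_insert, not_or] at hx'
    obtain ⟨h1, ⟨h2, h3⟩, h4⟩ := hx'
    have hc : ({u, w, x} : Finset V).card = 3 := card_eq_three.2 ⟨u, w, x, h2, h3, h1, rfl⟩
    obtain ⟨z, hz, hzt⟩ := h.nt _ h4 hc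
    grind
  by_cases hne : u = w
  · subst hne
    have huT : u ∈ T := huw.2 (by simp)
    obtain ⟨x, hx⟩ := (h.nv u huT).1
    grind [lk, res, mem_verts, IsLowerSet]
  · exact key u w hne huw

theorem star_const {A : Finset V → ZMod 2} {B : V → ZMod 2}
    (hA : ∀ σ, A σ ≠ 0 → σ ∈ res K T ∧ σ.card = 4)
    (hB : ∀ t ∈ res K T, t.card = 3 → ∀ u ∈ t,
      ∑ v ∈ tᶜ, A (insert v t) = if t ⊆ Z then B u else 0) {u : V} (hu : u ∈ T) :
    ∃ k, (∀ σ ∈ res K T, σ.card = 4 → u ∈ σ → A σ = k) ∧ (u ∈ Z → B u = k) := by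
  set c : Finset V → ZMod 2 := fun τ => if u ∈ τ then 0 else
    A (insert u τ) + (if u ∈ Z ∧ insert u τ ∈ res K T ∧ τ.card = 3 then B u else 0) with hc
  have hcyc : IsCyc2 (lk K u) c := by
    refine ⟨fun τ hτ => ?_, fun e he => ?_⟩
    · grind [lk, res, mem_verts, IsLowerSet]
    · by_cases hue : u ∈ e
      · simp_all
      set t := insert u e with ht
      have h3 : t.card = 3 := by grind
      have h1 : ∑ v ∈ eᶜ, c (insert v e) = ∑ v ∈ tᶜ, (A (insert v t) +
          if u ∈ Z ∧ insert v t ∈ res K T then B u else 0) := by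
        have : eᶜ = insert u tᶜ := by simp_all
        rw [this, sum_insert (by simp [ht])]
        have h0 : c (insert u e) = 0 := by simp [hc]
        rw [h0, zero_add]
        refine sum_congr rfl fun v hv => ?_
        simp only [ht, Finset.mem_compl, Finset.mem_insert, not_or] at hv
        have huv : u ∉ insert v e := by grind
        simp only [hc]
        rw [if_neg huv, Finset.insert_comm u v e, Finset.card_insert_of_notMem hv.2, he]
        simp [ht]
      rw [h1, sum_add_distrib]
      by_cases htT : t ∈ res K T
      · rw [hB t htT h3 u (by simp [ht])]
        by_cases huZ : u ∈ Z
        · simp only [huZ, true_and]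
          rw [← sum_filter, sum_const, h.tri_count htT h3]
          split_ifs
          · grind
          · grind
        · rw [if_neg fun h => huZ (h (by simp [ht]))]
          simp [huZ]
      · have hn : ∀ v, insert v t ∉ res K T := fun v hv =>
          htT ((isLowerSet_res h.lower T) (Finset.subset_insert _ _) hv)
        grind
  obtain ⟨k, hk⟩ := (h.surf hu).cyc_const hcyc
  have hσ : ∀ σ ∈ res K T, σ.card = 4 → u ∈ σ → A σ + (if u ∈ Z then B u else 0) = k := fun σ hσ h4 huσ => by
    have hi : insert u (σ.erase u) = σ := insert_erase huσ
    grind [lk, res, mem_verts, IsLowerSet]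
  by_cases huZ : u ∈ Z
  · obtain ⟨-, ⟨m, hm⟩, -⟩ := h.link_zero huZ
    have hm' := Finset.mem_sdiff.1 hm
    have hmT : m ∉ T := fun hmT => hm'.2 (Finset.mem_inter.2 ⟨hm'.1, hmT⟩)
    obtain ⟨b, hb⟩ := ((h.surf hu).link m hm'.1).ne
    obtain ⟨x, hx, hbx⟩ := ((h.surf hu).link m hm'.1).exists_edge hb
    have h1 := hbx.1
    simp at h1
    have hk0 : k = 0 := by
      rw [← hk _ hbx.2 (card_eq_three.2 ⟨m, b, x, h1.1, h1.2, hx.symm, rfl⟩)]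
      have hn : insert u (insert m {b, x}) ∉ res K T := fun h => hmT (h.2 (by simp))
      grind
    refine ⟨B u, fun σ h1 h2 h3 => ?_, fun _ => rfl⟩
    grind
  · aesop

theorem tet_const {A : Finset V → ZMod 2} {B : V → ZMod 2}
    (hA : ∀ σ, A σ ≠ 0 → σ ∈ res K T ∧ σ.card = 4)
    (hB : ∀ t ∈ res K T, t.card = 3 → ∀ u ∈ t, ∑ v ∈ tᶜ, A (insert v t) = if t ⊆ Z then B u else 0) :
    ∃ k, (∀ σ ∈ res K T, σ.card = 4 → A σ = k) ∧ (∀ u ∈ Z, B u = k) := by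
  have h1 : ∀ u ∈ T, ∃ k, (∀ σ ∈ res K T, σ.card = 4 → u ∈ σ → A σ = k) ∧ (u ∈ Z → B u = k) :=
    fun u hu => h.star_const hA hB hu
  choose! m hm hm' using h1
  obtain ⟨u0, hu0⟩ := h.ne
  have h2 : ∀ u ∈ T, m u = m u0 := fun u hu => by
    refine h.connT.const (f := m) (fun a ha b hb hab => ?_) hu hu0
    obtain ⟨σ, hσ, h4, haσ, hbσ⟩ := h.exists_tet (u := a) (w := b) ⟨hab, by
      intro x hx; simp at hx; rcases hx with rfl | rfl <;> assumption⟩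
    rw [← hm a ha σ hσ h4 haσ, hm b hb σ hσ h4 hbσ]
  refine ⟨m u0, fun σ hσ h4 => ?_, fun u hu => (hm' u (h.subZ hu) hu).trans (h2 u (h.subZ hu))⟩
  obtain ⟨u, hu⟩ : σ.Nonempty := by rw [← Finset.card_pos]; omega
  rw [hm u (hσ.2 hu) σ hσ h4 hu, h2 u (hσ.2 hu)]

theorem comp_surf {S : Finset V} (hS : S ∈ Z.image (cl K Z)) : IsSurf (res K S) := by
  obtain ⟨z, hz, rfl⟩ := Finset.mem_image.1 hS
  exact h.zero_surf (cl_sub z) ⟨z, mem_cl_self hz⟩ (conn_cl hz) (cl_sep)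

end Trig

theorem comp_eq {S : Finset V} (hS : S ∈ Z.image (cl K Z)) {u : V} (hu : u ∈ S) : S = cl K Z u := by
  obtain ⟨z, hz, rfl⟩ := Finset.mem_image.1 hS
  exact (cl_eq hz hu).symm

/-- The boundary of a `3`-chain plus a combination of fundamental cycles of components. -/
def bdMap (K : Set (Finset V)) (T Z : Finset V) :
    ((Fc (res K T) 4 → ZMod 2) × ({S // S ∈ Z.image (cl K Z)} → ZMod 2)) →ₗ[ZMod 2]
      (Fc (res K T) 3 → ZMod 2) :=
  (cobd (res K T) 3).transpose.mulVecLin.coprod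
    (∑ S, LinearMap.smulRight (LinearMap.proj S)
      (fun t : Fc (res K T) 3 => if t.1 ⊆ S.1 then (1 : ZMod 2) else 0))

theorem bdMap_apply (a : Fc (res K T) 4 → ZMod 2) (b : {S // S ∈ Z.image (cl K Z)} → ZMod 2)
    (t : Fc (res K T) 3) : bdMap K T Z (a, b) t =
      ∑ v ∈ t.1ᶜ, ext0 a (insert v t.1) + ∑ S, b S * if t.1 ⊆ S.1 then 1 else 0 := by
  rw [bdMap, LinearMap.coprod_apply, Pi.add_apply, Matrix.mulVecLin_apply, cobdT_apply]
  simp [LinearMap.sum_apply]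

namespace Trig
variable (h : Trig K T Z)
include h

theorem range_bdMap : LinearMap.range (bdMap K T Z) ≤
    ker (cobd (res K T) 2).transpose.mulVecLin := by
  have hL := isLowerSet_res h.lower T
  have hm : cobd (res K T) 3 * cobd (res K T) 2 = 0 := by
    apply Matrix.toLin'.injective
    apply LinearMap.ext
    intro f
    rw [Matrix.toLin'_apply, ← Matrix.mulVec_mulVec, cobd_cobd hL]
    simp
  rw [bdMap, LinearMap.range_coprod, sup_le_iff]
  constructor
  · rintro _ ⟨a, rfl⟩
    rw [mem_ker, Matrix.mulVecLin_apply, Matrix.mulVecLin_apply, Matrix.mulVec_mulVec,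
      ← Matrix.transpose_mul, hm]
    simp
  · rintro _ ⟨b, rfl⟩
    rw [LinearMap.sum_apply]
    refine Submodule.sum_mem _ fun S _ => ?_
    rw [LinearMap.smulRight_apply]
    refine Submodule.smul_mem _ _ ?_
    rw [mem_ker_iff hL]
    have h1 := (h.comp_surf S.2).cyc_one
    have hST : S.1 ⊆ T := by
      obtain ⟨z, hz, he⟩ := Finset.mem_image.1 S.2
      rw [← he]; exact (cl_sub z).trans h.subZ
    have : ext0 (fun t : Fc (res K T) 3 => if t.1 ⊆ S.1 then (1 : ZMod 2) else 0) =
        fun τ => if τ ∈ res K S.1 ∧ τ.card = 3 then 1 else 0 := by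
      ext τ
      simp only [ext0, res, mem_setOf_eq]
      grind
    rw [this]
    exact ⟨fun τ hτ => ⟨⟨(h1.1 τ hτ).1.1, (h1.1 τ hτ).1.2.trans hST⟩, (h1.1 τ hτ).2⟩, h1.2⟩

theorem ker_bdMap : finrank (ZMod 2) (ker (bdMap K T Z)) ≤ 1 := by
  have key : ∀ x ∈ ker (bdMap K T Z), ∃ k, (∀ σ, x.1 σ = k) ∧ ∀ S, x.2 S = k := by
    rintro ⟨a, b⟩ hx
    rw [mem_ker] at hx
    set B : V → ZMod 2 := fun u => if hu : cl K Z u ∈ Z.image (cl K Z) then b ⟨_, hu⟩ else 0 with hBd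
    obtain ⟨k, hk1, hk2⟩ := h.tet_const (A := ext0 a) (B := B) (fun σ hσ => by
        by_contra h'
        exact hσ (by simp only [ext0, dif_neg h'])) (by
      intro t ht h3 u hu
      have h1 := congrFun hx ⟨t, ht, h3⟩
      rw [bdMap_apply] at h1
      simp only [Pi.zero_apply] at h1
      rw [CharTwo.add_eq_zero.1 h1]
      split_ifs with hZ
      · have huZ := hZ hu
        have hm : cl K Z u ∈ Z.image (cl K Z) := Finset.mem_image_of_mem _ huZ
        simp only [hBd, dif_pos hm]
        rw [sum_eq_single ⟨_, hm⟩]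
        · rw [if_pos, mul_one]
          intro w hw
          exact cl_closed (mem_cl_self huZ) (hZ hw) (h.lower (by
            intro y hy; simp at hy; rcases hy with rfl | rfl <;> assumption) ht.1)
        · intro S _ hS
          rw [if_neg, mul_zero]
          intro hts
          exact hS (Subtype.ext (comp_eq S.2 (hts hu)))
        · simp
      · refine sum_eq_zero fun S _ => ?_
        rw [if_neg, mul_zero]
        intro hts
        obtain ⟨z, hz, he⟩ := Finset.mem_image.1 S.2
        exact hZ (hts.trans (he ▸ cl_sub z)))
    refine ⟨k, fun σ => ?_, fun S => ?_⟩
    · rw [← hk1 σ.1 σ.2.1 σ.2.2, ext0_apply]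
    · grind
  obtain ⟨u, hu⟩ := h.ne
  obtain ⟨σ, hσ, h4, -⟩ := h.exists_tet (u := u) (w := u) ⟨by
    simpa using mem_verts.1 (h.subT hu), by grind⟩
  let ev : ker (bdMap K T Z) →ₗ[ZMod 2] ZMod 2 :=
    (LinearMap.proj (⟨σ, hσ, h4⟩ : Fc (res K T) 4)).comp
      ((LinearMap.fst _ _ _).comp (Submodule.subtype _))
  have hinj : Injective ev := by
    rw [injective_iff_map_eq_zero]
    rintro ⟨x, hx⟩ h0
    obtain ⟨k, h1, h2⟩ := key x hx
    have hk : k = 0 := by rw [← h1 ⟨σ, hσ, h4⟩]; exact h0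
    subst hk
    exact Subtype.ext (Prod.ext (funext h1) (funext h2))
  simpa using LinearMap.finrank_le_finrank_of_injective hinj

set_option maxHeartbeats 400000 in
theorem card_comps_le : ((Z.image (cl K Z)).card : ℤ) ≤ chi (res K T) := by
  have h1 := LinearMap.finrank_range_add_finrank_ker (bdMap K T Z)
  have h2 := h.ker_bdMap
  have h3 : finrank (ZMod 2) (LinearMap.range (bdMap K T Z)) ≤ z2 (res K T) :=
    finrank_mono h.range_bdMap
  rw [finrank_prod, finrank_pi, finrank_pi, card_Fc, Fintype.card_coe] at h1
  have h4 := chi_eq (isLowerSet_res h.lower T) (by rw [h.verts_T]; exact h.ne)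
    (conn_res h.subT h.connT) h.b1T
  omega

theorem comp_chi {S : Finset V} (hS : S ∈ Z.image (cl K Z)) : chi (res K S) = 2 := by
  have h1 := h.chi_zero
  have h2 := h.card_comps_le
  have h3 : chi (res K Z) = ∑ S ∈ Z.image (cl K Z), chi (res K S) := by
    simp only [chi, sum_add_distrib, sum_sub_distrib]
    rw [fc_comps h.lower one_ne_zero, fc_comps h.lower two_ne_zero, fc_comps h.lower three_ne_zero,
      fc_comps h.lower four_ne_zero]
    push_cast; rfl
  have h4 : ∀ S ∈ Z.image (cl K Z), chi (res K S) ≤ 2 := fun S hS => (h.comp_surf hS).chi_le_two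
  have h5 : ∑ S ∈ Z.image (cl K Z), chi (res K S) = ∑ S ∈ Z.image (cl K Z), (2 : ℤ) := by
    refine le_antisymm (Finset.sum_le_sum h4) ?_
    rw [← h3, h1, sum_const, nsmul_eq_mul]
    linarith
  exact (Finset.sum_eq_sum_iff_of_le h4).1 h5 S hS

theorem comp_homeo {S : Finset V} (hS : S ∈ Z.image (cl K Z)) :
    ∃ e, HomeoOn e (realiz (res K S)) (sphere (0 : E3) 1) :=
  (h.comp_surf hS).homeo (h.comp_chi hS)

end Trig
end

section
open scoped Classical
variable {V : Type} [Fintype V] [DecidableEq V] {K : Set (Finset V)} {T Z : Finset V}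

/-- The component of `v` among the vertices outside `T`. -/
def outc (K : Set (Finset V)) (T : Finset V) (v : V) : Finset V := cl K (verts K \ T) v

/-- The vertices of `Z` adjacent to `C`. -/
def nbd (K : Set (Finset V)) (Z C : Finset V) : Finset V := Z.filter fun z => ∃ c ∈ C, {z, c} ∈ K

/-- The colouring which is negative on `C`, zero on `S` and positive elsewhere. -/
def ncol (C S : Finset V) (v : V) : ℝ := if v ∈ C then -1 else if v ∈ S then 0 else 1

namespace Trig
variable (h : Trig K T Z)
include h

theorem mem_out {σ : Finset V} (hσ : σ ∈ K) {b : V} (hb : b ∈ σ) (hbT : b ∉ T) : b ∈ verts K \ T :=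
  Finset.mem_sdiff.2 ⟨mem_verts_of_mem h.lower hσ hb, hbT⟩

theorem outc_unique {z m m' : V} (hz : z ∈ Z) (hm : m ∉ T) (hm' : m' ∉ T) (h1 : {z, m} ∈ K)
    (h2 : {z, m'} ∈ K) : outc K T m = outc K T m' := by
  obtain ⟨-, -, -, -, hc⟩ := h.link_zero hz
  have key : ∀ m, m ∉ T → {z, m} ∈ K → m ∈ verts (lk K z) \ (verts (lk K z) ∩ T) := fun m hm h1 =>
    Finset.mem_sdiff.2 ⟨mem_verts_lk.2 ⟨fun he => hm (he ▸ h.subZ hz), h1⟩, fun h => hm (Finset.mem_inter.1 h).2⟩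
  refine cl_eq_of_conn (A := verts (lk K z) \ (verts (lk K z) ∩ T)) ?_ ?_ (key m hm h1) (key m' hm' h2)
  · intro x hx
    obtain ⟨hx1, hx2⟩ := Finset.mem_sdiff.1 hx
    refine Finset.mem_sdiff.2 ⟨?_, fun h => hx2 (Finset.mem_inter.2 ⟨hx1, h⟩)⟩
    exact mem_verts_of_mem h.lower (mem_verts_lk.1 hx1).2 (by simp)
  · intro A hA hne hne'
    obtain ⟨a, ha, b, hb, hb', hab⟩ := hc A hA hne hne'
    exact ⟨a, ha, b, hb, hb', h.lower (Finset.subset_insert _ _) hab.2⟩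

theorem comp_inj {z z' m m' : V} (hz : z ∈ Z) (hz' : z' ∈ Z) (hm : m ∉ T) (hm' : m' ∉ T)
    (h1 : {z, m} ∈ K) (h2 : {z', m'} ∈ K) (he : outc K T m = outc K T m') : z' ∈ cl K Z z := by
  by_contra hz'S
  set S := cl K Z z with hS
  have hST : ∀ a ∈ S, a ∈ T := fun a ha => h.subZ (cl_sub _ ha)
  set s : V → ZMod 2 := fun u => if u ∈ S then 1 else 0 with hs
  set φ : V → V → ZMod 2 := fun u w => if (u ∈ S ∧ w ∉ T) ∨ (w ∈ S ∧ u ∉ T) then 1 else 0 with hφ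
  obtain ⟨ψ, hψ⟩ := h.b1 φ (fun a b => by grind) (by
    intro a b c habc
    by_cases hex : (∃ p ∈ ({a, b, c} : Finset V), p ∈ S) ∧ ∃ q ∈ ({a, b, c} : Finset V), q ∉ T
    · obtain ⟨⟨p, hp, hpS⟩, q, hq, hqT⟩ := hex
      have hall : ∀ x ∈ ({a, b, c} : Finset V), x ∈ S ∨ x ∉ T := fun x hx => by
        by_contra! hcon
        by_cases hxZ : x ∈ Z
        · exact hcon.1 (cl_closed hpS hxZ (h.lower (by
            intro y hy; rcases Finset.mem_insert.1 hy with rfl | hy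
            · exact hp
            · grind) habc))
        · exact h.noPM x hcon.2 hxZ q hqT (h.lower (by
            intro y hy; rcases Finset.mem_insert.1 hy with rfl | hy
            · exact hx
            · grind) habc)
      grind
    · grind)
  have e1 : ψ z = ψ z' := h.connT.const (f := ψ) (fun a ha b hb hab => by grind) (h.subZ hz) (h.subZ hz')
  have hmo := h.mem_out h1 (by simp) hm
  have hmo' := h.mem_out h2 (by simp) hm'
  have e2 : ψ m = ψ m' := by
    refine (conn_cl (L := K) hmo).const (f := ψ) (fun a ha b hb hab => ?_) (mem_cl_self hmo) ?_
    · have := hψ a b hab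
      rw [← CharTwo.add_eq_zero, ← this]
      have ha' := (Finset.mem_sdiff.1 (cl_sub _ ha)).2
      have hb' := (Finset.mem_sdiff.1 (cl_sub _ hb)).2
      grind
    · have : m' ∈ outc K T m' := mem_cl_self hmo'
      rw [← he] at this
      exact this
  have e3 := hψ z m h1
  have e4 := hψ z' m' h2
  rw [e1, e2, ← e4] at e3
  simp [hφ, hm, hm', h.subZ hz, h.subZ hz', hS, mem_cl_self hz] at e3
  exact hz'S e3

variable {m : V} (hm : m ∈ verts K \ T)
include hm

theorem nbd_mem : nbd K Z (outc K T m) ∈ Z.image (cl K Z) := by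
  have hCT : ∀ a ∈ outc K T m, a ∉ T := fun a ha => (Finset.mem_sdiff.1 (cl_sub _ ha)).2
  obtain ⟨u, hu⟩ := h.ne
  obtain ⟨a, ha, b, hb, hb', hab⟩ := h.conn (outc K T m) ((cl_sub m).trans Finset.sdiff_subset)
    ⟨m, mem_cl_self hm⟩ (fun he => hCT u (he ▸ h.subT hu) hu)
  have hbT : b ∈ T := by
    by_contra hbT
    exact hb' (cl_closed ha (Finset.mem_sdiff.2 ⟨hb, hbT⟩) hab)
  have hbZ : b ∈ Z := by
    by_contra hbZ
    exact h.noPM b hbT hbZ a (hCT a ha) (by rwa [Finset.pair_comm])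
  have hba : {b, a} ∈ K := by rwa [Finset.pair_comm]
  refine Finset.mem_image.2 ⟨b, hbZ, ?_⟩
  have hea : ∀ a ∈ outc K T m, outc K T a = outc K T m := fun a ha => cl_eq hm ha
  refine Finset.Subset.antisymm (cl_min ?_ ?_) ?_
  · exact mem_filter.2 ⟨hbZ, a, ha, hba⟩
  · intro y hy w hw hyw
    obtain ⟨hyZ, c, hc, hyc⟩ := mem_filter.1 hy
    obtain ⟨d, hd, hdyw⟩ := h.zneg {y, w} hyw (by simp) (by
      intro x hx; simp at hx; rcases hx with rfl | rfl <;> assumption)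
    have hdo := h.mem_out hdyw (by simp) hd
    have h1 := h.outc_unique hyZ (hCT c hc) hd hyc (h.lower (by grind) hdyw)
    refine mem_filter.2 ⟨hw, d, ?_, h.lower (by grind) hdyw⟩
    rw [← hea c hc, h1]
    exact mem_cl_self hdo
  · intro y hy
    obtain ⟨hyZ, c, hc, hyc⟩ := mem_filter.1 hy
    exact h.comp_inj hbZ hyZ (hCT a ha) (hCT c hc) hba hyc (by grind)

theorem out_not_T {a : V} (ha : a ∈ outc K T m) : a ∉ T := (Finset.mem_sdiff.1 (cl_sub _ ha)).2

theorem nbd_out {z b : V} (hz : z ∈ nbd K Z (outc K T m)) (hb : b ∉ T) (hzb : {z, b} ∈ K) :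
    b ∈ outc K T m := by
  obtain ⟨hzZ, c, hc, hzc⟩ := mem_filter.1 hz
  have h1 := h.outc_unique hzZ (h.out_not_T hm hc) hb hzc hzb
  have h2 : outc K T c = outc K T m := cl_eq hm hc
  rw [← h2, h1]
  exact mem_cl_self (h.mem_out hzb (by simp) hb)

theorem out_no_edge {a b : V} (ha : a ∈ outc K T m) (hb : b ∉ outc K T m)
    (hb' : b ∉ nbd K Z (outc K T m)) : {a, b} ∉ K := fun hab => by
  have hba : {b, a} ∈ K := by rwa [Finset.pair_comm]
  by_cases hbT : b ∈ T
  · by_cases hbZ : b ∈ Z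
    · exact hb' (mem_filter.2 ⟨hbZ, a, ha, hba⟩)
    · exact h.noPM b hbT hbZ a (h.out_not_T hm ha) hba
  · exact hb (cl_closed ha (h.mem_out hab (by simp) hbT) hab)

theorem signEquiv_out :
    SignEquiv K (ncol (outc K T m) (nbd K Z (outc K T m))) (pmCol (outc K T m)ᶜ) := by
  set C := outc K T m with hC
  set S := nbd K Z C with hS
  have hSm : S ∈ Z.image (cl K Z) := h.nbd_mem hm
  have hz : (fstL 1 ℝ ℝ E2) ≠ 0 := fun h0 => by
    have := congrArg (fun f => f (toLp 1 ((1 : ℝ), (0 : E2)))) h0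
    simp at this
  refine signEquiv_of_flip hz h.lower (fun w hw hw0 g' hg' => ?_) _ ?_
  · have hwS : w ∈ S := by
      unfold ncol at hw0; split_ifs at hw0 with h1 h2
      · norm_num at hw0
      · exact h2
      · norm_num at hw0
    have hwZ : w ∈ Z := (mem_filter.1 hwS).1
    have hag : ∀ v ∈ verts (lk K w), ncol C S v = zcol T Z v := fun v hv => by
      obtain ⟨hne, hwv⟩ := mem_verts_lk.1 hv
      by_cases hvT : v ∈ T
      · have hvC : v ∉ C := fun hc => h.out_not_T hm hc hvT
        by_cases hvZ : v ∈ Z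
        · have : v ∈ S := by
            rw [comp_eq hSm hwS]
            exact cl_closed (mem_cl_self hwZ) hvZ hwv
          simp [ncol, zcol, hvC, this, hvZ]
        · have : v ∉ S := fun hv => hvZ (mem_filter.1 hv).1
          simp [ncol, zcol, hvC, this, hvZ, hvT]
      · have hvC : v ∈ C := h.nbd_out hm hwS hvT hwv
        have hvZ : v ∉ Z := fun hz => hvT (h.subZ hz)
        simp [ncol, zcol, hvC, hvZ, hvT]
    have hL := isLowerSet_lk h.lower w
    have h1 := h.signPair_vertex hwZ (g' := fun v => if v ∈ verts (lk K w) then g' v else zcol T Z v) (by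
      intro v
      by_cases hv : v ∈ verts (lk K w)
      · simp only [if_pos hv, ← hag v hv]; exact hg' v
      · grind)
    exact h1.of_equiv (SignEquiv.of_eqOn hL fun v hv => by simp [hv])
  · intro v
    have : v ∈ S → v ∉ C := fun hv hc => h.out_not_T hm hc (h.subZ (mem_filter.1 hv).1)
    by_cases h1 : v ∈ C <;> by_cases h2 : v ∈ S <;> simp [ncol, pmCol, h1, h2]

end Trig
end

section
open scoped Classical
variable {ι : Type} [Fintype ι] [DecidableEq ι] (ℓ : ι → R3 →ᵃ[ℝ] ℝ) (I : Set ι)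

/-- The sign vector of a point with respect to a family of affine functions. -/
def sgn (x : R3) : ι → SignType := fun i => sign (ℓ i x)

/-- The polyhedral region cut out by the functions indexed by `I`. -/
def region : Set R3 := {x | ∀ i ∈ I, 0 ≤ ℓ i x}

/-- Sign vectors realized in the region. -/
def Good (s : ι → SignType) : Prop := ∃ x ∈ region ℓ I, sgn ℓ x = s

/-- A chosen point in a cell. -/
def cpt (s : ι → SignType) : R3 := if h : Good ℓ I s then h.choose else 0

/-- The face relation on sign vectors. -/
def Fle (s t : ι → SignType) : Prop := ∀ i, s i = 0 ∨ s i = t i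

/-- The order complex of the cells of the region. -/
def cellCx : Set (Finset (ι → SignType)) := {σ | (∀ s ∈ σ, Good ℓ I s) ∧ ∀ s ∈ σ, ∀ t ∈ σ, Fle s t ∨ Fle t s}

/-- Homogenized weighted sum of the chosen points. -/
def wsum (w : (ι → SignType) → ℝ) : ℝ × R3 := ∑ s, w s • ((1 : ℝ), cpt ℓ I s)

/-- The homogenization of an affine function. -/
def hom (f : R3 →ᵃ[ℝ] ℝ) : ℝ × R3 →ₗ[ℝ] ℝ := (LinearMap.toSpanSingleton ℝ ℝ (f 0)).coprod f.linear

theorem hom_one (f : R3 →ᵃ[ℝ] ℝ) (x : R3) : hom f (1, x) = f x := by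
  have := f.map_vadd 0 x
  simp only [vadd_eq_add, add_zero] at this
  rw [this]; simp [hom, add_comm]

/-- The map from the realization of the order complex. -/
def cmap (w : (ι → SignType) → ℝ) : R3 := ∑ s, w s • cpt ℓ I s

variable {ℓ I}

theorem cpt_spec {s : ι → SignType} (h : Good ℓ I s) : cpt ℓ I s ∈ region ℓ I ∧ sgn ℓ (cpt ℓ I s) = s := by
  rw [cpt, dif_pos h]; exact h.choose_spec

theorem wsum_eq (w : (ι → SignType) → ℝ) : wsum ℓ I w = (∑ s, w s, cmap ℓ I w) := by
  ext1 <;> simp [wsum, cmap, Prod.fst_sum, Prod.snd_sum]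

theorem wsum_add (w w' : (ι → SignType) → ℝ) : wsum ℓ I (w + w') = wsum ℓ I w + wsum ℓ I w' := by
  simp only [wsum, Pi.add_apply, add_smul, sum_add_distrib]

theorem wsum_single (s : ι → SignType) (a : ℝ) : wsum ℓ I (single s a) = a • ((1 : ℝ), cpt ℓ I s) := by
  rw [wsum, sum_eq_single s]
  · simp
  · intro b _ hb; simp [hb]
  · simp

theorem hom_wsum (f : R3 →ᵃ[ℝ] ℝ) (w : (ι → SignType) → ℝ) :
    hom f (wsum ℓ I w) = ∑ s, w s * f (cpt ℓ I s) := by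
  simp only [wsum, map_sum, map_smul, hom_one, smul_eq_mul]

theorem Fle.refl (s : ι → SignType) : Fle s s := fun _ => Or.inr rfl

theorem Fle.trans {s t u : ι → SignType} (h : Fle s t) (h' : Fle t u) : Fle s u := fun i => by
  rcases h i with h1 | h1
  · exact Or.inl h1
  · rw [h1]; exact h' i

theorem isLowerSet_cellCx : IsLowerSet (cellCx ℓ I) := fun _ _ hτ hσ =>
  ⟨fun s hs => hσ.1 s (hτ hs), fun s hs t ht => hσ.2 s (hτ hs) t (hτ ht)⟩

theorem mem_verts_cellCx {s : ι → SignType} : s ∈ verts (cellCx ℓ I) ↔ Good ℓ I s := by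
  rw [mem_verts]
  simp [cellCx, Fle.refl]

theorem pair_cellCx {s t : ι → SignType} : {s, t} ∈ cellCx ℓ I ↔ Good ℓ I s ∧ Good ℓ I t ∧ (Fle s t ∨ Fle t s) := by
  simp [cellCx, Fle.refl]; tauto

theorem exists_top {σ : Finset (ι → SignType)} (hσ : σ ∈ cellCx ℓ I) (hne : σ.Nonempty) :
    ∃ s ∈ σ, ∀ t ∈ σ, Fle t s := by
  induction hne using Finset.Nonempty.cons_induction with
  | singleton a => exact ⟨a, by simp, by simp [Fle.refl]⟩
  | cons a τ ha hτ ih =>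
    rw [Finset.cons_eq_insert] at hσ ⊢
    obtain ⟨s, hs, hst⟩ := ih (isLowerSet_cellCx (Finset.subset_insert _ _) hσ)
    rcases hσ.2 s (Finset.mem_insert_of_mem hs) a (mem_insert_self _ _) with h | h
    · refine ⟨a, mem_insert_self _ _, fun t ht => ?_⟩
      rcases Finset.mem_insert.1 ht with rfl | ht
      exacts [Fle.refl _, (hst t ht).trans h]
    · aesop

theorem sign_wsum {w : (ι → SignType) → ℝ} (h0 : ∀ s, 0 ≤ w s) (hw : vsupp w ∈ cellCx ℓ I)
    {s : ι → SignType} (hs : s ∈ vsupp w) (hst : ∀ t ∈ vsupp w, Fle t s) (i : ι) :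
    sign (hom (ℓ i) (wsum ℓ I w)) = s i := by
  rw [hom_wsum]
  have hsg : ∀ t ∈ vsupp w, sign (ℓ i (cpt ℓ I t)) = t i := fun t ht => congrFun (cpt_spec (hw.1 t ht)).2 i
  have hspos : 0 < w s := (h0 s).lt_of_ne' (mem_vsupp.1 hs)
  have hz : ∀ t, t ∉ vsupp w → w t = 0 := fun t ht => by simp_all
  rcases hsi : s i with _ | _ | _
  · change _ = (0 : SignType)
    rw [sign_eq_zero_iff]
    refine sum_eq_zero fun t _ => ?_
    by_cases ht : t ∈ vsupp w
    · have h1 : t i = 0 := by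
        rcases hst t ht i with h | h
        exacts [h, h.trans hsi]
      rw [sign_eq_zero_iff.1 ((hsg t ht).trans h1), mul_zero]
    · rw [hz t ht, zero_mul]
  · change _ = (-1 : SignType)
    rw [sign_eq_neg_one_iff]
    refine sum_neg' (fun t _ => ?_) ⟨s, Finset.mem_univ _, ?_⟩
    · by_cases ht : t ∈ vsupp w
      · refine mul_nonpos_of_nonneg_of_nonpos (h0 t) ?_
        rcases hst t ht i with h | h
        · exact (sign_eq_zero_iff.1 ((hsg t ht).trans h)).le
        · exact (sign_eq_neg_one_iff.1 ((hsg t ht).trans (h.trans hsi))).le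
      · rw [hz t ht, zero_mul]
    · exact mul_neg_of_pos_of_neg hspos (sign_eq_neg_one_iff.1 ((hsg s hs).trans hsi))
  · change _ = (1 : SignType)
    rw [sign_eq_one_iff]
    refine sum_pos' (fun t _ => ?_) ⟨s, Finset.mem_univ _, ?_⟩
    · by_cases ht : t ∈ vsupp w
      · refine mul_nonneg (h0 t) ?_
        rcases hst t ht i with h | h
        · exact (sign_eq_zero_iff.1 ((hsg t ht).trans h)).ge
        · exact (sign_eq_one_iff.1 ((hsg t ht).trans (h.trans hsi))).le
      · rw [hz t ht, zero_mul]
    · exact mul_pos hspos (sign_eq_one_iff.1 ((hsg s hs).trans hsi))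

theorem wsum_inj : ∀ n : ℕ, ∀ w w' : (ι → SignType) → ℝ, (vsupp w).card + (vsupp w').card = n →
    (∀ s, 0 ≤ w s) → (∀ s, 0 ≤ w' s) → vsupp w ∈ cellCx ℓ I → vsupp w' ∈ cellCx ℓ I →
    wsum ℓ I w = wsum ℓ I w' → w = w' := fun n => by
  induction n using Nat.strong_induction_on with
  | _ n ih =>
  intro w w' hn h0 h0' hw hw' he
  have hsum : ∑ s, w s = ∑ s, w' s := by
    have := congrArg Prod.fst he
    rwa [wsum_eq, wsum_eq] at this
  have hzero : ∀ w : (ι → SignType) → ℝ, (∀ s, 0 ≤ w s) → ∑ s, w s = 0 → w = 0 := fun w h0 h => by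
    ext s; exact (sum_eq_zero_iff_of_nonneg fun s _ => h0 s).1 h s (Finset.mem_univ s)
  have hemp : ∀ w : (ι → SignType) → ℝ, ¬ (vsupp w).Nonempty → w = 0 := fun w h => by
    ext s; by_contra hs; exact h ⟨s, mem_vsupp.2 hs⟩
  by_cases hne : (vsupp w).Nonempty
  swap
  · have := hemp w hne
    subst this
    rw [hzero w' h0' (by rw [← hsum]; simp)]
  by_cases hne' : (vsupp w').Nonempty
  swap
  · have := hemp w' hne'
    subst this
    rw [hzero w h0 (by rw [hsum]; simp)]
  obtain ⟨s, hs, hst⟩ := exists_top hw hne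
  obtain ⟨s', hs', hst'⟩ := exists_top hw' hne'
  have hss : s = s' := by ext1 i; rw [← sign_wsum h0 hw hs hst i, he, sign_wsum h0' hw' hs' hst' i]
  subst hss
  have red : ∀ (w : (ι → SignType) → ℝ) (a : ℝ), (∀ t, 0 ≤ w t) → s ∈ vsupp w → a ≤ w s →
      (∀ t, 0 ≤ (w + (single s (-a) : (ι → SignType) → ℝ)) t) ∧ vsupp (w + single s (-a)) ⊆ vsupp w ∧
      (a = w s → vsupp (w + single s (-a)) ⊆ (vsupp w).erase s) := fun w a h0 hs ha => by
    refine ⟨fun t => ?_, fun t ht => ?_, fun ha t ht => ?_⟩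
    · by_cases h : t = s
      · subst h; simp; linarith
      · simpa [h] using h0 t
    · by_cases h : t = s
      · subst h; exact hs
      · rw [mem_vsupp] at ht ⊢; simpa [h] using ht
    · rw [mem_vsupp] at ht
      by_cases h : t = s
      · subst h; simp [ha] at ht
      · rw [mem_erase, mem_vsupp]; exact ⟨h, by simpa [h] using ht⟩
  set a := min (w s) (w' s) with ha
  obtain ⟨r1, r2, r3⟩ := red w a h0 hs (min_le_left _ _)
  obtain ⟨r1', r2', r3'⟩ := red w' a h0' hs' (min_le_right _ _)
  have hlt : (vsupp (w + single s (-a))).card + (vsupp (w' + single s (-a))).card < n := by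
    rw [← hn]
    rcases min_choice (w s) (w' s) with h | h
    · have := Finset.card_le_card (r3 (ha.trans h))
      rw [card_erase_of_mem hs] at this
      have := Finset.card_le_card r2'
      have := Finset.card_pos.2 ⟨s, hs⟩
      omega
    · have := Finset.card_le_card (r3' (ha.trans h))
      rw [card_erase_of_mem hs'] at this
      have := Finset.card_le_card r2
      have := Finset.card_pos.2 ⟨s, hs'⟩
      omega
  exact add_right_cancel (ih _ hlt _ _ rfl r1 r1' (isLowerSet_cellCx r2 hw) (isLowerSet_cellCx r2' hw')
    (by rw [wsum_add, wsum_add, he]))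

theorem linInd_cell {σ : Finset (ι → SignType)} (hσ : σ ∈ cellCx ℓ I) :
    LinearIndependent ℝ (fun s : σ => ((1 : ℝ), cpt ℓ I s.1)) := by
  rw [Fintype.linearIndependent_iff]
  intro c hc
  set w : (ι → SignType) → ℝ := fun s => if h : s ∈ σ then c ⟨s, h⟩ else 0 with hw
  have hE : wsum ℓ I w = 0 := by
    rw [← hc, wsum, ← sum_subset (Finset.subset_univ σ) (fun s _ hs => by aesop), ← sum_coe_sort]
    exact sum_congr rfl fun s _ => by simp [hw]
  have hsub : ∀ f : ℝ → ℝ, f 0 = 0 → vsupp (fun s => f (w s)) ⊆ σ := fun f hf s hs => by aesop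
  have hpm : ((fun s => max (w s) 0) : (ι → SignType) → ℝ) = fun s => max (-w s) 0 := by
    refine wsum_inj _ _ _ rfl (fun s => le_max_right _ _) (fun s => le_max_right _ _)
      (isLowerSet_cellCx (hsub (fun x => max x 0) (by simp)) hσ)
      (isLowerSet_cellCx (hsub (fun x => max (-x) 0) (by simp)) hσ) ?_
    have : ((fun s => max (w s) 0) : (ι → SignType) → ℝ) = w + fun s => max (-w s) 0 := by
      ext s; simp only [Pi.add_apply]
      grind
    rw [this, wsum_add, hE, zero_add]
  intro s
  have h1 := congrFun hpm s.1
  grind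

theorem card_cell {σ : Finset (ι → SignType)} (hσ : σ ∈ cellCx ℓ I) : σ.card ≤ 4 := by
  have := (linInd_cell hσ).fintype_card_le_finrank
  simpa [finrank_prod] using this

theorem continuous_cmap : Continuous (cmap ℓ I) := by unfold cmap; fun_prop

theorem sgn_cmap {w : (ι → SignType) → ℝ} (hw : w ∈ realiz (cellCx ℓ I))
    {s : ι → SignType} (hs : s ∈ vsupp w) (hst : ∀ t ∈ vsupp w, Fle t s) : sgn ℓ (cmap ℓ I w) = s := by
  ext1 i
  rw [← sign_wsum hw.1 hw.2.2 hs hst i, wsum_eq, hw.2.1, hom_one]; rfl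

theorem top_realiz {w : (ι → SignType) → ℝ} (hw : w ∈ realiz (cellCx ℓ I)) :
    ∃ s ∈ vsupp w, ∀ t ∈ vsupp w, Fle t s := by
  refine exists_top hw.2.2 ?_
  by_contra h
  have h1 := hw.2.1
  rw [sum_eq_zero fun s _ => by_contra fun hs => h ⟨s, mem_vsupp.2 hs⟩] at h1
  norm_num at h1

theorem mem_region_iff {x : R3} : x ∈ region ℓ I ↔ ∀ i ∈ I, 0 ≤ sgn ℓ x i := by
  simp only [region, mem_setOf_eq, sgn, sign_nonneg_iff]

theorem cmap_mem {w : (ι → SignType) → ℝ} (hw : w ∈ realiz (cellCx ℓ I)) : cmap ℓ I w ∈ region ℓ I := by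
  obtain ⟨s, hs, hst⟩ := top_realiz hw
  rw [mem_region_iff, sgn_cmap hw hs hst]
  have h := cpt_spec (hw.2.2.1 s hs)
  rw [mem_region_iff, h.2] at h
  exact h.1

theorem cmap_injOn : InjOn (cmap ℓ I) (realiz (cellCx ℓ I)) := fun w hw w' hw' he =>
  wsum_inj _ w w' rfl hw.1 hw'.1 hw.2.2 hw'.2.2 (by rw [wsum_eq, wsum_eq, hw.2.1, hw'.2.1, he])

end

section
open scoped Classical
variable {ι : Type} [Fintype ι] [DecidableEq ι] {ℓ : ι → R3 →ᵃ[ℝ] ℝ} {I : Set ι}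

theorem continuous_aff (f : R3 →ᵃ[ℝ] ℝ) : Continuous f := f.continuous_of_finiteDimensional

theorem fle_sgn_iff {x : R3} {s : ι → SignType} :
    Fle (sgn ℓ x) s ↔ ∀ i, (0 ≤ s i → 0 ≤ ℓ i x) ∧ (s i ≤ 0 → ℓ i x ≤ 0) := by
  refine forall_congr' fun i => ?_
  simp only [sgn, sign_eq_zero_iff]
  rcases h : s i with _ | _ | _
  · change (_ ∨ _ = (0 : SignType)) ↔ ((0 : SignType) ≤ 0 → _) ∧ ((0 : SignType) ≤ 0 → _)
    rw [sign_eq_zero_iff]; simp; exact ⟨fun h => ⟨h.ge, h.le⟩, fun h => le_antisymm h.2 h.1⟩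
  · change (_ ∨ _ = (-1 : SignType)) ↔ ((0 : SignType) ≤ -1 → _) ∧ ((-1 : SignType) ≤ 0 → _)
    rw [sign_eq_neg_one_iff, show ((0 : SignType) ≤ -1) = False by decide, show ((-1 : SignType) ≤ 0) = True by decide]
    simp [le_iff_lt_or_eq, or_comm]
  · change (_ ∨ _ = (1 : SignType)) ↔ ((0 : SignType) ≤ 1 → _) ∧ ((1 : SignType) ≤ 0 → _)
    rw [sign_eq_one_iff, show ((0 : SignType) ≤ 1) = True by decide, show ((1 : SignType) ≤ 0) = False by decide]
    simp [le_iff_lt_or_eq, or_comm, eq_comm]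

theorem isClosed_fle (s : ι → SignType) : IsClosed {x : R3 | Fle (sgn ℓ x) s} := by
  simp only [fle_sgn_iff, setOf_forall, setOf_and]
  refine isClosed_iInter fun i => IsClosed.inter ?_ ?_ <;> refine isClosed_iInter fun _ => ?_
  · exact isClosed_le continuous_const (continuous_aff _)
  · exact isClosed_le (continuous_aff _) continuous_const

theorem region_of_fle {x : R3} {s : ι → SignType} (hs : Good ℓ I s) (h : Fle (sgn ℓ x) s) : x ∈ region ℓ I := by
  obtain ⟨y, hy, rfl⟩ := hs
  rw [mem_region_iff] at hy ⊢
  intro i hi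
  rcases h i with h1 | h1
  · exact h1.ge
  · rw [h1]; exact hy i hi

theorem isClosed_region : IsClosed (region ℓ I) := by
  simp only [region, setOf_forall]
  exact isClosed_iInter fun i => isClosed_iInter fun _ => isClosed_le continuous_const (continuous_aff _)

theorem aff_lineMap (f : R3 →ᵃ[ℝ] ℝ) (b p : R3) (t : ℝ) :
    f (lineMap b p t) = f b + t * (f p - f b) := by
  rw [AffineMap.apply_lineMap, AffineMap.lineMap_apply]; simp; ring

theorem exists_exit (hbd : IsBounded (region ℓ I)) {b p : R3} (hb : b ∈ region ℓ I)
    (hs : sgn ℓ p = sgn ℓ b) (hne : b ≠ p) :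
    ∃ τ : ℝ, 1 ≤ τ ∧ Fle (sgn ℓ (lineMap b p τ)) (sgn ℓ b) ∧
      sgn ℓ (lineMap b p τ) ≠ sgn ℓ b := by
  set q : ℝ → R3 := fun t => lineMap b p t with hq
  have hqc : Continuous q := lineMap_continuous
  set A : Set ℝ := {t | Fle (sgn ℓ (q t)) (sgn ℓ b)} with hA
  have hAc : IsClosed A := (isClosed_fle _).preimage hqc
  have h1 : (1 : ℝ) ∈ A := by simp only [hA, hq, mem_setOf_eq, AffineMap.lineMap_apply_one, hs]; exact Fle.refl _
  obtain ⟨C, hC⟩ := hbd.subset_closedBall b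
  have hd : 0 < ‖p - b‖ := norm_pos_iff.2 (sub_ne_zero.2 hne.symm)
  have hAb : BddAbove A := by
    refine ⟨C / ‖p - b‖, fun t ht => ?_⟩
    have := hC (region_of_fle ⟨b, hb, rfl⟩ ht)
    rw [Metric.mem_closedBall, hq, dist_lineMap_left, dist_comm b p, dist_eq_norm p b] at this
    rw [le_div_iff₀ hd]
    exact (mul_le_mul_of_nonneg_right (le_abs_self t) hd.le).trans this
  have hm : sSup A ∈ A := hAc.csSup_mem ⟨1, h1⟩ hAb
  refine ⟨sSup A, le_csSup hAb h1, hm, fun he => ?_⟩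
  have hev : ∀ᶠ t in 𝓝 (sSup A), t ∈ A := by
    simp only [hA, mem_setOf_eq, Fle]
    rw [Filter.eventually_all]
    intro i
    have hci : Continuous fun t => ℓ i (q t) := (continuous_aff _).comp hqc
    have hei := congrFun he i
    rcases lt_trichotomy (ℓ i b) 0 with h | h | h
    · have h2 : sign (ℓ i b) = -1 := sign_eq_neg_one_iff.2 h
      filter_upwards [hci.continuousAt.eventually_lt continuousAt_const (sign_eq_neg_one_iff.1 (hei.trans h2))]
        with t ht
      exact Or.inr ((sign_eq_neg_one_iff.2 ht).trans h2.symm)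
    · refine Filter.Eventually.of_forall fun t => Or.inl ?_
      have h3 : ℓ i p = 0 := by
        have := congrFun hs i
        simp only [sgn, h, sign_zero, sign_eq_zero_iff] at this
        exact this
      simp [sgn, hq, h, h3]
    · have h2 : sign (ℓ i b) = 1 := sign_eq_one_iff.2 h
      filter_upwards [continuousAt_const.eventually_lt hci.continuousAt (sign_eq_one_iff.1 (hei.trans h2))]
        with t ht
      exact Or.inr ((sign_eq_one_iff.2 ht).trans h2.symm)
  obtain ⟨t, ht, ht'⟩ := (hev.and_frequently (frequently_gt_nhds (sSup A))).exists
  exact absurd (le_csSup hAb ht) (not_le.2 ht')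

theorem cmap_add (w w' : (ι → SignType) → ℝ) : cmap ℓ I (w + w') = cmap ℓ I w + cmap ℓ I w' := by
  simp only [cmap, Pi.add_apply, add_smul, sum_add_distrib]

theorem cmap_smul (a : ℝ) (w : (ι → SignType) → ℝ) : cmap ℓ I (a • w) = a • cmap ℓ I w := by
  simp only [cmap, Finset.smul_sum, Pi.smul_apply, smul_eq_mul, mul_smul]

theorem cmap_single (s : ι → SignType) (a : ℝ) : cmap ℓ I (single s a) = a • cpt ℓ I s := by
  rw [cmap, sum_eq_single s]
  · simp
  · intro b _ hb; simp [hb]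
  · simp

theorem exists_weights (hbd : IsBounded (region ℓ I)) : ∀ n, ∀ p ∈ region ℓ I,
    (Finset.univ.filter fun i => sgn ℓ p i ≠ 0).card = n →
    ∃ w ∈ realiz (cellCx ℓ I), cmap ℓ I w = p ∧ ∀ t ∈ vsupp w, Fle t (sgn ℓ p) := fun n => by
  induction n using Nat.strong_induction_on with
  | _ n ih =>
  intro p hp hn
  have hg : Good ℓ I (sgn ℓ p) := ⟨p, hp, rfl⟩
  set s := sgn ℓ p with hs
  obtain ⟨hb, hbs⟩ := cpt_spec hg
  by_cases hne : cpt ℓ I s = p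
  · refine ⟨single s 1, single_mem_realiz (mem_verts_cellCx.2 hg), by rw [cmap_single, one_smul, hne], ?_⟩
    intro t ht
    have : t = s := by by_contra h; exact mem_vsupp.1 ht (by simp [h])
    rw [this]; exact Fle.refl _
  · obtain ⟨τ, h1, hf, hsn⟩ := exists_exit hbd hb (hs.symm.trans hbs.symm) hne
    rw [hbs] at hf hsn
    set r : R3 := lineMap (cpt ℓ I s) p τ with hr
    obtain ⟨w, hw, hwr, hwt⟩ := ih _ (by
      rw [← hn]
      refine Finset.card_lt_card ⟨fun i hi => ?_, fun hsub => hsn ?_⟩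
      · simp only [mem_filter_univ] at hi ⊢
        rwa [← (hf i).resolve_left hi]
      · ext1 i
        rcases hf i with h | h
        · rw [h]
          by_contra h0
          exact (mem_filter.1 (hsub (mem_filter.2 ⟨Finset.mem_univ i, Ne.symm h0⟩))).2 h
        · exact h) r (region_of_fle hg hf) rfl
    have hτ : 0 < τ := by linarith
    have hτ1 : τ⁻¹ ≤ 1 := inv_le_one_of_one_le₀ h1
    refine ⟨single s (1 - τ⁻¹) + τ⁻¹ • w, ⟨fun t => ?_, ?_, ?_⟩, ?_, ?_⟩
    · have h2 : 0 ≤ (single s (1 - τ⁻¹) : (ι → SignType) → ℝ) t := by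
        by_cases h : t = s
        · subst h; simp; linarith
        · simp [h]
      exact add_nonneg h2 (mul_nonneg (inv_nonneg.2 hτ.le) (hw.1 t))
    · simp only [Pi.add_apply, Pi.smul_apply, smul_eq_mul, sum_add_distrib, ← mul_sum, hw.2.1]
      simp
    · refine isLowerSet_cellCx (a := insert s (vsupp w)) (fun t ht => ?_) ⟨?_, ?_⟩
      · rw [Finset.mem_insert, mem_vsupp]
        by_contra! hcon
        exact mem_vsupp.1 ht (by simp_all)
      · intro t ht
        rcases Finset.mem_insert.1 ht with rfl | ht
        exacts [hg, hw.2.2.1 t ht]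
      · intro t ht u hu
        have hl : ∀ t ∈ vsupp w, Fle t s := fun t ht => (hwt t ht).trans hf
        rcases Finset.mem_insert.1 ht with rfl | ht <;> rcases Finset.mem_insert.1 hu with rfl | hu
        exacts [Or.inl (Fle.refl _), Or.inr (hl u hu), Or.inl (hl t ht), hw.2.2.2 t ht u hu]
    · rw [cmap_add, cmap_single, cmap_smul, hwr, hr, AffineMap.lineMap_apply_module']
      rw [smul_add, smul_smul, inv_mul_cancel₀ hτ.ne']
      module
    · intro t ht
      by_cases h : t = s
      · rw [h]; exact Fle.refl _
      · refine (hwt t (mem_vsupp.2 fun h0 => mem_vsupp.1 ht ?_)).trans hf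
        simp [h, h0]

theorem cmap_homeo (hbd : IsBounded (region ℓ I)) :
    HomeoOn (cmap ℓ I) (realiz (cellCx ℓ I)) (region ℓ I) :=
  ⟨continuous_cmap.continuousOn, fun w hw => cmap_mem hw, cmap_injOn, fun p hp => by
    obtain ⟨w, hw, hwp, -⟩ := exists_weights hbd _ p hp rfl
    exact ⟨w, hw, hwp⟩⟩

/-- The point of a cell of the order complex lies in the relative interior of the top cell. -/
theorem vsupp_le_sgn {w : (ι → SignType) → ℝ} (hw : w ∈ realiz (cellCx ℓ I)) :
    sgn ℓ (cmap ℓ I w) ∈ vsupp w ∧ ∀ t ∈ vsupp w, Fle t (sgn ℓ (cmap ℓ I w)) := by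
  obtain ⟨s, hs, hst⟩ := top_realiz hw
  rw [sgn_cmap hw hs hst]
  exact ⟨hs, hst⟩

/-- Full subcomplexes on down-closed sets of sign vectors. -/
theorem mem_realiz_res {T : Finset (ι → SignType)} (hT : ∀ s ∈ T, ∀ t, Good ℓ I t → Fle t s → t ∈ T)
    {w : (ι → SignType) → ℝ} (hw : w ∈ realiz (cellCx ℓ I)) :
    w ∈ realiz (res (cellCx ℓ I) T) ↔ sgn ℓ (cmap ℓ I w) ∈ T := by
  obtain ⟨h1, h2⟩ := vsupp_le_sgn hw
  constructor
  · intro h; exact h.2.2.2 h1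
  · intro h; exact ⟨hw.1, hw.2.1, hw.2.2, fun t ht => hT _ h t (hw.2.2.1 t ht) (h2 t ht)⟩

end

section
open scoped Classical
variable {ι : Type} [Fintype ι] [DecidableEq ι] {ℓ : ι → R3 →ᵃ[ℝ] ℝ} {I : Set ι} {N : Set R3}

/-- An arrangement of affine functions adapted to a compact set `N`. -/
structure Adapted (ℓ : ι → R3 →ᵃ[ℝ] ℝ) (I : Set ι) (N : Set R3) : Prop where
  bdd : IsBounded (region ℓ I)
  pos : ∀ x ∈ N, ∀ i ∈ I, 0 < ℓ i x
  sat : ∀ x ∈ N, ∀ y, sgn ℓ y = sgn ℓ x → y ∈ N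
  bconn : _root_.IsConnected {x ∈ region ℓ I | ∃ i ∈ I, ℓ i x = 0}
  closed : IsClosed N

variable (ℓ I N) in
/-- Cells contained in `N`. -/
def cells : Finset (ι → SignType) := Finset.univ.filter fun s => Good ℓ I s ∧ cpt ℓ I s ∈ N

variable (ℓ I N) in
/-- Cells contained in `N` and in the closure of a cell off `N`. -/
def bcells : Finset (ι → SignType) := (cells ℓ I N).filter fun s => ∃ s', Good ℓ I s' ∧ s' ∉ cells ℓ I N ∧ Fle s s'

theorem mem_cells {s : ι → SignType} : s ∈ cells ℓ I N ↔ Good ℓ I s ∧ cpt ℓ I s ∈ N := by simp [cells]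

theorem cmap_pos {w : (ι → SignType) → ℝ} (hw : w ∈ realiz (cellCx ℓ I)) {u : ι → SignType} (hu : u ∈ vsupp w)
    {i : ι} (hi : i ∈ I) (hp : 0 < ℓ i (cpt ℓ I u)) : 0 < ℓ i (cmap ℓ I w) := by
  have : ℓ i (cmap ℓ I w) = ∑ s, w s * ℓ i (cpt ℓ I s) := by rw [← hom_wsum, wsum_eq, hw.2.1, hom_one]
  rw [this]
  refine sum_pos' (fun s _ => ?_) ⟨u, Finset.mem_univ _, mul_pos ?_ hp⟩
  · by_cases hs : s ∈ vsupp w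
    · exact mul_nonneg (hw.1 s) ((cpt_spec (hw.2.2.1 s hs)).1 i hi)
    · simp_all
  · exact lt_of_le_of_ne (hw.1 u) (Ne.symm (mem_vsupp.1 hu))

namespace Adapted
variable (h : Adapted ℓ I N)
include h

theorem sub_region : N ⊆ region ℓ I := fun x hx i hi => (h.pos x hx i hi).le

theorem down : ∀ s ∈ cells ℓ I N, ∀ t, Good ℓ I t → Fle t s → t ∈ cells ℓ I N := fun s hs t ht hts => by
  obtain ⟨hs, hsN⟩ := mem_cells.1 hs
  have hc : Continuous fun ε : ℝ => lineMap (cpt ℓ I t) (cpt ℓ I s) ε := lineMap_continuous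
  have ht0 : Tendsto (fun ε : ℝ => lineMap (cpt ℓ I t) (cpt ℓ I s) ε) (𝓝[>] 0)
      (𝓝 (cpt ℓ I t)) := by
    have := hc.tendsto 0
    rw [AffineMap.lineMap_apply_zero] at this
    exact this.mono_left nhdsWithin_le_nhds
  refine mem_cells.2 ⟨ht, h.closed.mem_of_tendsto ht0 ?_⟩
  filter_upwards [Ioc_mem_nhdsGT (zero_lt_one' ℝ)] with ε hε
  refine h.sat _ hsN _ ?_
  ext1 i
  have e1 := congrFun (cpt_spec hs).2 i
  have e2 := congrFun (cpt_spec ht).2 i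
  have hcv : ∀ a b : ℝ, a + ε * (b - a) = (1 - ε) * a + ε * b := fun a b => by ring
  simp only [sgn, aff_lineMap] at e1 e2 ⊢
  rw [hcv]
  rcases hts i with h0 | h0
  · rw [h0, sign_eq_zero_iff] at e2
    rw [e2, mul_zero, zero_add, sign_mul, sign_pos hε.1, one_mul]
  · rw [h0, ← e1] at e2
    rcases lt_trichotomy (ℓ i (cpt ℓ I s)) 0 with hl | hl | hl
    · rw [sign_neg hl, sign_eq_neg_one_iff] at e2
      rw [sign_neg hl, sign_eq_neg_one_iff]
      nlinarith [hε.1, hε.2, mul_neg_of_pos_of_neg hε.1 hl, mul_nonneg (sub_nonneg.2 hε.2) (neg_nonneg.2 e2.le)]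
    · rw [hl, sign_zero, sign_eq_zero_iff] at e2
      rw [hl, e2]; simp
    · rw [sign_pos hl, sign_eq_one_iff] at e2
      rw [sign_pos hl, sign_eq_one_iff]
      nlinarith [hε.1, hε.2, mul_pos hε.1 hl, mul_nonneg (sub_nonneg.2 hε.2) e2.le]

theorem sgn_mem_cells {x : R3} (hx : x ∈ region ℓ I) : sgn ℓ x ∈ cells ℓ I N ↔ x ∈ N := by
  have hg : Good ℓ I (sgn ℓ x) := ⟨x, hx, rfl⟩
  rw [mem_cells]
  exact ⟨fun hh => h.sat _ hh.2 _ (cpt_spec hg).2.symm, fun hh => ⟨hg, h.sat _ hh _ (cpt_spec hg).2⟩⟩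

theorem homeo : HomeoOn (cmap ℓ I) (realiz (res (cellCx ℓ I) (cells ℓ I N))) N :=
  (cmap_homeo h.bdd).restrict (fun w hw => ⟨hw.1, hw.2.1, hw.2.2.1⟩) h.sub_region fun w hw => by
    rw [mem_realiz_res h.down hw, h.sgn_mem_cells (cmap_mem hw)]

theorem pos_cell {s : ι → SignType} (hs : s ∈ cells ℓ I N) {i : ι} (hi : i ∈ I) : 0 < ℓ i (cpt ℓ I s) :=
  h.pos _ (mem_cells.1 hs).2 i hi

theorem cmap_interior {w : (ι → SignType) → ℝ} (hw : w ∈ realiz (cellCx ℓ I)) {u : ι → SignType}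
    (hu : u ∈ vsupp w) (huT : u ∈ cells ℓ I N) : ∀ i ∈ I, 0 < ℓ i (cmap ℓ I w) := fun i hi =>
  cmap_pos hw hu hi (h.pos_cell huT hi)

end Adapted

theorem isOpen_pos (ℓ : ι → R3 →ᵃ[ℝ] ℝ) (I : Set ι) : IsOpen {x : R3 | ∀ i ∈ I, 0 < ℓ i x} := by
  have : {x : R3 | ∀ i ∈ I, 0 < ℓ i x} = ⋂ i ∈ I, {x | 0 < ℓ i x} := by ext; simp
  rw [this]
  exact (Set.toFinite I).isOpen_biInter fun i _ => isOpen_lt continuous_const (continuous_aff _)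

theorem pos_sub_interior : {x : R3 | ∀ i ∈ I, 0 < ℓ i x} ⊆ interior (region ℓ I) :=
  interior_maximal (fun x hx i hi => (hx i hi).le) (isOpen_pos ℓ I)

theorem HomeoOn.locPunct {A : Type} [TopologicalSpace A] {f : A → R3} {X : Set A} {Y : Set R3} (hX : IsCompact X)
    (hf : HomeoOn f X Y) {x : A} (hx : x ∈ X) (h : LocPunct (⟨f x, hf.bij.mapsTo hx⟩ : Y)) :
    LocPunct (⟨x, hx⟩ : X) := by
  have : CompactSpace X := isCompact_iff_compactSpace.1 hX
  let e : X ≃ₜ Y := Continuous.homeoOfEquivCompactToT2 (f := Equiv.ofBijective _ hf.bij.bijective)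
    (hf.cont.mapsToRestrict hf.bij.mapsTo)
  exact LocPunct.of_image e.isOpenEmbedding h

namespace Adapted
variable (h : Adapted ℓ I N)
include h

theorem locFace {σ : Finset (ι → SignType)} {u : ι → SignType} (hu : u ∈ σ) (huT : u ∈ cells ℓ I N) :
    LocFace (cellCx ℓ I) σ := fun hσ hne => by
  refine (cmap_homeo h.bdd).locPunct (isCompact_realiz isLowerSet_cellCx) _ (locPunct_interior _ ?_)
  exact pos_sub_interior (h.cmap_interior (bary_mem hσ hne) (by rwa [vsupp_bary hne]) huT)

theorem locFace_res (hN : IsManifold3WithBoundary N) {σ : Finset (ι → SignType)} :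
    LocFace (res (cellCx ℓ I) (cells ℓ I N)) σ := fun hσ hne => by
  exact h.homeo.locPunct (isCompact_realiz (isLowerSet_res isLowerSet_cellCx _)) _ (locPunct_manifold hN _)

end Adapted

theorem exists_functional {σ : Finset (ι → SignType)} (hσ : σ ∈ cellCx ℓ I) (hc : σ.card = 3) :
    ∃ f : ℝ × R3 →ₗ[ℝ] ℝ, ∀ x, f x = 0 ↔ ∃ c : (ι → SignType) → ℝ, (∀ s, s ∉ σ → c s = 0) ∧ wsum ℓ I c = x := by
  have hl := linInd_cell hσ
  set S := span ℝ (range fun s : σ => ((1 : ℝ), cpt ℓ I s.1)) with hS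
  have hS3 : finrank ℝ S = 3 := by rw [hS, finrank_span_eq_card hl]; simpa using hc
  have hE : finrank ℝ (ℝ × R3) = 4 := by simp
  have hlt : S < ⊤ := by
    refine lt_top_iff_ne_top.2 fun he => ?_
    rw [he, finrank_top] at hS3; omega
  obtain ⟨f, hf, hle⟩ := S.exists_le_ker_of_lt_top hlt
  have hker : finrank ℝ (ker f) = 3 := by
    have h1 := f.finrank_range_add_finrank_ker
    have h2 : finrank ℝ (LinearMap.range f) = 1 := by
      rw [LinearMap.range_eq_top.2 (LinearMap.surjective hf), finrank_top]; simp
    omega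
  have hSk : S = ker f := Submodule.eq_of_le_of_finrank_eq hle (by aesop)
  have key : ∀ c : (ι → SignType) → ℝ, (∀ s, s ∉ σ → c s = 0) →
      wsum ℓ I c = ∑ s : σ, c s • ((1 : ℝ), cpt ℓ I s.1) := fun c hc0 => by
    rw [wsum, sum_coe_sort σ fun s => c s • ((1 : ℝ), cpt ℓ I s)]
    refine (sum_subset (Finset.subset_univ σ) fun s _ hs => ?_).symm
    rw [hc0 s hs, zero_smul]
  refine ⟨f, fun x => ?_⟩
  rw [← mem_ker, ← hSk, hS, Submodule.mem_span_range_iff_exists_fun]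
  constructor
  · rintro ⟨c, rfl⟩
    refine ⟨fun s => if hs : s ∈ σ then c ⟨s, hs⟩ else 0, fun s hs => by simp [hs], ?_⟩
    rw [key _ (fun s hs => by simp [hs])]
    simp
  · rintro ⟨c, hc0, rfl⟩
    exact ⟨fun s => c s, (key c hc0).symm⟩

section
variable {σ : Finset (ι → SignType)} (hσ : σ ∈ cellCx ℓ I) {f : ℝ × R3 →ₗ[ℝ] ℝ}
  (hf : ∀ x, f x = 0 ↔ ∃ c : (ι → SignType) → ℝ, (∀ s, s ∉ σ → c s = 0) ∧ wsum ℓ I c = x)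
include hσ hf

theorem functional_zero {s : ι → SignType} (hs : s ∈ σ) : f (1, cpt ℓ I s) = 0 :=
  (hf _).2 ⟨single s 1, fun t ht => by
    rw [single_apply, if_neg]; rintro rfl; exact ht hs, by rw [wsum_single, one_smul]⟩

/-- Nonnegative combination of two apexes that lies in the plane of `σ` is trivial. -/
theorem apex_unique {z z' : ι → SignType} (hz : z ∉ σ) (hzσ : insert z σ ∈ cellCx ℓ I)
    (hzσ' : insert z' σ ∈ cellCx ℓ I) {a b : ℝ} (ha : 0 < a) (hb : 0 ≤ b)
    (he : a * f (1, cpt ℓ I z) = b * f (1, cpt ℓ I z')) : z = z' := by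
  by_contra hne
  have h0 : f (a • (1, cpt ℓ I z) - b • (1, cpt ℓ I z')) = 0 := by
    rw [map_sub, map_smul, map_smul, smul_eq_mul, smul_eq_mul, he, sub_self]
  obtain ⟨c, hc, hce⟩ := (hf _).1 h0
  have hsub : ∀ (y : ι → SignType) (r : ℝ) (d : (ι → SignType) → ℝ), (∀ s, s ∉ σ → d s = 0) →
      vsupp ((single y r : (ι → SignType) → ℝ) + d) ≤ insert y σ := fun y r d hd s hs => by
    by_contra hs'
    rw [Finset.mem_insert, not_or] at hs'
    exact mem_vsupp.1 hs (by aesop)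
  have hn : ∀ (y : ι → SignType) (r : ℝ) (d : (ι → SignType) → ℝ), 0 ≤ r → (∀ s, 0 ≤ d s) →
      ∀ s, 0 ≤ ((single y r : (ι → SignType) → ℝ) + d) s := fun y r d hr hd s => by
    refine add_nonneg ?_ (hd s)
    rw [single_apply]; split_ifs <;> simp [hr]
  obtain ⟨p, m, hp, hm, hp0, hm0, hpm⟩ : ∃ p m : (ι → SignType) → ℝ, (∀ s, 0 ≤ p s) ∧ (∀ s, 0 ≤ m s) ∧
      (∀ s, s ∉ σ → p s = 0) ∧ (∀ s, s ∉ σ → m s = 0) ∧ c + m = p :=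
    ⟨fun s => max (c s) 0, fun s => max (-c s) 0, fun s => le_max_right _ _, fun s => le_max_right _ _,
      fun s hs => by grind, fun s hs => by grind, funext fun s => by
        rcases le_total (c s) 0 with h | h <;> simp [h]⟩
  have h1 : wsum ℓ I (single z a + m) = wsum ℓ I (single z' b + p) := by
    rw [wsum_add, wsum_add, wsum_single, wsum_single, ← hpm, wsum_add, hce]; abel
  have h3 : (single z a + m : (ι → SignType) → ℝ) = single z' b + p := by
    refine wsum_inj _ _ _ rfl (hn z a m ha.le hm) (hn z' b p hb hp) ?_ ?_ h1
    · exact isLowerSet_cellCx (hsub z a m hm0) hzσ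
    · exact isLowerSet_cellCx (hsub z' b p hp0) hzσ'
  have h2 := congrFun h3 z
  simp only [Pi.add_apply, Pi.single_eq_same, hm0 z hz, hp0 z hz, add_zero, single_apply, if_neg hne] at h2
  exact ha.ne' h2

theorem functional_ne {z : ι → SignType} (hz : z ∉ σ) (hzσ : insert z σ ∈ cellCx ℓ I) :
    f (1, cpt ℓ I z) ≠ 0 := fun h0 => by
  obtain ⟨u, hu⟩ | hu := σ.eq_empty_or_nonempty.symm
  · have := apex_unique hσ hf hz hzσ (z' := u) (by grind) one_pos le_rfl
      (by aesop)
    exact hz (this ▸ hu)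
  · subst hu
    obtain ⟨c, hc, hce⟩ := (hf _).1 h0
    have h1 : c = 0 := funext fun s => hc s (by simp)
    have := congrArg Prod.fst hce
    simp [h1, wsum] at this

/-- On each side of the plane of a triangle with a vertex in `N` there is a tetrahedron. -/
theorem exists_apex (h : Adapted ℓ I N) {u : ι → SignType} (hu : u ∈ σ) (huT : u ∈ cells ℓ I N) {v : R3}
    (hv : 0 < f (0, v)) : ∃ z, z ∉ σ ∧ insert z σ ∈ cellCx ℓ I ∧ 0 < f (1, cpt ℓ I z) := by
  have hne : σ.Nonempty := ⟨u, hu⟩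
  have hb := bary_mem hσ hne
  obtain ⟨g, hg, hinv⟩ := (cmap_homeo h.bdd).exists_symm (isCompact_realiz isLowerSet_cellCx)
  set c := cmap ℓ I (bary σ) with hc
  have hcpos : ∀ i ∈ I, 0 < ℓ i c := h.cmap_interior hb (by rwa [vsupp_bary hne]) huT
  have hcint := pos_sub_interior hcpos
  have hgc : ContinuousAt g c := (hg.cont c (interior_subset hcint)).continuousAt (mem_interior_iff_mem_nhds.1 hcint)
  have hgb : g c = bary σ := hinv.1 hb
  have ht : Tendsto (fun ε : ℝ => c + ε • v) (𝓝[>] 0) (𝓝 c) := by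
    have hcont : Continuous fun ε : ℝ => c + ε • v := by fun_prop
    have := hcont.tendsto 0
    simp only [zero_smul, add_zero] at this
    exact this.mono_left nhdsWithin_le_nhds
  have hev1 : ∀ᶠ ε in 𝓝[>] (0 : ℝ), c + ε • v ∈ region ℓ I := ht (mem_interior_iff_mem_nhds.1 hcint)
  have hev2 : ∀ᶠ ε in 𝓝[>] (0 : ℝ), ∀ s ∈ σ, 0 < g (c + ε • v) s := by
    refine (Finset.eventually_all σ).2 fun s hs => ?_
    have h1 : Tendsto (fun ε : ℝ => g (c + ε • v) s) (𝓝[>] 0) (𝓝 (bary σ s)) := by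
      rw [← hgb]; exact ((continuous_apply s).tendsto _).comp (hgc.tendsto.comp ht)
    refine h1.eventually (lt_mem_nhds ?_)
    exact lt_of_le_of_ne (hb.1 s) (Ne.symm (mem_vsupp.1 (by rwa [vsupp_bary hne])))
  obtain ⟨ε, h1, h2, h3⟩ := (hev1.and (hev2.and self_mem_nhdsWithin)).exists
  have hε : (0 : ℝ) < ε := h3
  set w := g (c + ε • v) with hw
  have hwK : w ∈ realiz (cellCx ℓ I) := hg.bij.mapsTo h1
  have hwc : cmap ℓ I w = c + ε • v := hinv.2 h1
  have hfw : f (1, cmap ℓ I w) = ∑ s, w s * f (1, cpt ℓ I s) := by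
    have := wsum_eq (ℓ := ℓ) (I := I) w
    rw [hwK.2.1] at this
    rw [← this, wsum, map_sum]; simp only [map_smul, smul_eq_mul]
  have hfc : f (1, c) = 0 := by
    refine (hf _).2 ⟨bary σ, fun s hs => by simp [bary, hs], ?_⟩
    rw [wsum_eq, hb.2.1]
  have hpos : 0 < f (1, cmap ℓ I w) := by
    have : ((1 : ℝ), c + ε • v) = (1, c) + ε • ((0 : ℝ), v) := by simp
    rw [hwc, this, map_add, hfc, map_smul, zero_add]
    exact mul_pos hε hv
  rw [hfw] at hpos
  obtain ⟨z, -, hz⟩ := Finset.exists_lt_of_sum_lt (s := Finset.univ) (f := fun _ => (0 : ℝ))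
    (g := fun s => w s * f (1, cpt ℓ I s)) (by simp_all)
  have hz0 : w z ≠ 0 := by intro h0; simp [h0] at hz
  refine ⟨z, fun hzσ => ?_, isLowerSet_cellCx ?_ hwK.2.2,
    (mul_pos_iff_of_pos_left (lt_of_le_of_ne (hwK.1 z) hz0.symm)).1 hz⟩
  · rw [functional_zero hσ hf hzσ] at hz; simp at hz
  · intro s hs
    rcases Finset.mem_insert.1 hs with rfl | hs
    · exact mem_vsupp.2 hz0
    · exact mem_vsupp.2 (h2 s hs).ne'

end

theorem Adapted.kt (h : Adapted ℓ I N) {σ : Finset (ι → SignType)} (hσ : σ ∈ cellCx ℓ I) (hc : σ.card = 3)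
    {u : ι → SignType} (hu : u ∈ σ) (huT : u ∈ cells ℓ I N) :
    (Finset.univ.filter fun z => z ∉ σ ∧ insert z σ ∈ cellCx ℓ I).card = 2 := by
  obtain ⟨f, hf⟩ := exists_functional hσ hc
  have hfneg : ∀ x, (-f) x = 0 ↔
      ∃ c : (ι → SignType) → ℝ, (∀ s, s ∉ σ → c s = 0) ∧ wsum ℓ I c = x := by
    intro x; rw [← hf x]; simp
  have hv : ∃ v : R3, 0 < f (0, v) := by
    by_contra! hcon
    have h0 : ∀ v : R3, f (0, v) = 0 := fun v => le_antisymm (hcon v) (by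
      have := hcon (-v)
      have e : ((0 : ℝ), -v) = -(0, v) := by simp
      rw [e, map_neg] at this; linarith)
    have h1 : ∀ x : ℝ × R3, f x = 0 := fun x => by
      have e : x = x.1 • (1, cpt ℓ I u) + (0, x.2 - x.1 • cpt ℓ I u) := by simp
      rw [e, map_add, map_smul, functional_zero hσ hf hu, h0]; simp
    have hE : finrank ℝ (ℝ × R3) = 4 := by simp
    have hr : (⊤ : Submodule ℝ (ℝ × R3)) ≤ span ℝ (↑(σ.image fun s => ((1 : ℝ), cpt ℓ I s)) : Set (ℝ × R3)) := fun x _ => by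
      obtain ⟨c, hc0, rfl⟩ := (hf x).1 (h1 x)
      refine Submodule.sum_mem _ fun s _ => ?_
      by_cases hs : s ∈ σ
      · exact Submodule.smul_mem _ _ (Submodule.subset_span (mem_coe.2 (Finset.mem_image_of_mem _ hs)))
      · simp_all
    have h2 := finrank_span_finset_le_card (R := ℝ) (σ.image fun s => ((1 : ℝ), cpt ℓ I s))
    rw [Set.finrank, top_le_iff.1 hr, finrank_top, hE] at h2
    grind
  obtain ⟨v, hv⟩ := hv
  obtain ⟨z, hz, hzσ, hzp⟩ := exists_apex hσ hf h hu huT hv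
  obtain ⟨z', hz', hzσ', hzp'⟩ := exists_apex hσ hfneg h hu huT (v := -v) (by
    have e : ((0 : ℝ), -v) = -(0, v) := by simp
    rw [e, map_neg, LinearMap.neg_apply, neg_neg]; exact hv)
  rw [LinearMap.neg_apply, neg_pos] at hzp'
  refine card_eq_two.2 ⟨z, z', ?_, ?_⟩
  · rintro rfl; linarith
  · ext y
    simp only [mem_filter_univ, Finset.mem_insert, Finset.mem_singleton]
    constructor
    · rintro ⟨hy, hyσ⟩
      rcases lt_or_gt_of_ne (functional_ne hσ hf hy hyσ) with hl | hl
      · exact Or.inr (apex_unique hσ hf hy hyσ hzσ' (a := -f (1, cpt ℓ I z')) (b := -f (1, cpt ℓ I y))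
          (by linarith) (by linarith) (by ring))
      · exact Or.inl (apex_unique hσ hf hy hyσ hzσ hzp hl.le (by ring))
    · grind

theorem starConvex_region {c : R3} (hc : c ∈ region ℓ I) : StarConvex ℝ c (region ℓ I) := fun y hy a b ha hb hab i hi => by
  have e : a • c + b • y = lineMap c y b := by rw [AffineMap.lineMap_apply_module, ← hab]; simp
  rw [e, aff_lineMap]
  nlinarith [hc i hi, hy i hi, mul_nonneg ha (hc i hi), mul_nonneg hb (hy i hi), show a = 1 - b by linarith]

theorem Adapted.trig (h : Adapted ℓ I N) (hN : IsManifold3WithBoundary N) (hcon : _root_.IsConnected N)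
    (h1 : Subsingleton (H 1 ↥N)) : Trig (cellCx ℓ I) (cells ℓ I N) (bcells ℓ I N) := by
  have hK := isLowerSet_cellCx (ℓ := ℓ) (I := I)
  have hKc := isCompact_realiz hK
  have hR := isLowerSet_res hK (cells ℓ I N)
  have hRc := isCompact_realiz hR
  obtain ⟨x₀, hx₀⟩ := hcon.nonempty
  have hstar := starConvex_region (h.sub_region hx₀)
  obtain ⟨g, hg, hinv⟩ := (cmap_homeo h.bdd).exists_symm hKc
  obtain ⟨g', hg', hinv'⟩ := h.homeo.exists_symm hRc
  have hsubT : cells ℓ I N ⊆ verts (cellCx ℓ I) := fun s hs => mem_verts_cellCx.2 (mem_cells.1 hs).1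
  have hvR : verts (res (cellCx ℓ I) (cells ℓ I N)) = cells ℓ I N := by rw [verts_res, Finset.inter_eq_right.2 hsubT]
  have hnv : ∀ v ∈ cells ℓ I N, _ := fun v hv => (h.locFace_res hN (σ := {v})).vertex hR (by rwa [hvR])
  exact
  { lower := hK
    dim := fun σ hσ => card_cell hσ
    conn := conn_of_realiz hK ((cmap_homeo h.bdd).isPreconnected hKc
        (hstar.isPathConnected (h.sub_region hx₀)).isConnected.isPreconnected)
    b1 := b1_of_pathSimply hK (hstar.simplyConn.pathSimply.of_retract hg.cont (cmap_homeo h.bdd).cont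
        hg.bij.mapsTo (cmap_homeo h.bdd).bij.mapsTo hinv.1)
    subT := hsubT
    subZ := filter_subset _ _
    noPM := fun a ha haZ b hb hab => by
      obtain ⟨hga, hgb, hl | hl⟩ := pair_cellCx.1 hab
      · exact haZ (mem_filter.2 ⟨ha, b, hgb, hb, hl⟩)
      · exact hb (h.down a ha b hgb hl)
    zneg := fun σ hσ hne hσZ => by
      obtain ⟨s, hs, hst⟩ := exists_top hσ hne
      obtain ⟨-, s', hs', hsT, hss⟩ := mem_filter.1 (hσZ hs)
      refine ⟨s', hsT, fun t ht => ?_, fun t ht t' ht' => ?_⟩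
      · rcases Finset.mem_insert.1 ht with rfl | ht
        exacts [hs', hσ.1 t ht]
      · rcases Finset.mem_insert.1 ht with h1 | ht <;> rcases Finset.mem_insert.1 ht' with h2 | ht'
        · exact Or.inl (by rw [h1, h2]; exact Fle.refl _)
        · exact Or.inr (by rw [h1]; exact (hst t' ht').trans hss)
        · exact Or.inl (by rw [h2]; exact (hst t ht).trans hss)
        · exact hσ.2 t ht t' ht'
    kv := fun v hv => (h.locFace (Finset.mem_singleton_self v) hv).vertex hK (hsubT hv)
    ke := fun u hu v huv hσ => (h.locFace (σ := {u, v}) (by simp) hu).edge hK huv hσ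
    kt := fun σ hσ hc ⟨u, hu, huT⟩ => h.kt hσ hc hu huT
    ne := ⟨sgn ℓ x₀, (h.sgn_mem_cells (h.sub_region hx₀)).2 hx₀⟩
    connT := by
      have := conn_of_realiz hR (h.homeo.isPreconnected hRc hcon.isPreconnected)
      rw [hvR] at this
      exact conn_of_res this
    b1T := b1_of_pathSimply hR ((pathSimply_of_H1 h1).of_retract hg'.cont h.homeo.cont
        hg'.bij.mapsTo h.homeo.bij.mapsTo hinv'.1)
    nv := hnv
    nee := fun u v huv hσ => (h.locFace_res hN (σ := {u, v})).edge hR huv hσ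
    nt := fun σ hσ hc => (h.locFace_res hN (σ := σ)).triangle hR hc hσ }

end

section
open scoped Classical

theorem IsSimplexSet.sgn_det {S : Set R3} (hS : IsSimplexSet S) :
    ∃ Φ : Finset (R3 →ᵃ[ℝ] ℝ), ∀ x ∈ S, ∀ y,
      (∀ φ ∈ Φ, sign (φ y) = sign (φ x)) → y ∈ S := by
  obtain ⟨t, ht, rfl⟩ := hS
  obtain ⟨u, htu, hu, hspan⟩ := exists_subset_affineIndependent_affineSpan_eq_top ht
  have hfin : u.Finite := finite_set_of_fin_dim_affineIndependent ℝ hu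
  have : Fintype u := hfin.fintype
  let b : AffineBasis u ℝ R3 := ⟨(↑), hu, by aesop⟩
  have hb : ∀ j : u, b j = j.1 := fun j => rfl
  have key : ∀ x, x ∈ convexHull ℝ (t : Set R3) ↔
      ∀ j : u, 0 ≤ b.coord j x ∧ (j.1 ∉ t → b.coord j x = 0) := fun x => by
    constructor
    · intro hx j
      have hc : Convex ℝ {x : R3 | 0 ≤ b.coord j x ∧ (j.1 ∉ t → b.coord j x = 0)} := fun x hx y hy p q hp hq hpq => by
        have e : b.coord j (p • x + q • y) = p * b.coord j x + q * b.coord j y := by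
          have := Convex.combo_affine_apply (f := b.coord j) (x := x) (y := y) hpq
          simpa using this
        refine ⟨?_, fun hj => ?_⟩
        · rw [e]; exact add_nonneg (mul_nonneg hp hx.1) (mul_nonneg hq hy.1)
        · simp_all
      refine convexHull_min (fun v hv => ?_) hc hx
      have hv' : v = b ⟨v, htu hv⟩ := rfl
      refine ⟨?_, fun hj => ?_⟩
      · rw [hv', b.coord_apply]; split_ifs <;> simp
      · rw [hv', b.coord_apply, if_neg]
        rintro rfl; exact hj hv
    · intro hx
      rw [← b.linear_combination_coord_eq_self x,
        ← Finset.sum_filter_of_ne (p := fun j : u => j.1 ∈ t) (fun j _ hj => by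
          by_contra hjt; exact hj (by simp_all))]
      refine (convex_convexHull ℝ _).sum_mem (fun j _ => (hx j).1) ?_ fun j hj =>
        subset_convexHull ℝ _ (mem_filter.1 hj).2
      rw [Finset.sum_filter_of_ne (fun j _ hj => by by_contra hjt; exact hj ((hx j).2 hjt))]
      exact b.sum_coord_apply_eq_one x
  refine ⟨Finset.univ.image b.coord, fun x hx y hxy => ?_⟩
  rw [key] at hx ⊢
  intro j
  have := hxy (b.coord j) (by simp)
  obtain ⟨h0, h1⟩ := hx j
  refine ⟨?_, fun hj => ?_⟩
  · rcases h0.lt_or_eq with h | h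
    · rw [sign_pos h, sign_eq_one_iff] at this; exact this.le
    · rw [← h, sign_zero, sign_eq_zero_iff] at this; exact this.ge
  · simp_all

theorem IsPolyhedron.sgn_det {N : Set R3} (hN : IsPolyhedron N) :
    ∃ Φ : Finset (R3 →ᵃ[ℝ] ℝ), ∀ x ∈ N, ∀ y,
      (∀ φ ∈ Φ, sign (φ y) = sign (φ x)) → y ∈ N := by
  obtain ⟨F, hF, rfl⟩ := hN
  choose! Φ hΦ using fun s hs => (hF s hs).sgn_det
  refine ⟨F.biUnion Φ, fun x hx y hxy => ?_⟩
  obtain ⟨s, hs, hxs⟩ := mem_iUnion₂.1 hx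
  exact mem_iUnion₂.2 ⟨s, hs, hΦ s hs x hxs y fun φ hφ => hxy φ (Finset.mem_biUnion.2 ⟨s, hs, hφ⟩)⟩

/-- The affine functions `R ± x k`. -/
def boxFn (R : ℝ) (p : Fin 3 × Bool) : R3 →ᵃ[ℝ] ℝ :=
  AffineMap.const ℝ R3 R +
    ((if p.2 then (1 : ℝ) else -1) • ((EuclideanSpace.proj p.1 : R3 →L[ℝ] ℝ) : R3 →ₗ[ℝ] ℝ)).toAffineMap

theorem boxFn_apply (R : ℝ) (p : Fin 3 × Bool) (x : R3) :
    boxFn R p x = R + (if p.2 then x p.1 else -x p.1) := by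
  rcases p with ⟨k, _ | _⟩ <;> simp [boxFn]

theorem box_nonneg {R : ℝ} {x : R3} : (∀ p, 0 ≤ boxFn R p x) ↔ ∀ k, |x k| ≤ R := by
  simp only [boxFn_apply, Prod.forall, Bool.forall_bool, abs_le]
  grind

theorem exists_adapted {N : Set R3} (hN : IsPolyhedron N) (hc : IsCompact N) :
    ∃ (ι : Type) (_ : Fintype ι) (_ : DecidableEq ι) (ℓ : ι → R3 →ᵃ[ℝ] ℝ) (I : Set ι), Adapted ℓ I N := by
  obtain ⟨Φ, hΦ⟩ := hN.sgn_det
  obtain ⟨R, hR0, hR⟩ := hc.isBounded.subset_ball_lt 0 (0 : R3)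
  let ℓ : {φ // φ ∈ Φ} ⊕ (Fin 3 × Bool) → R3 →ᵃ[ℝ] ℝ := elim (fun φ => φ.1) (boxFn R)
  have hreg : ∀ x, x ∈ region ℓ (range inr) ↔ ∀ k, |x k| ≤ R := by intro x; rw [← box_nonneg]; simp [region, ℓ]
  let e := EuclideanSpace.equiv (Fin 3) ℝ
  have hes : ∀ x : R3, e.symm (e x) = x := fun x => e.symm_apply_apply x
  have hek : ∀ (x : R3) k, e x k = x k := fun x k => rfl
  refine ⟨_, inferInstance, inferInstance, ℓ, range inr, ⟨?_, ?_, ?_, ?_, hc.isClosed⟩⟩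
  · have h1 : IsCompact (e.symm '' closedBall (0 : Fin 3 → ℝ) R) :=
      (isCompact_closedBall _ _).image e.symm.continuous
    refine h1.isBounded.subset fun x hx => ⟨e x, ?_, hes x⟩
    rw [mem_closedBall_zero_iff, pi_norm_le_iff_of_nonneg hR0.le]
    exact (hreg x).1 hx
  · rintro x hx _ ⟨p, rfl⟩
    have h1 := mem_ball_zero_iff.1 (hR hx)
    have h2 : |x p.1| < R := lt_of_le_of_lt (PiLp.norm_apply_le x p.1) h1
    rw [abs_lt] at h2
    change 0 < boxFn R p x
    rw [boxFn_apply]; split_ifs <;> linarith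
  · intro x hx y hxy
    refine hΦ x hx y fun φ hφ => ?_
    exact congrFun hxy (Sum.inl ⟨φ, hφ⟩)
  · have h1 : 1 < Module.rank ℝ (Fin 3 → ℝ) := by
      rw [rank_fin_fun]; exact_mod_cast (by norm_num : 1 < 3)
    convert (isConnected_sphere h1 (0 : Fin 3 → ℝ) hR0.le).image e.symm e.symm.continuous.continuousOn using 1
    have hz : ∀ x : R3, (∃ i ∈ range inr, ℓ i x = 0) ↔ ∃ p, boxFn R p x = 0 := by aesop
    ext x
    rw [mem_setOf_eq, hreg, hz]
    constructor
    · rintro ⟨h2, p, hp⟩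
      refine ⟨e x, mem_sphere_zero_iff_norm.2 (le_antisymm ?_ ?_), hes x⟩
      · exact (pi_norm_le_iff_of_nonneg hR0.le).2 h2
      · refine le_trans ?_ (norm_le_pi_norm (e x) p.1)
        rw [norm_eq_abs, hek]
        rw [boxFn_apply] at hp
        split_ifs at hp
        · grind
        · grind
    · rintro ⟨y, hy, rfl⟩
      rw [mem_sphere_zero_iff_norm] at hy
      have hk : ∀ k, (e.symm y) k = y k := fun k => rfl
      refine ⟨fun k => ?_, ?_⟩
      · rw [hk, ← hy]; exact norm_le_pi_norm y k
      · by_contra! hcon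
        have : ‖y‖ < R := by
          rw [pi_norm_lt_iff hR0]
          intro k
          refine lt_of_le_of_ne (hy ▸ norm_le_pi_norm y k) fun h3 => ?_
          rw [norm_eq_abs] at h3
          have e1 := hcon (k, true)
          have e2 := hcon (k, false)
          rw [boxFn_apply] at e1 e2
          rcases abs_cases (y k) with h | h <;> simp [hk] at e1 e2
          · exact e2 (by linarith)
          · exact e1 (by linarith)
        exact absurd hy this.ne

/-- The cells in the boundary of the region. -/
theorem Adapted.bd_conn {ι : Type} [Fintype ι] [DecidableEq ι] {ℓ : ι → R3 →ᵃ[ℝ] ℝ} {I : Set ι} {N : Set R3}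
    (h : Adapted ℓ I N) : ∃ Q : Finset (ι → SignType),
      (∀ s, s ∈ Q ↔ Good ℓ I s ∧ ∃ i ∈ I, s i = 0) ∧ Q.Nonempty ∧ Disjoint Q (cells ℓ I N) ∧
      Conn (cellCx ℓ I) Q := by
  have hK := isLowerSet_cellCx (ℓ := ℓ) (I := I)
  let Q : Finset (ι → SignType) := Finset.univ.filter fun s => Good ℓ I s ∧ ∃ i ∈ I, s i = 0
  have hQ : ∀ s, s ∈ Q ↔ Good ℓ I s ∧ ∃ i ∈ I, s i = 0 := fun s => by simp [Q]
  have hdown : ∀ s ∈ Q, ∀ t, Good ℓ I t → Fle t s → t ∈ Q := fun s hs t ht hts => by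
    obtain ⟨-, i, hi, h0⟩ := (hQ s).1 hs
    refine (hQ t).2 ⟨ht, i, hi, (hts i).elim id fun h => h.trans h0⟩
  have hho : HomeoOn (cmap ℓ I) (realiz (res (cellCx ℓ I) Q)) {x ∈ region ℓ I | ∃ i ∈ I, ℓ i x = 0} := by
    refine (cmap_homeo h.bdd).restrict (fun w hw => ⟨hw.1, hw.2.1, hw.2.2.1⟩) (fun x hx => hx.1) fun w hw => ?_
    rw [mem_realiz_res hdown hw, hQ]
    refine ⟨fun h => ⟨cmap_mem hw, ?_⟩, fun h => ⟨⟨_, cmap_mem hw, rfl⟩, ?_⟩⟩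
    · obtain ⟨i, hi, h0⟩ := h.2; exact ⟨i, hi, sign_eq_zero_iff.1 h0⟩
    · obtain ⟨i, hi, h0⟩ := h.2; exact ⟨i, hi, sign_eq_zero_iff.2 h0⟩
  refine ⟨Q, hQ, ?_, ?_, ?_⟩
  · obtain ⟨x, hx, i, hi, h0⟩ := h.bconn.nonempty
    exact ⟨sgn ℓ x, (hQ _).2 ⟨⟨x, hx, rfl⟩, i, hi, sign_eq_zero_iff.2 h0⟩⟩
  · rw [Finset.disjoint_left]
    intro s hs hsN
    obtain ⟨hg, i, hi, h0⟩ := (hQ s).1 hs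
    have h1 := h.pos_cell hsN hi
    have h2 := congrFun (cpt_spec hg).2 i
    rw [h0] at h2
    exact h1.ne' (sign_eq_zero_iff.1 h2)
  · have hR := isLowerSet_res hK Q
    have := conn_of_realiz hR (hho.isPreconnected (isCompact_realiz hR) h.bconn.isPreconnected)
    rw [verts_res, Finset.inter_eq_right.2 (fun s hs => mem_verts_cellCx.2 ((hQ s).1 hs).1)] at this
    exact conn_of_res this

end

section
open Metric

/-- An open embedding onto a ball that is the identity on the concentric ball of half the radius. -/
theorem exists_squash {E : Type*} [NormedAddCommGroup E] [NormedSpace ℝ E] (c : E) {δ : ℝ} (hδ : 0 < δ) :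
    ∃ θ ζ : E → E, Continuous θ ∧ (∀ y, dist y c < δ → θ y = y) ∧ (∀ y, dist (θ y) c < 2 * δ) ∧
      (∀ y, ζ (θ y) = y) ∧ ∀ y, dist y c < 2 * δ → θ (ζ y) = y ∧ ContinuousAt ζ y := by
  have hM : ∀ x : E, 0 < max ‖x‖ δ := fun x => lt_max_of_lt_right hδ
  let S : E → E := fun x => (2 * (δ / max ‖x‖ δ) - (δ / max ‖x‖ δ) ^ 2) • x
  let U : E → E := fun y => (δ ^ 2 / ((2 * δ - max ‖y‖ δ) * max ‖y‖ δ)) • y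
  have hS : Continuous S := by
    have : Continuous fun x : E => δ / max ‖x‖ δ := continuous_const.div (by fun_prop) fun x => (hM x).ne'
    exact ((continuous_const.mul this).sub (this.pow 2)).smul continuous_id
  have hS1 : ∀ x, ‖x‖ ≤ δ → S x = x := fun x hx => by simp only [S, max_eq_right hx, div_self hδ.ne']; norm_num
  have hU1 : ∀ x, ‖x‖ ≤ δ → U x = x := fun x hx => by grind
  have hSn : ∀ x, δ < ‖x‖ → ‖S x‖ = 2 * δ - δ ^ 2 / ‖x‖ := fun x hx => by
    have h0 := hδ.trans hx
    have h1 : δ / ‖x‖ < 1 := (div_lt_one h0).2 hx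
    have h2 : 0 < δ / ‖x‖ := div_pos hδ h0
    simp only [S, max_eq_left hx.le, norm_smul]
    have h3 : 0 < 2 * (δ / ‖x‖) - (δ / ‖x‖) ^ 2 := by nlinarith
    rw [norm_eq_abs, abs_of_pos h3]
    field_simp
  have hb : ∀ x : E, δ < ‖x‖ → δ ^ 2 / ‖x‖ < δ ∧ 0 < δ ^ 2 / ‖x‖ := fun x hx => by
    have h0 := hδ.trans hx
    have h1 : δ ^ 2 < δ * ‖x‖ := by rw [sq]; exact mul_lt_mul_of_pos_left hx hδ
    exact ⟨(div_lt_iff₀ h0).2 h1, by aesop⟩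
  have hSb : ∀ x, ‖S x‖ < 2 * δ := fun x => by
    rcases le_or_gt ‖x‖ δ with h | h
    · rw [hS1 x h]; linarith
    · grind
  have hUS : ∀ x, U (S x) = x := fun x => by
    rcases le_or_gt ‖x‖ δ with h | h
    · rw [hS1 x h, hU1 x h]
    · have h0 := hδ.trans h
      have h2 := hSn x h
      have h3 : δ < ‖S x‖ := by grind
      have h4 : (2 * ‖x‖ - δ) ≠ 0 := by linarith
      simp only [U]
      rw [max_eq_left h3.le, h2]
      simp only [S, max_eq_left h.le, smul_smul]
      rw [show δ ^ 2 / ((2 * δ - (2 * δ - δ ^ 2 / ‖x‖)) * (2 * δ - δ ^ 2 / ‖x‖)) *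
        (2 * (δ / ‖x‖) - (δ / ‖x‖) ^ 2) = 1 by
          have : 2 * δ - δ ^ 2 / ‖x‖ ≠ 0 := by grind
          rw [show 2 * (δ / ‖x‖) - (δ / ‖x‖) ^ 2 = (2 * δ - δ ^ 2 / ‖x‖) / ‖x‖ by grind]
          rw [sub_sub_cancel]
          field_simp
          exact div_self (by linarith), one_smul]
  have hSU : ∀ y, ‖y‖ < 2 * δ → S (U y) = y := fun y hy => by
    rcases le_or_gt ‖y‖ δ with h | h
    · rw [hU1 y h, hS1 y h]
    · have h0 := hδ.trans h
      have h1 : 0 < 2 * δ - ‖y‖ := by linarith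
      have h2 : ‖U y‖ = δ ^ 2 / (2 * δ - ‖y‖) := by
        simp only [U, max_eq_left h.le, norm_smul]
        rw [norm_eq_abs, abs_of_pos (by positivity)]
        field_simp
      have h3 : δ < ‖U y‖ := by rw [h2, lt_div_iff₀ h1]; nlinarith
      simp only [S]
      rw [max_eq_left h3.le, h2]
      simp only [U, max_eq_left h.le, smul_smul]
      rw [show (2 * (δ / (δ ^ 2 / (2 * δ - ‖y‖))) - (δ / (δ ^ 2 / (2 * δ - ‖y‖))) ^ 2) *
        (δ ^ 2 / ((2 * δ - ‖y‖) * ‖y‖)) = 1 by field_simp; ring, one_smul]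
  refine ⟨fun y => c + S (y - c), fun y => c + U (y - c), by fun_prop, fun y hy => ?_, fun y => ?_,
    fun y => ?_, fun y hy => ⟨?_, ?_⟩⟩
  · rw [dist_eq_norm] at hy
    simp only [hS1 _ hy.le, add_sub_cancel]
  · simp_all
  · grind
  · rw [dist_eq_norm] at hy
    simp only [add_sub_cancel_left, hSU _ hy, add_sub_cancel]
  · rw [dist_eq_norm] at hy
    have h1 : ContinuousAt U (y - c) := by
      refine ContinuousAt.smul (continuousAt_const.div (by fun_prop) ?_) continuousAt_id
      have : max ‖y - c‖ δ < 2 * δ := max_lt hy (by linarith)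
      exact (mul_pos (by linarith) (hM _)).ne'
    exact continuousAt_const.add (ContinuousAt.comp (f := fun y => y - c) (x := y) h1 (by fun_prop))

/-- Lifting a squashing map along a map `f` with a partial section. -/
theorem squash_lift {X E : Type*} [TopologicalSpace X] [NormedAddCommGroup E] [NormedSpace ℝ E]
    {f : X → E} {s : E → X} {c : E} {δ : ℝ} (hδ : 0 < δ) (hf : Continuous f) (hO : IsOpen (range f))
    (hb : ∀ y, dist y c < 2 * δ → y ∈ range f) (hs : ∀ y ∈ range f, f (s y) = y)
    (hu : ∀ y, dist y c < 2 * δ → y ≠ c → ContinuousAt s y ∧ ∀ x, f x = y → x = s y) :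
    ∃ (g : X → X) (s' : X → X), Continuous g ∧ IsOpen (range g) ∧ (∀ x, dist (f x) c < δ → g x = x) ∧
      (∀ x y, g x = g y → f x = f y ∧ (f x = c → x = y)) ∧
      (∀ x, ∀ U ∈ 𝓝 (f x), ∃ V ∈ 𝓝 (g x), ∀ x', g x' ∈ V → f x' ∈ U) ∧
      (∀ x y, f x = f y → f x ≠ c → g x = g y) ∧
      (∀ y ∈ range g, g (s' y) = y) ∧ (∀ x, dist (f (g x)) c < 2 * δ) ∧ ∀ x, f x = c ∨ ContinuousAt s (f x) → ContinuousAt s' (g x) := by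
  classical
  obtain ⟨θ, ζ, hθ, hθ1, hθ2, hζθ, hζ⟩ := exists_squash c hδ
  have hθi : Injective θ := Function.LeftInverse.injective hζθ
  have hθc : ∀ y, θ y = c → y = c := fun y hy => hθi (by simp_all)
  have hθd : ∀ y, dist (θ y) c < δ → θ y = y := fun y hy => hθi (hθ1 _ hy)
  have hfs : ∀ y, f (s (θ y)) = θ y := fun y => hs _ (hb _ (hθ2 y))
  have hsf : ∀ x, dist (f x) c < 2 * δ → f x ≠ c → s (f x) = x := fun x h h' => ((hu _ h h').2 x rfl).symm
  let g : X → X := fun x => if dist (f x) c < δ then x else s (θ (f x))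
  have hg1 : ∀ x, dist (f x) c < δ → g x = x := fun x hx => if_pos hx
  have hg2 : ∀ x, f x ≠ c → g x = s (θ (f x)) := fun x hx => by grind
  have hfg : ∀ x, f (g x) = θ (f x) := fun x => by grind
  have hgc : Continuous g := by
    refine continuous_iff_continuousAt.2 fun x => ?_
    by_cases h : f x = c
    · refine continuousAt_id.congr ?_
      have : {x | dist (f x) c < δ} ∈ 𝓝 x :=
        (isOpen_lt (by fun_prop) continuous_const).mem_nhds (by simpa [h] using hδ)
      filter_upwards [this] with y hy using (hg1 y hy).symm
    · have h1 : ContinuousAt (fun x => s (θ (f x))) x :=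
        ContinuousAt.comp (f := fun x => θ (f x)) (hu _ (hθ2 _) fun h' => h (hθc _ h')).1
          (hθ.comp hf).continuousAt
      refine h1.congr ?_
      filter_upwards [(isOpen_compl_singleton.preimage hf).mem_nhds h] with y hy using (hg2 y hy).symm
  let s' : X → X := fun y => if dist (f y) c < δ then y else s (ζ (f y))
  have hfζ : ∀ x, ζ (f (g x)) = f x := fun x => by grind
  have hgs : ∀ y, dist (f y) c < 2 * δ → ζ (f y) ∈ range f → g (s' y) = y := fun y hy hr => by
    by_cases h : dist (f y) c < δ
    · grind
    · have h1 : s' y = s (ζ (f y)) := if_neg h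
      have h2 : f (s' y) = ζ (f y) := by grind
      have h3 : f y ≠ c := by rintro h'; rw [h'] at h; exact h (by simpa using hδ)
      have h4 : f (s' y) ≠ c := fun h' => h3 (by
        rw [← (hζ _ hy).1, ← h2, h', hθ1 c (by simpa using hδ)])
      rw [hg2 _ h4, h2, (hζ _ hy).1, hsf y hy h3]
  have hrange : ∀ y, y ∈ range g ↔ dist (f y) c < 2 * δ ∧ ζ (f y) ∈ range f := fun y => by
    constructor
    · rintro ⟨x, rfl⟩
      grind
    · rintro ⟨h1, h2⟩; exact ⟨_, hgs y h1 h2⟩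
  have hζc : ∀ y, dist (f y) c < 2 * δ → ContinuousAt (fun y => ζ (f y)) y := fun y hy =>
    ContinuousAt.comp (f := f) (hζ _ hy).2 hf.continuousAt
  have hopen : ∀ y : X, dist (f y) c < 2 * δ → {y | dist (f y) c < 2 * δ} ∈ 𝓝 y := fun y hy =>
    (isOpen_lt (by fun_prop) continuous_const).mem_nhds hy
  refine ⟨g, s', hgc, ?_, hg1, fun x y hxy => ⟨?_, fun hx => ?_⟩, fun x U hU => ?_, fun x y hxy hx => ?_,
    fun y hy => hgs y ((hrange y).1 hy).1 ((hrange y).1 hy).2,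
    fun x => by grind, fun x hx => ?_⟩
  · refine isOpen_iff_mem_nhds.2 fun y hy => ?_
    obtain ⟨h1, h2⟩ := (hrange y).1 hy
    filter_upwards [hopen y h1, hζc y h1 (hO.mem_nhds h2)] with z hz hz'
    exact (hrange z).2 ⟨hz, hz'⟩
  · rw [← hfζ x, hxy, hfζ]
  · have hy : f y = c := by rw [← hx, ← hfζ x, hxy, hfζ]
    rwa [hg1 x (by simpa [hx] using hδ), hg1 y (by simpa [hy] using hδ)] at hxy
  · rw [← hfζ x] at hU
    exact ⟨_, hζc (g x) (by grind) hU, fun x' hx' => by grind⟩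
  · grind
  · have hd : dist (f (g x)) c < 2 * δ := by rw [hfg]; exact hθ2 _
    by_cases h : dist (f (g x)) c < δ
    · refine continuousAt_id.congr ?_
      filter_upwards [(isOpen_lt (by fun_prop) continuous_const : IsOpen {y | dist (f y) c < δ}).mem_nhds h]
        with y hy using (if_pos hy).symm
    · have h3 : f (g x) ≠ c := by rintro h'; rw [h'] at h; exact h (by simpa using hδ)
      have h4 : f x ≠ c := fun h' => h3 (by rw [hfg, h', hθ1 c (by simpa using hδ)])
      have h5 : ContinuousAt (fun y => s (ζ (f y))) (g x) :=
        ContinuousAt.comp (f := fun y => ζ (f y)) (by grind) (hζc _ hd)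
      refine h5.congr ?_
      filter_upwards [hopen _ hd, (isOpen_compl_singleton.preimage hf).mem_nhds h3] with y hy hy'
      by_cases h6 : dist (f y) c < δ
      · grind
      · exact (if_neg h6).symm

/-- A radial homeomorphism with compact support compressing a ball. -/
theorem exists_compress {E : Type*} [NormedAddCommGroup E] [NormedSpace ℝ E] (r : ℝ) {ε : ℝ} (hε : 0 < ε) :
    ∃ τ : E → E, Continuous τ ∧ Bijective τ ∧ (∀ x, r + 1 ≤ ‖x‖ → τ x = x) ∧
      ∀ x, ‖x‖ ≤ r → ‖τ x‖ < ε := by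
  obtain ⟨e, he0, he1, her⟩ : ∃ e : ℝ, 0 < e ∧ e < 1 ∧ e * r < ε := by
    have hpos : 0 < |r| + ε + 1 := by grind
    refine ⟨ε / (|r| + ε + 1), by aesop, by rw [div_lt_one hpos]; linarith [abs_nonneg r], ?_⟩
    rw [div_mul_eq_mul_div, div_lt_iff₀ hpos]
    nlinarith [le_abs_self r]
  let l : ℝ → ℝ := fun t => min 1 (e + max 0 (t - r))
  have hlc : Continuous l := by fun_prop
  have hl0 : ∀ t, 0 < l t := fun t => lt_min one_pos (by grind)
  have hlm : Monotone l := fun a b hab => min_le_min le_rfl (by grind)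
  have hl1 : ∀ t, r + 1 ≤ t → l t = 1 := fun t ht => min_eq_left (by grind)
  have hlr : ∀ t, t ≤ r → l t = e := fun t ht => by grind
  have hnorm : ∀ x : E, ‖l ‖x‖ • x‖ = l ‖x‖ * ‖x‖ := fun x => by rw [norm_smul, norm_eq_abs, abs_of_pos (hl0 _)]
  refine ⟨fun x => l ‖x‖ • x, (hlc.comp continuous_norm).smul continuous_id, ⟨fun x y hxy => ?_, fun y => ?_⟩,
    fun x hx => by simp_all, fun x hx => ?_⟩
  · simp only at hxy
    have h1 : l ‖x‖ * ‖x‖ = l ‖y‖ * ‖y‖ := by grind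
    have h2 : ‖x‖ = ‖y‖ := by
      rcases lt_trichotomy ‖x‖ ‖y‖ with h | h | h
      · exact absurd h1 (ne_of_lt (mul_lt_mul' (hlm h.le) h (norm_nonneg _) (hl0 _)))
      · exact h
      · exact absurd h1.symm (ne_of_lt (mul_lt_mul' (hlm h.le) h (norm_nonneg _) (hl0 _)))
    rw [h2] at hxy
    exact smul_right_injective E (hl0 _).ne' hxy
  · have hT : (0:ℝ) ≤ max ‖y‖ (r + 1) := le_max_of_le_left (norm_nonneg _)
    obtain ⟨t, ht, hty⟩ := intermediate_value_Icc hT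
      (f := fun t => l t * t) (hlc.mul continuous_id).continuousOn
      (show ‖y‖ ∈ Icc _ _ by simp_all)
    have h1 : ‖(l t)⁻¹ • y‖ = t := by
      rw [norm_smul, norm_inv, norm_eq_abs, abs_of_pos (hl0 _), ← hty]
      field_simp [(hl0 t).ne']
    refine ⟨(l t)⁻¹ • y, ?_⟩
    simp only [h1]
    rw [smul_inv_smul₀ (hl0 t).ne']
  · rw [hnorm, hlr _ hx]
    exact lt_of_le_of_lt (mul_le_mul_of_nonneg_left hx he0.le) her

/-- `A` has arbitrarily small open neighbourhoods that can be compressed to a point. -/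
def Cellular {X : Type*} [TopologicalSpace X] (A : Set X) : Prop :=
  ∀ U, IsOpen U → A ⊆ U → ∃ B c, IsOpen B ∧ A ⊆ B ∧ B ⊆ U ∧ c ∈ B ∧
    ∀ Z, IsCompact Z → Z ⊆ B → ∀ G ∈ 𝓝 c, ∃ ρ : X → X, Continuous ρ ∧ Bijective ρ ∧
      (∀ x, x ∉ B → ρ x = x) ∧ ∀ x ∈ Z, ρ x ∈ G

/-- Open cells in a proper normed space. -/
theorem exists_compress_cell {X : Type*} [NormedAddCommGroup X] [NormedSpace ℝ X] [ProperSpace X] {k s : X → X}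
    (hk : Continuous k) (hki : Injective k) (hO : IsOpen (range k))
    (hs : ∀ y ∈ range k, k (s y) = y) (hsc : ∀ x, ContinuousAt s (k x)) {Z : Set X} (hZ : IsCompact Z)
    (hZB : Z ⊆ range k) {G : Set X} (hG : G ∈ 𝓝 (k 0)) :
    ∃ ρ : X → X, Continuous ρ ∧ Bijective ρ ∧ (∀ x, x ∉ range k → ρ x = x) ∧ ∀ x ∈ Z, ρ x ∈ G := by
  classical
  have hsk : ∀ x, s (k x) = x := fun x => hki (hs _ (mem_range_self x))
  have hsZ : IsCompact (s '' Z) := hZ.image_of_continuousOn fun z hz => by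
    obtain ⟨x, rfl⟩ := hZB hz; exact (hsc x).continuousWithinAt
  obtain ⟨r, hr⟩ := hsZ.isBounded.subset_closedBall 0
  obtain ⟨ε, hε, hεG⟩ := Metric.mem_nhds_iff.1 (hk.continuousAt.preimage_mem_nhds hG)
  obtain ⟨τ, hτ, ⟨hτi, hτs⟩, hτ1, hτ2⟩ := exists_compress (E := X) r hε
  let ρ : X → X := fun x => if x ∈ range k then k (τ (s x)) else x
  have h1 : ∀ x, ρ (k x) = k (τ x) := fun x => by grind
  have h2 : ∀ x, x ∉ range k → ρ x = x := fun x hx => if_neg hx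
  have h3 : ∀ x, x ∉ k '' closedBall 0 (r + 1) → ρ x = x := fun x hx => by
    by_cases h : x ∈ range k
    · obtain ⟨y, rfl⟩ := h
      rw [h1, hτ1 y]
      by_contra hcon
      exact hx ⟨y, by rw [mem_closedBall_zero_iff]; exact (not_le.1 hcon).le, rfl⟩
    · exact h2 x h
  refine ⟨ρ, continuous_iff_continuousAt.2 fun x => ?_, ⟨fun x y hxy => ?_, fun y => ?_⟩, h2, fun x hx => ?_⟩
  · by_cases h : x ∈ range k
    · obtain ⟨y, rfl⟩ := h
      have : ContinuousAt (fun x => k (τ (s x))) (k y) := ContinuousAt.comp (f := s) (hk.comp hτ).continuousAt (hsc y)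
      refine this.congr ?_
      filter_upwards [hO.mem_nhds (mem_range_self y)] with z hz using (if_pos hz).symm
    · refine continuousAt_id.congr ?_
      have hc : IsClosed (k '' closedBall 0 (r + 1)) := ((isCompact_closedBall _ _).image hk).isClosed
      filter_upwards [hc.isOpen_compl.mem_nhds fun h' => h (image_subset_range _ _ h')] with z hz
      exact (h3 z hz).symm
  · grind
  · by_cases hy : y ∈ range k
    · obtain ⟨x, rfl⟩ := hy
      obtain ⟨z, rfl⟩ := hτs x
      exact ⟨k z, h1 z⟩
    · exact ⟨y, h2 y hy⟩
  · obtain ⟨y, rfl⟩ := hZB hx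
    rw [h1]
    refine hεG (mem_ball_zero_iff.2 (hτ2 y ?_))
    simpa [hsk] using hr (mem_image_of_mem s hx)

theorem continuousAt_section {X E : Type*} [TopologicalSpace X] [TopologicalSpace E] {f : X → E} {s : E → X}
    (hf : IsClosedMap f) (hs : ∀ y, f (s y) = y) {y : E} (hy : ∀ x, f x = y → x = s y) : ContinuousAt s y := fun U hU => by
  obtain ⟨U', hU', hO, hm⟩ := mem_nhds_iff.1 hU
  have : (f '' U'ᶜ)ᶜ ∈ 𝓝 y := (hf _ hO.isClosed_compl).isOpen_compl.mem_nhds (by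
    rintro ⟨x, hx, hxy⟩
    exact hx (hy x hxy ▸ hm))
  refine Filter.mem_map.2 (Filter.mem_of_superset this fun z hz => hU' ?_)
  by_contra hcon
  exact hz ⟨s z, hcon, hs z⟩

/-- A map of `X` onto a normed space with exactly two nondegenerate fibers has cellular fibers. -/
theorem cellular_of_two_fibers {X E : Type*} [NormedAddCommGroup X] [NormedSpace ℝ X] [ProperSpace X]
    [NormedAddCommGroup E] [NormedSpace ℝ E] {f : X → E} (hf : Continuous f) (hcl : IsClosedMap f)
    (hsurj : Surjective f) {a : E} (ha : a ≠ 0)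
    (hinj : ∀ x y, f x = f y → x = y ∨ f x = 0 ∨ f x = a) : Cellular (f ⁻¹' {a}) := by
  obtain ⟨s, hs⟩ := hsurj.hasRightInverse
  have hsc : ∀ y, y ≠ 0 → y ≠ a → ContinuousAt s y ∧ ∀ x, f x = y → x = s y := fun y h0 h1 => by
    have : ∀ x, f x = y → x = s y := fun x hx => by grind
    exact ⟨continuousAt_section hcl hs this, this⟩
  have hδ : 0 < ‖a‖ / 2 := by aesop
  obtain ⟨g, s₁, hg, hgO, -, hgi, hgn, hga, hgs, -, hgc⟩ := squash_lift (f := f) (s := s) (c := 0) hδ hf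
    (by rw [hsurj.range_eq]; exact isOpen_univ) (fun y _ => hsurj y) (fun y _ => hs y)
    fun y hy h0 => hsc y h0 (by rintro rfl; rw [dist_zero_right] at hy; linarith)
  obtain ⟨x₀, hx₀⟩ := hsurj a
  have hq : ∀ x, g x = g x₀ ↔ f x = a := fun x => ⟨fun h => by grind, fun h => hga x x₀ (by grind) (h ▸ ha)⟩
  have hgc' : ∀ x, f x ≠ a → ContinuousAt s₁ (g x) := fun x hx => hgc x (by
    by_cases h0 : f x = 0
    · exact Or.inl h0
    · grind)
  have hgi' : ∀ x y, g x = g y → f x ≠ a → x = y := fun x y hxy hx => by grind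
  intro U hU hAU
  have hnU : (f '' Uᶜ)ᶜ ∈ 𝓝 (f x₀) := (hcl _ hU.isClosed_compl).isOpen_compl.mem_nhds (by
    rintro ⟨x, hx, hxy⟩
    exact hx (hAU (hxy.trans hx₀)))
  obtain ⟨V, hV, hVU⟩ := hgn x₀ _ hnU
  obtain ⟨η, hη, hηV⟩ := Metric.mem_nhds_iff.1 (Filter.inter_mem hV (hgO.mem_nhds (mem_range_self x₀)))
  have hball : ∀ y, dist y (g x₀) < 2 * (η / 2) → y ∈ V ∧ y ∈ range g := fun y hy => hηV (mem_ball.2 (by linarith))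
  have hη2 : 0 < η / 2 := by linarith
  obtain ⟨k, s₂, hk, hkO, hk1, hki, -, -, hks, hkd, hkc⟩ := squash_lift (f := g) (s := s₁) (c := g x₀) hη2 hg hgO
    (fun y hy => (hball y hy).2) hgs (fun y hy hne => by grind)
  have hkinj : Injective k := fun x y hxy => by grind
  have hkc' : ∀ x, ContinuousAt s₂ (k x) := fun x => hkc x (by
    by_cases h : f x = a
    · exact Or.inl ((hq x).2 h)
    · exact Or.inr (hgc' x h))
  have hkU : range k ⊆ U := by
    rintro _ ⟨x, rfl⟩
    by_contra hcon
    exact hVU (k x) (hball _ (hkd x)).1 ⟨k x, hcon, rfl⟩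
  refine ⟨range k, k 0, hkO, fun x hx => ⟨x, hk1 x ?_⟩, hkU, mem_range_self 0, fun Z hZ hZB G hG =>
    exists_compress_cell hk hkinj hkO hks hkc' hZ hZB hG⟩
  rw [(hq x).2 hx, dist_self]; exact hη2

end

section
open Metric

/-- A cellular set in the interior of a compact set `C` can be shrunk to a point by a map of `C` onto itself. -/
theorem Cellular.exists_shrink {X : Type*} [MetricSpace X] [ProperSpace X] {A C : Set X} (hC : IsCompact C)
    (hA : IsClosed A) (hAC : A ⊆ interior C) (hcell : Cellular A) :
    ∃ Θ : X → X, Continuous Θ ∧ Θ '' C = C ∧ ∀ x y, Θ x = Θ y ↔ x = y ∨ (x ∈ A ∧ y ∈ A) := by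
  have hAc : IsCompact A := hC.of_isClosed_subset hA (hAC.trans interior_subset)
  let St := {p : (X → X) × Set X // Continuous p.1 ∧ Injective p.1 ∧ p.1 '' C = C ∧
    IsCompact p.2 ∧ A ⊆ interior p.2 ∧ p.2 ⊆ C}
  have step : ∀ (n : ℕ) (p : St), ∃ q : St, q.1.2 ⊆ p.1.2 ∧ q.1.2 ⊆ thickening (1 / 2 ^ n) A ∧
      (∀ x ∈ q.1.2, ∀ y ∈ q.1.2, dist (q.1.1 x) (q.1.1 y) ≤ 1 / 2 ^ n) ∧
      ∃ ρ : X → X, q.1.1 = p.1.1 ∘ ρ ∧ Injective ρ ∧ ∀ x, x ∉ p.1.2 → ρ x = x := by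
    rintro n ⟨⟨T, Z⟩, hT, hTi, hTC, hZ, hAZ, hZC⟩
    have hε : (0:ℝ) < 1 / 2 ^ n := by simp
    obtain ⟨B, c, hB, hAB, hBU, hc, H⟩ := hcell (interior Z ∩ thickening (1 / 2 ^ n) A)
      (isOpen_interior.inter isOpen_thickening) (subset_inter hAZ (self_subset_thickening hε A))
    obtain ⟨Z', hZ', hAZ', hZB⟩ := exists_compact_between hAc hB hAB
    obtain ⟨ρ, hρ, hρb, hρ1, hρ2⟩ := H Z' hZ' hZB (T ⁻¹' ball (T c) (1 / 2 ^ n / 2))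
      (hT.continuousAt.preimage_mem_nhds (ball_mem_nhds _ (by simp)))
    have hBZ : B ⊆ Z := fun x hx => interior_subset (hBU hx).1
    have hρC : ρ '' C = C := by
      have h1 : ∀ x, x ∉ C → ρ x = x := fun x hx => hρ1 x fun h => hx (hZC (hBZ h))
      ext y
      obtain ⟨x, rfl⟩ := hρb.2 y
      rw [hρb.1.mem_set_image]
      by_cases hx : x ∈ C
      · refine iff_of_true hx (by_contra fun h => ?_)
        rw [hρb.1 (h1 _ h)] at h
        exact h hx
      · rw [h1 x hx]
    refine ⟨⟨(T ∘ ρ, Z'), hT.comp hρ, hTi.comp hρb.1, by grind, hZ', hAZ',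
      (hZB.trans hBZ).trans hZC⟩, hZB.trans hBZ, fun x hx => (hBU (hZB hx)).2, fun x hx y hy => ?_,
      ρ, rfl, hρb.1, fun x hx => hρ1 x fun h => hx (hBZ h)⟩
    have h1 := mem_ball.1 (hρ2 x hx)
    have h2 := mem_ball.1 (hρ2 y hy)
    exact (dist_triangle_right _ _ (T c)).trans (by grind)
  choose F hF1 hF2 hF3 ρ hF4 hF5 hF6 using step
  let p : ℕ → St := fun n => Nat.rec ⟨(id, C), continuous_id, Function.injective_id, image_id C, hC, hAC, subset_rfl⟩ F n
  let T : ℕ → X → X := fun n => (p n).1.1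
  let Z : ℕ → Set X := fun n => (p n).1.2
  have hT : ∀ n, Continuous (T n) := fun n => (p n).2.1
  have hTi : ∀ n, Injective (T n) := fun n => (p n).2.2.1
  have hTC : ∀ n, T n '' C = C := fun n => (p n).2.2.2.1
  have hZc : ∀ n, IsCompact (Z n) := fun n => (p n).2.2.2.2.1
  have hAZ : ∀ n, A ⊆ Z n := fun n => (p n).2.2.2.2.2.1.trans interior_subset
  have hZs : ∀ n, Z (n + 1) ⊆ Z n := fun n => hF1 n (p n)
  have hZa : Antitone Z := antitone_nat_of_succ_le hZs
  have hZt : ∀ n, Z (n + 1) ⊆ thickening (1 / 2 ^ n) A := fun n => hF2 n (p n)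
  have hd : ∀ n, ∀ x ∈ Z (n + 1), ∀ y ∈ Z (n + 1), dist (T (n + 1) x) (T (n + 1) y) ≤ 1 / 2 ^ n := fun n => hF3 n (p n)
  have hstep : ∀ n x, T (n + 1) x = T n (ρ n (p n) x) := fun n x => congrFun (hF4 n (p n)) x
  have hoff : ∀ n x, x ∉ Z n → ρ n (p n) x = x := fun n => hF6 n (p n)
  have hpres : ∀ n (W : Set X), Z n ⊆ W → ∀ x ∈ W, ρ n (p n) x ∈ W := fun n W hW x hx => by
    by_contra h
    have := hF5 n (p n) (hoff n _ fun h' => h (hW h'))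
    rw [this] at h
    exact h hx
  have hTe : ∀ n m x, x ∉ Z n → T (n + m) x = T n x := fun n m x hx => by
    induction m with
    | zero => rfl
    | succ m ih => rw [← add_assoc, hstep, hoff _ _ fun h => hx (hZa (by lia) h), ih]
  have hTz : ∀ (n m : ℕ), ∀ x ∈ Z n, T (n + m) x ∈ T n '' Z n := fun n m => by
    induction m with
    | zero => exact fun x hx => mem_image_of_mem _ hx
    | succ m ih =>
      intro x hx
      rw [← add_assoc, hstep]
      exact ih _ (hpres _ _ (hZa (by lia)) x hx)
  have hdist : ∀ x n, dist (T (n + 1) x) (T (n + 2) x) ≤ 2 / 2 / 2 ^ n := fun x n => by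
    rw [show (2:ℝ) / 2 = 1 by norm_num]
    by_cases hx : x ∈ Z (n + 1)
    · rw [show T (n + 2) x = _ from hstep (n + 1) x]
      exact hd n x hx _ (hpres (n + 1) (Z (n + 1)) subset_rfl x hx)
    · rw [show T (n + 2) x = T (n + 1) x from hTe (n + 1) 1 x hx, dist_self]; positivity
  have hlim : ∀ x, ∃ y, Tendsto (fun n => T (n + 1) x) Filter.atTop (𝓝 y) := fun x =>
    cauchySeq_tendsto_of_complete (cauchySeq_of_le_geometric_two (hdist x))
  choose Θ hΘ using hlim
  have hunif : ∀ x n, dist (T (n + 1) x) (Θ x) ≤ 2 / 2 ^ n := fun x n =>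
    dist_le_of_le_geometric_two_of_tendsto (hdist x) (hΘ x) n
  have hto0 : Tendsto (fun n : ℕ => (2:ℝ) / 2 ^ n) Filter.atTop (𝓝 0) := by
    have := (tendsto_pow_atTop_nhds_zero_of_lt_one (r := (1/2:ℝ)) (by norm_num) (by norm_num)).const_mul 2
    rw [mul_zero] at this
    exact this.congr fun n => by rw [one_div, inv_pow]; rfl
  have hsmall : ∀ ε > 0, ∃ n : ℕ, (2:ℝ) / 2 ^ n < ε := fun ε hε => ((hto0.eventually (gt_mem_nhds hε))).exists
  have hcont : Continuous Θ := by
    refine TendstoUniformly.continuous (F := fun n x => T (n + 1) x) (p := Filter.atTop) ?_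
      (Filter.Frequently.of_forall fun n => hT (n + 1))
    refine Metric.tendstoUniformly_iff.2 fun ε hε => ?_
    filter_upwards [hto0.eventually (gt_mem_nhds hε)] with n hn x
    rw [dist_comm]; exact (hunif x n).trans_lt hn
  have hoffΘ : ∀ n x, x ∉ Z n → Θ x = T n x := fun n x hx =>
    tendsto_nhds_unique (hΘ x) (tendsto_atTop_of_eventually_const (i₀ := n) fun m hm => by
      obtain ⟨k, rfl⟩ := Nat.exists_eq_add_of_le hm
      rw [add_assoc]; exact hTe n (k + 1) x hx)
  have hinΘ : ∀ n, ∀ x ∈ Z n, Θ x ∈ T n '' Z n := fun n x hx =>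
    (((hZc n).image (hT n)).isClosed).mem_of_tendsto (hΘ x) (by
      filter_upwards [Filter.eventually_ge_atTop n] with m hm
      obtain ⟨k, rfl⟩ := Nat.exists_eq_add_of_le hm
      rw [add_assoc]; exact hTz n (k + 1) x hx)
  have hout : ∀ x, x ∉ A → ∃ n, x ∉ Z n := fun x hx => by
    rcases A.eq_empty_or_nonempty with rfl | hne
    · exact ⟨1, fun h => by simpa using hZt 0 h⟩
    have hpos : 0 < infDist x A := (hA.notMem_iff_infDist_pos hne).1 hx
    obtain ⟨n, hn⟩ := hsmall _ hpos
    refine ⟨n + 1, fun h => ?_⟩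
    have h1 := (mem_thickening_iff_infDist_lt hne).1 (hZt n h)
    grind
  have hsep : ∀ x y, x ∉ A → y ∈ A → Θ x ≠ Θ y := fun x y hx hy h => by
    obtain ⟨n, hn⟩ := hout x hx
    obtain ⟨z, hz, hzy⟩ := hinΘ n y (hAZ n hy)
    rw [← h, hoffΘ n x hn] at hzy
    exact hn (hTi n hzy ▸ hz)
  refine ⟨Θ, hcont, subset_antisymm ?_ fun y hy => ?_, fun x y => ⟨fun h => ?_, ?_⟩⟩
  · rintro _ ⟨x, hx, rfl⟩
    exact hC.isClosed.mem_of_tendsto (hΘ x) (Filter.Eventually.of_forall fun n => by grind)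
  · rw [← (hC.image hcont).isClosed.closure_eq]
    refine Metric.mem_closure_iff.2 fun ε hε => ?_
    obtain ⟨n, hn⟩ := hsmall ε hε
    rw [← hTC (n + 1)] at hy
    obtain ⟨x, hx, rfl⟩ := hy
    exact ⟨_, mem_image_of_mem _ hx, (hunif x n).trans_lt hn⟩
  · by_cases hx : x ∈ A <;> by_cases hy : y ∈ A
    · exact Or.inr ⟨hx, hy⟩
    · grind
    · grind
    · obtain ⟨n, hn⟩ := hout x hx
      obtain ⟨m, hm⟩ := hout y hy
      have h1 := hoffΘ (max n m) x fun h => hn (hZa (le_max_left _ _) h)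
      have h2 := hoffΘ (max n m) y fun h => hm (hZa (le_max_right _ _) h)
      exact Or.inl (hTi _ (by rw [← h1, ← h2, h]))
  · rintro (rfl | ⟨hx, hy⟩)
    · rfl
    · refine dist_le_zero.1 (le_of_forall_pos_le_add fun ε hε => ?_)
      obtain ⟨n, hn⟩ := hsmall ε hε
      obtain ⟨x', hx', hx⟩ := hinΘ (n + 1) x (hAZ (n + 1) hx)
      obtain ⟨y', hy', hy⟩ := hinΘ (n + 1) y (hAZ (n + 1) hy)
      rw [← hx, ← hy]
      have h2 : (1:ℝ) / 2 ^ n ≤ 2 / 2 ^ n := by gcongr; norm_num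
      linarith [hd n x' hx' y' hy']

end

section
open Metric Filter

variable {X : Type*} [NormedAddCommGroup X] [NormedSpace ℝ X]

/-- The inversion `x ↦ x / ‖x‖²`, with value `0` at `0`. -/
def nInv (x : X) : X := ((‖x‖ ^ 2)⁻¹ : ℝ) • x

theorem norm_nInv (x : X) : ‖nInv x‖ = ‖x‖⁻¹ := by
  rw [nInv, norm_smul, norm_inv, norm_pow, norm_norm]
  grind

theorem nInv_nInv (x : X) : nInv (nInv x) = x := by
  conv_lhs => rw [nInv]
  rw [norm_nInv, nInv, smul_smul]
  rcases eq_or_ne x 0 with rfl | h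
  · simp
  · simp_all

theorem nInv_zero : nInv (0 : X) = 0 := smul_zero _

theorem nInv_inj {x y : X} (h : nInv x = nInv y) : x = y := by rw [← nInv_nInv x, h, nInv_nInv]

theorem continuousAt_nInv {x : X} (h : x ≠ 0) :
    ContinuousAt nInv x := by
  have := norm_ne_zero_iff.2 h
  exact ContinuousAt.smul (ContinuousAt.inv₀ (by fun_prop) (by grind)) continuousAt_id

/-- A compact set whose boundary is bicollared by a sphere `{u = 1/2}` is a ball. -/
theorem exists_homeo_ball_of_collar {X E : Type*} [NormedAddCommGroup X] [NormedSpace ℝ X] [ProperSpace X]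
    [NormedAddCommGroup E] [NormedSpace ℝ E] [ProperSpace E] [Nontrivial E] {u : X → ℝ} {π : X → E} (hu : Continuous u)
    (hu0 : ∀ z, 0 ≤ u z) (hu1 : ∀ z, u z ≤ 1) (hub : ∃ R, ∀ z, R < ‖z‖ → u z = 0) (hne : ∃ z, u z = 1)
    (hπ : ContinuousOn π {z | 0 < u z ∧ u z < 1}) (hπ1 : ∀ z, 0 < u z → u z < 1 → ‖π z‖ = 1)
    (hinj : ∀ z z', 0 < u z → u z < 1 → u z = u z' → π z = π z' → z = z')
    (hsurj : ∀ t p, 0 < t → t < 1 → ‖p‖ = 1 → ∃ z, u z = t ∧ π z = p) :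
    ∃ e : X → E, HomeoOn e {z | 1 / 2 ≤ u z} (closedBall 0 1) := by
  obtain ⟨z₁, hz₁⟩ := hne
  obtain ⟨R, hR⟩ := hub
  have hUo : IsOpen {z | 0 < u z ∧ u z < 1} := (isOpen_lt continuous_const hu).inter (isOpen_lt hu continuous_const)
  have hnorm : ∀ (d : ℝ → ℝ), d 1 = 0 → (∀ t, 0 < t → t ≤ 1 → 0 ≤ d t) → ∀ z, 0 < u z → ‖d (u z) • π z‖ = d (u z) := fun d hd1 hd z hz => by
    rcases (hu1 z).lt_or_eq with h | h
    · rw [norm_smul, hπ1 z hz h, mul_one, norm_eq_abs, abs_of_nonneg (hd _ hz h.le)]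
    · rw [h, hd1]; simp
  have hcont : ∀ (d : ℝ → ℝ), d 1 = 0 → (∀ t, 0 < t → t ≤ 1 → 0 ≤ d t) → (∀ t, 0 < t → ContinuousAt d t) →
      ∀ z, 0 < u z → ContinuousAt (fun z => d (u z) • π z) z := fun d hd1 hd hdc z hz => by
    rcases (hu1 z).lt_or_eq with h | h
    · exact ContinuousAt.smul (ContinuousAt.comp (f := u) (hdc _ hz) hu.continuousAt)
        (hπ.continuousAt (hUo.mem_nhds ⟨hz, h⟩))
    · have h2 : Tendsto (fun z => d (u z)) (𝓝 z) (𝓝 0) := by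
        rw [← hd1, ← h]; exact ContinuousAt.comp (f := u) (hdc _ hz) hu.continuousAt
      have : d (u z) • π z = 0 := by rw [h, hd1, zero_smul]
      rw [ContinuousAt, this]
      refine squeeze_zero_norm' ?_ h2
      filter_upwards [(isOpen_lt continuous_const hu).mem_nhds hz] with y hy
      exact (hnorm d hd1 hd y hy).le
  obtain ⟨p₀, hp₀⟩ := exists_norm_eq E zero_le_one
  obtain ⟨o, ho, -⟩ := hsurj (1 / 4) p₀ (by norm_num) (by norm_num) hp₀
  let c : ℝ → ℝ := fun t => t⁻¹ - 1
  have hc1 : c 1 = 0 := by simp [c]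
  have hc0 : ∀ t, 0 < t → t ≤ 1 → 0 ≤ c t := fun t h0 h1 => sub_nonneg.2 ((one_le_inv₀ h0).2 h1)
  have hcc : ∀ t, 0 < t → ContinuousAt c t := fun t ht => (continuousAt_inv₀ ht.ne').sub continuousAt_const
  have hcn := hnorm c hc1 hc0
  have hci : ∀ t s, c t = c s → t = s := fun t s h => inv_injective (sub_left_injective h)
  have ho1 : ‖π o‖ = 1 := hπ1 o (by grind) (by grind)
  let y₀ : E := (3:ℝ) • π o
  have hy₀ : ‖y₀‖ = 3 := by grind
  let w : X → E := fun z => c (u z) • π z - y₀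
  have hw : ∀ z, 0 < u z → ContinuousAt w z := fun z hz => (hcont c hc1 hc0 hcc z hz).sub continuousAt_const
  have hwinj : ∀ z z', 0 < u z → 0 < u z' → w z = w z' → z = z' ∨ u z = 1 := fun z z' hz hz' h => by
    have h1 : c (u z) • π z = c (u z') • π z' := sub_left_injective h
    have h2 : u z = u z' := hci _ _ (by grind)
    rcases (hu1 z).lt_or_eq with h3 | h3
    · have h4 : c (u z) ≠ 0 := fun h => h3.ne (hci _ _ (h.trans hc1.symm))
      rw [← h2] at h1
      exact Or.inl (hinj z z' hz h3 h2 (smul_right_injective E h4 h1))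
    · exact Or.inr h3
  have hwo : w o = 0 := by grind
  have huo : 0 < u o := by grind
  have hw0 : ∀ z, 0 < u z → z ≠ o → w z ≠ 0 := fun z hz hzo h => by grind
  let G : X → E := fun z => if u z = 0 then 0 else nInv (w z)
  have hG : ∀ z, 0 < u z → G z = nInv (w z) := fun z hz => if_neg hz.ne'
  have hGs : ∀ z, u z < 1 / 8 → ‖G z‖ ≤ 2 * u z := fun z hz => by
    rcases (hu0 z).lt_or_eq with h | h
    · rw [hG z h, norm_nInv]
      have h1 : c (u z) - 3 ≤ ‖w z‖ := by rw [← hcn z h, ← hy₀]; exact norm_sub_norm_le _ _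
      have h2 : (2 * u z)⁻¹ ≤ ‖w z‖ := by
        refine le_trans ?_ h1
        have h3 : 8 ≤ (u z)⁻¹ := by rw [le_inv_comm₀ (by norm_num) h]; linarith
        simp only [c]
        rw [mul_inv]; linarith
      rw [inv_le_comm₀ (lt_of_lt_of_le (by positivity) h2) (by grind)]
      exact h2
    · rw [show G z = 0 from if_pos h.symm]; simp [← h]
  have hGc : ∀ z, z ≠ o → ContinuousAt G z := fun z hz => by
    rcases (hu0 z).lt_or_eq with h | h
    · have h1 : ContinuousAt (fun z => nInv (w z)) z :=
        ContinuousAt.comp (f := w) (continuousAt_nInv (hw0 z h hz)) (hw z h)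
      refine h1.congr ?_
      filter_upwards [(isOpen_lt continuous_const hu).mem_nhds h] with y hy using (hG y hy).symm
    · have h2 : Tendsto (fun z => 2 * u z) (𝓝 z) (𝓝 0) := by
        have : Continuous fun z => 2 * u z := by fun_prop
        simpa [← h] using this.tendsto z
      rw [ContinuousAt, show G z = 0 from if_pos h.symm]
      refine squeeze_zero_norm' ?_ h2
      filter_upwards [(isOpen_lt hu continuous_const).mem_nhds (show u z < 1 / 8 by grind)] with y hy
      exact hGs y hy
  let f : X → E := fun x => G (o + nInv x)
  have hzx : ∀ z, o + nInv (nInv (z - o)) = z := fun z => by rw [nInv_nInv]; abel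
  have hfz : ∀ z, f (nInv (z - o)) = G z := fun z => by simp only [f, hzx]
  have hne0 : ∀ x : X, x ≠ 0 → o + nInv x ≠ o := fun x hx h => hx (nInv_inj (by
    rw [nInv_zero]; exact add_eq_left.1 h))
  have hsh : ∀ x : X, x ≠ 0 → ContinuousAt (fun x => o + nInv x) x := fun x hx =>
    continuousAt_const.add (continuousAt_nInv hx)
  have hf0 : f 0 = 0 := by simp only [f, nInv_zero, add_zero]; rw [hG o huo, hwo, nInv_zero]
  have hfc : Continuous f := by
    refine continuous_iff_continuousAt.2 fun x => ?_
    by_cases hx : x = 0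
    · subst hx
      refine (continuousAt_const (y := (0:E))).congr ?_
      have hpos : 0 < |R| + ‖o‖ + 1 := by positivity
      filter_upwards [ball_mem_nhds (0:X) (inv_pos.2 hpos)] with x hx
      rw [mem_ball_zero_iff] at hx
      by_cases h0 : x = 0
      · rw [h0, hf0]
      · have h1 : |R| + ‖o‖ + 1 < ‖x‖⁻¹ := by rwa [lt_inv_comm₀ hpos (norm_pos_iff.2 h0)]
        have h2 : ‖nInv x‖ - ‖o‖ ≤ ‖o + nInv x‖ := by
          have := norm_sub_norm_le (nInv x) (-o)
          rwa [norm_neg, sub_neg_eq_add, add_comm (nInv x)] at this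
        rw [norm_nInv] at h2
        exact (if_pos (hR _ (by linarith [le_abs_self R]))).symm
    · exact ContinuousAt.comp (f := fun x => o + nInv x) (hGc _ (hne0 x hx)) (hsh x hx)
  have hcl : IsClosedMap f := by
    refine (isProperMap_iff_tendsto_cocompact.2 ⟨hfc, ?_⟩).isClosedMap
    rw [← Metric.cobounded_eq_cocompact (α := E), ← comap_norm_atTop, tendsto_comap_iff]
    have h1 : Tendsto (fun x : X => nInv x) (cocompact X) (𝓝 0) := by
      refine squeeze_zero_norm (fun x => (norm_nInv x).le) ?_
      exact tendsto_inv_atTop_zero.comp tendsto_norm_cocompact_atTop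
    have h2 : Tendsto (fun x : X => o + nInv x) (cocompact X) (𝓝 o) := by simpa using h1.const_add o
    have h3 : Tendsto (fun x => ‖w (o + nInv x)‖) (cocompact X) (𝓝[>] 0) := by
      refine tendsto_nhdsWithin_iff.2 ⟨?_, ?_⟩
      · have := ((hw o huo).tendsto.comp h2).norm
        rwa [hwo, norm_zero] at this
      · filter_upwards [h2.eventually ((isOpen_lt continuous_const hu).mem_nhds huo),
          (Metric.isCompact_of_isClosed_isBounded isClosed_singleton Bornology.isBounded_singleton :
            IsCompact ({0} : Set X)).compl_mem_cocompact] with x hx hx0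
        exact norm_pos_iff.2 (hw0 _ hx (hne0 x hx0))
    refine (tendsto_inv_nhdsGT_zero.comp h3).congr' ?_
    filter_upwards [h2.eventually ((isOpen_lt continuous_const hu).mem_nhds huo)] with x hx
    simp only [Function.comp, f]
    rw [hG _ hx, norm_nInv]
  have hy₀0 : -y₀ ≠ 0 := by rw [← norm_ne_zero_iff, norm_neg, hy₀]; norm_num
  have ha : nInv (-y₀) ≠ 0 := fun h => hy₀0 (nInv_inj (h.trans nInv_zero.symm))
  have hGa : ∀ z, G z = nInv (-y₀) ↔ u z = 1 := fun z => by
    rcases (hu0 z).lt_or_eq with h | h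
    · rw [hG z h]
      refine ⟨fun h1 => ?_, fun h1 => ?_⟩
      · have h2 : c (u z) • π z = 0 := by
          have h3 : c (u z) • π z - y₀ = -y₀ := nInv_inj h1
          rw [sub_eq_neg_self] at h3; exact h3
        have h3 := hcn z h
        rw [h2, norm_zero] at h3
        exact hci _ _ (h3.symm.trans hc1.symm)
      · simp only [w, h1, hc1, zero_smul, zero_sub]
    · grind
  have hfsurj : Surjective f := fun b => by
    suffices h : b = 0 ∨ ∃ z, G z = b by
      rcases h with rfl | ⟨z, hz⟩
      exacts [⟨0, hf0⟩, ⟨_, (hfz z).trans hz⟩]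
    by_cases hq : nInv b + y₀ = 0
    · refine Or.inr ⟨z₁, ?_⟩
      rw [(hGa z₁).2 hz₁, ← eq_neg_of_add_eq_zero_left hq, nInv_nInv]
    · have hqn := norm_pos_iff.2 hq
      have hpos : 0 < 1 + ‖nInv b + y₀‖ := by positivity
      obtain ⟨z, hz, hzp⟩ := hsurj (1 + ‖nInv b + y₀‖)⁻¹ (‖nInv b + y₀‖⁻¹ • (nInv b + y₀)) (by positivity)
        (inv_lt_one_of_one_lt₀ (by linarith)) (by rw [norm_smul, norm_inv, norm_norm]; field_simp)
      refine Or.inr ⟨z, ?_⟩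
      rw [hG z (by rw [hz]; positivity)]
      simp only [w, c, hz, hzp, inv_inv]
      rw [add_sub_cancel_left, smul_inv_smul₀ hqn.ne', add_sub_cancel_right, nInv_nInv]
  have hfinj : ∀ x y, f x = f y → x = y ∨ f x = 0 ∨ f x = nInv (-y₀) := fun x y h => by
    by_cases h0 : f x = 0
    · exact Or.inr (Or.inl h0)
    have hp : ∀ x, f x ≠ 0 → 0 < u (o + nInv x) := fun x hx => lt_of_le_of_ne (hu0 _) fun h' => hx (if_pos h'.symm)
    have hx := hp x h0
    have hy := hp y (h ▸ h0)
    have h1 : w (o + nInv x) = w (o + nInv y) := nInv_inj (by rw [← hG _ hx, ← hG _ hy]; exact h)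
    rcases hwinj _ _ hx hy h1 with h2 | h2
    · exact Or.inl (nInv_inj (add_left_cancel h2))
    · grind
  have hcell := cellular_of_two_fibers hfc hcl hfsurj ha hfinj
  have hCc : IsCompact {z | 1 / 2 ≤ u z} := by
    refine Metric.isCompact_of_isClosed_isBounded (isClosed_le continuous_const hu)
      (isBounded_closedBall (x := (0:X)) (r := R) |>.subset fun z hz => ?_)
    rw [mem_closedBall_zero_iff]
    by_contra h
    have := hR z (not_le.1 h)
    simp only [mem_setOf_eq, this] at hz
    norm_num at hz
  have hνc : ContinuousOn (fun z => nInv (z - o)) {z | 1 / 2 ≤ u z} := fun z hz => by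
    have hzo : z ≠ o := by rintro rfl; rw [mem_setOf_eq, ho] at hz; norm_num at hz
    exact (ContinuousAt.comp (f := fun z => z - o) (continuousAt_nInv (sub_ne_zero.2 hzo)) (by fun_prop)).continuousWithinAt
  have hνi : Injective fun z : X => nInv (z - o) := fun z z' h => sub_left_injective (nInv_inj h)
  obtain ⟨Θ, hΘ, hΘC, hΘi⟩ := hcell.exists_shrink (hCc.image_of_continuousOn hνc)
    (isClosed_singleton.preimage hfc) (by
      intro x hx
      have hx1 : u (o + nInv x) = 1 := (hGa _).1 hx
      have hx0 : x ≠ 0 := by rintro rfl; rw [nInv_zero, add_zero, ho] at hx1; norm_num at hx1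
      refine mem_interior_iff_mem_nhds.2 ?_
      filter_upwards [(ContinuousAt.comp (f := fun x => o + nInv x) (hu.continuousAt) (hsh x hx0)).preimage_mem_nhds
        ((isOpen_lt continuous_const continuous_id : IsOpen {t : ℝ | 1 / 2 < t}).mem_nhds (by
          simp only [Function.comp, hx1, mem_setOf_eq]; norm_num))] with y hy
      exact ⟨o + nInv y, (show 1 / 2 < u (o + nInv y) from hy).le, by simp only [add_sub_cancel_left, nInv_nInv]⟩)
  have hA : ∀ z, nInv (z - o) ∈ f ⁻¹' {nInv (-y₀)} ↔ u z = 1 := fun z => by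
    rw [mem_preimage, hfz, mem_singleton_iff, hGa]
  let d : ℝ → ℝ := fun t => 2 * (1 - t)
  have hd1 : d 1 = 0 := by simp [d]
  have hd0 : ∀ t, 0 < t → t ≤ 1 → 0 ≤ d t := fun t h0 h1 => by linarith
  have hdn := hnorm d hd1 hd0
  have hpos : ∀ z, 1 / 2 ≤ u z → 0 < u z := fun z hz => by linarith
  obtain ⟨e, he, -⟩ := HomeoOn.param hCc (α := fun z => Θ (nInv (z - o))) (β := fun z => d (u z) • π z)
    (X := (fun z => nInv (z - o)) '' {z | 1 / 2 ≤ u z}) (Y := closedBall (0:E) 1) (hΘ.comp_continuousOn hνc)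
    (fun z hz => (hcont d hd1 hd0 (fun t _ => by simp only [d]; fun_prop) z (hpos z hz)).continuousWithinAt)
    ((image_image Θ _ _).symm.trans hΘC) (by
      ext p
      rw [mem_closedBall_zero_iff]
      constructor
      · rintro ⟨z, hz, rfl⟩
        simp only [hdn z (hpos z hz)]
        simp only [d]; linarith [show 1 / 2 ≤ u z from hz]
      · intro hp
        by_cases h0 : p = 0
        · exact ⟨z₁, by rw [mem_setOf_eq, hz₁]; norm_num, by simp only [hz₁, hd1, zero_smul, h0]⟩
        · have hp0 := norm_pos_iff.2 h0
          obtain ⟨z, hz, hzp⟩ := hsurj (1 - ‖p‖ / 2) (‖p‖⁻¹ • p) (by linarith) (by linarith)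
            (by rw [norm_smul, norm_inv, norm_norm]; field_simp)
          refine ⟨z, by rw [mem_setOf_eq, hz]; linarith, ?_⟩
          simp only [hz, hzp, d]
          rw [sub_sub_cancel, mul_div_cancel₀ _ two_ne_zero, smul_inv_smul₀ hp0.ne']) (by
      intro z hz z' hz'
      rw [hΘi, hA, hA]
      constructor
      · rintro (h | ⟨h, h'⟩)
        · rw [hνi h]
        · simp only [h, h', hd1, zero_smul]
      · intro h
        have h1 : d (u z) = d (u z') := by rw [← hdn z (hpos z hz), h, hdn z' (hpos z' hz')]
        have h2 : u z = u z' := by linarith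
        rcases (hu1 z).lt_or_eq with h3 | h3
        · have h4 : d (u z) ≠ 0 := by simp only [d]; intro h5; linarith
          rw [← h2] at h
          rw [hinj z z' (hpos z hz) h3 h2 (smul_right_injective E h4 h)]
          exact Or.inl rfl
        · grind)
  exact ⟨_, he.comp ⟨hνc, mapsTo_image _ _, hνi.injOn, surjOn_image _ _⟩⟩

end

section
open Metric
variable {V : Type} [Fintype V] [DecidableEq V] {K : Set (Finset V)} {P : Finset V}

/-- The total weight of the vertices in `P`. -/
def mass (P : Finset V) (y : V → ℝ) : ℝ := ∑ v ∈ P, y v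

/-- Rescale the weights of the vertices in `P` and off `P`. -/
def rwt (P : Finset V) (a b : ℝ) (y : V → ℝ) : V → ℝ := fun v => (if v ∈ P then a else b) * y v

theorem continuous_mass (P : Finset V) : Continuous (mass P) := by unfold mass; fun_prop

theorem mass_compl {y : V → ℝ} (hy : y ∈ realiz K) (P : Finset V) : mass Pᶜ y = 1 - mass P y := by
  rw [← hy.2.1, ← Finset.sum_add_sum_compl P]; simp [mass]

theorem mass_nonneg {y : V → ℝ} (hy : y ∈ realiz K) (P : Finset V) : 0 ≤ mass P y :=
  sum_nonneg fun v _ => hy.1 v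

theorem mass_pos {y : V → ℝ} (hy : y ∈ realiz K) :
    0 < mass P y ↔ ∃ v ∈ P, v ∈ vsupp y := by
  rw [mass, Finset.sum_pos_iff_of_nonneg fun v _ => hy.1 v]
  exact exists_congr fun v => and_congr_right fun _ => by rw [mem_vsupp]; exact (hy.1 v).lt_iff_ne'

theorem mass_rwt (P : Finset V) (a b : ℝ) (y : V → ℝ) : mass P (rwt P a b y) = a * mass P y := by
  rw [mass, mass, mul_sum]
  exact sum_congr rfl fun v hv => by simp [rwt, hv]

theorem rwt_mem {y : V → ℝ} (hy : y ∈ realiz K) {a b : ℝ} (ha : 0 < a) (hb : 0 < b)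
    (h : a * mass P y + b * (1 - mass P y) = 1) : rwt P a b y ∈ realiz K := by
  have hp : ∀ v, 0 < if v ∈ P then a else b := fun v => by grind
  refine ⟨fun v => mul_nonneg (hp v).le (hy.1 v), ?_, ?_⟩
  · rw [← Finset.sum_add_sum_compl P]
    rw [← mass_compl hy] at h
    refine Eq.trans ?_ h
    rw [mass, mass, mul_sum, mul_sum]
    exact congrArg₂ _ (sum_congr rfl fun v hv => by simp [rwt, hv])
      (sum_congr rfl fun v hv => by rw [Finset.mem_compl] at hv; simp [rwt, hv])
  · have : vsupp (rwt P a b y) = vsupp y := by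
      ext v; simp only [mem_vsupp, rwt, ne_eq, mul_eq_zero, (hp v).ne', false_or]
    rw [this]; exact hy.2.2

theorem rwt_rwt (P : Finset V) (a b c d : ℝ) (y : V → ℝ) : rwt P a b (rwt P c d y) = rwt P (a * c) (b * d) y := by
  ext v; simp only [rwt]; split_ifs <;> ring

theorem rwt_one (P : Finset V) (y : V → ℝ) : rwt P 1 1 y = y := by ext v; simp [rwt]

variable {ι : Type} [Fintype ι] [DecidableEq ι] {ℓ : ι → R3 →ᵃ[ℝ] ℝ} {I : Set ι}

theorem exists_mass_ext (hbd : IsBounded (region ℓ I)) {P : Finset (ι → SignType)}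
    (hP : ∀ v ∈ P, Good ℓ I v → ∀ i ∈ I, v i ≠ 0) :
    ∃ (u : R3 → ℝ) (g : R3 → (ι → SignType) → ℝ), Continuous u ∧ ContinuousOn g (region ℓ I) ∧
      (∀ y ∈ realiz (cellCx ℓ I), u (cmap ℓ I y) = mass P y ∧ g (cmap ℓ I y) = y) ∧
      ∀ z, u z ≠ 0 → (∀ i ∈ I, 0 < ℓ i z) ∧ ∃ y ∈ realiz (cellCx ℓ I), cmap ℓ I y = z := by
  classical
  have hΦ := cmap_homeo hbd
  obtain ⟨g, hg, hinv⟩ := hΦ.exists_symm (isCompact_realiz isLowerSet_cellCx)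
  have hgm : ∀ y ∈ realiz (cellCx ℓ I), g (cmap ℓ I y) = y := fun y hy => hinv.1 hy
  let u : R3 → ℝ := fun z => if z ∈ region ℓ I then mass P (g z) else 0
  have hu : ∀ y ∈ realiz (cellCx ℓ I), u (cmap ℓ I y) = mass P y := fun y hy => by
    simp only [u]; rw [if_pos (cmap_mem hy), hgm y hy]
  have hu0 : ∀ z, u z ≠ 0 → (∀ i ∈ I, 0 < ℓ i z) ∧ ∃ y ∈ realiz (cellCx ℓ I), cmap ℓ I y = z := fun z hz => by
    have hzW : z ∈ region ℓ I := by_contra fun h => hz (if_neg h)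
    obtain ⟨y, hy, rfl⟩ := hΦ.bij.surjOn hzW
    rw [hu y hy] at hz
    obtain ⟨v, hvP, hv⟩ := (mass_pos hy).1 (lt_of_le_of_ne (mass_nonneg hy P) hz.symm)
    refine ⟨fun i hi => cmap_pos hy hv hi ?_, y, hy, rfl⟩
    have hc := cpt_spec (hy.2.2.1 v hv)
    refine lt_of_le_of_ne (hc.1 i hi) fun h0 => hP v hvP (hy.2.2.1 v hv) i hi ?_
    rw [← hc.2, sgn, ← h0, sign_zero]
  refine ⟨u, g, ?_, hg.cont, fun y hy => ⟨hu y hy, hgm y hy⟩, hu0⟩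
  rw [← continuousOn_univ, show (univ : Set R3) = region ℓ I ∪ {z | ∀ i ∈ I, 0 < ℓ i z}ᶜ from
    (eq_univ_of_forall fun z => or_iff_not_imp_right.2 fun h i hi => (not_not.1 h i hi).le).symm]
  refine ContinuousOn.union_of_isClosed ?_ ?_ isClosed_region (isOpen_pos ℓ I).isClosed_compl
  · exact ((continuous_mass P).comp_continuousOn hg.cont).congr fun z hz => if_pos hz
  · exact (continuousOn_const (c := (0:ℝ))).congr fun z hz => by_contra fun h => hz (hu0 z h).1

theorem isOpen_image_mass (hbd : IsBounded (region ℓ I)) {P : Finset (ι → SignType)}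
    (hP : ∀ v ∈ P, Good ℓ I v → ∀ i ∈ I, v i ≠ 0) : IsOpen (cmap ℓ I '' {y | y ∈ realiz (cellCx ℓ I) ∧ 0 < mass P y}) := by
  obtain ⟨u, g, hu, -, hug, hu0⟩ := exists_mass_ext hbd hP
  convert isOpen_lt continuous_const hu using 1
  ext z
  constructor
  · rintro ⟨y, ⟨hy, hp⟩, rfl⟩; rwa [← (hug y hy).1] at hp
  · grind

instance : ProperSpace E3 := FiniteDimensional.proper ℝ E3

theorem exists_homeo_ball_of_mass (hbd : IsBounded (region ℓ I)) {P : Finset (ι → SignType)}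
    (hP : ∀ v ∈ P, Good ℓ I v → ∀ i ∈ I, v i ≠ 0) (hne : ∃ y ∈ realiz (cellCx ℓ I), mass P y = 1) {κ : ((ι → SignType) → ℝ) → E3}
    (hκ : HomeoOn κ {y | y ∈ realiz (cellCx ℓ I) ∧ mass P y = 1 / 2} (sphere 0 1)) :
    ∃ e : ((ι → SignType) → ℝ) → E3,
      HomeoOn e {y | y ∈ realiz (cellCx ℓ I) ∧ 1 / 2 ≤ mass P y} (closedBall 0 1) := by
  obtain ⟨u, g, hu, hg, hug, hu0⟩ := exists_mass_ext hbd hP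
  let K := cellCx ℓ I
  have hle : ∀ y ∈ realiz K, mass P y ≤ 1 := fun y hy => by linarith [mass_compl hy P, mass_nonneg hy Pᶜ]
  have hr : ∀ z, u z ≠ 0 → ∃ y ∈ realiz K, cmap ℓ I y = z ∧ u z = mass P y ∧ g z = y := fun z hz => by grind
  have hcol : ∀ y ∈ realiz K, ∀ t, mass P y = t → 0 < t → t < 1 →
      rwt P (2 * t)⁻¹ (2 * (1 - t))⁻¹ y ∈ {y | y ∈ realiz K ∧ mass P y = 1 / 2} := fun y hy t ht h0 h1 => by
    have h2 : 0 < 1 - t := by linarith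
    refine ⟨rwt_mem hy (by aesop) (by positivity) ?_, ?_⟩
    · grind
    · rw [mass_rwt, ht]; field_simp
  obtain ⟨R, hR⟩ := hbd.subset_closedBall 0
  obtain ⟨e, he⟩ := exists_homeo_ball_of_collar (u := u)
    (π := fun z => κ (rwt P (2 * u z)⁻¹ (2 * (1 - u z))⁻¹ (g z))) hu
    (fun z => by
      by_contra h
      obtain ⟨y, hy, -, h2, -⟩ := hr z (fun h0 => h h0.ge)
      exact h (h2 ▸ mass_nonneg hy P))
    (fun z => by
      by_contra h
      obtain ⟨y, hy, -, h2, -⟩ := hr z (fun h0 => h (by grind))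
      exact h (h2 ▸ hle y hy))
    ⟨R, fun z hz => by
      by_contra h
      obtain ⟨y, hy, rfl, -⟩ := hr z h
      have := hR (cmap_mem hy)
      rw [mem_closedBall_zero_iff] at this
      linarith⟩
    (by grind)
    (by
      refine hκ.cont.comp ?_ fun z hz => ?_
      · have h1 : ContinuousOn g {z | 0 < u z ∧ u z < 1} := hg.mono fun z hz => by
          obtain ⟨y, hy, rfl, -⟩ := hr z hz.1.ne'
          exact cmap_mem hy
        refine continuousOn_pi.2 fun v => ContinuousOn.mul ?_ (continuousOn_pi.1 h1 v)
        split_ifs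
        · exact ContinuousOn.inv₀ (by fun_prop) fun z hz => by have := hz.1; positivity
        · exact ContinuousOn.inv₀ (by fun_prop) fun z hz => by have := sub_pos.2 hz.2; positivity
      · obtain ⟨y, hy, rfl, h1, h2⟩ := hr z hz.1.ne'
        rw [h2]; exact hcol y hy _ h1.symm hz.1 hz.2)
    (fun z h0 h1 => by
      obtain ⟨y, hy, -, h2, h3⟩ := hr z h0.ne'
      simp only [h3]
      exact mem_sphere_zero_iff_norm.1 (hκ.bij.mapsTo (hcol y hy _ h2.symm h0 h1)))
    (fun z z' h0 h1 he hκe => by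
      obtain ⟨y, hy, rfl, h2, h3⟩ := hr z h0.ne'
      obtain ⟨y', hy', rfl, h2', h3'⟩ := hr z' (he ▸ h0.ne')
      simp only [h3, h3', ← he] at hκe
      rw [← he] at h2'
      have h4 := congrArg (rwt P (2 * u (cmap ℓ I y)) (2 * (1 - u (cmap ℓ I y))))
        (hκ.bij.injOn (hcol y hy _ h2.symm h0 h1) (hcol y' hy' _ h2'.symm h0 h1) hκe)
      have h5 : 0 < 1 - u (cmap ℓ I y) := by linarith
      simp only [rwt_rwt, mul_inv_cancel₀ (show 2 * u (cmap ℓ I y) ≠ 0 by grind),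
        mul_inv_cancel₀ (show 2 * (1 - u (cmap ℓ I y)) ≠ 0 by grind), rwt_one] at h4
      rw [h4])
    (fun t p h0 h1 hp => by
      obtain ⟨x, ⟨hx, hxm⟩, rfl⟩ := hκ.bij.surjOn (mem_sphere_zero_iff_norm.2 hp)
      have h5 : 0 < 1 - t := by linarith
      have hy : rwt P (2 * t) (2 * (1 - t)) x ∈ realiz K := rwt_mem hx (by grind) (by grind) (by grind)
      have hm : u (cmap ℓ I (rwt P (2 * t) (2 * (1 - t)) x)) = t := by rw [(hug _ hy).1, mass_rwt, hxm]; ring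
      refine ⟨_, hm, ?_⟩
      rw [hm, (hug _ hy).2, rwt_rwt, inv_mul_cancel₀ (by grind), inv_mul_cancel₀ (by grind), rwt_one])
  refine ⟨_, he.comp ((cmap_homeo hbd).restrict (fun y hy => hy.1) (fun z hz => ?_) fun y hy => ?_)⟩
  · obtain ⟨y, hy, rfl, -⟩ := hr z (fun h => by rw [mem_setOf_eq, h] at hz; norm_num at hz)
    exact cmap_mem hy
  · grind

end

section
open Metric

theorem exists_homeoOn_closedBall : ∃ φ : E3 → R3, HomeoOn φ (closedBall 0 1) (closedBall 0 1) := by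
  have hd : finrank ℝ E3 = finrank ℝ R3 := by
    rw [finrank_euclideanSpace_fin, (linearEquiv 1 ℝ (ℝ × E2)).finrank_eq, finrank_prod,
      (linearEquiv 1 ℝ (ℝ × ℝ)).finrank_eq, finrank_prod, Module.finrank_self]
  let φ : E3 ≃L[ℝ] R3 := ContinuousLinearEquiv.ofFinrankEq hd
  obtain ⟨f, -, hf, -⟩ := exists_homeomorph_image_interior_closure_frontier_eq_unitBall (s := φ '' closedBall 0 1)
    ((convex_closedBall 0 1).linear_image φ.toLinearMap)
    ⟨φ 0, interior_maximal (image_mono ball_subset_closedBall) (φ.toHomeomorph.isOpenMap _ isOpen_ball)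
      ⟨0, mem_ball_self one_pos, rfl⟩⟩
    ((isCompact_closedBall 0 1).image φ.continuous).isBounded
  rw [((isCompact_closedBall 0 1).image φ.continuous).isClosed.closure_eq, image_image] at hf
  exact ⟨_, (f.continuous.comp φ.continuous).continuousOn, hf ▸ ((f.injective.comp φ.injective).injOn.bijOn_image)⟩

variable {V : Type} [Fintype V] [DecidableEq V] {K : Set (Finset V)} {v : V} {P : Finset V}

theorem mem_realiz_res_iff {x : V → ℝ} (hx : x ∈ realiz K) :
    x ∈ realiz (res K P) ↔ ¬ 0 < mass Pᶜ x := by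
  rw [mass_pos hx]
  push Not
  refine ⟨fun h v hv hs => Finset.mem_compl.1 hv (h.2.2.2 hs), fun h => ⟨hx.1, hx.2.1, hx.2.2, fun v hv => ?_⟩⟩
  by_contra hP
  exact h v (Finset.mem_compl.2 hP) hv

theorem realiz_res_sub : realiz (res K P) ⊆ realiz K := fun x hx => ⟨hx.1, hx.2.1, hx.2.2.1⟩

section
variable {T Z : Finset V} (h : Trig K T Z)
include h

theorem Trig.mem_outc_self (hv : v ∈ verts K \ T) : v ∈ outc K T v := mem_cl_self hv

theorem Trig.nbd_sub {C : Finset V} (hv : v ∈ nbd K Z C) : v ∈ T := by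
  classical exact h.subZ (mem_filter.1 hv).1

theorem Trig.mass_sep {m : V} (hm : m ∈ verts K \ T) {x : V → ℝ} (hx : x ∈ realiz K)
    (h1 : 0 < mass (outc K T m) x) : ¬ 0 < mass (outc K T m ∪ nbd K Z (outc K T m))ᶜ x := by
  rw [mass_pos hx] at h1 ⊢
  obtain ⟨a, ha, hax⟩ := h1
  rintro ⟨b, hb, hbx⟩
  simp only [Finset.mem_compl, Finset.mem_union, not_or] at hb
  exact h.out_no_edge hm ha hb.1 hb.2 (h.lower (by grind) hx.2.2)

theorem Trig.exists_flip {m : V} (hm : m ∈ verts K \ T) :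
    ∃ f : (V → ℝ) → (V → ℝ), HomeoOn f (realiz K) (realiz K) ∧ ∀ x ∈ realiz K,
      (0 < mass (outc K T m) x ↔ 1 / 2 < mass (outc K T m) (f x)) ∧
      (0 < mass (outc K T m ∪ nbd K Z (outc K T m))ᶜ x ↔ mass (outc K T m) (f x) < 1 / 2) ∧
      (0 < mass (nbd K Z (outc K T m))ᶜ x ↔ mass (outc K T m) (f x) ≠ 1 / 2) := by
  obtain ⟨f, hf, hs⟩ := h.signEquiv_out hm
  refine ⟨f, hf, fun x hx => ?_⟩
  have hsep := h.mass_sep hm hx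
  set C := outc K T m with hC
  set S := nbd K Z C with hS
  have hme : ∀ (P : Finset V) y, mass P y = ∑ v, if v ∈ P then y v else 0 := fun P y => by aesop
  have hD := mass_nonneg hx (C ∪ S)ᶜ
  have hC0 := mass_nonneg hx C
  have h1 : evCol (ncol C S) x = mass (C ∪ S)ᶜ x - mass C x := by
    rw [evCol, hme, hme, ← sum_sub_distrib]
    refine sum_congr rfl fun v _ => ?_
    by_cases hv : v ∈ C <;> by_cases hv' : v ∈ S <;> simp [ncol, hv, hv']
  have h2 : evCol (pmCol Cᶜ) (f x) = 1 - 2 * mass C (f x) := by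
    rw [← (hf.bij.mapsTo hx).2.1, evCol, hme, mul_sum, ← sum_sub_distrib]
    refine sum_congr rfl fun v _ => ?_
    by_cases hv : v ∈ C <;> simp [pmCol, hv]
    ring
  have h3 := hs x hx
  have h4 : 0 < mass Sᶜ x ↔ 0 < mass C x ∨ 0 < mass (C ∪ S)ᶜ x := by
    simp only [mass_pos hx, ← exists_or, ← or_and_right]
    refine exists_congr fun v => and_congr_left fun _ => ?_
    simp only [Finset.mem_compl, Finset.mem_union]
    have : v ∈ C → v ∉ S := fun hc hv => h.out_not_T hm hc (h.nbd_sub hv)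
    tauto
  rw [h1, h2] at h3
  have h5 : 0 < mass C x ↔ 1 / 2 < mass C (f x) := by
    constructor <;> intro h0
    · have := hsep h0
      rw [sign_neg (show mass (C ∪ S)ᶜ x - mass C x < 0 by linarith), sign_eq_neg_one_iff] at h3
      linarith
    · rw [sign_neg (show 1 - 2 * mass C (f x) < 0 by linarith), eq_comm, sign_eq_neg_one_iff] at h3
      linarith
  have h6 : 0 < mass (C ∪ S)ᶜ x ↔ mass C (f x) < 1 / 2 := by
    constructor <;> intro h0
    · have : ¬ 0 < mass C x := fun h => hsep h h0
      rw [sign_pos (show 0 < mass (C ∪ S)ᶜ x - mass C x by linarith), sign_eq_one_iff] at h3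
      linarith
    · rw [sign_pos (show 0 < 1 - 2 * mass C (f x) by linarith), eq_comm, sign_eq_one_iff] at h3
      linarith
  exact ⟨h5, h6, by grind⟩

theorem Trig.body_disjoint {m m' : V} (hm : m ∈ verts K \ T) (hm' : m' ∈ verts K \ T)
    (hne : outc K T m ≠ outc K T m') :
    Disjoint (outc K T m ∪ nbd K Z (outc K T m)) (outc K T m' ∪ nbd K Z (outc K T m')) := by
  have hcl : ∀ {m c}, m ∈ verts K \ T → c ∈ outc K T m → outc K T c = outc K T m := fun hm hc => cl_eq hm hc
  classical
  rw [Finset.disjoint_left]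
  intro v hv hv'
  rw [Finset.mem_union] at hv hv'
  rcases hv with hv | hv <;> rcases hv' with hv' | hv'
  · grind
  · exact h.out_not_T hm hv (h.nbd_sub hv')
  · exact h.out_not_T hm' hv' (h.nbd_sub hv)
  · obtain ⟨hz, c, hc, h1⟩ := mem_filter.1 hv
    obtain ⟨-, c', hc', h2⟩ := mem_filter.1 hv'
    exact hne ((hcl hm hc).symm.trans ((h.outc_unique hz (h.out_not_T hm hc) (h.out_not_T hm' hc') h1 h2).trans
      (hcl hm' hc')))

end

section
variable {ι : Type} [Fintype ι] [DecidableEq ι] {ℓ : ι → R3 →ᵃ[ℝ] ℝ} {I : Set ι}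

variable (ℓ I) in
/-- The union of the cells spanned by vertices in `P`. -/
def body (P : Finset (ι → SignType)) : Set R3 := cmap ℓ I '' realiz (res (cellCx ℓ I) P)

theorem isPolyhedron_body (P : Finset (ι → SignType)) : IsPolyhedron (body ℓ I P) := by
  classical
  have hai : ∀ σ ∈ cellCx ℓ I, AffineIndependent ℝ (fun s : σ => cpt ℓ I s.1) := fun σ hσ => by
    rw [affineIndependent_iff_of_fintype]
    intro w h0 hw i
    rw [Finset.univ.weightedVSub_eq_linear_combination h0] at hw
    refine Fintype.linearIndependent_iff.1 (linInd_cell hσ) w ?_ i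
    simpa [Prod.ext_iff, Prod.fst_sum, Prod.snd_sum] using And.intro h0 hw
  refine ⟨(Finset.univ.filter fun σ => σ ∈ res (cellCx ℓ I) P).image
    fun σ => convexHull ℝ ((σ.image (cpt ℓ I) : Finset R3) : Set R3), ?_, ?_⟩
  · intro s hs
    obtain ⟨σ, hσ, rfl⟩ := Finset.mem_image.1 hs
    refine ⟨_, ((hai σ (mem_filter.1 hσ).2.1).range).mono ?_, rfl⟩
    intro x hx
    obtain ⟨v, hv, rfl⟩ := Finset.mem_image.1 (mem_coe.1 hx)
    exact ⟨⟨v, hv⟩, rfl⟩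
  · ext z
    simp only [Finset.mem_image, mem_filter_univ, mem_iUnion, exists_prop, exists_exists_and_eq_and]
    constructor
    · rintro ⟨x, hx, rfl⟩
      refine ⟨vsupp x, hx.2.2, ?_⟩
      have h0 : ∀ v ∉ vsupp x, x v = 0 := fun v hv => by aesop
      rw [cmap, ← sum_subset (Finset.subset_univ (vsupp x)) fun v _ hv => by aesop]
      refine (convex_convexHull ℝ _).sum_mem (fun v _ => hx.1 v) ?_
        fun v hv => subset_convexHull ℝ _ (mem_coe.2 (Finset.mem_image_of_mem _ hv))
      rw [← hx.2.1]
      exact sum_subset (Finset.subset_univ _) fun v _ hv => h0 v hv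
    · rintro ⟨σ, hσ, hz⟩
      obtain ⟨w, hw, h1, rfl⟩ := Finset.mem_convexHull'.1 hz
      have hinj : InjOn (cpt ℓ I) σ := fun a ha b hb hab =>
        congrArg Subtype.val ((hai σ hσ.1).injective (a₁ := ⟨a, ha⟩) (a₂ := ⟨b, hb⟩) hab)
      rw [Finset.sum_image hinj] at h1 ⊢
      refine ⟨fun v => if v ∈ σ then w (cpt ℓ I v) else 0, ⟨fun v => ?_, ?_, ?_⟩, ?_⟩
      · aesop
      · simpa using h1
      · refine isLowerSet_res isLowerSet_cellCx P (a := σ) (fun v hv => ?_) hσ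
        rw [mem_vsupp] at hv
        exact by_contra fun h => hv (if_neg h)
      · simp [cmap, ite_smul]

theorem mem_body (hbd : IsBounded (region ℓ I)) {P : Finset (ι → SignType)} {x : (ι → SignType) → ℝ}
    (hx : x ∈ realiz (cellCx ℓ I)) : cmap ℓ I x ∈ body ℓ I P ↔ ¬ 0 < mass Pᶜ x := by
  rw [← mem_realiz_res_iff hx]
  exact ⟨fun ⟨y, hy, he⟩ => (cmap_homeo hbd).bij.injOn (realiz_res_sub hy) hx he ▸ hy, mem_image_of_mem _⟩

theorem body_sub {P : Finset (ι → SignType)} {z : R3} (hz : z ∈ body ℓ I P) :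
    ∃ x ∈ realiz (cellCx ℓ I), cmap ℓ I x = z := by
  obtain ⟨x, hx, rfl⟩ := hz
  exact ⟨x, realiz_res_sub hx, rfl⟩

variable {T Z : Finset (ι → SignType)} (h : Trig (cellCx ℓ I) T Z) (hbd : IsBounded (region ℓ I))
  {m : ι → SignType} (hm : m ∈ verts (cellCx ℓ I) \ T)
include h hbd hm

/-- Both sides of the surface around an outer component are balls, the side `R` being the one
on which the weight of `P` is at least one half after flipping. -/
theorem body_homeo {P R : Finset (ι → SignType)} {f : ((ι → SignType) → ℝ) → (ι → SignType) → ℝ}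
    (hP : ∀ v ∈ P, Good ℓ I v → ∀ i ∈ I, v i ≠ 0) (hne : ∃ v ∈ P, v ∈ verts (cellCx ℓ I))
    (hf : HomeoOn f (realiz (cellCx ℓ I)) (realiz (cellCx ℓ I)))
    (hR : ∀ x ∈ realiz (cellCx ℓ I), 0 < mass Rᶜ x ↔ mass P (f x) < 1 / 2)
    (hS : ∀ x ∈ realiz (cellCx ℓ I),
      0 < mass (nbd (cellCx ℓ I) Z (outc (cellCx ℓ I) T m))ᶜ x ↔ mass P (f x) ≠ 1 / 2) :
    Nonempty (↥(body ℓ I R) ≃ₜ ↥(closedBall (0 : R3) 1)) := by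
  have hK := isLowerSet_cellCx (ℓ := ℓ) (I := I)
  obtain ⟨e, he⟩ := h.comp_homeo (h.nbd_mem hm)
  obtain ⟨g, hg, hgf⟩ := hf.exists_symm (isCompact_realiz hK)
  have hκ : HomeoOn (e ∘ g) {y | y ∈ realiz (cellCx ℓ I) ∧ mass P y = 1 / 2} (sphere 0 1) := by
    refine he.comp (hg.restrict (fun y hy => hy.1) realiz_res_sub fun y hy => ?_)
    rw [mem_realiz_res_iff (hg.bij.mapsTo hy), hS _ (hg.bij.mapsTo hy), hgf.2 hy, not_not]
    exact and_iff_right hy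
  obtain ⟨v, hv, hvK⟩ := hne
  obtain ⟨e', he'⟩ := exists_homeo_ball_of_mass hbd hP ⟨_, single_mem_realiz hvK, by simp [mass, hv]⟩ hκ
  obtain ⟨φ, hφ⟩ := exists_homeoOn_closedBall
  have h1 : HomeoOn f (realiz (res (cellCx ℓ I) R)) {y | y ∈ realiz (cellCx ℓ I) ∧ 1 / 2 ≤ mass P y} := by
    refine hf.restrict realiz_res_sub (fun y hy => hy.1) fun x hx => ?_
    rw [mem_realiz_res_iff hx, hR x hx, not_lt]
    exact (and_iff_right (hf.bij.mapsTo hx)).symm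
  have hc : IsCompact (realiz (res (cellCx ℓ I) R)) := isCompact_realiz (isLowerSet_res hK R)
  have h2 : HomeoOn (cmap ℓ I) (realiz (res (cellCx ℓ I) R)) (body ℓ I R) :=
    ⟨(continuous_cmap).continuousOn, ((cmap_homeo hbd).bij.injOn.mono realiz_res_sub).bijOn_image⟩
  exact ⟨((h2.nonempty_homeomorph hc).some.symm).trans ((hφ.comp (he'.comp h1)).nonempty_homeomorph hc).some⟩

theorem body_ball (hP : ∀ v ∈ outc (cellCx ℓ I) T m, ∀ i ∈ I, v i ≠ 0) :
    Nonempty (↥(body ℓ I (outc (cellCx ℓ I) T m ∪ nbd (cellCx ℓ I) Z (outc (cellCx ℓ I) T m)))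
      ≃ₜ ↥(closedBall (0 : R3) 1)) := by
  obtain ⟨f, hf, hs⟩ := h.exists_flip hm
  refine body_homeo h hbd hm (fun v hv _ => hP v hv) ⟨m, h.mem_outc_self hm, (Finset.mem_sdiff.1 hm).1⟩ hf
    (fun x hx => (hs x hx).2.1) fun x hx => (hs x hx).2.2

theorem coBody_ball (hP : ∀ v, Good ℓ I v → v ∉ outc (cellCx ℓ I) T m → ∀ i ∈ I, v i ≠ 0) :
    Nonempty (↥(body ℓ I (outc (cellCx ℓ I) T m)ᶜ) ≃ₜ ↥(closedBall (0 : R3) 1)) := by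
  obtain ⟨f, hf, hs⟩ := h.exists_flip hm
  obtain ⟨u, hu⟩ := h.ne
  refine body_homeo h hbd hm (P := (outc (cellCx ℓ I) T m)ᶜ) (fun v hv hg => hP v hg (Finset.mem_compl.1 hv))
    ⟨u, Finset.mem_compl.2 fun hc => h.out_not_T hm hc hu, h.subT hu⟩ hf
    (fun x hx => ?_) fun x hx => ?_
  · rw [compl_compl, (hs x hx).1, mass_compl (hf.bij.mapsTo hx)]
    constructor <;> intro <;> linarith
  · rw [(hs x hx).2.2, mass_compl (hf.bij.mapsTo hx), not_iff_not]
    constructor <;> intro <;> linarith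

theorem interior_body (hP : ∀ v ∈ outc (cellCx ℓ I) T m, ∀ i ∈ I, v i ≠ 0) {x : (ι → SignType) → ℝ}
    (hx : x ∈ realiz (cellCx ℓ I)) :
    cmap ℓ I x ∈ interior (body ℓ I (outc (cellCx ℓ I) T m ∪ nbd (cellCx ℓ I) Z (outc (cellCx ℓ I) T m))) ↔
      0 < mass (outc (cellCx ℓ I) T m) x := by
  constructor
  · intro hi
    by_contra h0
    obtain ⟨f, hf, hs⟩ := h.exists_flip hm
    obtain ⟨g, hg, hgf⟩ := hf.exists_symm (isCompact_realiz isLowerSet_cellCx)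
    have h1 := (mem_body hbd hx).1 (interior_subset hi)
    rw [(hs x hx).2.1] at h1
    rw [(hs x hx).1] at h0
    set C := outc (cellCx ℓ I) T m with hC
    have hy := hf.bij.mapsTo hx
    have hm2 : mass C (f x) = 1 / 2 := by linarith
    have hr : ∀ t ∈ Ioo (0:ℝ) 1, rwt C (2 * t) (2 * (1 - t)) (f x) ∈ realiz (cellCx ℓ I) := fun t ht =>
      rwt_mem hy (by grind) (by grind) (by grind)
    have hcont : ContinuousOn (fun t : ℝ => cmap ℓ I (g (rwt C (2 * t) (2 * (1 - t)) (f x)))) (Ioo 0 1) := by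
      refine continuous_cmap.comp_continuousOn (hg.cont.comp (Continuous.continuousOn ?_) hr)
      refine continuous_pi fun v => ?_
      unfold rwt
      split_ifs <;> fun_prop
    have hat := hcont.continuousAt (x := 1 / 2) (Ioo_mem_nhds (by norm_num) (by norm_num))
    have hval : g (rwt C (2 * (1 / 2)) (2 * (1 - 1 / 2)) (f x)) = x := by norm_num [rwt_one]; exact hgf.1 hx
    have hev := (hat.tendsto.mono_left (nhdsWithin_le_nhds (s := Iio (1 / 2 : ℝ)))).eventually
      (isOpen_interior.mem_nhds (by rw [hval]; exact hi))
    obtain ⟨t, ht, ht2, ht1⟩ := (hev.and (Ioo_mem_nhdsLT (show (0 : ℝ) < 1 / 2 by norm_num))).exists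
    have hrt := hr t ⟨ht2, by linarith⟩
    have hgt := hg.bij.mapsTo hrt
    refine (mem_body hbd hgt).1 (interior_subset ht) ?_
    rw [(hs _ hgt).2.1, hgf.2 hrt, mass_rwt, hm2]
    linarith
  · intro h0
    refine interior_maximal ?_ (isOpen_image_mass hbd fun v hv _ => hP v hv) ⟨x, ⟨hx, h0⟩, rfl⟩
    rintro _ ⟨y, ⟨hy, hp⟩, rfl⟩
    exact (mem_body hbd hy).2 (h.mass_sep hm hy hp)

end
end

/-- A nonempty compact connected polyhedral 3-manifold with boundary in `ℝ³` with trivial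
`H₁(·; ℤ/2)` is a perforated ball: it is obtained from a polyhedral ball `B` by removing
the interiors of finitely many disjoint polyhedral balls contained in the interior of `B`. -/
theorem perforated_ball_of_trivial_H1 (N : Set R3) (hne : N.Nonempty) (hc : IsCompact N)
    (hconn : IsConnected N) (hpoly : IsPolyhedron N) (hm : IsManifold3WithBoundary N)
    (h1 : Subsingleton (H 1 ↥N)) :
    ∃ (B : Set R3) (m : ℕ) (Bs : Fin m → Set R3),
      IsPolyhedron B ∧ Nonempty (↥B ≃ₜ ↥(Metric.closedBall (0 : R3) 1)) ∧
      (∀ i, IsPolyhedron (Bs i) ∧ Bs i ⊆ interior B ∧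
        Nonempty (↥(Bs i) ≃ₜ ↥(Metric.closedBall (0 : R3) 1))) ∧
      (Pairwise fun i j => Disjoint (Bs i) (Bs j)) ∧
      N = B \ ⋃ i, interior (Bs i) := by
  obtain ⟨ι, _, _, ℓ, I, h⟩ := exists_adapted hpoly hc
  have ht := h.trig hm hconn h1
  obtain ⟨Q, hQ, ⟨q, hq⟩, hQT, hQc⟩ := h.bd_conn
  have hbd := h.bdd
  set K := cellCx ℓ I with hK
  set T := cells ℓ I N with hT
  set Z := bcells ℓ I N with hZ
  have hQs : Q ⊆ verts K \ T := fun s hs =>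
    Finset.mem_sdiff.2 ⟨mem_verts_cellCx.2 ((hQ s).1 hs).1, fun hs' => Finset.disjoint_left.1 hQT hs hs'⟩
  have hqm := hQs hq
  let C₀ := outc K T q
  have hQ₀ : ∀ v ∈ Q, v ∈ C₀ := fun v hv => by
    have : outc K T v = C₀ := cl_eq_of_conn hQs hQc hv hq
    exact this ▸ ht.mem_outc_self (hQs hv)
  have hnz : ∀ v, Good ℓ I v → v ∉ C₀ → ∀ i ∈ I, v i ≠ 0 := fun v hg hv i hi h0 =>
    hv (hQ₀ v ((hQ v).2 ⟨hg, i, hi, h0⟩))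
  let J := ((verts K \ T).image (outc K T)).erase C₀
  have hJ : ∀ C ∈ J, C ≠ C₀ ∧ ∃ m ∈ verts K \ T, outc K T m = C := fun C hC =>
    ⟨(mem_erase.1 hC).1, Finset.mem_image.1 (mem_erase.1 hC).2⟩
  have hnzJ : ∀ C ∈ J, ∀ v ∈ C, ∀ i ∈ I, v i ≠ 0 := fun C hC v hv => by
    obtain ⟨hne, m, hm, rfl⟩ := hJ C hC
    refine hnz v (mem_verts_cellCx.1 (Finset.mem_sdiff.1 (cl_sub _ hv)).1) fun hv' => ?_
    exact Finset.disjoint_left.1 (ht.body_disjoint hm hqm hne) (Finset.mem_union_left _ hv)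
      (Finset.mem_union_left _ hv')
  let D : Finset (ι → SignType) → Set R3 := fun C => body ℓ I (C ∪ nbd K Z C)
  have hsep : ∀ m ∈ verts K \ T, ∀ x ∈ realiz K, cmap ℓ I x ∈ D (outc K T m) →
      ∃ v ∈ vsupp x, v ∈ outc K T m ∪ nbd K Z (outc K T m) := fun m hm x hx hxD => by
    by_contra! hcon
    obtain ⟨v, -, hv⟩ := Finset.exists_ne_zero_of_sum_ne_zero (ne_of_eq_of_ne hx.2.1 one_ne_zero)
    rw [mem_body hbd hx, mass_pos hx] at hxD
    exact hxD ⟨v, Finset.mem_compl.2 (hcon v (mem_vsupp.2 hv)), mem_vsupp.2 hv⟩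
  have hdis : ∀ m ∈ verts K \ T, ∀ m' ∈ verts K \ T, outc K T m ≠ outc K T m' → ∀ x ∈ realiz K,
      cmap ℓ I x ∈ D (outc K T m) →
      0 < mass (outc K T m' ∪ nbd K Z (outc K T m'))ᶜ x := fun m hm m' hm' hne x hx hxD => by
    obtain ⟨v, hv, hvm⟩ := hsep m hm x hx hxD
    exact (mass_pos hx).2 ⟨v, Finset.mem_compl.2 (Finset.disjoint_left.1 (ht.body_disjoint hm hm' hne) hvm), hv⟩
  have hball : ∀ C ∈ J, Nonempty (↥(D C) ≃ₜ ↥(closedBall (0 : R3) 1)) := fun C hC => by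
    have hn := hnzJ C hC
    obtain ⟨-, m, hm, rfl⟩ := hJ C hC
    exact body_ball ht hbd hm hn
  obtain ⟨e⟩ : Nonempty (Fin J.card ≃ J) := ⟨J.equivFin.symm⟩
  refine ⟨body ℓ I C₀ᶜ, J.card, fun i => D (e i), isPolyhedron_body _, coBody_ball ht hbd hqm hnz,
    fun i => ⟨isPolyhedron_body _, ?_, ?_⟩, ?_, ?_⟩
  · obtain ⟨hne, m, hm, he⟩ := hJ _ (e i).2
    simp only [← he] at hne ⊢
    intro z hz
    obtain ⟨x, hx, rfl⟩ := body_sub hz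
    refine interior_maximal ?_ (isOpen_image_mass hbd (P := (C₀ ∪ nbd K Z C₀)ᶜ) fun v hv hg =>
      hnz v hg fun hv' => Finset.mem_compl.1 hv (Finset.mem_union_left _ hv')) ⟨x, ⟨hx, hdis m hm q hqm hne x hx hz⟩, rfl⟩
    rintro _ ⟨y, ⟨hy, hp⟩, rfl⟩
    rw [mem_body hbd hy, compl_compl]
    exact fun h0 => ht.mass_sep hqm hy h0 hp
  · exact hball _ (e i).2
  · intro i j hij
    have hne : (e i).1 ≠ (e j).1 := fun h => hij (e.injective (Subtype.ext h))
    obtain ⟨-, m, hm, he⟩ := hJ _ (e i).2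
    obtain ⟨-, m', hm', he'⟩ := hJ _ (e j).2
    simp only [← he, ← he'] at hne ⊢
    rw [Set.disjoint_left]
    intro z hz hz'
    obtain ⟨x, hx, rfl⟩ := body_sub hz
    exact (mem_body hbd hx).1 hz' (hdis m hm m' hm' hne x hx hz)
  · have hNT : ∀ x ∈ realiz K, cmap ℓ I x ∈ N ↔ ¬ 0 < mass Tᶜ x := fun x hx => by
      rw [← mem_body hbd hx, body, h.homeo.bij.image_eq]
    have hTC : ∀ x ∈ realiz K, 0 < mass Tᶜ x ↔ ∃ m ∈ verts K \ T, 0 < mass (outc K T m) x := fun x hx => by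
      simp only [mass_pos hx, Finset.mem_compl]
      constructor
      · rintro ⟨v, hv, hvx⟩
        have := Finset.mem_sdiff.2 ⟨mem_verts_cellCx.2 (hx.2.2.1 v hvx), hv⟩
        exact ⟨v, this, v, ht.mem_outc_self this, hvx⟩
      · rintro ⟨m, hm, v, hv, hvx⟩
        exact ⟨v, ht.out_not_T hm hv, hvx⟩
    have hInt : ∀ x ∈ realiz K, ∀ i, cmap ℓ I x ∈ interior (D (e i)) ↔ 0 < mass (e i).1 x := fun x hx i => by
      have hn := hnzJ _ (e i).2
      obtain ⟨-, m, hm, he⟩ := hJ _ (e i).2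
      rw [← he] at hn ⊢
      exact interior_body ht hbd hm hn hx
    have key : ∀ x ∈ realiz K, cmap ℓ I x ∈ N ↔ cmap ℓ I x ∈ body ℓ I C₀ᶜ \ ⋃ i, interior (D (e i)) := fun x hx => by
      rw [hNT x hx, hTC x hx, mem_sdiff, mem_body hbd hx, compl_compl, mem_iUnion]
      simp only [hInt x hx]
      push Not
      constructor
      · grind
      · rintro ⟨h0, hi⟩ m hm
        by_cases hm0 : outc K T m = C₀
        · rw [hm0]; exact h0
        · have := hi (e.symm ⟨outc K T m, mem_erase.2 ⟨hm0, Finset.mem_image_of_mem _ hm⟩⟩)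
          rwa [e.apply_symm_apply] at this
    ext z
    constructor
    · intro hz
      obtain ⟨x, hx, rfl⟩ := (cmap_homeo hbd).bij.surjOn (h.sub_region hz)
      exact (key x hx).1 hz
    · intro hz
      obtain ⟨x, hx, rfl⟩ := body_sub hz.1
      exact (key x hx).2 hz
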